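/- There exists a universal constant c₀ > 0 (the constant of the main small-ball theorem) such that for every n ≥ 1, every convex body K ⊂ ℝⁿ in convex isotropic position, and every 0 < ε < c₀, one has Vol(K ∩ L_K·√(ε·n)·B₂ⁿ) ≤ ε^{c₀·n}. -/

import Mathlib

open MeasureTheory

noncomputable section

/-- A convex body in `ℝⁿ`: a compact convex set with nonempty interior. -/
def IsConvexBody {n : ℕ} (K : Set (EuclideanSpace ℝ (Fin n))) : Prop :=
  IsCompact K ∧ Convex ℝ K ∧ (interior K).Nonempty

/-- A convex body `K ⊂ ℝⁿ` is in convex isotropic position with constant `L = L_K > 0`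
if `Vol(K) = 1`, `∫_K x dx = 0` and `∫_K x xᵀ dx = L_K² Iₙ`. -/
def IsConvexIsotropic {n : ℕ} (K : Set (EuclideanSpace ℝ (Fin n))) (L : ℝ) : Prop := IsConvexBody K
  ∧ volume K = 1 ∧ 0 < L ∧ (∀ i, ∫ x in K, x i = 0) ∧ (∀ i j, ∫ x in K, x i * x j = if i = j then L
  ^ 2 else 0)

namespace SmallBall

open Set Filter Topology ENNReal Real Metric RealInnerProductSpace ProbabilityTheory Pointwise
open MeasureTheory.Measure hiding map_sum
open Finset (sum_congr mul_sum sum_le_sum sum_add_distrib sum_comm sum_sub_distrib sum_nonneg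
  sum_smul sum_mul smul_sum)
open ContinuousLinearMap (le_opNorm norm_smulRight_apply smulRight_apply mul_apply comp_apply
  smulRightL one_apply inr_apply apply_apply opNorm_comp_le integral_comp_comm integral_apply
  mulLeftRight fst snd inr)

lemma volume_add_le_of_isCompact {A B : Set ℝ} (hA : IsCompact A) (hB : IsCompact B)
    (hA' : A.Nonempty) (hB' : B.Nonempty) : volume A + volume B ≤ volume (A + B) := by
  have ha := hA.sSup_mem hA'
  have hb := hB.sInf_mem hB'
  set a := sSup A
  set b := sInf B
  have h1 : volume (A + {b}) = volume A := by simp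
  have h2 : volume ({a} + B) = volume B := by simp
  have hdis : volume ((A + {b}) ∩ ({a} + B)) = 0 := by
    refine measure_mono_null (t := {a + b}) ?_ (by simp)
    rintro x ⟨⟨y, hy, z, hz, rfl⟩, ⟨u, hu, v, hv, huv⟩⟩
    simp only [mem_singleton_iff] at hz hu huv ⊢
    have e1 := le_csSup hA.bddAbove hy
    have e2 := csInf_le hB.bddBelow hv
    linarith
  have hm : MeasurableSet ({a} + B) := ((isCompact_singleton).add hB).measurableSet
  calc volume A + volume B = volume (A + {b}) + volume ({a} + B) := by rw [h1, h2]
    _ = volume ((A + {b}) ∪ ({a} + B)) := by rw [← measure_union_add_inter _ hm, hdis, add_zero]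
    _ ≤ volume (A + B) := by
        apply measure_mono
        apply union_subset
        · exact add_subset_add_left (by simpa using hb)
        · exact add_subset_add_right (by simpa using ha)

lemma volume_combination_le {A B C : Set ℝ} (hA : MeasurableSet A) (hB : MeasurableSet B)
    (hA' : A.Nonempty) (hB' : B.Nonempty) {l : ℝ} (hl : 0 < l) (hl1 : l < 1)
    (hC : ∀ x ∈ A, ∀ y ∈ B, (1 - l) * x + l * y ∈ C) :
    ENNReal.ofReal (1 - l) * volume A + ENNReal.ofReal l * volume B ≤ volume C := by
  have hl' : 0 < 1 - l := by linarith
  have key : ∀ K ⊆ A, IsCompact K → ∀ L ⊆ B, IsCompact L → ENNReal.ofReal (1 - l) * volume K +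
      ENNReal.ofReal l * volume L ≤ volume C := by
    have key' : ∀ K ⊆ A, IsCompact K → K.Nonempty → ∀ L ⊆ B, IsCompact L → L.Nonempty →
        ENNReal.ofReal (1 - l) * volume K + ENNReal.ofReal l * volume L ≤ volume C := by
      intro K hK hKc hKn L hL hLc hLn
      have := volume_add_le_of_isCompact (hKc.smul (1 - l)) (hLc.smul l) hKn.smul_set hLn.smul_set
      rw [addHaar_smul, addHaar_smul] at this
      simp only [Module.finrank_self, pow_one, abs_of_pos hl, abs_of_pos hl'] at this
      refine this.trans (measure_mono ?_)
      rintro _ ⟨_, ⟨x, hx, rfl⟩, _, ⟨y, hy, rfl⟩, rfl⟩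
      aesop
    obtain ⟨a, ha⟩ := hA'
    obtain ⟨b, hb⟩ := hB'
    intro K hK hKc L hL hLc
    refine le_trans ?_ (key' (K ∪ {a}) (union_subset hK (by simpa using ha))
      (hKc.union isCompact_singleton) (by simp) (L ∪ {b}) (union_subset hL (by simpa using hb))
      (hLc.union isCompact_singleton) (by simp))
    gcongr <;> exact subset_union_left
  have sup_le : ∀ (S : Set ℝ), MeasurableSet S → ∀ (c d T : ℝ≥0∞), c ≠ ∞ →
      (∀ K ⊆ S, IsCompact K → d + c * volume K ≤ T) → d + c * volume S ≤ T := by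
    intro S hS c d T hc h
    have h0 := le_trans le_self_add (h ∅ (empty_subset _) isCompact_empty)
    rcases eq_or_ne d ∞ with hd | hd
    · rw [hd, top_le_iff] at h0
      simp [h0]
    rw [add_comm, ← le_sub_iff_add_le_right hd h0, hS.measure_eq_iSup_isCompact volume]
    simp only [mul_iSup, iSup_le_iff]
    intro K hK hKc
    rw [le_sub_iff_add_le_right hd h0, add_comm]
    exact h K hK hKc
  refine sup_le B hB _ _ _ ofReal_ne_top fun L hL hLc => ?_
  rw [add_comm]
  refine sup_le A hA _ _ _ ofReal_ne_top fun K hK hKc => ?_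
  rw [add_comm]
  exact key K hK hKc L hL hLc

lemma lintegral_eq_lintegral_superlevel {f : ℝ → ℝ≥0∞} (hf : Measurable f) (hf1 : ∀ x, f x ≤ 1) :
    ∫⁻ x, f x = ∫⁻ t in Ioo (0:ℝ) 1, volume {x | ENNReal.ofReal t < f x} := by
  have hne : ∀ x, f x ≠ ∞ := fun x => ne_top_of_le_ne_top (by simp) (hf1 x)
  have h := lintegral_eq_lintegral_meas_lt (volume : Measure ℝ) (f := fun x => (f x).toReal)
    (.of_forall fun x => toReal_nonneg) hf.ennreal_toReal.aemeasurable
  simp only [ofReal_toReal (hne _)] at h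
  rw [h, ← Ioo_union_Ici_eq_Ioi (zero_lt_one), lintegral_union measurableSet_Ici
    (by rw [disjoint_left]; intro x hx hx'; exact absurd hx.2 (not_lt.2 hx'))]
  rw [setLIntegral_congr_fun (g := fun _ => 0) measurableSet_Ici, lintegral_zero, add_zero]
  · apply setLIntegral_congr_fun measurableSet_Ioo
    intro t ht
    simp only
    congr 1; ext x
    simp only [mem_ofPred_eq]
    rw [ofReal_lt_iff_lt_toReal ht.1.le (hne x)]
  · intro t ht
    have : {a | t < (f a).toReal} = ∅ := by
      ext x
      simp only [mem_ofPred_eq, mem_empty_iff_false, iff_false, not_lt]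
      have := toReal_mono (by simp) (hf1 x)
      exact this.trans ht
    simp [this]

lemma prekopa_leindler_normalized {f g h : ℝ → ℝ≥0∞} (hf : Measurable f) (hg : Measurable g)
    (hh : Measurable h) (hf1 : ⨆ x, f x = 1) (hg1 : ⨆ x, g x = 1) {l : ℝ} (hl : 0 < l) (hl1 : l < 1)
    (H : ∀ x y, f x ^ (1 - l) * g y ^ l ≤ h ((1 - l) * x + l * y)) :
    ENNReal.ofReal (1 - l) * (∫⁻ x, f x) + ENNReal.ofReal l * (∫⁻ x, g x) ≤ ∫⁻ x, h x := by
  have hl' : 0 < 1 - l := by linarith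
  have hf' : ∀ x, f x ≤ 1 := fun x => hf1 ▸ le_iSup f x
  have hg' : ∀ x, g x ≤ 1 := fun x => hg1 ▸ le_iSup g x
  have hmin : ∫⁻ x, min (h x) 1 ≤ ∫⁻ x, h x := lintegral_mono fun x => min_le_left _ _
  refine le_trans ?_ hmin
  rw [lintegral_eq_lintegral_superlevel hf hf', lintegral_eq_lintegral_superlevel hg hg',
    lintegral_eq_lintegral_superlevel (hh.min measurable_const) (fun x => min_le_right _ _)]
  have mono : ∀ u : ℝ → ℝ≥0∞, Measurable fun t : ℝ => volume {x | ENNReal.ofReal t < u x} := by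
    intro u
    apply Antitone.measurable
    intro s t hst
    apply measure_mono
    intro x hx
    exact lt_of_le_of_lt (ofReal_le_ofReal hst) hx
  rw [← lintegral_const_mul _ (mono f), ← lintegral_const_mul _ (mono g),
    ← lintegral_add_left ((mono f).const_mul _)]
  apply setLIntegral_mono_ae (mono _).aemeasurable
  refine .of_forall fun t ht => ?_
  have ht1 : ENNReal.ofReal t < 1 := by simpa using ht.2
  apply volume_combination_le (measurableSet_lt measurable_const hf) (measurableSet_lt
    measurable_const hg) _ _ hl hl1
  · intro x hx y hy
    refine lt_min (lt_of_lt_of_le ?_ (H x y)) ht1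
    have : ENNReal.ofReal t = ENNReal.ofReal t ^ (1 - l) * ENNReal.ofReal t ^ l := by
      rw [← rpow_add _ _ (by simpa using ht.1) (by simp)]; simp
    rw [this]
    exact mul_lt_mul (rpow_lt_rpow hx hl') (rpow_lt_rpow hy hl)
  · by_contra hne
    rw [not_nonempty_iff_eq_empty] at hne
    have : ⨆ x, f x ≤ ENNReal.ofReal t := iSup_le fun x => by
      by_contra hx
      have : x ∈ {x | ENNReal.ofReal t < f x} := not_le.1 hx
      rw [hne] at this; exact this
    rw [hf1] at this; exact absurd ht1 (not_lt.2 this)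
  · by_contra hne
    rw [not_nonempty_iff_eq_empty] at hne
    have : ⨆ x, g x ≤ ENNReal.ofReal t := iSup_le fun x => by
      by_contra hx
      have : x ∈ {x | ENNReal.ofReal t < g x} := not_le.1 hx
      rw [hne] at this; exact this
    rw [hg1] at this; exact absurd ht1 (not_lt.2 this)

lemma ennreal_geom_mean_le {l : ℝ} (hl : 0 < l) (hl1 : l < 1) (a b : ℝ≥0∞) :
    a ^ (1 - l) * b ^ l ≤ ENNReal.ofReal (1 - l) * a + ENNReal.ofReal l * b := by
  have hl' : 0 < 1 - l := by linarith
  rcases eq_or_ne a ∞ with rfl | ha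
  · simp_all
  rcases eq_or_ne b ∞ with rfl | hb
  · simp_all
  lift a to NNReal using ha
  lift b to NNReal using hb
  have := NNReal.geom_mean_le_arith_mean2_weighted (toNNReal (1 - l)) (toNNReal l) a b
    (by rw [← toNNReal_add hl'.le hl.le]; simp)
  rw [coe_toNNReal _ hl'.le, coe_toNNReal _ hl.le] at this
  rw [← coe_rpow_of_nonneg _ hl'.le, ← coe_rpow_of_nonneg _ hl.le]
  unfold ENNReal.ofReal
  exact_mod_cast this

lemma prekopa_leindler_bounded {f g h : ℝ → ℝ≥0∞} (hf : Measurable f) (hg : Measurable g) (hh :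
    Measurable h) {N : ℝ≥0∞} (hN : N ≠ ∞) (hfN : ∀ x, f x ≤ N) (hgN : ∀ x, g x ≤ N) {l : ℝ} (hl : 0
    < l) (hl1 : l < 1) (H : ∀ x y, f x ^ (1 - l) * g y ^ l ≤ h ((1 - l) * x + l * y)) : (∫⁻ x, f x)
    ^ (1 - l) * (∫⁻ x, g x) ^ l ≤ ∫⁻ x, h x := by
  have hl' : 0 < 1 - l := by linarith
  set a := ⨆ x, f x with ha
  set b := ⨆ x, g x with hb
  have haN : a ≠ ∞ := ne_top_of_le_ne_top hN (iSup_le hfN)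
  have hbN := ne_top_of_le_ne_top hN (iSup_le hgN)
  rcases eq_or_ne a 0 with ha0 | ha0
  · have : ∀ x, f x = 0 := fun x => le_antisymm (ha0 ▸ le_iSup f x) bot_le
    simp [this, hl']
  rcases eq_or_ne b 0 with hb0 | hb0
  · have : ∀ x, g x = 0 := fun x => le_antisymm (hb0 ▸ le_iSup g x) bot_le
    simp [this, hl]
  have hc0 : a ^ (1 - l) * b ^ l ≠ 0 := by simp [ha0, hb0, haN, hl.le]
  have hcN := mul_ne_top (rpow_ne_top_of_nonneg hl'.le haN) (rpow_ne_top_of_nonneg hl.le hbN)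
  have key := prekopa_leindler_normalized (f := fun x => a⁻¹ * f x) (g := fun x => b⁻¹ * g x)
    (h := fun x => (a ^ (1 - l) * b ^ l)⁻¹ * h x) (hf.const_mul _) (hg.const_mul _) (hh.const_mul _)
    (by rw [← mul_iSup]; exact ENNReal.inv_mul_cancel ha0 haN)
    (by rw [← mul_iSup]; exact ENNReal.inv_mul_cancel hb0 hbN) hl hl1 (by
      intro x y
      rw [mul_rpow_of_nonneg _ _ hl'.le, mul_rpow_of_nonneg _ _ hl.le, ENNReal.mul_inv (Or.inr
        (rpow_ne_top_of_nonneg hl.le hbN)) (Or.inl (rpow_ne_top_of_nonneg hl'.le haN)),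
        ENNReal.inv_rpow, ENNReal.inv_rpow]
      calc _ = (a ^ (1 - l))⁻¹ * (b ^ l)⁻¹ * (f x ^ (1 - l) * g y ^ l) := by ring
        _ ≤ _ := by gcongr; exact H x y)
  rw [lintegral_const_mul _ hf, lintegral_const_mul _ hg, lintegral_const_mul _ hh] at key
  have key2 := (ennreal_geom_mean_le hl hl1 _ _).trans key
  rw [mul_rpow_of_nonneg _ _ hl'.le, mul_rpow_of_nonneg _ _ hl.le,
    ENNReal.inv_rpow, ENNReal.inv_rpow] at key2
  have e : (a ^ (1 - l))⁻¹ * (∫⁻ x, f x) ^ (1 - l) * ((b ^ l)⁻¹ * (∫⁻ x, g x) ^ l) =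
      (a ^ (1 - l) * b ^ l)⁻¹ * ((∫⁻ x, f x) ^ (1 - l) * (∫⁻ x, g x) ^ l) := by
    rw [ENNReal.mul_inv (Or.inr (rpow_ne_top_of_nonneg hl.le hbN))
          (Or.inl (rpow_ne_top_of_nonneg hl'.le haN))]
    ring
  rw [e] at key2
  exact (ENNReal.mul_le_mul_iff_right (ENNReal.inv_ne_zero.2 hcN) (inv_ne_top.2 hc0)).1 key2

lemma prekopa_leindler_real {f g h : ℝ → ℝ≥0∞} (hf : Measurable f) (hg : Measurable g) (hh :
    Measurable h) {l : ℝ} (hl : 0 < l) (hl1 : l < 1) (H : ∀ x y, f x ^ (1 - l) * g y ^ l ≤ h ((1 -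
    l) * x + l * y)) : (∫⁻ x, f x) ^ (1 - l) * (∫⁻ x, g x) ^ l ≤ ∫⁻ x, h x := by
  have hl' : 0 < 1 - l := by linarith
  have lim : ∀ u : ℝ → ℝ≥0∞, Measurable u → Tendsto (fun N : ℕ => ∫⁻ x, min (u x) N) atTop (𝓝 (∫⁻ x,
      u x)) := by
    intro u hu
    apply lintegral_tendsto_of_tendsto_of_monotone
    · fun_prop
    · refine .of_forall fun x i j hij => ?_
      simp_all
    · refine .of_forall fun x => ?_
      have := (tendsto_const_nhds (x := u x)).min tendsto_nat_nhds_top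
      grind
  have h1 : ∀ N : ℕ, (∫⁻ x, min (f x) N) ^ (1 - l) * (∫⁻ x, min (g x) N) ^ l ≤ ∫⁻ x, h x := by
    intro N
    apply prekopa_leindler_bounded (hf.min measurable_const) (hg.min measurable_const) hh
      (N := N) (by simp) (fun x => min_le_right _ _) (fun x => min_le_right _ _) hl hl1
    intro x y
    refine le_trans ?_ (H x y)
    gcongr <;> exact min_le_left _ _
  rcases eq_or_ne (∫⁻ x, f x) 0 with hf0 | hf0
  · simp [hf0, hl']
  rcases eq_or_ne (∫⁻ x, g x) 0 with hg0 | hg0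
  · simp [hg0, hl]
  refine le_of_tendsto' (Tendsto.mul ((continuous_rpow_const.tendsto _).comp (lim f hf)) (Or.inl ?_)
    ((continuous_rpow_const.tendsto _).comp (lim g hg)) (Or.inl ?_)) h1
  · simp [hf0, hl'.not_gt]
  · simp [hg0, hl.le]

lemma prekopa_leindler_pi {l : ℝ} (hl : 0 < l) (hl1 : l < 1) (n : ℕ) : ∀ {f g h : (Fin n → ℝ) →
    ℝ≥0∞}, Measurable f → Measurable g → Measurable h → (∀ x y, f x ^ (1 - l) * g y ^ l ≤ h ((1 - l)
    • x + l • y)) → (∫⁻ x, f x) ^ (1 - l) * (∫⁻ x, g x) ^ l ≤ ∫⁻ x, h x := by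
  induction n with
  | zero =>
    intro f g h hf hg hh H
    rw [volume_pi, pi_of_empty _ 0, lintegral_dirac, lintegral_dirac, lintegral_dirac]
    simp_all
  | succ n ih =>
    intro f g h hf hg hh H
    let e := (MeasurableEquiv.piFinSuccAbove (fun _ : Fin (n+1) => ℝ) 0).symm
    have he : MeasurePreserving e := (volume_preserving_piFinSuccAbove (fun _ => ℝ) 0).symm _
    have hlin : ∀ (x₁ y₁ : ℝ) (x₂ y₂ : Fin n → ℝ), e ((1 - l) * x₁ + l * y₁, (1 - l) • x₂ + l • y₂) =
        (1 - l) • e (x₁, x₂) + l • e (y₁, y₂) := by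
      intro x₁ y₁ x₂ y₂
      ext i
      refine Fin.cases ?_ (fun i => ?_) i <;> simp [e]
    have conv : ∀ u : (Fin (n+1) → ℝ) → ℝ≥0∞, Measurable u → ∫⁻ x, u x = ∫⁻ s : ℝ, ∫⁻ v : Fin n → ℝ,
        u (e (s, v)) := by
      intro u hu
      rw [← he.lintegral_comp hu, volume_eq_prod, lintegral_prod]
      exact (hu.comp e.measurable).aemeasurable
    have hm : ∀ u : (Fin (n+1) → ℝ) → ℝ≥0∞, Measurable u → Measurable fun s : ℝ => ∫⁻ v : Fin n → ℝ,
        u (e (s, v)) := by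
      intro u hu
      exact (hu.comp e.measurable).lintegral_prod_right'
    rw [conv f hf, conv g hg, conv h hh]
    apply prekopa_leindler_real (hm f hf) (hm g hg) (hm h hh) hl hl1
    intro x₁ y₁
    apply ih
    · exact (hf.comp e.measurable).comp measurable_prodMk_left
    · exact (hg.comp e.measurable).comp measurable_prodMk_left
    · exact (hh.comp e.measurable).comp measurable_prodMk_left
    · intro x₂ y₂
      rw [hlin]
      exact H _ _

theorem prekopa_leindler {n : ℕ} {l : ℝ} (hl : 0 < l) (hl1 : l < 1) {f g h : EuclideanSpace ℝ (Fin
    n) → ℝ≥0∞} (hf : Measurable f) (hg : Measurable g) (hh : Measurable h) (H : ∀ x y, f x ^ (1 - l)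
    * g y ^ l ≤ h ((1 - l) • x + l • y)) : (∫⁻ x, f x) ^ (1 - l) * (∫⁻ x, g x) ^ l ≤ ∫⁻ x, h x := by
  have he := (EuclideanSpace.volume_preserving_symm_measurableEquiv_toLp (Fin n)).symm
  have hme : Measurable (MeasurableEquiv.toLp 2 (Fin n → ℝ)) := MeasurableEquiv.measurable _
  rw [← he.lintegral_comp hf, ← he.lintegral_comp hg, ← he.lintegral_comp hh]
  apply prekopa_leindler_pi hl hl1 n (hf.comp hme) (hg.comp hme) (hh.comp hme)
  simp_all

section PL

variable {n : ℕ}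

local notation "𝔼" => EuclideanSpace ℝ (Fin n)

lemma lintegral_indicator_exp {A : Set 𝔼} (hA : IsCompact A) {ψ : 𝔼 → ℝ} (hψ : Continuous ψ) : ∫⁻ x,
    A.indicator (fun x => ENNReal.ofReal (exp (ψ x))) x = ENNReal.ofReal (∫ x in A, exp (ψ x)) := by
  rw [lintegral_indicator hA.measurableSet, ofReal_integral_eq_lintegral_ofReal]
  · exact (continuous_exp.comp hψ).continuousOn.integrableOn_compact hA
  · exact .of_forall fun x => (exp_pos _).le

lemma prekopa_leindler_exp {A B C : Set 𝔼} (hA : IsCompact A) (hB : IsCompact B) (hC : IsCompact C)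
    {ψ₁ ψ₂ ψ₃ : 𝔼 → ℝ} (h₁ : Continuous ψ₁) (h₂ : Continuous ψ₂) (h₃ : Continuous ψ₃) {l : ℝ} (hl :
    0 < l) (hl1 : l < 1) (H : ∀ x ∈ A, ∀ y ∈ B, (1 - l) • x + l • y ∈ C ∧ (1 - l) * ψ₁ x + l * ψ₂ y
    ≤ ψ₃ ((1 - l) • x + l • y)) : (∫ x in A, exp (ψ₁ x)) ^ (1 - l) * (∫ x in B, exp (ψ₂ x)) ^ l ≤ ∫
    x in C, exp (ψ₃ x) := by
  have hl' : 0 < 1 - l := by linarith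
  have hm : ∀ {S : Set 𝔼} {ψ : 𝔼 → ℝ}, IsCompact S → Continuous ψ → Measurable (S.indicator (fun x
    => ENNReal.ofReal (exp (ψ x)))) := fun hS hψ => ((continuous_exp.comp
    hψ).measurable.ennreal_ofReal).indicator hS.measurableSet
  have key := prekopa_leindler hl hl1 (hm hA h₁) (hm hB h₂) (hm hC h₃) (by
    intro x y
    by_cases hx : x ∈ A
    · by_cases hy : y ∈ B
      · obtain ⟨hc, hle⟩ := H x hx y hy
        rw [indicator_of_mem hx, indicator_of_mem hy, indicator_of_mem hc,
          ofReal_rpow_of_pos (exp_pos _), ofReal_rpow_of_pos (exp_pos _),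
          ← ofReal_mul (by positivity), ← exp_mul, ← exp_mul, ← exp_add]
        bound
      simp_all
    simp_all)
  rw [lintegral_indicator_exp hA h₁, lintegral_indicator_exp hB h₂, lintegral_indicator_exp hC h₃,
    ofReal_rpow_of_nonneg (by positivity) hl'.le, ofReal_rpow_of_nonneg (by positivity) hl.le, ←
    ofReal_mul (by positivity)] at key
  exact (ofReal_le_ofReal_iff (by positivity)).1 key

end PL

/-- A crude third order lower bound for the moment generating function. -/
lemma exp_ge_of_abs_le_one {z : ℝ} (hz : |z| ≤ 1) : 1 + z + z ^ 2 / 2 - |z| ^ 3 ≤ exp z := by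
  have := exp_bound (x := z) hz (n := 3) (by norm_num)
  simp only [Finset.sum_range_succ] at this
  norm_num [Nat.factorial] at this
  grind

lemma integral_sq_le_of_mgf_le {Ω : Type*} [MeasurableSpace Ω] {ν : Measure Ω} [IsProbabilityMeasure
    ν] {Y : Ω → ℝ} (hY : AEStronglyMeasurable Y ν) {M : ℝ} (hM : ∀ᵐ x ∂ν, |Y x| ≤ M) (h0 : ∫ x, Y x
    ∂ν = 0) {σ : ℝ} (hσ : 0 < σ) (H : ∀ τ : ℝ, (∫ x, exp (τ * Y x) ∂ν) * (∫ x, exp (-τ * Y x) ∂ν) ≤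
    exp (τ ^ 2 / σ)) : ∫ x, Y x ^ 2 ∂ν ≤ 1 / σ := by
  have hM0 : 0 ≤ M := by
    obtain ⟨x, hx⟩ := hM.exists
    grind
  have iY := Integrable.of_bound hY M (by simpa using hM)
  have iY2 : Integrable (fun x => Y x ^ 2) ν := by
    refine Integrable.of_bound (hY.pow 2) (M ^ 2) ?_
    filter_upwards [hM] with x hx
    rw [norm_eq_abs, abs_pow]; gcongr
  set V := ∫ x, Y x ^ 2 ∂ν with hV
  have low : ∀ τ : ℝ, |τ| * (M + 1) ≤ 1 →
      1 + τ ^ 2 * V / 2 - |τ| ^ 3 * M ^ 3 ≤ ∫ x, exp (τ * Y x) ∂ν := by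
    intro τ hτ
    have e : ∫ x, (1 + τ * Y x + τ ^ 2 / 2 * Y x ^ 2 - |τ| ^ 3 * M ^ 3) ∂ν =
        1 + τ ^ 2 * V / 2 - |τ| ^ 3 * M ^ 3 := by
      rw [integral_sub, integral_add, integral_add, integral_const_mul, integral_const_mul, h0, ← hV]
      · simp; ring
      · fun_prop
      · fun_prop
      · fun_prop
      · fun_prop
      · fun_prop
      fun_prop
    rw [← e]
    apply integral_mono_ae
    · exact (((integrable_const _).add (iY.const_mul _)).add (iY2.const_mul _)).sub
        (integrable_const _)
    · refine Integrable.of_bound (continuous_exp.comp_aestronglyMeasurable (hY.const_mul τ))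
        (exp 1) ?_
      filter_upwards [hM] with x hx
      rw [norm_eq_abs, abs_of_pos (exp_pos _)]
      apply exp_le_exp.2
      refine (le_abs_self _).trans ?_
      rw [abs_mul]
      exact (mul_le_mul_of_nonneg_left (by linarith) (abs_nonneg _)).trans hτ
    · filter_upwards [hM] with x hx
      have h1 : |τ * Y x| ≤ 1 := by
        rw [abs_mul]
        exact (mul_le_mul_of_nonneg_left (by linarith) (abs_nonneg _)).trans hτ
      have h2 := exp_ge_of_abs_le_one h1
      have h3 : |τ * Y x| ^ 3 ≤ |τ| ^ 3 * M ^ 3 := by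
        rw [abs_mul, mul_pow]; gcongr
      linarith
  have ev : ∀ᶠ τ in 𝓝[>] (0:ℝ), V ≤ 1 / σ + τ ^ 2 / σ ^ 2 + 2 * τ * M ^ 3 := by
    have c1 : ∀ᶠ τ in 𝓝[>] (0:ℝ), τ * (M + 1) ≤ 1 := by
      have : Tendsto (fun τ : ℝ => τ * (M + 1)) (𝓝[>] 0) (𝓝 (0 * (M + 1))) :=
        (Continuous.tendsto (by fun_prop) 0).mono_left nhdsWithin_le_nhds
      rw [zero_mul] at this
      filter_upwards [this.eventually (gt_mem_nhds zero_lt_one)] with τ h using h.le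
    have c2 : ∀ᶠ τ in 𝓝[>] (0:ℝ), τ ^ 2 / σ ≤ 1 := by
      have : Tendsto (fun τ : ℝ => τ ^ 2 / σ) (𝓝[>] 0) (𝓝 (0 ^ 2 / σ)) :=
        (Continuous.tendsto (by fun_prop) 0).mono_left nhdsWithin_le_nhds
      rw [zero_pow two_ne_zero, zero_div] at this
      filter_upwards [this.eventually (gt_mem_nhds zero_lt_one)] with τ h using h.le
    filter_upwards [c1, c2, self_mem_nhdsWithin] with τ h1 h2 hτ
    have hτ : 0 < τ := hτ
    have l1 := low τ (by rwa [abs_of_pos hτ])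
    have l2 := low (-τ) (by rwa [abs_neg, abs_of_pos hτ])
    rw [abs_neg, neg_sq] at l2
    rw [abs_of_pos hτ] at l1 l2
    have hu := H τ
    have hexp : exp (τ ^ 2 / σ) ≤ 1 + τ ^ 2 / σ + (τ ^ 2 / σ) ^ 2 := by
      have := abs_exp_sub_one_sub_id_le (x := τ ^ 2 / σ) (by rwa [abs_of_nonneg (by positivity)])
      linarith [(abs_le.1 this).2]
    have hpos : 0 ≤ 1 + τ ^ 2 * V / 2 - τ ^ 3 * M ^ 3 := by
      have : τ * M ≤ 1 := by nlinarith
      have : (τ * M) ^ 3 ≤ 1 := pow_le_one₀ (by positivity) this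
      have : 0 ≤ τ ^ 2 * V / 2 := by positivity
      nlinarith
    have : τ ^ 2 * V ≤ τ ^ 2 * (1 / σ + τ ^ 2 / σ ^ 2 + 2 * τ * M ^ 3) := by
      have e : τ ^ 2 * (1 / σ + τ ^ 2 / σ ^ 2 + 2 * τ * M ^ 3) =
        τ ^ 2 / σ + (τ ^ 2 / σ) ^ 2 + 2 * (τ ^ 3 * M ^ 3) := by field_simp
      nlinarith [sq_nonneg (τ ^ 2 * V / 2 - τ ^ 3 * M ^ 3)]
    exact le_of_mul_le_mul_left this (by positivity)
  have lim : Tendsto (fun τ : ℝ => 1 / σ + τ ^ 2 / σ ^ 2 + 2 * τ * M ^ 3) (𝓝[>] 0) (𝓝 (1 / σ)) := by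
    have : Tendsto (fun τ : ℝ => 1 / σ + τ ^ 2 / σ ^ 2 + 2 * τ * M ^ 3) (𝓝[>] 0) (𝓝 (1 / σ + 0 ^ 2 /
      σ ^ 2 + 2 * 0 * M ^ 3)) := (Continuous.tendsto (by fun_prop) 0).mono_left nhdsWithin_le_nhds
    simpa using this
  exact ge_of_tendsto lim ev

section BL

variable {n : ℕ}

local notation "𝔼" => EuclideanSpace ℝ (Fin n)

lemma integral_exp_pos {K : Set 𝔼} (hK : IsCompact K) (hK0 : volume K ≠ 0) {ψ : 𝔼 → ℝ}
    (hψ : Continuous ψ) : 0 < ∫ x in K, exp (ψ x) := by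
  have : NeZero (volume.restrict K) := ⟨by simpa using hK0⟩
  apply MeasureTheory.integral_exp_pos
  exact (continuous_exp.comp hψ).continuousOn.integrableOn_compact hK

/-- One-dimensional Brascamp–Lieb inequality for linear functionals. -/
lemma integral_inner_sq_le {K : Set 𝔼} (hK : IsCompact K) (hKc : Convex ℝ K) (hK0 : volume K ≠ 0) {ψ
    : 𝔼 → ℝ} (hψ : Continuous ψ) {σ : ℝ} (hσ : 0 < σ) {e : 𝔼} (H : ∀ x y, (ψ x + ψ y) / 2 + σ / 8 *
    ⟪e, x - y⟫ ^ 2 ≤ ψ ((1 / 2 : ℝ) • x + (1 / 2 : ℝ) • y)) : ∫ x, (⟪e, x⟫ - ∫ z, ⟪e, z⟫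
    ∂((volume.restrict K).tilted ψ)) ^ 2 ∂((volume.restrict K).tilted ψ) ≤ 1 / σ := by
  have : NeZero (volume.restrict K) := ⟨by simpa using hK0⟩
  have iexp : ∀ {φ : 𝔼 → ℝ}, Continuous φ → IntegrableOn (fun x => exp (φ x)) K := fun hφ =>
    (continuous_exp.comp hφ).continuousOn.integrableOn_compact hK
  have hprob := isProbabilityMeasure_tilted (iexp hψ)
  set ν := (volume.restrict K).tilted ψ with hν
  set m := ∫ z, ⟪e, z⟫ ∂ν with hm
  obtain ⟨R, hR⟩ := hK.isBounded.exists_norm_le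
  have hKν : ∀ᵐ x ∂ν, x ∈ K := by
    apply (tilted_absolutelyContinuous _ _).ae_le
    exact ae_restrict_mem hK.measurableSet
  have hbd : ∀ᵐ x ∂ν, |⟪e, x⟫ - m| ≤ ‖e‖ * R + |m| := by
    filter_upwards [hKν] with x hx
    refine (abs_sub _ _).trans ?_
    gcongr
    refine (abs_real_inner_le_norm _ _).trans ?_
    gcongr
    exact hR x hx
  have hcont : Continuous fun x : 𝔼 => ⟪e, x⟫ - m := by fun_prop
  have hint : Integrable (fun x : 𝔼 => ⟪e, x⟫) ν := by
    refine Integrable.of_bound (Continuous.aestronglyMeasurable (by fun_prop)) (‖e‖ * R) ?_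
    filter_upwards [hKν] with x hx
    refine (norm_inner_le_norm _ _).trans ?_
    gcongr
    exact hR x hx
  refine integral_sq_le_of_mgf_le hcont.aestronglyMeasurable hbd ?_ hσ ?_
  · rw [integral_sub hint (integrable_const _)]; simp [hm]
  intro τ
  have hF : ∀ τ : ℝ, ∫ x, exp (τ * (⟪e, x⟫ - m)) ∂ν =
      exp (-τ * m) * ((∫ x in K, exp (ψ x + τ * ⟪e, x⟫)) / ∫ x in K, exp (ψ x)) := by
    intro τ
    rw [hν, integral_tilted, ← integral_div, ← integral_const_mul]
    congr 1; ext x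
    rw [smul_eq_mul, div_mul_eq_mul_div, ← exp_add, mul_div_assoc', ← exp_add]
    congr 2; ring
  have key := prekopa_leindler_exp hK hK hK (ψ₁ := fun x => ψ x + τ * ⟪e, x⟫)
    (ψ₂ := fun x => ψ x + -τ * ⟪e, x⟫) (ψ₃ := fun x => ψ x + τ ^ 2 / (2 * σ)) (by fun_prop)
    (by fun_prop) (by fun_prop) (l := 1 / 2) (by norm_num) (by norm_num) (by
      intro x hx y hy
      refine ⟨hKc hx hy (by norm_num) (by norm_num) (by norm_num), ?_⟩
      have h1 := H x y
      have h2 : ⟪e, x - y⟫ = ⟪e, x⟫ - ⟪e, y⟫ := inner_sub_right _ _ _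
      rw [h2] at h1
      have h3 : τ * (⟪e, x⟫ - ⟪e, y⟫) / 2 ≤ σ / 8 * (⟪e, x⟫ - ⟪e, y⟫) ^ 2 + τ ^ 2 / (2 * σ) := by
        have : 0 ≤ (σ / 8) * ((⟪e, x⟫ - ⟪e, y⟫) - 2 * τ / σ) ^ 2 := by positivity
        have e2 : (σ / 8) * ((⟪e, x⟫ - ⟪e, y⟫) - 2 * τ / σ) ^ 2 =
          σ / 8 * (⟪e, x⟫ - ⟪e, y⟫) ^ 2 + τ ^ 2 / (2 * σ) - τ * (⟪e, x⟫ - ⟪e, y⟫) / 2 := by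
          field_simp; ring
        linarith
      linarith)
  have hZ := integral_exp_pos hK hK0 hψ
  set Z := ∫ x in K, exp (ψ x)
  set Fp := ∫ x in K, exp (ψ x + τ * ⟪e, x⟫)
  set Fm := ∫ x in K, exp (ψ x + -τ * ⟪e, x⟫)
  have hFp : 0 ≤ Fp := integral_nonneg fun x => (exp_pos _).le
  have hFm : 0 ≤ Fm := integral_nonneg fun x => (exp_pos _).le
  have e3 : ∫ x in K, exp (ψ x + τ ^ 2 / (2 * σ)) = Z * exp (τ ^ 2 / (2 * σ)) := by
    simp only [exp_add]
    rw [integral_mul_const]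
  rw [e3] at key
  have key2 : Fp * Fm ≤ Z ^ 2 * exp (τ ^ 2 / σ) := by
    have := mul_self_le_mul_self (by positivity) key
    have e4 : Fp ^ (1 - 1 / 2 : ℝ) * Fm ^ (1 / 2 : ℝ) * (Fp ^ (1 - 1 / 2 : ℝ) * Fm ^ (1 / 2 : ℝ)) =
        Fp * Fm := by
      norm_num only
      rw [← sqrt_eq_rpow, ← sqrt_eq_rpow]
      calc _ = (√Fp * √Fp) * (√Fm * √Fm) := by ring
        _ = _ := by rw [mul_self_sqrt hFp, mul_self_sqrt hFm]
    rw [e4] at this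
    refine this.trans_eq ?_
    have : exp (τ ^ 2 / σ) = exp (τ ^ 2 / (2 * σ)) * exp (τ ^ 2 / (2 * σ)) := by
      rw [← exp_add]; congr 1; field_simp; ring
    rw [this]; ring
  rw [hF τ, hF (-τ)]
  have e5 : exp (-τ * m) * (Fp / Z) * (exp (- -τ * m) * (Fm / Z)) = Fp * Fm / Z ^ 2 := by
    have : exp (-τ * m) * exp (- -τ * m) = 1 := by rw [← exp_add]; simp
    calc _ = (exp (-τ * m) * exp (- -τ * m)) * (Fp / Z * (Fm / Z)) := by ring
      _ = _ := by rw [this]; field_simp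
  rw [e5, div_le_iff₀ (by positivity)]
  linarith

/-- A transport type inequality for measures of the form `e^{⟨θ,x⟩ - t|x|²/2} dx` on `K`. -/
lemma log_measureReal_le {K S : Set 𝔼} (hK : IsCompact K) (hKc : Convex ℝ K) (hS : IsCompact S) (hSK
    : S ⊆ K) (hS0 : volume S ≠ 0) (θ : 𝔼) {t : ℝ} (ht : 0 < t) {D : 𝔼 → ℝ} (hD : Continuous D) (hDS
    : ∀ x, ∀ y ∈ S, D x ≤ ‖x - y‖ ^ 2) {l : ℝ} (hl : 0 < l) (hl1 : l < 1) : log (((volume.restrict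
    K).tilted fun x => ⟪θ, x⟫ - t / 2 * ‖x‖ ^ 2).real S) ≤ -((1 - l) * (t / 2) * ∫ x, D x
    ∂((volume.restrict K).tilted fun x => ⟪θ, x⟫ - t / 2 * ‖x‖ ^ 2)) := by
  have hK0 : volume K ≠ 0 := fun h => hS0 (measure_mono_null hSK h)
  have : NeZero (volume.restrict K) := ⟨by simpa using hK0⟩
  set ψ : 𝔼 → ℝ := fun x => ⟪θ, x⟫ - t / 2 * ‖x‖ ^ 2 with hψd
  have hψ : Continuous ψ := by fun_prop
  have iexp : ∀ {φ : 𝔼 → ℝ}, Continuous φ → IntegrableOn (fun x => exp (φ x)) K := fun hφ =>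
    (continuous_exp.comp hφ).continuousOn.integrableOn_compact hK
  have hprob := isProbabilityMeasure_tilted (iexp hψ)
  set ν := (volume.restrict K).tilted ψ with hν
  have hl' : 0 < 1 - l := by linarith
  have key := prekopa_leindler_exp hK hS hK (ψ₁ := fun x => ψ x + t * l / 2 * D x)
    (ψ₂ := ψ) (ψ₃ := ψ) (by fun_prop) hψ hψ hl hl1 (by
      intro x hx y hy
      refine ⟨hKc hx (hSK hy) hl'.le hl.le (by ring), ?_⟩
      have h1 := hDS x y hy
      have h2 : ψ ((1 - l) • x + l • y) = (1 - l) * ψ x + l * ψ y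
          + t / 2 * l * (1 - l) * ‖x - y‖ ^ 2 := by
        simp only [hψd, inner_add_right, real_inner_smul_right, norm_add_sq_real, norm_sub_sq_real,
          norm_smul, real_inner_smul_left, mul_pow, norm_eq_abs, sq_abs]
        ring
      have : t / 2 * l * (1 - l) * D x ≤ t / 2 * l * (1 - l) * ‖x - y‖ ^ 2 := by gcongr
      linarith)
  have hZ := integral_exp_pos hK hK0 hψ
  have hZS := integral_exp_pos hS hS0 hψ
  have hZD := integral_exp_pos hK hK0 (ψ := fun x => ψ x + t * l / 2 * D x) (by fun_prop)
  set Z := ∫ x in K, exp (ψ x) with hZdef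
  set ZS := ∫ x in S, exp (ψ x) with hZSdef
  set ZD := ∫ x in K, exp (ψ x + t * l / 2 * D x) with hZDdef
  have eS : ν.real S = ZS / Z := by
    rw [measureReal_def, hν, tilted_apply_eq_ofReal_integral' ψ hS.measurableSet,
      toReal_ofReal (by positivity), restrict_restrict hS.measurableSet,
      inter_eq_self_of_subset_left hSK, integral_div]
  have eD : ∫ x, exp (t * l / 2 * D x) ∂ν = ZD / Z := by
    rw [hν, integral_tilted, ← integral_div]
    congr 1; ext x
    rw [smul_eq_mul, div_mul_eq_mul_div, ← exp_add]
  have jensen : exp (t * l / 2 * ∫ x, D x ∂ν) ≤ ZD / Z := by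
    rw [← eD, ← integral_const_mul]
    obtain ⟨C, hC⟩ := hK.exists_bound_of_continuousOn hD.continuousOn
    have hKν : ∀ᵐ x ∂ν, x ∈ K := by
      apply (tilted_absolutelyContinuous _ _).ae_le
      exact ae_restrict_mem hK.measurableSet
    refine convexOn_exp.map_integral_le continuous_exp.continuousOn isClosed_univ
      (.of_forall fun _ => mem_univ _) ?_ ?_
    · refine (Integrable.of_bound hD.aestronglyMeasurable C ?_).const_mul _
      filter_upwards [hKν] with x hx using hC x hx
    · obtain ⟨C', hC'⟩ := hK.exists_bound_of_continuousOn
        (f := fun x => exp (t * l / 2 * D x)) (by fun_prop)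
      refine Integrable.of_bound (Continuous.aestronglyMeasurable (by fun_prop)) C' ?_
      filter_upwards [hKν] with x hx using hC' x hx
  have hlog := log_le_log (by positivity) key
  rw [log_mul (by positivity) (by positivity), log_rpow hZD, log_rpow hZS] at hlog
  have hj := (le_log_iff_exp_le (by positivity)).2 jensen
  rw [log_div hZD.ne' hZ.ne'] at hj
  rw [eS, log_div hZS.ne' hZ.ne']
  have h6 := mul_le_mul_of_nonneg_left hj hl'.le
  have : l * (log ZS - log Z) ≤ l * -((1 - l) * (t / 2) * ∫ x, D x ∂ν) := by linarith
  exact le_of_mul_le_mul_left this hl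

end BL

section Euclidean

variable {E : Type*} [NormedAddCommGroup E] [InnerProductSpace ℝ E] [FiniteDimensional ℝ E]
  [MeasurableSpace E] [BorelSpace E]

/-- `μ` is supported in the centred ball of radius `R`. -/
abbrev SuppIn (μ : Measure E) (R : ℝ) : Prop := ∀ᵐ b ∂μ, ‖b‖ ≤ R

section Gaussian

lemma integrable_exp_neg_norm_sq {b : ℝ} (hb : 0 < b) :
    Integrable (fun v : E => exp (-b * ‖v‖ ^ 2)) := by
  have := (GaussianFourier.integrable_cexp_neg_mul_sq_norm_add (V := E) (b := (b : ℂ))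
    (by simpa using hb) 0 0).re
  refine this.congr (.of_forall fun v => ?_)
  simp only [zero_mul, add_zero]
  rw [← Complex.ofReal_pow, ← Complex.ofReal_neg, ← Complex.ofReal_mul]
  bound

/-- The unnormalised Gaussian kernel exponent. -/
def gexp (η : ℝ) (x y : E) : ℝ := -‖y - x‖ ^ 2 / (2 * η)

lemma integrable_exp_gexp {η : ℝ} (hη : 0 < η) (x : E) :
    Integrable (fun y : E => exp (gexp η x y)) := by
  have := (integrable_exp_neg_norm_sq (E := E) (b := 1 / (2 * η)) (by positivity)).comp_sub_right x
  refine this.congr (.of_forall fun v => ?_)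
  simp only [gexp]; congr 1; ring

lemma charFun_gauss {η : ℝ} (hη : 0 < η) (x t : E) :
    charFun (volume.tilted (gexp η x)) t = Complex.exp (⟪x, t⟫ * Complex.I - η * ‖t‖ ^ 2 / 2) := by
  rw [charFun_apply, integral_tilted]
  have hb : 0 < ((1 / (2 * η) : ℝ) : ℂ).re := by simp_all
  have h1 := GaussianFourier.integral_cexp_neg_mul_sq_norm_add (V := E) hb Complex.I t
  have h0 : ∫ y : E, exp (gexp η x y) = (2 * Real.pi * η) ^ (Module.finrank ℝ E / 2 : ℝ) := by
    have := GaussianFourier.integral_rexp_neg_mul_sq_norm (V := E) (b := 1 / (2 * η)) (by positivity)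
    rw [← integral_sub_right_eq_self _ x] at this
    rw [show Real.pi / (1 / (2 * η)) = 2 * Real.pi * η by field_simp] at this
    rw [← this]; congr 1; ext y; simp only [gexp]; congr 1; ring
  have hpos : 0 < (2 * Real.pi * η) ^ (Module.finrank ℝ E / 2 : ℝ) := by positivity
  have hc : (Real.pi / ((1 / (2 * η) : ℝ) : ℂ)) ^ (Module.finrank ℝ E / 2 : ℂ) =
      (((2 * Real.pi * η) ^ (Module.finrank ℝ E / 2 : ℝ) : ℝ) : ℂ) := by
    rw [Complex.ofReal_cpow (by positivity)]
    congr 1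
    · push_cast; field_simp
    · push_cast; rfl
  rw [hc] at h1
  calc ∫ y : E, (exp (gexp η x y) / ∫ z, exp (gexp η x z)) • Complex.exp (⟪y, t⟫ * Complex.I) = ∫ y
      : E, ((fun y : E => (((2 * Real.pi * η) ^ (Module.finrank ℝ E / 2 : ℝ) : ℝ) : ℂ)⁻¹ *
      Complex.exp (⟪x, t⟫ * Complex.I) * Complex.exp (-((1 / (2 * η) : ℝ) : ℂ) * ‖y‖ ^ 2 + Complex.I
      * ⟪t, y⟫)) (y - x)) := by
        congr 1; ext y
        generalize (((2 * Real.pi * η) ^ (Module.finrank ℝ E / 2 : ℝ) : ℝ)) = c at h0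
        beta_reduce
        rw [h0, Complex.real_smul, Complex.ofReal_div, Complex.ofReal_exp, mul_assoc,
          ← Complex.exp_add, div_mul_eq_mul_div, ← Complex.exp_add, div_eq_inv_mul]
        congr 2
        simp only [gexp, inner_sub_right, real_inner_comm t]
        push_cast
        ring
    _ = _ := by
        rw [integral_sub_right_eq_self (fun y : E => (((2 * Real.pi * η) ^ (Module.finrank ℝ E / 2 :
          ℝ) : ℝ) : ℂ)⁻¹ * Complex.exp (⟪x, t⟫ * Complex.I) * Complex.exp (-((1 / (2 * η) : ℝ) : ℂ)
          * ‖y‖ ^ 2 + Complex.I * ⟪t, y⟫)) x, integral_const_mul, h1]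
        have : (((2 * Real.pi * η) ^ (Module.finrank ℝ E / 2 : ℝ) : ℝ) : ℂ) ≠ 0 := by
          exact_mod_cast hpos.ne'
        field_simp
        rw [mul_comm, ← Complex.exp_add]
        simp only [Complex.I_sq]
        push_cast
        field_simp
        ring_nf

lemma stdGaussian_map_eq {η : ℝ} (hη : 0 < η) (x : E) :
    (stdGaussian E).map (fun u => x + √η • u) = volume.tilted (gexp η x) := by
  apply ext_of_charFun
  ext t
  rw [charFun_gauss hη, charFun_apply, integral_map (by fun_prop) (by fun_prop)]
  have h := charFun_stdGaussian (E := E) (√η • t)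
  rw [charFun_apply] at h
  simp only [inner_add_left, real_inner_smul_left, Complex.ofReal_add, add_mul, Complex.exp_add]
  rw [integral_const_mul, sub_eq_add_neg, Complex.exp_add]
  simp only [real_inner_smul_right] at h
  rw [h, norm_smul]
  rw [norm_eq_abs, abs_of_nonneg (sqrt_nonneg _)]
  push_cast
  rw [mul_pow, ← Complex.ofReal_pow, sq_sqrt hη.le]
  ring_nf

lemma stdGaussian_eq_tilted : stdGaussian E = volume.tilted (gexp 1 (0 : E)) := by
  rw [← stdGaussian_map_eq one_pos]
  simp

/-- Gaussian integration by parts in one direction. -/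
lemma stein {F F' : E → ℝ} (e : E) (h : ∀ x, HasLineDerivAt ℝ F (F' x) x e) (hF : Integrable F
    (stdGaussian E)) (hF' : Integrable F' (stdGaussian E)) (hFe : Integrable (fun x => F x * ⟪e, x⟫)
    (stdGaussian E)) : ∫ x, F x * ⟪e, x⟫ ∂stdGaussian E = ∫ x, F' x ∂(stdGaussian E) := by
  have hi := integrable_exp_gexp one_pos (0 : E)
  rw [stdGaussian_eq_tilted] at hF hF' hFe ⊢
  rw [integrable_tilted_iff hi] at hF hF' hFe
  simp only [integral_tilted, smul_eq_mul, div_mul_eq_mul_div]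
  rw [integral_div, integral_div]
  congr 1
  have hd : ∀ x : E, HasLineDerivAt ℝ (fun x => exp (gexp 1 (0 : E) x))
      (-(⟪e, x⟫ * exp (gexp 1 (0 : E) x))) x e := by
    intro x
    have h1 : HasFDerivAt (fun x : E => -‖x‖ ^ 2 / 2) (-(innerSL ℝ x)) x := by
      have := (hasStrictFDerivAt_norm_sq x).hasFDerivAt.const_mul (-1 / 2 : ℝ)
      have e1 : (fun x : E => -‖x‖ ^ 2 / 2) = fun x => -1 / 2 * ‖x‖ ^ 2 := by ext y; ring
      rw [e1]
      refine this.congr_fderiv ?_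
      ext v
      simp
      ring
    have h2 := h1.exp.hasLineDerivAt e
    simp only [gexp, sub_zero, mul_one]
    convert h2 using 1
    simp [real_inner_comm]; ring
  have := integral_bilinear_hasLineDerivAt_right_eq_neg_left_of_integrable (μ := (volume : Measure
    E)) (f := F) (f' := F') (g := fun x => exp (gexp 1 (0 : E) x)) (g' := fun x => -(⟪e, x⟫ * exp
    (gexp 1 (0 : E) x))) (v := e) (B := ContinuousLinearMap.mul ℝ ℝ) (by simpa [mul_comm] using hF')
    (by
      refine hFe.neg.congr (.of_forall fun x => ?_)
      simp; ring) (by simpa [mul_comm] using hF) (fun x _ => h x) (fun x _ => hd x)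
  simp only [ContinuousLinearMap.mul_apply'] at this
  calc ∫ x, exp (gexp 1 0 x) * (F x * ⟪e, x⟫) = -∫ x, F x * -(⟪e, x⟫ * exp (gexp 1 0 x)) := by
        rw [← integral_neg]; congr 1; ext x; ring
    _ = _ := by
      rw [this, neg_neg]; congr 1; ext x; ring

lemma integral_sq_stdGaussian (L : StrongDual ℝ E) : ∫ x, L x ^ 2 ∂stdGaussian E = ‖L‖ ^ 2 := by
  rw [← variance_dual_stdGaussian L, variance_of_integral_eq_zero (by fun_prop)
    (integral_strongDual_stdGaussian L)]

lemma integrable_norm_pow_stdGaussian (k : ℕ) :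
    Integrable (fun x : E => ‖x‖ ^ k) (stdGaussian E) := by
  rcases Nat.eq_zero_or_pos k with rfl | hk
  · simp
  have := (IsGaussian.memLp_id (stdGaussian E) k (by simp)).integrable_norm_pow (by omega)
  fun_prop

lemma sq_integral_le {Ω : Type*} [MeasurableSpace Ω] {J : Measure Ω} [IsFiniteMeasure J]
    {f : Ω → ℝ} (hf : Integrable f J) (hf2 : Integrable (fun x => f x ^ 2) J) :
    (∫ x, f x ∂J) ^ 2 ≤ J.real univ * ∫ x, f x ^ 2 ∂J := by
  set a := ∫ x, f x ∂J with ha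
  set c := J.real univ with hc
  have hc0 : 0 ≤ c := measureReal_nonneg
  have h3 : 0 ≤ ∫ x, (c * f x - a) ^ 2 ∂J := integral_nonneg fun _ => sq_nonneg _
  have e : ∀ x, (c * f x - a) ^ 2 = c ^ 2 * f x ^ 2 - 2 * c * a * f x + a ^ 2 := fun x => by ring
  simp only [e] at h3
  rw [integral_add (f := fun x => c ^ 2 * f x ^ 2 - 2 * c * a * f x) ((hf2.const_mul _).sub
    (hf.const_mul _)) (integrable_const _), integral_sub (hf2.const_mul _) (hf.const_mul _),
    integral_const_mul, integral_const_mul, ← ha, integral_const, ← hc, smul_eq_mul] at h3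
  rcases hc0.eq_or_lt with h | h
  · have : J = 0 := by
      rw [← measure_univ_eq_zero]
      exact (measureReal_eq_zero_iff).1 h.symm
    simp [ha, this]
  nlinarith

lemma hasDerivAt_rotation {F : E → ℝ} (hF : Differentiable ℝ F) (x y : E) (θ : ℝ) : HasDerivAt (fun
  θ => F (cos θ • x + sin θ • y)) (fderiv ℝ F (cos θ • x + sin θ • y) (-sin θ • x + cos θ • y)) θ :=
  (hF _).hasFDerivAt.comp_hasDerivAt θ (((hasDerivAt_cos θ).smul_const x).add ((hasDerivAt_sin
  θ).smul_const y))

lemma sq_sub_le_of_hasDerivAt {f f' : ℝ → ℝ} (hd : ∀ θ, HasDerivAt f (f' θ) θ) (hm : Measurable f')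
    {B : ℝ} (hB : ∀ θ, |f' θ| ≤ B) : (f 0 - f (Real.pi / 2)) ^ 2 ≤ Real.pi / 2 * ∫ θ in Ioc 0
    (Real.pi / 2), f' θ ^ 2 := by
  have hint : IntegrableOn f' (Ioc 0 (Real.pi / 2)) :=
    Integrable.of_bound hm.aestronglyMeasurable B (.of_forall hB)
  have hint2 : IntegrableOn (fun θ => f' θ ^ 2) (Ioc 0 (Real.pi / 2)) := by
    refine Integrable.of_bound (hm.pow_const 2).aestronglyMeasurable (B ^ 2)
      (.of_forall fun θ => ?_)
    rw [norm_pow]; bound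
  have ftc := intervalIntegral.integral_eq_sub_of_hasDerivAt (a := 0) (b := Real.pi / 2)
    (fun θ _ => hd θ) ((intervalIntegrable_iff_integrableOn_Ioc_of_le (by positivity)).2 hint)
  rw [intervalIntegral.integral_of_le (by positivity)] at ftc
  have cs := sq_integral_le hint hint2
  rw [measureReal_restrict_apply_univ, volume_real_Ioc_of_le (by positivity), ftc, sub_zero] at cs
  linarith

/-- Gaussian Poincaré inequality (with a non-optimal constant). -/
lemma gaussian_poincare {F : E → ℝ} (hF : Differentiable ℝ F) {C : ℝ} (hC : ∀ x, ‖fderiv ℝ F x‖ ≤ C)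
    {M : ℝ} (hM : ∀ x, |F x| ≤ M) : ∫ x, (F x - ∫ z, F z ∂stdGaussian E) ^ 2 ∂stdGaussian E ≤
    Real.pi ^ 2 / 8 * ∫ x, ‖fderiv ℝ F x‖ ^ 2 ∂(stdGaussian E) := by
  set γ := stdGaussian E with hγ
  set P := γ.prod γ with hP
  set m := ∫ z, F z ∂γ with hm
  have hFm := hF.continuous.measurable
  have hC0 := (norm_nonneg _).trans (hC 0)
  have iF : Integrable F γ := Integrable.of_bound hFm.aestronglyMeasurable M (.of_forall hM)
  have iF2 : Integrable (fun x => (F x - m) ^ 2) γ := by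
    refine Integrable.of_bound (by fun_prop) ((M + |m|) ^ 2) (.of_forall fun x => ?_)
    rw [norm_eq_abs, abs_pow]
    gcongr
    grind
  obtain ⟨φ, hφ⟩ : ∃ φ : ℝ → E × E → ℝ, φ = fun θ p => fderiv ℝ F
    (ContinuousLinearMap.rotation θ p).1 (ContinuousLinearMap.rotation θ p).2 := ⟨_, rfl⟩
  have hφm : Measurable (fun q : (E × E) × ℝ => φ q.2 q.1) := by
    have c1 : Continuous (fun q : (E × E) × ℝ => ContinuousLinearMap.rotation q.2 q.1) := by
      simp only [ContinuousLinearMap.rotation_apply]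
      fun_prop
    have m1 := (measurable_fderiv ℝ F).comp c1.fst.measurable
    rw [hφ]
    exact isBoundedBilinearMap_apply.continuous.measurable.comp (m1.prodMk c1.snd.measurable)
  have hφb : ∀ θ p, |φ θ p| ≤ C * (‖p.1‖ + ‖p.2‖) := by
    intro θ p
    rw [hφ, ← norm_eq_abs]
    refine (le_opNorm _ _).trans ?_
    gcongr
    · exact hC _
    · rw [ContinuousLinearMap.rotation_apply]
      refine (norm_add_le _ _).trans ?_
      rw [norm_smul, norm_smul, norm_neg]
      have h1 := abs_sin_le_one θ
      have h2 := abs_cos_le_one θ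
      rw [norm_eq_abs, norm_eq_abs]
      nlinarith [norm_nonneg p.1, norm_nonneg p.2]
  have idom : Integrable (fun p : E × E => (C * (‖p.1‖ + ‖p.2‖)) ^ 2) P := by
    have e : (fun p : E × E => (C * (‖p.1‖ + ‖p.2‖)) ^ 2) = fun p => C ^ 2 * (‖p.1‖ ^ 2 * 1) +
        2 * C ^ 2 * (‖p.1‖ ^ 1 * ‖p.2‖ ^ 1) + C ^ 2 * (1 * ‖p.2‖ ^ 2) := by
      ext p; ring
    rw [e]
    exact ((((integrable_norm_pow_stdGaussian 2).mul_prod (integrable_const 1)).const_mul _).add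
      (((integrable_norm_pow_stdGaussian 1).mul_prod (integrable_norm_pow_stdGaussian 1)).const_mul
      _)).add (((integrable_const 1).mul_prod (integrable_norm_pow_stdGaussian 2)).const_mul _)
  set J : Measure ℝ := volume.restrict (Ioc 0 (Real.pi / 2)) with hJ
  have hJ1 : J.real univ = Real.pi / 2 := by
    rw [hJ, measureReal_restrict_apply_univ, volume_real_Ioc_of_le (by positivity)]; ring
  have hpt : ∀ p : E × E, (F p.1 - F p.2) ^ 2 ≤ Real.pi / 2 * ∫ θ, φ θ p ^ 2 ∂J := by
    intro p
    have h1 := sq_sub_le_of_hasDerivAt (f := fun θ => F (cos θ • p.1 + sin θ • p.2))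
      (f' := fun θ => φ θ p) (fun θ => by
        have := hasDerivAt_rotation hF p.1 p.2 θ
        simpa only [hφ, ContinuousLinearMap.rotation_apply] using this)
      (hφm.comp (measurable_prodMk_left (x := p))) (hφb · p)
    simpa using h1
  have iprod : Integrable (fun q : (E × E) × ℝ => φ q.2 q.1 ^ 2) (P.prod J) := by
    have := idom.mul_prod (integrable_const (1 : ℝ) (μ := J))
    refine this.mono' (hφm.pow_const 2).aestronglyMeasurable (.of_forall fun q => ?_)
    rw [mul_one, norm_pow]
    gcongr
    exact hφb q.2 q.1
  have hrot : ∀ θ, ∫ p, φ θ p ^ 2 ∂P = ∫ x, ‖fderiv ℝ F x‖ ^ 2 ∂γ := by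
    intro θ
    have hmr := IsGaussian.map_rotation_eq_self (μ := γ) (by simpa using integral_id_stdGaussian) θ
    have hmm : Measurable fun p : E × E => (fderiv ℝ F p.1 p.2) ^ 2 :=
      (isBoundedBilinearMap_apply.continuous.measurable.comp (((measurable_fderiv ℝ F).comp
      measurable_fst).prodMk measurable_snd)).pow_const 2
    have h1 : ∫ p, φ θ p ^ 2 ∂P = ∫ p, (fderiv ℝ F p.1 p.2) ^ 2 ∂P := by
      rw [hφ]
      conv_rhs => rw [hP, ← hmr]
      rw [integral_map (by fun_prop) hmm.aestronglyMeasurable]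
    have hi2 : Integrable (fun p : E × E => (fderiv ℝ F p.1 p.2) ^ 2) P := by
      refine idom.mono' hmm.aestronglyMeasurable (.of_forall fun p => ?_)
      rw [norm_pow]
      gcongr
      refine (le_opNorm _ _).trans ?_
      gcongr
      · exact hC _
      · linarith [norm_nonneg p.1]
    rw [h1, hP, integral_prod _ hi2]
    simp only [integral_sq_stdGaussian, hγ]
  have hsum : ∫ p : E × E, (F p.1 - F p.2) ^ 2 ∂P = 2 * ∫ x, (F x - m) ^ 2 ∂γ := by
    have i1 : Integrable (fun p : E × E => (F p.1 - m) ^ 2 * 1) P := iF2.mul_prod (integrable_const 1)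
    have i2 : Integrable (fun p : E × E => 1 * (F p.2 - m) ^ 2) P := (integrable_const 1).mul_prod iF2
    have i0 : Integrable (fun x => F x - m) γ := iF.sub (integrable_const _)
    have i3 := i0.mul_prod i0
    have e : ∀ p : E × E, (F p.1 - F p.2) ^ 2 = (F p.1 - m) ^ 2 * 1 + 1 * (F p.2 - m) ^ 2
      - 2 * ((F p.1 - m) * (F p.2 - m)) := fun p => by ring
    have z : ∫ x, (F x - m) ∂γ = 0 := by
      rw [integral_sub iF (integrable_const _)]; simp [hm]
    have j1 : ∫ p : E × E, (F p.1 - m) ^ 2 * 1 ∂P = ∫ x, (F x - m) ^ 2 ∂γ := by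
      rw [hP, integral_prod_mul (fun x => (F x - m) ^ 2) (fun _ => (1:ℝ))]; simp
    have j2 : ∫ p : E × E, 1 * (F p.2 - m) ^ 2 ∂P = ∫ x, (F x - m) ^ 2 ∂γ := by
      rw [hP, integral_prod_mul (fun _ => (1:ℝ)) (fun x => (F x - m) ^ 2)]; simp
    have j3 : ∫ p : E × E, 2 * ((F p.1 - m) * (F p.2 - m)) ∂P = 0 := by
      rw [integral_const_mul, hP, integral_prod_mul (fun x => F x - m) (fun x => F x - m), z]; simp
    simp only [e]
    rw [integral_sub (f := fun p : E × E => (F p.1 - m) ^ 2 * 1 + 1 * (F p.2 - m) ^ 2)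
      (i1.add i2) (i3.const_mul 2), integral_add i1 i2, j1, j2, j3]
    ring
  have hfin : ∫ p : E × E, (F p.1 - F p.2) ^ 2 ∂P ≤ ∫ p, Real.pi / 2 * ∫ θ, φ θ p ^ 2 ∂J ∂P := by
    apply integral_mono_of_nonneg (.of_forall fun _ => sq_nonneg _)
    · exact iprod.integral_prod_left.const_mul _
    · exact .of_forall hpt
  rw [hsum, integral_const_mul, integral_integral_swap iprod] at hfin
  simp only [hrot] at hfin
  rw [integral_const, hJ1, smul_eq_mul] at hfin
  linarith

end Gaussian

section Channel

lemma continuous_gexp (η : ℝ) : Continuous (fun p : E × E => gexp η p.1 p.2) := by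
  unfold gexp; fun_prop

lemma gexp_nonpos {η : ℝ} (hη : 0 < η) (x y : E) : gexp η x y ≤ 0 := by
  unfold gexp
  exact div_nonpos_of_nonpos_of_nonneg (by simp) (by positivity)

/-- Joint law of `(X, X + √η G)` with `X` distributed as `ρ`, `G` standard Gaussian. -/
def chan (ρ : Measure E) (η : ℝ) : Measure (E × E) :=
  (ρ.prod (stdGaussian E)).map (fun p => (p.1, p.1 + √η • p.2))

/-- Posterior law of `X` given `X + √η G = y`. -/
def post (ρ : Measure E) (η : ℝ) (y : E) : Measure E := ρ.tilted (fun x => gexp η x y)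

variable {ρ : Measure E} [IsProbabilityMeasure ρ] {η : ℝ}

instance : IsProbabilityMeasure (chan ρ η) := isProbabilityMeasure_map (by fun_prop)

lemma integrable_gexp (hη : 0 < η) (y : E) : Integrable (fun x => exp (gexp η x y)) ρ := by
  refine Integrable.of_bound ?_ 1 (.of_forall fun x => ?_)
  · exact (continuous_exp.comp
      ((continuous_gexp η).comp (by fun_prop : Continuous fun x : E => (x, y)))).aestronglyMeasurable
  · rw [norm_eq_abs, abs_of_pos (exp_pos _)]
    exact exp_le_one_iff.2 (gexp_nonpos hη x y)

lemma isProbabilityMeasure_post (hη : 0 < η) (y : E) : IsProbabilityMeasure (post ρ η y) :=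
  isProbabilityMeasure_tilted (integrable_gexp hη y)

lemma measurable_postDensity : Measurable (Function.uncurry fun (y x : E) =>
    ENNReal.ofReal (exp (gexp η x y) / ∫ z, exp (gexp η z y) ∂ρ)) := by
  have h1 : Measurable (fun p : E × E => exp (gexp η p.2 p.1)) :=
    (Real.continuous_exp.comp ((continuous_gexp η).comp continuous_swap)).measurable
  have h2 : Measurable (fun y : E => ∫ z, exp (gexp η z y) ∂ρ) :=
    (h1.stronglyMeasurable.integral_prod_right (ν := ρ)).measurable
  exact (h1.div (h2.comp measurable_fst)).ennreal_ofReal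

variable (ρ η) in
/-- The posterior as a Markov kernel. -/
def postK : Kernel E E := Kernel.withDensity (Kernel.const E ρ) (fun y x =>
  ENNReal.ofReal (exp (gexp η x y) / ∫ z, exp (gexp η z y) ∂ρ))

lemma postK_apply (y : E) : postK ρ η y = post ρ η y := by
  rw [postK, Kernel.withDensity_apply _ measurable_postDensity, Kernel.const_apply]
  rfl

lemma isMarkovKernel_postK (hη : 0 < η) : IsMarkovKernel (postK ρ η) :=
  ⟨fun y => by rw [postK_apply]; exact isProbabilityMeasure_post hη y⟩

lemma integral_exp_gexp_eq (x : E) : ∫ y : E, exp (gexp η x y) =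
    ∫ y : E, exp (gexp η (0 : E) y) := by
  rw [← integral_sub_right_eq_self (fun y : E => exp (gexp η (0 : E) y)) x]
  simp [gexp]

lemma lintegral_chan {F : E × E → ℝ≥0∞} (hF : Measurable F) (hη : 0 < η) : ∫⁻ q, F q ∂chan ρ η = ∫⁻
    y, ∫⁻ x, ENNReal.ofReal (exp (gexp η x y) / ∫ z : E, exp (gexp η (0 : E) z)) * F (x, y) ∂ρ := by
  obtain ⟨c, hc⟩ : ∃ c, c = ∫ z : E, exp (gexp η (0 : E) z) := ⟨_, rfl⟩
  rw [← hc]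
  have h1 : ∀ x, ∫⁻ u, F (x, x + √η • u) ∂stdGaussian E =
      ∫⁻ y, ENNReal.ofReal (exp (gexp η x y) / c) * F (x, y) := by
    intro x
    have h2 := lintegral_map (μ := stdGaussian E) (f := fun y => F (x, y))
      (g := fun u => x + √η • u) (by fun_prop) (by fun_prop)
    rw [← h2, stdGaussian_map_eq hη, lintegral_tilted, integral_exp_gexp_eq, hc]
  have hm : Measurable (fun p : E × E => ENNReal.ofReal (exp (gexp η p.1 p.2) / c) * F p) :=
    (((Real.continuous_exp.comp (continuous_gexp η)).measurable.div_const _).ennreal_ofReal).mul hF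
  rw [chan, lintegral_map hF (by fun_prop), lintegral_prod _ (by fun_prop)]
  simp only [h1]
  exact lintegral_lintegral_swap
    (f := fun x y => ENNReal.ofReal (exp (gexp η x y) / c) * F (x, y)) hm.aemeasurable

lemma chan_swap (hη : 0 < η) :
    (chan ρ η).map Prod.swap = ((chan ρ η).map Prod.snd) ⊗ₘ (postK ρ η) := by
  have := isMarkovKernel_postK (ρ := ρ) hη
  have : IsProbabilityMeasure ((chan ρ η).map Prod.snd) := isProbabilityMeasure_map (by fun_prop)
  refine ext_of_lintegral _ fun F hF => ?_
  rw [lintegral_compProd hF, lintegral_map hF (by fun_prop)]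
  have hm2 : Measurable fun y => ∫⁻ x, F (y, x) ∂(postK ρ η y) := hF.lintegral_kernel_prod_right'
  rw [lintegral_map hm2 (by fun_prop), lintegral_chan (by fun_prop) hη,
    lintegral_chan (F := fun q => ∫⁻ x, F (q.2, x) ∂postK ρ η q.2) (hm2.comp measurable_snd) hη]
  congr 1; ext y
  have hZ : 0 < ∫ z, exp (gexp η z y) ∂ρ := MeasureTheory.integral_exp_pos (integrable_gexp hη y)
  have hm3 : Measurable fun x => ENNReal.ofReal (exp (gexp η x y)) := (continuous_exp.comp
    ((continuous_gexp η).comp (by fun_prop : Continuous fun x : E => (x,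
    y)))).measurable.ennreal_ofReal
  have hc : 0 < ∫ z : E, exp (gexp η (0 : E) z) :=
    MeasureTheory.integral_exp_pos (integrable_exp_gexp hη 0)
  simp only [postK_apply, post, lintegral_tilted, Prod.swap_prod_mk]
  rw [lintegral_mul_const _ (by simp_rw [ofReal_div_of_pos hc]; exact hm3.div_const _)]
  simp_rw [ofReal_div_of_pos hc, ofReal_div_of_pos hZ, div_eq_mul_inv]
  rw [lintegral_mul_const _ hm3, ← ofReal_integral_eq_lintegral_ofReal (integrable_gexp hη y)
    (.of_forall fun _ => (exp_pos _).le)]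
  have e1 : ∀ x, ENNReal.ofReal (exp (gexp η x y)) * (ENNReal.ofReal (∫ z : E, exp (gexp η 0 z)))⁻¹
      * F (y, x) = (ENNReal.ofReal (∫ z : E, exp (gexp η 0 z)))⁻¹ * (ENNReal.ofReal (exp (gexp η x
      y)) * F (y, x)) := fun x => by ring
  have e2 : ∀ x, ENNReal.ofReal (exp (gexp η x y)) * (ENNReal.ofReal (∫ z : E, exp (gexp η z y)
      ∂ρ))⁻¹ * F (y, x) = (ENNReal.ofReal (∫ z : E, exp (gexp η z y) ∂ρ))⁻¹ * (ENNReal.ofReal (exp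
      (gexp η x y)) * F (y, x)) := fun x => by ring
  have hm4 : Measurable fun x => ENNReal.ofReal (exp (gexp η x y)) * F (y, x) := by fun_prop
  simp_rw [e1, e2]
  rw [lintegral_const_mul _ hm4, lintegral_const_mul _ hm4]
  have hZ' : ENNReal.ofReal (∫ z, exp (gexp η z y) ∂ρ) ≠ 0 := by simpa using hZ
  have hZt : ENNReal.ofReal (∫ z, exp (gexp η z y) ∂ρ) ≠ ⊤ := ofReal_ne_top
  generalize ENNReal.ofReal (∫ z, exp (gexp η z y) ∂ρ) = Z at hZ' hZt
  have := ENNReal.mul_inv_cancel hZ' hZt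
  calc _ = (Z * Z⁻¹) * _ := by rw [this, one_mul]
    _ = _ := by ring

variable {F : Type*} [NormedAddCommGroup F] [NormedSpace ℝ F]

lemma integrable_chan_iff {φ : E × E → F} (hφ : AEStronglyMeasurable φ (chan ρ η)) : Integrable φ
  (chan ρ η) ↔ Integrable (fun p : E × E => φ (p.1, p.1 + √η • p.2)) (ρ.prod (stdGaussian E)) :=
  integrable_map_measure hφ (by fun_prop)

lemma integral_chan {φ : E × E → F} (h : Integrable φ (chan ρ η)) :
    ∫ q, φ q ∂chan ρ η = ∫ x, ∫ u, φ (x, x + √η • u) ∂(stdGaussian E) ∂ρ := by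
  have h2 := (integrable_chan_iff h.1).1 h
  rw [chan, integral_map (by fun_prop) h.1, integral_prod _ h2]

lemma chan_bayes (hη : 0 < η) {φ : E × E → F} (h : Integrable φ (chan ρ η)) :
    Integrable (fun q => ∫ x, φ (x, q.2) ∂post ρ η q.2) (chan ρ η) ∧
    ∫ q, φ q ∂chan ρ η = ∫ q, ∫ x, φ (x, q.2) ∂(post ρ η q.2) ∂(chan ρ η) := by
  have := isMarkovKernel_postK (ρ := ρ) hη
  have h1 : Integrable (fun q => φ q.swap) (((chan ρ η).map Prod.snd) ⊗ₘ (postK ρ η)) := by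
    rw [← chan_swap hη]
    have e : (MeasurableEquiv.prodComm : E × E ≃ᵐ E × E) = (Prod.swap : E × E → E × E) := rfl
    rw [← e, integrable_map_equiv]
    exact h
  have h2 : Integrable (fun y => ∫ x, φ (x, y) ∂postK ρ η y) ((chan ρ η).map Prod.snd) :=
    h1.integral_compProd
  have h3 := Measure.integral_compProd h1
  simp only [Prod.swap_prod_mk, postK_apply] at h2 h3
  refine ⟨(integrable_map_measure h2.1 (by fun_prop)).1 h2, ?_⟩
  have h4 := integral_map (μ := chan ρ η) (φ := Prod.snd) (by fun_prop) h2.1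
  rw [h4, ← chan_swap hη] at h3
  rw [← h3]
  have e : (MeasurableEquiv.prodComm : E × E ≃ᵐ E × E) = (Prod.swap : E × E → E × E) := rfl
  rw [← e, integral_map_equiv]
  rfl

end Channel

section ExpFamily

variable {Ω : Type*} [MeasurableSpace Ω] {ρ : Measure Ω} {W : Type*} [NormedAddCommGroup W]
  [NormedSpace ℝ W] {F : Type*} [NormedAddCommGroup F] [NormedSpace ℝ F]

/-- The statistic `S` and base exponent `h` generate an everywhere defined exponential family. -/
structure IsExpFamily (ρ : Measure Ω) (h : Ω → ℝ) (S : Ω → W →L[ℝ] ℝ) : Prop where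
  aesm : AEStronglyMeasurable h ρ
  aesmS : AEStronglyMeasurable S ρ
  integrable : ∀ c : ℝ, Integrable (fun ω => exp (h ω + c * ‖S ω‖)) ρ

/-- Functions of at most exponential growth in the statistic `S`. -/
def SubExp (ρ : Measure Ω) (S : Ω → W →L[ℝ] ℝ) (φ : Ω → F) : Prop :=
  AEStronglyMeasurable φ ρ ∧ ∃ C c : ℝ, ∀ᵐ ω ∂ρ, ‖φ ω‖ ≤ C * exp (c * ‖S ω‖)

variable {h : Ω → ℝ} {S : Ω → W →L[ℝ] ℝ}

lemma subExp_of_bound {φ : Ω → F} (hφ : AEStronglyMeasurable φ ρ) {C : ℝ} (hC : ∀ᵐ ω ∂ρ, ‖φ ω‖ ≤ C)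
  : SubExp ρ S φ := ⟨hφ, C, 0, by simpa using hC⟩

lemma subExp_const (a : F) : SubExp ρ S (fun _ => a) :=
  subExp_of_bound aestronglyMeasurable_const (.of_forall fun _ => le_rfl)

lemma IsExpFamily.aesm_exp (H : IsExpFamily ρ h S) (v : W) : AEStronglyMeasurable (fun ω => exp (h ω
  + S ω v)) ρ := continuous_exp.comp_aestronglyMeasurable (H.aesm.add
  (H.aesmS.apply_continuousLinearMap v))

lemma exp_mul_le {h s x C c r : ℝ} {v : W} {T : W →L[ℝ] ℝ} (hs : s = T v) (hv : ‖v‖ ≤ r) (hx : x ≤ C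
    * exp (c * ‖T‖)) (hC : 0 ≤ C) : exp (h + s) * x ≤ C * exp (h + (r + c) * ‖T‖) := by
  have h1 : s ≤ r * ‖T‖ := by
    rw [hs]
    refine (le_abs_self _).trans ((T.le_opNorm v).trans ?_)
    rw [mul_comm]; gcongr
  calc exp (h + s) * x ≤ exp (h + s) * (C * exp (c * ‖T‖)) := by gcongr
    _ ≤ exp (h + r * ‖T‖) * (C * exp (c * ‖T‖)) := by gcongr
    _ = C * (exp (h + r * ‖T‖) * exp (c * ‖T‖)) := by ring
    _ = _ := by rw [← exp_add]; ring_nf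

lemma SubExp.nonneg_bound {φ : Ω → F} (hφ : SubExp ρ S φ) :
    ∃ C c : ℝ, 0 ≤ C ∧ ∀ᵐ ω ∂ρ, ‖φ ω‖ ≤ C * exp (c * ‖S ω‖) := by
  obtain ⟨_, C, c, hb⟩ := hφ
  refine ⟨|C|, c, abs_nonneg _, hb.mono fun ω hω => hω.trans ?_⟩
  bound

lemma SubExp.integrable (H : IsExpFamily ρ h S) {φ : Ω → F} (hφ : SubExp ρ S φ) (v : W) :
    Integrable (fun ω => exp (h ω + S ω v) • φ ω) ρ := by
  obtain ⟨C, c, hC, hb⟩ := hφ.nonneg_bound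
  refine ((H.integrable (‖v‖ + c)).const_mul C).mono' ((H.aesm_exp v).smul hφ.1)
    (hb.mono fun ω hω => ?_)
  rw [norm_smul, norm_eq_abs, abs_of_pos (exp_pos _)]
  exact exp_mul_le rfl le_rfl hω hC

lemma SubExp.smulRight (hS : AEStronglyMeasurable S ρ) {φ : Ω → F} (hφ : SubExp ρ S φ) :
    SubExp ρ S (fun ω => (S ω).smulRight (φ ω)) := by
  obtain ⟨C, c, hC, hb⟩ := hφ.nonneg_bound
  refine ⟨?_, C, c + 1, hb.mono fun ω hω => ?_⟩
  · have := (isBoundedBilinearMap_smulRight (𝕜 := ℝ) (E := W) (F := F)).continuous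
    exact this.comp_aestronglyMeasurable (hS.prodMk hφ.1)
  · rw [norm_smulRight_apply, add_mul, exp_add, one_mul]
    have := (by linarith [add_one_le_exp ‖S ω‖] : ‖S ω‖ ≤ exp ‖S ω‖)
    calc ‖S ω‖ * ‖φ ω‖ ≤ exp ‖S ω‖ * (C * exp (c * ‖S ω‖)) := by gcongr
      _ = _ := by ring

lemma SubExp.integrable_tilted (H : IsExpFamily ρ h S) {φ : Ω → F} (hφ : SubExp ρ S φ) (v : W) :
    Integrable φ (ρ.tilted (fun ω => h ω + S ω v)) := by
  rw [integrable_tilted_iff (by simpa using (subExp_const (1:ℝ)).integrable H v)]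
  exact hφ.integrable H v

lemma SubExp.hasFDerivAt_numerator (H : IsExpFamily ρ h S) {φ : Ω → F} (hφ : SubExp ρ S φ) (v : W) :
    HasFDerivAt (fun v => ∫ ω, exp (h ω + S ω v) • φ ω ∂ρ) (∫ ω, exp (h ω + S ω v) • (S ω).smulRight
    (φ ω) ∂ρ) v := by
  obtain ⟨C, c, hC, hb⟩ := (hφ.smulRight H.aesmS).nonneg_bound
  have hi := (hφ.smulRight H.aesmS).integrable H v
  refine hasFDerivAt_integral_of_dominated_of_fderiv_le (s := ball v 1) (bound := fun ω => C * exp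
    (h ω + (‖v‖ + 1 + c) * ‖S ω‖)) (ball_mem_nhds v one_pos) (.of_forall fun w => (hφ.integrable H
    w).1) (hφ.integrable H v) hi.1 (F' := fun w ω => exp (h ω + S ω w) • (S ω).smulRight (φ ω)) ?_
    ((H.integrable _).const_mul C) (.of_forall fun ω w _ => ?_)
  · filter_upwards [hb] with ω hω w hw
    rw [norm_smul, norm_eq_abs, abs_of_pos (exp_pos _)]
    refine exp_mul_le rfl ?_ hω hC
    have := mem_ball_iff_norm.1 hw
    linarith [norm_le_norm_add_norm_sub' w v]
  · have h1 : HasFDerivAt (fun w => exp (h ω + S ω w)) (exp (h ω + S ω w) • S ω) w :=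
      (((S ω).hasFDerivAt).const_add (h ω)).exp
    have h2 := h1.smul_const (φ ω)
    convert h2 using 1
    ext u
    simp [smul_smul]

lemma integral_tilted_eq_smul (f : Ω → ℝ) (φ : Ω → F) :
    ∫ ω, φ ω ∂(ρ.tilted f) = (∫ ω, exp (f ω) ∂ρ)⁻¹ • ∫ ω, exp (f ω) • φ ω ∂ρ := by
  rw [integral_tilted, ← integral_smul]
  congr 1; ext ω
  rw [smul_smul, div_eq_inv_mul]

lemma IsExpFamily.partition_pos (H : IsExpFamily ρ h S) [NeZero ρ] (v : W) : 0 < ∫ ω, exp (h ω + S ω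
  v) ∂ρ := MeasureTheory.integral_exp_pos (by simpa using (subExp_const (1:ℝ)).integrable H v)

lemma IsExpFamily.hasFDerivAt_partition (H : IsExpFamily ρ h S) (v : W) : HasFDerivAt (fun v => ∫ ω,
    exp (h ω + S ω v) ∂ρ) (∫ ω, exp (h ω + S ω v) • S ω ∂ρ) v := by
  have := (subExp_const (ρ := ρ) (S := S) (1:ℝ)).hasFDerivAt_numerator H v
  have e : ∀ T : W →L[ℝ] ℝ, T.smulRight (1:ℝ) = T := fun T => by ext; simp
  simp_all

lemma IsExpFamily.hasFDerivAt_log_partition (H : IsExpFamily ρ h S) [NeZero ρ] (v : W) : HasFDerivAt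
    (fun v => log (∫ ω, exp (h ω + S ω v) ∂ρ)) (∫ ω, S ω ∂(ρ.tilted (fun ω => h ω + S ω v))) v := by
  rw [integral_tilted_eq_smul]
  exact (H.hasFDerivAt_partition v).log (H.partition_pos v).ne'

/-- Differentiating the mean of an observable in an exponential family yields a covariance. -/
lemma SubExp.hasFDerivAt_mean (H : IsExpFamily ρ h S) [NeZero ρ] [CompleteSpace F] {φ : Ω → F} (hφ :
    SubExp ρ S φ) (v : W) : HasFDerivAt (fun v => ∫ ω, φ ω ∂(ρ.tilted (fun ω => h ω + S ω v))) (∫ ω,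
    (S ω).smulRight (φ ω) ∂(ρ.tilted (fun ω => h ω + S ω v)) - (∫ ω, S ω ∂(ρ.tilted (fun ω => h ω +
    S ω v))).smulRight (∫ ω, φ ω ∂(ρ.tilted (fun ω => h ω + S ω v)))) v := by
  simp only [integral_tilted_eq_smul]
  have hp := (H.partition_pos v).ne'
  have h1 := ((hasDerivAt_inv hp).comp_hasFDerivAt v (H.hasFDerivAt_partition v)).smul (hφ.hasFDerivAt_numerator H v)
  refine HasFDerivAt.congr_fderiv h1 ?_
  ext u
  simp only [_root_.add_apply, _root_.sub_apply,
    _root_.smul_apply, smulRight_apply, smul_smul, smul_eq_mul]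
  rw [sub_eq_add_neg, ← neg_smul]
  grind

end ExpFamily

section Smooth

/-- Law of `B + √β G` with `B` distributed as `ν`. -/
def smooth (ν : Measure E) (β : ℝ) : Measure E := (chan ν β).map Prod.snd

variable {ν : Measure E} [IsProbabilityMeasure ν] {β η : ℝ}

instance : IsProbabilityMeasure (smooth ν β) := isProbabilityMeasure_map (by fun_prop)

lemma gexp_add_gexp (hβ : 0 < β) (hη : 0 < η) (b x y : E) : gexp η x y + gexp β b x = gexp (β * η /
    (β + η)) ((1 / (β + η)) • (η • b + β • y)) x + gexp (β + η) b y := by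
  have h1 : ∀ u v : E, ‖u - v‖ ^ 2 = ‖u‖ ^ 2 - 2 * ⟪u, v⟫ + ‖v‖ ^ 2 := norm_sub_sq_real
  simp only [gexp, h1, inner_smul_right, inner_add_right, norm_smul, mul_pow, norm_add_sq_real,
    inner_smul_left]
  simp only [norm_eq_abs, sq_abs, real_inner_comm x y, real_inner_comm y b, conj_trivial]
  grind

lemma lintegral_smooth {φ : E → ℝ≥0∞} (hφ : Measurable φ) :
    ∫⁻ x, φ x ∂smooth ν β = ∫⁻ b, ∫⁻ u, φ (b + √β • u) ∂(stdGaussian E) ∂ν := by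
  rw [smooth, lintegral_map hφ measurable_snd, chan, lintegral_map (f := fun q : E × E => φ q.2) (by
    fun_prop) (by fun_prop), lintegral_prod _ (by fun_prop)]

lemma lintegral_stdGaussian_eq (hβ : 0 < β) (b : E) {φ : E → ℝ≥0∞} (hφ : Measurable φ) : ∫⁻ u, φ (b
    + √β • u) ∂stdGaussian E = (ENNReal.ofReal (∫ z : E, exp (gexp β (0 : E) z)))⁻¹ * ∫⁻ x,
    ENNReal.ofReal (exp (gexp β b x)) * φ x := by
  have hc : 0 < ∫ z : E, exp (gexp β (0 : E) z) :=
    MeasureTheory.integral_exp_pos (integrable_exp_gexp hβ 0)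
  have hm := (continuous_exp.comp ((continuous_gexp β).comp (by fun_prop : Continuous fun x : E =>
    (b, x)))).measurable.ennreal_ofReal
  have h2 := lintegral_map (μ := stdGaussian E) (f := φ) (g := fun u => b + √β • u) hφ (by fun_prop)
  have hmφ : Measurable fun x => ENNReal.ofReal (exp (gexp β b x)) * φ x := hm.mul hφ
  rw [← h2, stdGaussian_map_eq hβ, lintegral_tilted, integral_exp_gexp_eq,
    ← lintegral_const_mul _ hmφ]
  congr 1; ext x
  rw [ofReal_div_of_pos hc, div_eq_mul_inv]
  ring

/-- Completing the square in the posterior of a smoothed measure. -/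
lemma lintegral_gexp_smooth (hβ : 0 < β) (hη : 0 < η) (y : E) {φ : E → ℝ≥0∞} (hφ : Measurable φ) :
    ∫⁻ x, ENNReal.ofReal (exp (gexp η x y)) * φ x ∂smooth ν β = (ENNReal.ofReal (∫ z : E, exp (gexp
    β (0 : E) z)))⁻¹ * ENNReal.ofReal (∫ z : E, exp (gexp (β * η / (β + η)) (0 : E) z)) * ∫⁻ b,
    ENNReal.ofReal (exp (gexp (β + η) b y)) * ∫⁻ u, φ ((1 / (β + η)) • (η • b + β • y) + √(β * η /
    (β + η)) • u) ∂(stdGaussian E) ∂ν := by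
  have hv : 0 < β * η / (β + η) := by positivity
  have hc : 0 < ∫ z : E, exp (gexp (β * η / (β + η)) (0 : E) z) :=
    MeasureTheory.integral_exp_pos (integrable_exp_gexp hv 0)
  have hm : ∀ (a : ℝ) (y : E), Measurable fun x => ENNReal.ofReal (exp (gexp a x y)) := fun a y =>
    (continuous_exp.comp ((continuous_gexp a).comp (by fun_prop : Continuous fun x : E => (x,
    y)))).measurable.ennreal_ofReal
  have hm' : ∀ (a : ℝ) (y : E), Measurable fun x => ENNReal.ofReal (exp (gexp a y x)) := fun a y =>
    (continuous_exp.comp ((continuous_gexp a).comp (by fun_prop : Continuous fun x : E => (y,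
    x)))).measurable.ennreal_ofReal
  have hmm : Measurable fun b => ENNReal.ofReal (exp (gexp (β + η) b y)) *
      ∫⁻ u, φ ((1 / (β + η)) • (η • b + β • y) + √(β * η / (β + η)) • u) ∂(stdGaussian E) := by
    refine (hm _ _).mul ?_
    fun_prop
  have hmφ : Measurable fun x => ENNReal.ofReal (exp (gexp η x y)) * φ x := (hm η y).mul hφ
  rw [lintegral_smooth hmφ, ← lintegral_const_mul _ hmm]
  congr 1; ext b
  rw [lintegral_stdGaussian_eq hβ b hmφ, lintegral_stdGaussian_eq hv _ hφ]
  have h1 : ∀ x, ENNReal.ofReal (exp (gexp β b x)) * (ENNReal.ofReal (exp (gexp η x y)) * φ x) =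
      ENNReal.ofReal (exp (gexp (β + η) b y)) * (ENNReal.ofReal (exp (gexp (β * η / (β + η)) ((1 /
      (β + η)) • (η • b + β • y)) x)) * φ x) := by
    intro x
    rw [← mul_assoc, ← mul_assoc, ← ofReal_mul (exp_pos _).le, ← ofReal_mul (exp_pos _).le, ←
      exp_add, ← exp_add, add_comm (gexp β b x), gexp_add_gexp hβ hη, add_comm (gexp (β + η) b y)]
  simp only [h1]
  have hmφ' : Measurable fun x => ENNReal.ofReal (exp
      (gexp (β * η / (β + η)) ((1 / (β + η)) • (η • b + β • y)) x)) * φ x := (hm' _ _).mul hφ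
  rw [lintegral_const_mul _ hmφ']
  have hc' : ENNReal.ofReal (∫ z : E, exp (gexp (β * η / (β + η)) (0 : E) z)) ≠ 0 := by
    simpa using hc
  have := ENNReal.mul_inv_cancel hc' ofReal_ne_top
  generalize ENNReal.ofReal (∫ z : E, exp (gexp (β * η / (β + η)) (0 : E) z)) = c at this
  generalize ENNReal.ofReal (∫ z : E, exp (gexp β (0 : E) z)) = d
  generalize ∫⁻ a, ENNReal.ofReal (exp
    (gexp (β * η / (β + η)) ((1 / (β + η)) • (η • b + β • y)) a)) * φ a = I
  generalize ENNReal.ofReal (exp (gexp (β + η) b y)) = e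
  calc _ = d⁻¹ * (c * c⁻¹) * (e * I) := by rw [this]; ring
    _ = _ := by ring

lemma lintegral_post_smooth_le (hβ : 0 < β) (hη : 0 < η) (y : E) {φ : E → ℝ≥0∞} (hφ : Measurable φ)
    {A : ℝ≥0∞} (hA : ∀ᵐ b ∂ν, ∫⁻ u, φ ((1 / (β + η)) • (η • b + β • y) + √(β * η / (β + η)) • u)
    ∂stdGaussian E ≤ A) : ∫⁻ x, φ x ∂(post (smooth ν β) η y) ≤ A := by
  have hZ : 0 < ∫ z, exp (gexp η z y) ∂(smooth ν β) :=
    MeasureTheory.integral_exp_pos (integrable_gexp hη y)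
  have hm := (continuous_exp.comp ((continuous_gexp η).comp (by fun_prop : Continuous fun x : E =>
    (x, y)))).measurable.ennreal_ofReal
  have hm2 : Measurable fun x => ENNReal.ofReal (exp (gexp (β + η) x y)) := (continuous_exp.comp
    ((continuous_gexp (β + η)).comp (by fun_prop : Continuous fun x : E => (x,
    y)))).measurable.ennreal_ofReal
  have h1 : ∫⁻ x, ENNReal.ofReal (exp (gexp η x y)) * φ x ∂smooth ν β ≤
      A * ENNReal.ofReal (∫ z, exp (gexp η z y) ∂smooth ν β) := by
    have h2 := lintegral_gexp_smooth (ν := ν) hβ hη y (φ := fun _ => 1) measurable_const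
    simp only [mul_one, lintegral_const, measure_univ] at h2
    rw [ofReal_integral_eq_lintegral_ofReal (integrable_gexp hη y) (.of_forall fun _ => (exp_pos
      _).le), h2, lintegral_gexp_smooth hβ hη y hφ, mul_comm A, mul_assoc _ _ A]
    gcongr
    rw [← lintegral_mul_const _ hm2]
    refine lintegral_mono_ae (hA.mono fun b hb => ?_)
    gcongr
  rw [post, lintegral_tilted]
  have e : ∀ x, ENNReal.ofReal (exp (gexp η x y) / ∫ z, exp (gexp η z y) ∂smooth ν β) * φ x =
      (ENNReal.ofReal (exp (gexp η x y)) * φ x) * (ENNReal.ofReal (∫ z, exp (gexp η z y) ∂smooth ν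
      β))⁻¹ := fun x => by
    rw [ofReal_div_of_pos hZ, div_eq_mul_inv]; ring
  simp only [e]
  have hmφ : Measurable fun x => ENNReal.ofReal (exp (gexp η x y)) * φ x := hm.mul hφ
  rw [lintegral_mul_const _ hmφ, ← div_eq_mul_inv]
  exact div_le_of_le_mul h1

/-- Fourth moment of the posterior of a smoothed measure. -/
lemma integral_norm_pow_four_post (hβ : 0 < β) (hη : 0 < η) (hη1 : η ≤ 1) {R : ℝ}
    (hν : SuppIn ν R) (y : E) : Integrable (fun x => ‖x - (β / (β + η)) • y‖ ^ 4) (post (smooth ν β) η y)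
    ∧ ∫ x, ‖x - (β / (β + η)) • y‖ ^ 4 ∂(post (smooth ν β) η y) ≤ 8 * ((R / β) ^ 4 + ∫ u : E, ‖u‖ ^
    4 ∂stdGaussian E) * η ^ 2 := by
  have hG := integrable_norm_pow_stdGaussian (E := E) 4
  have key : ∫⁻ x, ENNReal.ofReal (‖x - (β / (β + η)) • y‖ ^ 4) ∂(post (smooth ν β) η y) ≤
      ENNReal.ofReal (8 * ((R / β) ^ 4 + ∫ u : E, ‖u‖ ^ 4 ∂stdGaussian E) * η ^ 2) := by
    refine lintegral_post_smooth_le hβ hη y (by fun_prop) (hν.mono fun b hb => ?_)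
    have hpt : ∀ u : E, ‖(1 / (β + η)) • (η • b + β • y) + √(β * η / (β + η)) • u -
        (β / (β + η)) • y‖ ^ 4 ≤ 8 * ((R / β) ^ 4 * η ^ 2) + 8 * η ^ 2 * ‖u‖ ^ 4 := by
      intro u
      have e : (1 / (β + η)) • (η • b + β • y) + √(β * η / (β + η)) • u - (β / (β + η)) • y =
          (η / (β + η)) • b + √(β * η / (β + η)) • u := by
        rw [smul_add, smul_smul, smul_smul, one_div_mul_eq_div, one_div_mul_eq_div]; abel
      rw [e]
      have h1 : ‖(η / (β + η)) • b‖ ≤ η * (R / β) := by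
        rw [norm_smul, norm_eq_abs, abs_of_pos (by positivity)]
        calc η / (β + η) * ‖b‖ ≤ η / β * R := by gcongr; linarith
          _ = _ := by ring
      have h2 : ‖√(β * η / (β + η)) • u‖ ≤ √η * ‖u‖ := by
        rw [norm_smul, norm_eq_abs, abs_of_nonneg (sqrt_nonneg _)]
        gcongr
        rw [div_le_iff₀ (by positivity)]
        nlinarith
      have h3 : √η ^ 4 = η ^ 2 := by rw [show (4:ℕ) = 2 * 2 from rfl, pow_mul, sq_sqrt hη.le]
      have h4 : η ^ 4 ≤ η ^ 2 := pow_le_pow_of_le_one hη.le hη1 (by norm_num)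
      have h5 : ∀ a b : ℝ, (a + b) ^ 4 ≤ 8 * a ^ 4 + 8 * b ^ 4 := fun a b => by
        nlinarith [sq_nonneg (a - b), sq_nonneg (a ^ 2 - b ^ 2)]
      calc _ ≤ (η * (R / β) + √η * ‖u‖) ^ 4 := by
            gcongr; exact (norm_add_le _ _).trans (add_le_add h1 h2)
        _ ≤ 8 * (η * (R / β)) ^ 4 + 8 * (√η * ‖u‖) ^ 4 := h5 _ _
        _ = 8 * ((R / β) ^ 4 * η ^ 4) + 8 * η ^ 2 * ‖u‖ ^ 4 := by
            rw [mul_pow, mul_pow, h3]; ring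
        _ ≤ _ := by gcongr
    calc _ ≤ ∫⁻ u, ENNReal.ofReal (8 * ((R / β) ^ 4 * η ^ 2) + 8 * η ^ 2 * ‖u‖ ^ 4)
          ∂(stdGaussian E) := lintegral_mono fun u => ofReal_le_ofReal (hpt u)
      _ = ENNReal.ofReal (∫ u : E, (8 * ((R / β) ^ 4 * η ^ 2) + 8 * η ^ 2 * ‖u‖ ^ 4) ∂stdGaussian E)
        := (ofReal_integral_eq_lintegral_ofReal ((integrable_const _).add (hG.const_mul _))
        (.of_forall fun u => show (0:ℝ) ≤ 8 * ((R / β) ^ 4 * η ^ 2) + 8 * η ^ 2 * ‖u‖ ^ 4 by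
        positivity)).symm
      _ = _ := by
        rw [integral_add (integrable_const _) (hG.const_mul _),
          integral_const_mul (8 * η ^ 2) (fun u : E => ‖u‖ ^ 4)]
        simp only [integral_const, probReal_univ]
        ring_nf
  have hm : AEStronglyMeasurable (fun x => ‖x - (β / (β + η)) • y‖ ^ 4)
    (post (smooth ν β) η y) := by fun_prop
  have hi : Integrable (fun x => ‖x - (β / (β + η)) • y‖ ^ 4) (post (smooth ν β) η y) := by
    refine ⟨hm, ?_⟩
    rw [hasFiniteIntegral_iff_ofReal (.of_forall fun _ => by positivity)]
    exact key.trans_lt ofReal_lt_top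
  refine ⟨hi, ?_⟩
  rw [← ofReal_integral_eq_lintegral_ofReal hi (.of_forall fun _ => by positivity)] at key
  exact (ofReal_le_ofReal_iff (by positivity)).1 key

end Smooth

section L2

variable {Ω : Type*} [MeasurableSpace Ω] {μ : Measure Ω} {F : Type*} [NormedAddCommGroup F]

section Eta

variable [NormedSpace ℝ F] {f g : Ω → F}

lemma iadd (hf : Integrable f μ) (hg : Integrable g μ) : Integrable (fun x => f x + g x) μ :=
  hf.add hg

lemma isub (hf : Integrable f μ) (hg : Integrable g μ) : Integrable (fun x => f x - g x) μ :=
  hf.sub hg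

lemma ismul (c : ℝ) (hf : Integrable f μ) : Integrable (fun x => c • f x) μ := hf.smul c

lemma imul (c : ℝ) {f : Ω → ℝ} (hf : Integrable f μ) : Integrable (fun x => c * f x) μ :=
  hf.const_mul c

end Eta

lemma sq_integral_mul_le {f g : Ω → ℝ} (hf : MemLp f 2 μ) (hg : MemLp g 2 μ) :
    (∫ x, f x * g x ∂μ) ^ 2 ≤ (∫ x, f x ^ 2 ∂μ) * ∫ x, g x ^ 2 ∂μ := by
  have hfg : Integrable (fun x => f x * g x) μ := hf.integrable_mul hg
  have hf2 := hf.integrable_sq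
  have hg2 := hg.integrable_sq
  have h : ∀ t : ℝ, 0 ≤ (∫ x, f x ^ 2 ∂μ) * (t * t) + (2 * ∫ x, f x * g x ∂μ) * t +
      ∫ x, g x ^ 2 ∂μ := by
    intro t
    have h1 : 0 ≤ ∫ x, (t * f x + g x) ^ 2 ∂μ := integral_nonneg fun _ => sq_nonneg _
    have e : ∀ x, (t * f x + g x) ^ 2 = t * t * f x ^ 2 + (2 * t * (f x * g x) + g x ^ 2) :=
      fun x => by ring
    simp only [e] at h1
    rw [integral_add (imul _ hf2) (iadd (imul _ hfg) hg2), integral_add (imul _ hfg) hg2, integral_const_mul, integral_const_mul] at h1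
    linarith
  have := discrim_le_zero h
  rw [discrim] at this
  linarith

lemma integral_mul_le_sqrt {f g : Ω → ℝ} (hf : MemLp f 2 μ) (hg : MemLp g 2 μ) :
    ∫ x, f x * g x ∂μ ≤ √(∫ x, f x ^ 2 ∂μ) * √(∫ x, g x ^ 2 ∂μ) := by
  rw [← sqrt_mul (integral_nonneg fun _ => sq_nonneg _)]
  exact le_sqrt_of_sq_le (sq_integral_mul_le hf hg)

lemma sqrt_integral_norm_add_sq_le {f g : Ω → F} (hf : MemLp f 2 μ) (hg : MemLp g 2 μ) :
    √(∫ x, ‖f x + g x‖ ^ 2 ∂μ) ≤ √(∫ x, ‖f x‖ ^ 2 ∂μ) + √(∫ x, ‖g x‖ ^ 2 ∂μ) := by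
  have hf' := hf.norm
  have hg' := hg.norm
  have h1 := integral_mul_le_sqrt hf' hg'
  have hfg : Integrable (fun x => ‖f x‖ * ‖g x‖) μ := hf'.integrable_mul hg'
  refine sqrt_le_iff.2 ⟨by positivity, ?_⟩
  have a := sq_sqrt (integral_nonneg (μ := μ) fun x => sq_nonneg ‖f x‖)
  have b := sq_sqrt (integral_nonneg (μ := μ) fun x => sq_nonneg ‖g x‖)
  calc ∫ x, ‖f x + g x‖ ^ 2 ∂μ ≤ ∫ x, (‖f x‖ ^ 2 + (2 * (‖f x‖ * ‖g x‖) + ‖g x‖ ^ 2)) ∂μ := by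
        refine integral_mono (hf.add hg).norm.integrable_sq (hf'.integrable_sq.add
          ((hfg.const_mul 2).add hg'.integrable_sq)) fun x => ?_
        have := norm_add_le (f x) (g x)
        have h0 := norm_nonneg (f x + g x)
        nlinarith
    _ = (∫ x, ‖f x‖ ^ 2 ∂μ) + (2 * (∫ x, ‖f x‖ * ‖g x‖ ∂μ) + ∫ x, ‖g x‖ ^ 2 ∂μ) := by
        rw [integral_add hf'.integrable_sq (iadd (imul 2 hfg) hg'.integrable_sq),
          integral_add (imul 2 hfg) hg'.integrable_sq, integral_const_mul]
    _ ≤ _ := by linarith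

lemma sqrt_integral_norm_sq_mono {F' : Type*} [NormedAddCommGroup F'] {f : Ω → F} {g : Ω → F'} (hg :
  MemLp g 2 μ) (h : ∀ᵐ x ∂μ, ‖f x‖ ≤ ‖g x‖) : √(∫ x, ‖f x‖ ^ 2 ∂μ) ≤ √(∫ x, ‖g x‖ ^ 2 ∂μ) :=
  sqrt_le_sqrt (integral_mono_of_nonneg (.of_forall fun _ => sq_nonneg _) hg.norm.integrable_sq
  (h.mono fun x hx => by bound))

lemma tilted_add_const (f : Ω → ℝ) (c : ℝ) : μ.tilted (fun x => f x + c) = μ.tilted f := by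
  unfold tilted
  congr 1; ext x
  simp only [exp_add, integral_mul_const]
  rw [mul_div_mul_right _ _ (exp_pos c).ne']

end L2

section PostCalculus

variable {F : Type*} [NormedAddCommGroup F] [NormedSpace ℝ F]
  {ρ : Measure E} [IsProbabilityMeasure ρ] {η : ℝ}

lemma post_eq_tilted (y : E) :
    post ρ η y = ρ.tilted (fun x => -‖x‖ ^ 2 / (2 * η) + (η⁻¹ • innerSL ℝ x) y) := by
  rw [← tilted_add_const _ (-‖y‖ ^ 2 / (2 * η)), post]
  congr 1; ext x
  simp only [gexp, norm_sub_sq_real, _root_.smul_apply, innerSL_apply_apply,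
    smul_eq_mul, real_inner_comm x y]
  rcases eq_or_ne η 0 with rfl | h
  · simp
  · field_simp; ring

lemma isExpFamily_post (hη : 0 < η) :
    IsExpFamily ρ (fun x => -‖x‖ ^ 2 / (2 * η)) (fun x : E => η⁻¹ • innerSL ℝ x) where
  aesm := by fun_prop
  aesmS := by fun_prop
  integrable c := by
    refine Integrable.of_bound (by fun_prop) (exp (c ^ 2 / (2 * η))) (.of_forall fun x => ?_)
    rw [norm_eq_abs, abs_of_pos (exp_pos _), norm_smul, innerSL_apply_norm, norm_inv,
      norm_eq_abs, abs_of_pos hη]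
    refine exp_le_exp.2 ?_
    have : c ^ 2 / (2 * η) - (-‖x‖ ^ 2 / (2 * η) + c * (η⁻¹ * ‖x‖)) =
        (‖x‖ - c) ^ 2 / (2 * η) := by grind
    have h2 : 0 ≤ (‖x‖ - c) ^ 2 / (2 * η) := by positivity
    linarith

lemma hasFDerivAt_post (hη : 0 < η) [CompleteSpace F] {φ : E → F} (hφ : SubExp ρ (fun x : E => η⁻¹ •
    innerSL ℝ x) φ) (y : E) : HasFDerivAt (fun y => ∫ x, φ x ∂post ρ η y) (∫ x, (η⁻¹ • innerSL ℝ
    x).smulRight (φ x) ∂post ρ η y - (∫ x, η⁻¹ • innerSL ℝ x ∂post ρ η y).smulRight (∫ x, φ x ∂post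
    ρ η y)) y := by
  simp only [post_eq_tilted]
  exact hφ.hasFDerivAt_mean (isExpFamily_post hη) y

lemma integrable_post (hη : 0 < η) {φ : E → F} (hφ : SubExp ρ (fun x : E => η⁻¹ • innerSL ℝ x) φ) (y
    : E) : Integrable φ (post ρ η y) := by
  rw [post_eq_tilted]
  exact hφ.integrable_tilted (isExpFamily_post hη) y

lemma subExp_of_le_pow (hη : 0 < η) {φ : E → F} (hφ : AEStronglyMeasurable φ ρ) (C : ℝ) (k : ℕ) (h :
    ∀ᵐ x ∂ρ, ‖φ x‖ ≤ C * (1 + ‖x‖) ^ k) : SubExp ρ (fun x : E => η⁻¹ • innerSL ℝ x) φ := by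
  refine ⟨hφ, |C|, k * η, h.mono fun x hx => hx.trans ?_⟩
  rw [norm_smul, innerSL_apply_norm, norm_inv, norm_eq_abs, abs_of_pos hη]
  have e : (k : ℝ) * η * (η⁻¹ * ‖x‖) = k * ‖x‖ := by field_simp
  rw [e, exp_nat_mul]
  have : 1 + ‖x‖ ≤ exp ‖x‖ := by linarith [add_one_le_exp ‖x‖]
  bound

variable (ρ η) in
/-- The gradient of the posterior mean of `f`. -/
def postGrad (f : E → ℝ) (y : E) : E :=
  η⁻¹ • (∫ x, f x • x ∂post ρ η y - (∫ x, f x ∂post ρ η y) • ∫ x, x ∂post ρ η y)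

lemma integrable_post_id (hη : 0 < η) (y : E) : Integrable (fun x : E => x) (post ρ η y) :=
  integrable_post hη (subExp_of_le_pow hη (by fun_prop) 1 1 (.of_forall fun x => by simp)) y

lemma integrable_post_of_bound (hη : 0 < η) {φ : E → F} (hφ : AEStronglyMeasurable φ ρ) {C : ℝ} (hC
  : ∀ x, ‖φ x‖ ≤ C) (y : E) : Integrable φ (post ρ η y) := integrable_post hη (subExp_of_bound hφ
  (.of_forall hC)) y

lemma integrable_post_smul_id (hη : 0 < η) {f : E → ℝ} (hf : AEStronglyMeasurable f ρ) {C : ℝ}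
    (hC : ∀ x, |f x| ≤ C) (y : E) : Integrable (fun x => f x • x) (post ρ η y) := by
  refine integrable_post hη (subExp_of_le_pow hη (by fun_prop) C 1 (.of_forall fun x => ?_)) y
  have h0 := (abs_nonneg _).trans (hC x)
  rw [norm_smul, norm_eq_abs, pow_one]
  bound

lemma hasFDerivAt_post_real (hη : 0 < η) {f : E → ℝ} (hf : AEStronglyMeasurable f ρ) {C : ℝ}
    (hC : ∀ x, |f x| ≤ C) (y : E) :
    HasFDerivAt (fun y => ∫ x, f x ∂post ρ η y) (innerSL ℝ (postGrad ρ η f y)) y := by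
  refine (hasFDerivAt_post hη (subExp_of_bound hf (.of_forall hC)) y).congr_fderiv ?_
  have hi := integrable_post_smul_id (η := η) hη hf hC y
  have hx := integrable_post_id (ρ := ρ) hη y
  have e1 : ∫ x, (η⁻¹ • innerSL ℝ x).smulRight (f x) ∂post ρ η y =
      innerSL ℝ (η⁻¹ • ∫ x, f x • x ∂post ρ η y) := by
    rw [← integral_smul, ← integral_comp_comm (innerSL ℝ) (ismul η⁻¹ hi)]
    congr 1; ext x v
    rw [map_smul, map_smul]
    change η⁻¹ * ⟪x, v⟫ * f x = η⁻¹ * (f x * ⟪x, v⟫)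
    ring
  have e2 : ∫ x, η⁻¹ • innerSL ℝ x ∂post ρ η y = innerSL ℝ (η⁻¹ • ∫ x, x ∂post ρ η y) := by
    rw [← integral_smul, ← integral_comp_comm (innerSL ℝ) (ismul η⁻¹ hx)]
    congr 1; ext x v
    rw [map_smul]
  rw [e1, e2]
  ext v
  simp [postGrad]
  ring

lemma postGrad_eq (hη : 0 < η) {f : E → ℝ} (hf : AEStronglyMeasurable f ρ) {C : ℝ}
    (hC : ∀ x, |f x| ≤ C) (y c : E) :
    postGrad ρ η f y = η⁻¹ • ∫ x, (f x - ∫ z, f z ∂post ρ η y) • (x - c) ∂(post ρ η y) := by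
  have := isProbabilityMeasure_post (ρ := ρ) hη y
  have hi := integrable_post_smul_id (η := η) hη hf hC y
  have hx := integrable_post_id (ρ := ρ) hη y
  have hfi := integrable_post_of_bound (η := η) hη hf hC y
  obtain ⟨m, hm⟩ : ∃ m, m = ∫ z, f z ∂(post ρ η y) := ⟨_, rfl⟩
  have e : ∀ x, (f x - m) • (x - c) = (f x • x - m • x) - (f x • c - m • c) := fun x => by
    rw [sub_smul, smul_sub, smul_sub]; abel
  rw [postGrad, ← hm]
  simp only [e]
  rw [integral_sub (isub hi (ismul m hx)) (isub (hfi.smul_const c) (integrable_const _)),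
    integral_sub hi (ismul m hx), integral_sub (hfi.smul_const c) (integrable_const _),
    integral_smul, integral_smul_const, ← hm]
  simp

lemma norm_postGrad_le (hη : 0 < η) {f : E → ℝ} (hf : AEStronglyMeasurable f ρ) {C : ℝ} (hC : ∀ x,
    |f x| ≤ C) (y c : E) {K : ℝ} (hK : ∫ x, ‖x - c‖ ^ 2 ∂post ρ η y ≤ K) : ‖postGrad ρ η f y‖ ^ 2 ≤
    η⁻¹ ^ 2 * K * ∫ x, f x ^ 2 ∂(post ρ η y) := by
  have := isProbabilityMeasure_post (ρ := ρ) hη y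
  have hac : post ρ η y ≪ ρ := tilted_absolutelyContinuous _ _
  have hfi := integrable_post_of_bound (η := η) hη hf hC y
  have hf2 : MemLp f 2 (post ρ η y) := MemLp.of_bound (hf.mono_ac hac) C (.of_forall hC)
  have hx2 : MemLp (fun x => ‖x - c‖) 2 (post ρ η y) := by
    rw [memLp_two_iff_integrable_sq (by fun_prop)]
    refine integrable_post hη (subExp_of_le_pow hη (by fun_prop) ((1 + ‖c‖) ^ 2) 2
      (.of_forall fun x => ?_)) y
    rw [norm_pow, norm_norm, ← mul_pow]
    gcongr
    nlinarith [norm_sub_le x c, norm_nonneg x, norm_nonneg c]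
  obtain ⟨m, hm⟩ : ∃ m, m = ∫ z, f z ∂(post ρ η y) := ⟨_, rfl⟩
  have hfm : MemLp (fun x => |f x - m|) 2 (post ρ η y) := (hf2.sub (memLp_const m)).abs
  have h1 := sq_integral_mul_le hfm hx2
  have h2 : ∫ x, |f x - m| ^ 2 ∂post ρ η y ≤ ∫ x, f x ^ 2 ∂(post ρ η y) := by
    have e : ∀ x, |f x - m| ^ 2 = f x ^ 2 - 2 * m * f x + m ^ 2 := fun x => by grind
    simp only [e]
    rw [integral_add (isub hf2.integrable_sq (imul _ hfi)) (integrable_const _),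
      integral_sub hf2.integrable_sq (imul _ hfi), integral_const_mul, ← hm]
    simp only [integral_const, probReal_univ, one_smul]
    nlinarith
  rw [postGrad_eq hη hf hC y c, norm_smul, mul_pow, ← hm, mul_assoc]
  rw [norm_inv, norm_eq_abs, abs_of_pos hη]
  gcongr
  have h3 : ‖∫ x, (f x - m) • (x - c) ∂(post ρ η y)‖ ≤ ∫ x, |f x - m| * ‖x - c‖ ∂(post ρ η y) := by
    refine (norm_integral_le_integral_norm _).trans (le_of_eq ?_)
    simp only [norm_smul, norm_eq_abs]
  calc _ ≤ (∫ x, |f x - m| * ‖x - c‖ ∂post ρ η y) ^ 2 := by gcongr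
    _ ≤ _ := h1
    _ ≤ (∫ x, f x ^ 2 ∂post ρ η y) * K := by gcongr
    _ = _ := mul_comm _ _

end PostCalculus

section Bhat

variable {F : Type*} [NormedAddCommGroup F] [NormedSpace ℝ F] [CompleteSpace F]
  {ν : Measure E} [IsProbabilityMeasure ν] {β η R : ℝ}

lemma norm_integral_post_le (hη : 0 < η) {φ : E → F} {B : ℝ}
    (hB : ∀ᵐ x ∂ν, ‖φ x‖ ≤ B) (y : E) : ‖∫ x, φ x ∂(post ν η y)‖ ≤ B := by
  have := isProbabilityMeasure_post (ρ := ν) hη y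
  have hac : post ν η y ≪ ν := tilted_absolutelyContinuous _ _
  have h := norm_integral_le_of_norm_le_const (hac.ae_le hB)
  simp_all

lemma norm_smul_innerSL (hη : 0 < η) (x : E) : ‖η⁻¹ • innerSL ℝ x‖ = η⁻¹ * ‖x‖ := by
  rw [norm_smul, innerSL_apply_norm, norm_inv, norm_eq_abs, abs_of_pos hη]

lemma norm_post_sub_le (hη : 0 < η) (hν : SuppIn ν R) {φ : E → F}
    (hφ : AEStronglyMeasurable φ ν) {B : ℝ} (hB : ∀ᵐ x ∂ν, ‖φ x‖ ≤ B) (x y : E) :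
    ‖∫ b, φ b ∂post ν η x - ∫ b, φ b ∂(post ν η y)‖ ≤ 2 * (η⁻¹ * R * B) * ‖x - y‖ := by
  have hR : 0 ≤ R := by
    obtain ⟨b, hb⟩ := hν.exists
    exact (norm_nonneg _).trans hb
  have hS : ∀ᵐ b ∂ν, ‖η⁻¹ • innerSL ℝ b‖ ≤ η⁻¹ * R := hν.mono fun b hb => by
    rw [norm_smul_innerSL hη]; gcongr
  refine Convex.norm_image_sub_le_of_norm_hasFDerivWithin_le (f := fun y => ∫ b, φ b ∂post ν η y) (s
    := univ) (fun z _ => (hasFDerivAt_post hη (subExp_of_bound hφ hB) z).hasFDerivWithinAt) (fun z _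
    => ?_) convex_univ (mem_univ _) (mem_univ _)
  have h1 : ‖∫ b, (η⁻¹ • innerSL ℝ b).smulRight (φ b) ∂(post ν η z)‖ ≤ η⁻¹ * R * B := by
    refine norm_integral_post_le hη ?_ z
    filter_upwards [hS, hB] with b h1 h2
    rw [norm_smulRight_apply]
    gcongr
  have h2 := norm_integral_post_le hη hS z
  have h3 := norm_integral_post_le hη hB z
  refine (norm_sub_le _ _).trans ?_
  rw [norm_smulRight_apply, two_mul]
  gcongr

variable (ν β) in
/-- Posterior mean. -/
def bhat (x : E) : E := ∫ b, b ∂(post ν β x)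

variable (ν β) in
/-- Derivative of the posterior mean. -/
def bhatDeriv (x : E) : E →L[ℝ] E := ∫ b, (β⁻¹ • innerSL ℝ b).smulRight b ∂post ν β x - (∫ b, β⁻¹ •
  innerSL ℝ b ∂post ν β x).smulRight (∫ b, b ∂post ν β x)

lemma hasFDerivAt_bhat (hβ : 0 < β) (hν : SuppIn ν R) (x : E) : HasFDerivAt (bhat ν β) (bhatDeriv ν
  β x) x := hasFDerivAt_post (φ := fun b => b) hβ (subExp_of_bound (by fun_prop) hν) x

lemma norm_bhat_le (hβ : 0 < β) (hν : SuppIn ν R) (x : E) : ‖bhat ν β x‖ ≤ R :=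
  norm_integral_post_le hβ hν x

lemma norm_bhatDeriv_sub_le (hβ : 0 < β) (hν : SuppIn ν R) (x y : E) :
    ‖bhatDeriv ν β x - bhatDeriv ν β y‖ ≤ 6 * (β⁻¹ ^ 2 * R ^ 3) * ‖x - y‖ := by
  have hR : 0 ≤ R := by
    obtain ⟨b, hb⟩ := hν.exists
    exact (norm_nonneg _).trans hb
  have hS : ∀ᵐ b ∂ν, ‖β⁻¹ • innerSL ℝ b‖ ≤ β⁻¹ * R := hν.mono fun b hb => by
    rw [norm_smul_innerSL hβ]; gcongr
  have hSb : ∀ᵐ b ∂ν, ‖(β⁻¹ • innerSL ℝ b).smulRight b‖ ≤ β⁻¹ * R * R := by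
    filter_upwards [hS, hν] with b h1 h2
    rw [norm_smulRight_apply]
    gcongr
  have hm : AEStronglyMeasurable (fun b : E => (β⁻¹ • innerSL ℝ b).smulRight b) ν := by fun_prop
  have h1 := norm_post_sub_le hβ hν hm hSb x y
  have h2 := norm_post_sub_le hβ hν (φ := fun b : E => β⁻¹ • innerSL ℝ b) (by fun_prop) hS x y
  have h3 := norm_post_sub_le hβ hν (φ := fun b : E => b) (by fun_prop) hν x y
  have h4 := norm_integral_post_le hβ hS y
  have h5 := norm_integral_post_le hβ hν x
  unfold bhatDeriv
  generalize ∫ b, (β⁻¹ • innerSL ℝ b).smulRight b ∂post ν β x = a1 at *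
  generalize ∫ b, (β⁻¹ • innerSL ℝ b).smulRight b ∂post ν β y = a2 at *
  generalize (∫ b, β⁻¹ • innerSL ℝ b ∂(post ν β x) : E →L[ℝ] ℝ) = s1 at *
  generalize (∫ b, β⁻¹ • innerSL ℝ b ∂(post ν β y) : E →L[ℝ] ℝ) = s2 at *
  generalize (∫ b, b ∂post ν β x) = m1 at *
  generalize (∫ b, b ∂post ν β y) = m2 at *
  have e : a1 - s1.smulRight m1 - (a2 - s2.smulRight m2) =
      (a1 - a2) - ((s1 - s2).smulRight m1 + s2.smulRight (m1 - m2)) := by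
    ext v
    simp only [_root_.sub_apply, _root_.add_apply,
      smulRight_apply, sub_smul, smul_sub]
    abel
  rw [e]
  refine (norm_sub_le _ _).trans ?_
  have h6 := norm_add_le ((s1 - s2).smulRight m1) (s2.smulRight (m1 - m2))
  rw [norm_smulRight_apply, norm_smulRight_apply] at h6
  have h7 : ‖s1 - s2‖ * ‖m1‖ ≤ 2 * (β⁻¹ * R * (β⁻¹ * R)) * ‖x - y‖ * R := by gcongr
  have h8 : ‖s2‖ * ‖m1 - m2‖ ≤ β⁻¹ * R * (2 * (β⁻¹ * R * R) * ‖x - y‖) := by gcongr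
  calc _ ≤ 2 * (β⁻¹ * R * (β⁻¹ * R * R)) * ‖x - y‖ + (2 * (β⁻¹ * R * (β⁻¹ * R)) * ‖x - y‖ * R +
        β⁻¹ * R * (2 * (β⁻¹ * R * R) * ‖x - y‖)) := by linarith
    _ = _ := by ring

lemma norm_bhat_taylor_le (hβ : 0 < β) (hν : SuppIn ν R) (x c : E) : ‖bhat ν β x - bhat ν β c -
    bhatDeriv ν β c (x - c)‖ ≤ 6 * (β⁻¹ ^ 2 * R ^ 3) * ‖x - c‖ ^ 2 := by
  have hR : 0 ≤ R := by
    obtain ⟨b, hb⟩ := hν.exists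
    exact (norm_nonneg _).trans hb
  rw [sq ‖x - c‖, ← mul_assoc]
  refine Convex.norm_image_sub_le_of_norm_hasFDerivWithin_le' (s := closedBall c ‖x - c‖) (f := bhat
    ν β) (fun z _ => (hasFDerivAt_bhat hβ hν z).hasFDerivWithinAt) (fun z hz => ?_)
    (convex_closedBall _ _) (mem_closedBall_self (norm_nonneg _)) (mem_closedBall_iff_norm.2 le_rfl)
  refine (norm_bhatDeriv_sub_le hβ hν z c).trans ?_
  rw [mem_closedBall_iff_norm] at hz
  gcongr

lemma inner_bhatDeriv (hβ : 0 < β) (hν : SuppIn ν R) (x v : E) : ⟪bhatDeriv ν β x v, v⟫ = β⁻¹ * (∫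
    b, ⟪v, b⟫ ^ 2 ∂post ν β x - (∫ b, ⟪v, b⟫ ∂post ν β x) ^ 2) := by
  have hid : SubExp ν (fun x : E => β⁻¹ • innerSL ℝ x) (fun b : E => b) :=
    subExp_of_bound (by fun_prop) hν
  have hb := integrable_post hβ hid x
  have hS : Integrable (fun b : E => β⁻¹ • innerSL ℝ b) (post ν β x) :=
    ismul _ ((innerSL ℝ).integrable_comp hb)
  have hSb := integrable_post hβ (hid.smulRight (by fun_prop)) x
  have hSb' : Integrable (fun b : E => (β⁻¹ * ⟪b, v⟫) • b) (post ν β x) :=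
    (ContinuousLinearMap.apply ℝ E v).integrable_comp hSb
  unfold bhatDeriv
  rw [_root_.sub_apply, smulRight_apply, integral_apply hSb, integral_apply hS,
    inner_sub_left, inner_smul_left]
  simp only [smulRight_apply, _root_.smul_apply,
    innerSL_apply_apply, smul_eq_mul, conj_trivial]
  rw [real_inner_comm, ← integral_inner hSb', real_inner_comm, ← integral_inner hb]
  simp only [inner_smul_right, real_inner_comm v]
  simp only [mul_assoc, integral_const_mul]
  ring_nf

end Bhat

section IBP

variable {ν : Measure E} [IsProbabilityMeasure ν] {β η R : ℝ}

lemma integral_smooth {F : Type*} [NormedAddCommGroup F] [NormedSpace ℝ F] {φ : E → F} (h :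
  AEStronglyMeasurable φ (smooth ν β)) : ∫ x, φ x ∂smooth ν β = ∫ q, φ q.2 ∂(chan ν β) :=
  integral_map (by fun_prop) h

lemma ae_chan_fst {p : E → Prop} (hp : ∀ᵐ b ∂ν, p b) : ∀ᵐ q ∂chan ν β, p q.1 := by
  have h1 : (chan ν β).map Prod.fst = ν := by
    rw [chan, map_map (by fun_prop) (by fun_prop)]
    exact fst_prod (μ := ν) (ν := stdGaussian E)
  exact ae_of_ae_map (f := Prod.fst) (by fun_prop) (by rwa [h1])

/-- Integration by parts against a Gaussian smoothing. -/
lemma integral_smooth_ibp (hβ : 0 < β) (hν : SuppIn ν R) {H : E → ℝ} {H' : E → E →L[ℝ] ℝ}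
    (hH : ∀ x, HasFDerivAt H (H' x) x) (hH' : Continuous H') {C C' : ℝ}
    (hC : ∀ x, |H x| * (1 + ‖x‖) ≤ C) (hC' : ∀ x, ‖H' x‖ ≤ C') (e : E) :
    ∫ x, H x * ⟪e, x - bhat ν β x⟫ ∂smooth ν β = β * ∫ x, H' x e ∂(smooth ν β) := by
  have hR : 0 ≤ R := by
    obtain ⟨b, hb⟩ := hν.exists
    exact (norm_nonneg _).trans hb
  have hHc := continuous_iff_continuousAt.2 fun x => (hH x).continuousAt
  have hbc := continuous_iff_continuousAt.2 fun x => (hasFDerivAt_bhat hβ hν x).continuousAt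
  have hC0 : ∀ x, |H x| ≤ C := fun x => by
    have := hC x; nlinarith [abs_nonneg (H x), norm_nonneg x]
  have hCp := (abs_nonneg _).trans (hC0 0)
  have hbound : ∀ x b : E, ‖b‖ ≤ R → ‖H x * ⟪e, x - b⟫‖ ≤ C * (1 + R) * ‖e‖ := by
    intro x b hb
    rw [norm_mul, norm_eq_abs]
    have h1 : ‖⟪e, x - b⟫‖ ≤ ‖e‖ * (‖x‖ + R) :=
      (norm_inner_le_norm _ _).trans (by gcongr; exact (norm_sub_le _ _).trans (by gcongr))
    calc |H x| * ‖⟪e, x - b⟫‖ ≤ |H x| * (‖e‖ * (‖x‖ + R)) := by gcongr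
      _ ≤ |H x| * (‖e‖ * ((1 + ‖x‖) * (1 + R))) := by
        gcongr; nlinarith [norm_nonneg x]
      _ = |H x| * (1 + ‖x‖) * (1 + R) * ‖e‖ := by ring
      _ ≤ _ := by gcongr; exact hC x
  have hφ : Integrable (fun q : E × E => H q.2 * ⟪e, q.2 - q.1⟫) (chan ν β) := Integrable.of_bound
    (by fun_prop) _ ((ae_chan_fst hν).mono fun q hq => hbound q.2 q.1 hq)
  have hD : Integrable (fun q : E × E => H' q.2 e) (chan ν β) := Integrable.of_bound (by fun_prop)
    (C' * ‖e‖) (.of_forall fun q => (le_opNorm _ _).trans (by gcongr; exact hC' _))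
  rw [integral_smooth (by fun_prop), integral_smooth (by fun_prop), integral_chan hD]
  have h1 := (chan_bayes hβ hφ).2
  have h2 : ∀ x, ∫ b, H x * ⟪e, x - b⟫ ∂post ν β x = H x * ⟪e, x - bhat ν β x⟫ := by
    intro x
    have := isProbabilityMeasure_post (ρ := ν) hβ x
    have hb := integrable_post hβ (subExp_of_bound (by fun_prop) hν) x
    rw [integral_const_mul, integral_inner (isub (integrable_const x) hb) e,
      integral_sub (integrable_const x) hb]
    simp [bhat]
  simp only [h2] at h1
  rw [← h1, integral_chan hφ, ← integral_const_mul]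
  refine integral_congr_ae (hν.mono fun b hb => ?_)
  simp only [add_sub_cancel_left, inner_smul_right]
  have hst := stein (F := fun u => H (b + √β • u)) (F' := fun u => √β * H' (b + √β • u) e) e ?_
    ?_ ?_ ?_
  · have e1 : ∀ u : E, H (b + √β • u) * (√β * ⟪e, u⟫) = √β * (H (b + √β • u) * ⟪e, u⟫) :=
      fun u => by ring
    simp only [e1]
    rw [integral_const_mul, hst, integral_const_mul, ← mul_assoc, mul_self_sqrt hβ.le]
  · intro u
    have h3 : HasFDerivAt (fun u : E => b + √β • u) (√β • ContinuousLinearMap.id ℝ E) u :=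
      ((hasFDerivAt_id u).const_smul (√β)).const_add b
    have h4 := ((hH (b + √β • u)).comp u h3).hasLineDerivAt e
    simpa [Function.comp_def] using h4
  · exact Integrable.of_bound (by fun_prop) C (.of_forall fun u => hC0 _)
  · refine Integrable.of_bound (by fun_prop) (√β * (C' * ‖e‖)) (.of_forall fun u => ?_)
    rw [norm_mul, norm_eq_abs, abs_of_nonneg (sqrt_nonneg _)]
    gcongr
    exact (le_opNorm _ _).trans (by gcongr; exact hC' _)
  · refine ((integrable_norm_pow_stdGaussian (E := E) 1).const_mul (C * ‖e‖)).mono' (by fun_prop)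
      (.of_forall fun u => ?_)
    rw [norm_mul, norm_eq_abs, pow_one, mul_assoc]
    gcongr
    · exact hC0 _
    · exact norm_inner_le_norm _ _

end IBP

section Commute

variable {ν : Measure E} [IsProbabilityMeasure ν] {β η R : ℝ}

lemma exp_gexp_le_one (hη : 0 < η) (x y : E) : exp (gexp η x y) ≤ 1 :=
  exp_le_one_iff.2 (gexp_nonpos hη x y)

lemma exp_gexp_mul_le (hη : 0 < η) (x y : E) : exp (gexp η x y) * ‖y - x‖ ≤ 1 + η := by
  have h1 : 1 - gexp η x y ≤ exp (-gexp η x y) := by linarith [add_one_le_exp (-gexp η x y)]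
  have h2 : ‖y - x‖ ≤ (1 + η) * (1 - gexp η x y) := by
    have e : (1 + η) * (1 - gexp η x y) - ‖y - x‖ =
        ((‖y - x‖ - η) ^ 2 / η + ‖y - x‖ ^ 2) / 2 + 1 + η / 2 := by
      unfold gexp; grind
    have : 0 ≤ ((‖y - x‖ - η) ^ 2 / η + ‖y - x‖ ^ 2) / 2 := by positivity
    linarith
  calc exp (gexp η x y) * ‖y - x‖ ≤ exp (gexp η x y) * ((1 + η) * exp (-gexp η x y)) := by
        gcongr; exact h2.trans (by gcongr)
    _ = 1 + η := by rw [mul_left_comm, ← exp_add, add_neg_cancel, exp_zero, mul_one]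

lemma hasFDerivAt_gexp (x y : E) :
    HasFDerivAt (fun x => gexp η x y) (innerSL ℝ (η⁻¹ • (y - x))) x := by
  have h1 : HasFDerivAt (fun x : E => y - x) (-ContinuousLinearMap.id ℝ E) x :=
    (hasFDerivAt_id x).const_sub y
  have h2 := ((h1.norm_sq.const_smul (-(2 * η)⁻¹)).congr_of_eventuallyEq (.of_forall fun z => by
        change gexp η z y = -(2 * η)⁻¹ * ‖y - z‖ ^ 2
        unfold gexp; ring))
  refine h2.congr_fderiv ?_
  ext v
  rw [map_smul]
  change -(2 * η)⁻¹ • ((2 • ⟪y - x, -v⟫)) = η⁻¹ * ⟪y - x, v⟫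
  rw [inner_neg_right]
  ring

/-- Weak commutation relation between the gradient and the posterior averaging. -/
lemma post_commute (hβ : 0 < β) (hη : 0 < η) (hν : SuppIn ν R) {f : E → ℝ} {g : E → E} (hf : ∀ x,
    HasFDerivAt f (innerSL ℝ (g x)) x) (hg : Continuous g) {C C' : ℝ} (hC : ∀ x, |f x| ≤ C) (hC' : ∀
    x, ‖g x‖ ≤ C') (y e : E) : ∫ x, (f x - ∫ z, f z ∂(post (smooth ν β) η y)) * ⟪e, x - bhat ν β x⟫
    ∂(post (smooth ν β) η y) = β * (∫ x, ⟪g x, e⟫ ∂(post (smooth ν β) η y)) + β * η⁻¹ * ∫ x, (f x -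
    ∫ z, f z ∂(post (smooth ν β) η y)) * ⟪y - x, e⟫ ∂(post (smooth ν β) η y) := by
  have hfc := continuous_iff_continuousAt.2 fun x => (hf x).continuousAt
  obtain ⟨m, hm⟩ : ∃ m, m = ∫ z, f z ∂(post (smooth ν β) η y) := ⟨_, rfl⟩
  have hmC : |m| ≤ C := by
    rw [hm]
    exact norm_integral_post_le (φ := f) hη (.of_forall fun x => (hC x : ‖f x‖ ≤ C)) y
  have hC0 := (abs_nonneg _).trans hmC
  rw [← hm]
  have hfm : ∀ x, |f x - m| ≤ 2 * C := fun x => by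
    have h1 := abs_sub (f x) m
    have h2 := hC x
    linarith
  have hgc := (continuous_gexp η).comp (by fun_prop : Continuous fun x : E => (x, y))
  have hgs : ∀ x : E, ‖innerSL ℝ (g x)‖ ≤ C' := fun x => by
    rw [innerSL_apply_norm]; exact hC' x
  have key := integral_smooth_ibp hβ hν (H := fun x => (f x - m) * exp (gexp η x y)) (H' := fun x =>
    (f x - m) • (exp (gexp η x y) • innerSL ℝ (η⁻¹ • (y - x))) + exp (gexp η x y) • innerSL ℝ (g x))
    (fun x => ((hf x).sub_const m).mul (hasFDerivAt_gexp x y).exp) (by fun_prop) (C := 2 * C * (1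
    + ‖y‖ + (1 + η))) (C' := 2 * C * (η⁻¹ * (1 + η)) + C') (fun x => ?_) (fun x => ?_) e
  · have i1 : Integrable (fun x => (f x - m) * (exp (gexp η x y) * (η⁻¹ * ⟪y - x, e⟫)))
        (smooth ν β) := by
      refine Integrable.of_bound (by fun_prop) (2 * C * (η⁻¹ * (1 + η) * ‖e‖))
        (.of_forall fun x => ?_)
      rw [norm_mul, norm_mul, norm_mul, norm_eq_abs, norm_eq_abs, norm_eq_abs,
        abs_of_pos (exp_pos _), abs_of_pos (inv_pos.2 hη)]
      refine mul_le_mul (hfm x) ?_ (by positivity) (by positivity)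
      · calc exp (gexp η x y) * (η⁻¹ * ‖⟪y - x, e⟫‖)
            ≤ exp (gexp η x y) * (η⁻¹ * (‖y - x‖ * ‖e‖)) := by
              gcongr; exact norm_inner_le_norm _ _
          _ = η⁻¹ * (exp (gexp η x y) * ‖y - x‖) * ‖e‖ := by ring
          _ ≤ _ := by gcongr; exact exp_gexp_mul_le hη x y
    have i2 : Integrable (fun x => exp (gexp η x y) * ⟪g x, e⟫) (smooth ν β) := by
      refine Integrable.of_bound (by fun_prop) (1 * (C' * ‖e‖)) (.of_forall fun x => ?_)
      rw [norm_mul, norm_eq_abs, abs_of_pos (exp_pos _)]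
      gcongr
      · exact exp_gexp_le_one hη x y
      · exact (norm_inner_le_norm _ _).trans (by gcongr; exact hC' x)
    have e1 : ∀ x, ((f x - m) • (exp (gexp η x y) • innerSL ℝ (η⁻¹ • (y - x))) + exp (gexp η x y) •
        innerSL ℝ (g x) : E →L[ℝ] ℝ) e = (f x - m) * (exp (gexp η x y) * (η⁻¹ * ⟪y - x, e⟫)) + exp
        (gexp η x y) * ⟪g x, e⟫ := fun x => by
      rw [map_smul]; rfl
    simp only [e1] at key
    rw [integral_add i1 i2] at key
    have e2 : ∀ φ : E → ℝ, ∫ x, φ x ∂(post (smooth ν β) η y) = (∫ x, exp (gexp η x y) ∂smooth ν β)⁻¹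
        * ∫ x, exp (gexp η x y) * φ x ∂(smooth ν β) := fun φ => integral_tilted_eq_smul _ _
    rw [e2, e2, e2]
    have e3 : ∀ x, (f x - m) * exp (gexp η x y) * ⟪e, x - bhat ν β x⟫ =
      exp (gexp η x y) * ((f x - m) * ⟪e, x - bhat ν β x⟫) := fun x => by ring
    have e4 : ∀ x, (f x - m) * (exp (gexp η x y) * (η⁻¹ * ⟪y - x, e⟫)) =
      η⁻¹ * (exp (gexp η x y) * ((f x - m) * ⟪y - x, e⟫)) := fun x => by ring
    simp only [e3, e4, integral_const_mul] at key
    rw [key]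
    ring
  · rw [abs_mul, abs_of_pos (exp_pos _), mul_assoc]
    refine mul_le_mul (hfm x) ?_ (by positivity) (by positivity)
    · have h1 := exp_gexp_mul_le hη x y
      have h2 := exp_gexp_le_one hη x y
      have h3 : ‖x‖ ≤ ‖y‖ + ‖y - x‖ := by
        have := norm_sub_le y (y - x); rwa [_root_.sub_sub_cancel] at this
      have h4 := (exp_pos (gexp η x y)).le
      calc exp (gexp η x y) * (1 + ‖x‖)
          ≤ exp (gexp η x y) * (1 + ‖y‖) + exp (gexp η x y) * ‖y - x‖ := by
            rw [← mul_add]; exact mul_le_mul_of_nonneg_left (by linarith) h4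
        _ ≤ 1 * (1 + ‖y‖) + (1 + η) := by gcongr
        _ = _ := by ring
  · refine (norm_add_le _ _).trans ?_
    rw [norm_smul, norm_smul, norm_smul, innerSL_apply_norm, norm_smul, norm_eq_abs,
      norm_eq_abs, norm_eq_abs, abs_of_pos (exp_pos _), abs_of_pos (inv_pos.2 hη)]
    refine add_le_add (mul_le_mul (hfm x) ?_ (by positivity) (by positivity)) ?_
    · calc exp (gexp η x y) * (η⁻¹ * ‖y - x‖) = η⁻¹ * (exp (gexp η x y) * ‖y - x‖) := by ring
        _ ≤ _ := by gcongr; exact exp_gexp_mul_le hη x y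
    · calc _ ≤ 1 * C' := by
            exact mul_le_mul (exp_gexp_le_one hη x y) (hgs x) (norm_nonneg _) zero_le_one
        _ = C' := one_mul _

/-- Pointwise gradient contraction for posterior averaging, with a small error. -/
lemma norm_postGrad_commute_le (hβ : 0 < β) (hη : 0 < η) (hν : SuppIn ν R) {s : ℝ} (hs : 0 ≤ s)
    (hvar : ∀ y v : E, ∫ b, ⟪v, b⟫ ^ 2 ∂post ν β y - (∫ b, ⟪v, b⟫ ∂post ν β y) ^ 2 ≤ ‖v‖ ^ 2 / (s +
    β⁻¹)) {f : E → ℝ} {g : E → E} (hf : ∀ x, HasFDerivAt f (innerSL ℝ (g x)) x) (hg : Continuous g)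
    {C C' : ℝ} (hC : ∀ x, |f x| ≤ C) (hC' : ∀ x, ‖g x‖ ≤ C') {K : ℝ} (y : E) (hK : ∫ x, ‖x - (β / (β
    + η)) • y‖ ^ 4 ∂(post (smooth ν β) η y) ≤ K ^ 2) (hK0 : 0 ≤ K) : (1 + η * (s / (1 + s * β))) *
    ‖postGrad (smooth ν β) η f y‖ ≤ ‖∫ x, g x ∂(post (smooth ν β) η y)‖ + β⁻¹ * (6 * (β⁻¹ ^ 2 * R ^
    3) * K * √(∫ x, (f x - ∫ z, f z ∂(post (smooth ν β) η y)) ^ 2 ∂(post (smooth ν β) η y))) := by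
  have hp := isProbabilityMeasure_post (ρ := smooth ν β) hη y
  have hR : 0 ≤ R := by
    obtain ⟨b, hb⟩ := hν.exists
    exact (norm_nonneg _).trans hb
  have hfc := continuous_iff_continuousAt.2 fun x => (hf x).continuousAt
  have hbc := continuous_iff_continuousAt.2 fun x => (hasFDerivAt_bhat hβ hν x).continuousAt
  have hcom := post_commute hβ hη hν hf hg hC hC' y
  have hgr := postGrad_eq (ρ := smooth ν β) (f := f) hη hfc.aestronglyMeasurable hC y
  obtain ⟨m, hm⟩ : ∃ m, m = ∫ z, f z ∂(post (smooth ν β) η y) := ⟨_, rfl⟩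
  rw [← hm] at hgr hcom ⊢
  obtain ⟨v, hv⟩ : ∃ v, v = postGrad (smooth ν β) η f y := ⟨_, rfl⟩
  rw [← hv] at hgr ⊢
  obtain ⟨c, hc⟩ : ∃ c, c = (β / (β + η)) • y := ⟨_, rfl⟩
  rw [← hc] at hK
  obtain ⟨J, hJ⟩ : ∃ J, J = bhatDeriv ν β c := ⟨_, rfl⟩
  have hfm : ∀ x, |f x - m| ≤ C + |m| := fun x => (abs_sub _ _).trans (by gcongr; exact hC x)
  have hCm := (abs_nonneg _).trans (hfm 0)
  have hfmc : Continuous fun x => f x - m := by fun_prop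
  have i1 : ∀ a : E, Integrable (fun x => (f x - m) • (x - a)) (post (smooth ν β) η y) := by
    intro a
    have h1 := integrable_post_smul_id (ρ := smooth ν β) hη hfmc.aestronglyMeasurable hfm y
    have h2 := (integrable_post_of_bound (ρ := smooth ν β) hη hfmc.aestronglyMeasurable hfm
      y).smul_const a
    refine (h1.sub h2).congr (.of_forall fun x => ?_)
    simp [smul_sub]
  have hsm : ∀ a : E, ∫ x, (f x - m) • (x - a) ∂(post (smooth ν β) η y) = η • v := fun a => by
    rw [hgr a, smul_smul, mul_inv_cancel₀ hη.ne', one_smul]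
  have i2 : Integrable (fun x => (f x - m) • (bhat ν β x - bhat ν β c))
      (post (smooth ν β) η y) := by
    refine integrable_post_of_bound hη (by fun_prop) (C := (C + |m|) * (R + R)) (fun x => ?_) y
    rw [norm_smul, norm_eq_abs]
    gcongr
    · exact hfm x
    · refine (norm_sub_le _ _).trans ?_
      gcongr <;> exact norm_bhat_le hβ hν _
  have i3 : Integrable (fun x => (f x - m) • J (x - c)) (post (smooth ν β) η y) := by
    refine (J.integrable_comp (i1 c)).congr (.of_forall fun x => ?_)
    simp
  obtain ⟨rem, hrem⟩ : ∃ rem : E, rem = ∫ x, (f x - m) • (bhat ν β x - bhat ν β c - J (x - c))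
    ∂(post (smooth ν β) η y) := ⟨_, rfl⟩
  have e1 : ∫ x, (f x - m) • (bhat ν β x - bhat ν β c) ∂(post (smooth ν β) η y) =
      η • J v + rem := by
    have h1 : rem = ∫ x, (f x - m) • (bhat ν β x - bhat ν β c) ∂(post (smooth ν β) η y) -
        ∫ x, (f x - m) • J (x - c) ∂(post (smooth ν β) η y) := by
      rw [hrem, ← integral_sub i2 i3]
      congr 1; ext x; rw [smul_sub]
    have h2 : ∫ x, (f x - m) • J (x - c) ∂(post (smooth ν β) η y) = η • J v := by
      have := J.integral_comp_comm (i1 c)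
      rw [hsm c, map_smul] at this
      rw [← this]
      congr 1; ext x; rw [map_smul]
    rw [h1, h2]; abel
  have e2 : ∫ x, (f x - m) * ⟪v, x - bhat ν β x⟫ ∂(post (smooth ν β) η y) =
      ⟪v, η • v - (η • J v + rem)⟫ := by
    rw [← e1, ← hsm (bhat ν β c), ← integral_sub (i1 _) i2, ← integral_inner (isub (i1 _) i2)]
    congr 1; ext x
    rw [← smul_sub, inner_smul_right]
    congr 2; abel
  have e3 : ∫ x, (f x - m) * ⟪y - x, v⟫ ∂(post (smooth ν β) η y) = -(η * ‖v‖ ^ 2) := by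
    have h1 := integral_inner (𝕜 := ℝ) (i1 y) v
    rw [hsm y, inner_smul_right, real_inner_self_eq_norm_sq v] at h1
    rw [← h1, ← integral_neg]
    refine integral_congr_ae (.of_forall fun x => ?_)
    change (f x - m) * ⟪y - x, v⟫ = -⟪v, (f x - m) • (x - y)⟫
    rw [inner_smul_right, ← mul_neg, ← inner_neg_right, neg_sub, real_inner_comm]
  have hgi : Integrable g (post (smooth ν β) η y) :=
    integrable_post_of_bound hη hg.aestronglyMeasurable hC' y
  have e4 : ∫ x, ⟪g x, v⟫ ∂(post (smooth ν β) η y) ≤ ‖∫ x, g x ∂(post (smooth ν β) η y)‖ * ‖v‖ := by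
    have h1 := integral_inner (𝕜 := ℝ) hgi v
    have h2 : ∫ x, ⟪g x, v⟫ ∂(post (smooth ν β) η y) = ∫ x, ⟪v, g x⟫ ∂(post (smooth ν β) η y) :=
      integral_congr_ae (.of_forall fun x => real_inner_comm _ _)
    rw [h2, h1, real_inner_comm]
    exact real_inner_le_norm _ _
  have hrn : ‖rem‖ ≤ 6 * (β⁻¹ ^ 2 * R ^ 3) * K *
      √(∫ x, (f x - m) ^ 2 ∂(post (smooth ν β) η y)) := by
    have m1 : MemLp (fun x => |f x - m|) 2 (post (smooth ν β) η y) :=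
      (MemLp.of_bound hfmc.aestronglyMeasurable _ (.of_forall hfm)).abs
    have i4 : Integrable (fun x => ‖x - c‖ ^ 4) (post (smooth ν β) η y) := by
      refine integrable_post hη (subExp_of_le_pow hη (by fun_prop) ((1 + ‖c‖) ^ 4) 4
        (.of_forall fun x => ?_)) y
      rw [norm_pow, norm_norm, ← mul_pow]
      gcongr
      nlinarith [norm_sub_le x c, norm_nonneg x, norm_nonneg c]
    have m2 : MemLp (fun x => ‖x - c‖ ^ 2) 2 (post (smooth ν β) η y) := by
      rw [memLp_two_iff_integrable_sq (by fun_prop)]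
      simpa [← pow_mul] using i4
    have h1 := integral_mul_le_sqrt m1 m2
    have h2 : √(∫ x, (‖x - c‖ ^ 2) ^ 2 ∂(post (smooth ν β) η y)) ≤ K := by
      simp only [← pow_mul]
      exact sqrt_le_iff.2 ⟨hK0, hK⟩
    have h3 := m1.integrable_mul m2
    calc ‖rem‖ ≤ ∫ x, 6 * (β⁻¹ ^ 2 * R ^ 3) * (|f x - m| * ‖x - c‖ ^ 2)
          ∂(post (smooth ν β) η y) := by
          rw [hrem]
          refine norm_integral_le_of_norm_le (imul _ h3) (.of_forall fun x => ?_)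
          rw [norm_smul, norm_eq_abs, mul_left_comm]
          gcongr
          rw [hJ]
          exact norm_bhat_taylor_le hβ hν x c
      _ ≤ 6 * (β⁻¹ ^ 2 * R ^ 3) * (√(∫ x, |f x - m| ^ 2 ∂(post (smooth ν β) η y)) * K) := by
          rw [integral_const_mul]
          gcongr
          exact h1.trans (by gcongr)
      _ = _ := by simp only [sq_abs]; ring
  have hJv : ⟪J v, v⟫ ≤ β⁻¹ * (‖v‖ ^ 2 / (s + β⁻¹)) := by
    rw [hJ, inner_bhatDeriv hβ hν]
    gcongr
    exact hvar c v
  have h5 := hcom v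
  rw [e2, e3, inner_sub_right, inner_add_right, inner_smul_right, inner_smul_right,
    real_inner_self_eq_norm_sq, real_inner_comm] at h5
  have h6 : ⟪v, rem⟫ ≤ ‖v‖ * ‖rem‖ := real_inner_le_norm _ _
  have h7 : (1 + η * (s / (1 + s * β))) * ‖v‖ ^ 2 ≤
      ‖∫ x, g x ∂(post (smooth ν β) η y)‖ * ‖v‖ + β⁻¹ * (‖v‖ * ‖rem‖) := by
    have a1 : (∫ x, ⟪g x, v⟫ ∂(post (smooth ν β) η y)) =
        β⁻¹ * (η * ‖v‖ ^ 2 - (η * ⟪J v, v⟫ + ⟪v, rem⟫)) + ‖v‖ ^ 2 := by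
      rw [h5]; field_simp; ring
    have a3 : β⁻¹ * (η * ‖v‖ ^ 2 - (η * (β⁻¹ * (‖v‖ ^ 2 / (s + β⁻¹))) + ‖v‖ * ‖rem‖)) ≤
        β⁻¹ * (η * ‖v‖ ^ 2 - (η * ⟪J v, v⟫ + ⟪v, rem⟫)) := by gcongr
    have a4 : (1 + η * (s / (1 + s * β))) * ‖v‖ ^ 2 = β⁻¹ * (η * ‖v‖ ^ 2 - (η * (β⁻¹ * (‖v‖ ^ 2 / (s
        + β⁻¹))) + ‖v‖ * ‖rem‖)) + ‖v‖ ^ 2 + β⁻¹ * (‖v‖ * ‖rem‖) := by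
      have : s + β⁻¹ ≠ 0 := by positivity
      have : 1 + s * β ≠ 0 := by positivity
      have : s + β⁻¹ = (1 + s * β) / β := by field_simp; ring
      field_simp
      ring
    linarith
  rcases (norm_nonneg v).eq_or_lt with h0 | h0
  · rw [← h0, mul_zero]
    positivity
  · have h8 : (1 + η * (s / (1 + s * β))) * ‖v‖ * ‖v‖ ≤
      (‖∫ x, g x ∂(post (smooth ν β) η y)‖ + β⁻¹ * ‖rem‖) * ‖v‖ := by nlinarith
    refine (le_of_mul_le_mul_right h8 h0).trans ?_
    gcongr

end Commute

/-- Bounded continuous functions, as a predicate. -/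
structure BddCont {α F : Type*} [TopologicalSpace α] [NormedAddCommGroup F] (f : α → F) : Prop where
  cont : Continuous f
  bdd : ∃ C, ∀ x, ‖f x‖ ≤ C

namespace BddCont

variable {α α' F : Type*} [TopologicalSpace α] [TopologicalSpace α'] [NormedAddCommGroup F]
  {f g : α → F}

lemma const (c : F) : BddCont fun _ : α => c := ⟨continuous_const, ‖c‖, fun _ => le_rfl⟩

lemma add (hf : BddCont f) (hg : BddCont g) : BddCont fun x => f x + g x := by
  obtain ⟨C, hC⟩ := hf.bdd
  obtain ⟨C', hC'⟩ := hg.bdd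
  exact ⟨hf.cont.add hg.cont, C + C', fun x => (norm_add_le _ _).trans (add_le_add (hC x) (hC' x))⟩

lemma sub (hf : BddCont f) (hg : BddCont g) : BddCont fun x => f x - g x := by
  obtain ⟨C, hC⟩ := hf.bdd
  obtain ⟨C', hC'⟩ := hg.bdd
  exact ⟨hf.cont.sub hg.cont, C + C', fun x => (norm_sub_le _ _).trans (add_le_add (hC x) (hC' x))⟩

lemma mul {f g : α → ℝ} (hf : BddCont f) (hg : BddCont g) : BddCont fun x => f x * g x := by
  obtain ⟨C, hC⟩ := hf.bdd
  obtain ⟨C', hC'⟩ := hg.bdd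
  refine ⟨hf.cont.mul hg.cont, C * C', fun x => ?_⟩
  rw [norm_mul]
  exact mul_le_mul (hC x) (hC' x) (norm_nonneg _) ((norm_nonneg _).trans (hC x))

lemma pow {f : α → ℝ} (hf : BddCont f) : BddCont fun x => f x ^ 2 := by
  simp only [sq]
  exact hf.mul hf

lemma norm (hf : BddCont f) : BddCont fun x => ‖f x‖ := by
  obtain ⟨C, hC⟩ := hf.bdd
  exact ⟨hf.cont.norm, C, fun x => by simp_all⟩

lemma comp (hf : BddCont f) {T : α' → α} (hT : Continuous T) : BddCont fun x => f (T x) := by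
  obtain ⟨C, hC⟩ := hf.bdd
  exact ⟨hf.cont.comp hT, C, fun x => hC _⟩

lemma clm {F' : Type*} [NormedAddCommGroup F'] [NormedSpace ℝ F] [NormedSpace ℝ F']
    (L : F →L[ℝ] F') (hf : BddCont f) : BddCont fun x => L (f x) := by
  obtain ⟨C, hC⟩ := hf.bdd
  exact ⟨L.continuous.comp hf.cont, ‖L‖ * C, fun x => (L.le_opNorm _).trans (by bound)⟩

variable [MeasurableSpace α] [OpensMeasurableSpace α] [SecondCountableTopology α]
  [TopologicalSpace.PseudoMetrizableSpace α] {μ : Measure α}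

lemma memLp (hf : BddCont f) [IsFiniteMeasure μ] : MemLp f 2 μ := by
  obtain ⟨C, hC⟩ := hf.bdd
  exact MemLp.of_bound hf.cont.aestronglyMeasurable C (.of_forall hC)

lemma integrable (hf : BddCont f) [IsFiniteMeasure μ] : Integrable f μ := by
  obtain ⟨C, hC⟩ := hf.bdd
  exact Integrable.of_bound hf.cont.aestronglyMeasurable C (.of_forall hC)

end BddCont

section Operators

variable {F : Type*} [NormedAddCommGroup F] [NormedSpace ℝ F] [CompleteSpace F]
  {ρ : Measure E} [IsProbabilityMeasure ρ] {η : ℝ}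

/-- Gaussian averaging. -/
def heat (η : ℝ) (g : E → F) (x : E) : F := ∫ u, g (x + √η • u) ∂(stdGaussian E)

variable (ρ η) in
/-- Posterior averaging. -/
def avg (f : E → F) (y : E) : F := ∫ x, f x ∂(post ρ η y)

lemma BddCont.heat {g : E → F} (hg : BddCont g) : BddCont (heat η g) := by
  obtain ⟨C, hC⟩ := hg.bdd
  have hc := hg.cont
  refine ⟨?_, C, fun x => ?_⟩
  · refine continuous_of_dominated (F := fun x u => g (x + √η • u)) (bound := fun _ => C) (fun x =>
      Continuous.aestronglyMeasurable (by fun_prop)) (fun x => .of_forall fun u => hC _)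
      (integrable_const _) (.of_forall fun u => by fun_prop)
  · have := norm_integral_le_of_norm_le_const (μ := stdGaussian E) (f := fun u => g (x + √η • u))
      (.of_forall fun u => hC _)
    aesop

lemma BddCont.avg (hη : 0 < η) {f : E → F} (hf : BddCont f) : BddCont (avg ρ η f) := by
  obtain ⟨C, hC⟩ := hf.bdd
  have hS : SubExp ρ (fun x : E => η⁻¹ • innerSL ℝ x) f :=
    subExp_of_bound hf.cont.aestronglyMeasurable (.of_forall hC)
  exact ⟨continuous_iff_continuousAt.2 fun y => (hasFDerivAt_post hη hS y).continuousAt, C,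
    fun y => norm_integral_post_le hη (.of_forall hC) y⟩

lemma hasFDerivAt_heat {g : E → ℝ} {G : E → E} (hg : BddCont g) (hG : BddCont G)
    (h : ∀ x, HasFDerivAt g (innerSL ℝ (G x)) x) (x : E) :
    HasFDerivAt (heat η g) (innerSL ℝ (heat η G x)) x := by
  obtain ⟨C, hC⟩ := hG.bdd
  have hgc := hg.cont
  have hGc := hG.cont
  have key := hasFDerivAt_integral_of_dominated_of_fderiv_le (μ := stdGaussian E) (F := fun x u => g
    (x + √η • u)) (F' := fun x u => innerSL ℝ (G (x + √η • u))) (x₀ := x) (bound := fun _ => C) (s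
    := univ) univ_mem (.of_forall fun x => Continuous.aestronglyMeasurable (by fun_prop)) (hg.comp
    (by fun_prop : Continuous fun u : E => x + √η • u)).integrable (Continuous.aestronglyMeasurable
    (by fun_prop)) (.of_forall fun u x _ => by simp_all) (integrable_const _) (.of_forall fun u x _
    => (h _).comp x ((hasFDerivAt_id x).add_const _))
  refine key.congr_fderiv ?_
  exact (innerSL ℝ : E →L[ℝ] E →L[ℝ] ℝ).integral_comp_comm
    (hG.comp (by fun_prop : Continuous fun u : E => x + √η • u)).integrable

lemma integral_chan_fst {f : E → F} (hf : BddCont f) : ∫ q, f q.1 ∂chan ρ η = ∫ x, f x ∂ρ := by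
  rw [integral_chan (hf.comp continuous_fst).integrable]
  simp

lemma integral_heat {g : E → F} (hg : BddCont g) :
    ∫ q, heat η g q.1 ∂chan ρ η = ∫ q, g q.2 ∂(chan ρ η) := by
  rw [integral_chan_fst hg.heat, integral_chan (hg.comp continuous_snd).integrable]
  rfl

lemma integral_avg (hη : 0 < η) {f : E → F} (hf : BddCont f) : ∫ q, avg ρ η f q.2 ∂chan ρ η = ∫ q, f
  q.1 ∂(chan ρ η) := (chan_bayes hη (hf.comp continuous_fst).integrable).2.symm

lemma integral_mul_heat {f g : E → ℝ} (hf : BddCont f) (hg : BddCont g) :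
    ∫ q, f q.1 * heat η g q.1 ∂chan ρ η = ∫ q, f q.1 * g q.2 ∂(chan ρ η) := by
  rw [integral_chan ((hf.comp continuous_fst).mul (hg.comp continuous_snd)).integrable,
    integral_chan_fst (hf.mul hg.heat)]
  refine integral_congr_ae (.of_forall fun x => ?_)
  exact (integral_const_mul _ _).symm

lemma integral_avg_mul (hη : 0 < η) {f g : E → ℝ} (hf : BddCont f) (hg : BddCont g) :
    ∫ q, avg ρ η f q.2 * g q.2 ∂chan ρ η = ∫ q, f q.1 * g q.2 ∂(chan ρ η) := by
  rw [(chan_bayes hη ((hf.comp continuous_fst).mul (hg.comp continuous_snd)).integrable).2]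
  refine integral_congr_ae (.of_forall fun q => ?_)
  exact (integral_mul_const _ _).symm

/-- Expected posterior variance. -/
lemma integral_sub_avg_sq (hη : 0 < η) {f g : E → ℝ} (hf : BddCont f) (hg : BddCont g) : ∫ q, (f q.1
    - g q.2) ^ 2 ∂chan ρ η = ∫ q, f q.1 ^ 2 ∂chan ρ η - 2 * ∫ q, avg ρ η f q.2 * g q.2 ∂chan ρ η + ∫
    q, g q.2 ^ 2 ∂(chan ρ η) := by
  have h1 := hf.comp (continuous_fst : Continuous (Prod.fst : E × E → E))
  have h2 := hg.comp (continuous_snd : Continuous (Prod.snd : E × E → E))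
  rw [integral_avg_mul hη hf hg, ← integral_const_mul,
    ← integral_sub h1.pow.integrable (imul _ (h1.mul h2).integrable),
    ← integral_add (isub h1.pow.integrable (imul _ (h1.mul h2).integrable)) h2.pow.integrable]
  grind

lemma integral_avg_sq_le (hη : 0 < η) {f : E → ℝ} (hf : BddCont f) :
    ∫ q, avg ρ η f q.2 ^ 2 ∂chan ρ η ≤ ∫ q, f q.1 ^ 2 ∂(chan ρ η) := by
  have h1 := integral_sub_avg_sq (ρ := ρ) hη hf (hf.avg (ρ := ρ) hη)
  have h2 : 0 ≤ ∫ q, (f q.1 - avg ρ η f q.2) ^ 2 ∂(chan ρ η) := integral_nonneg fun q => sq_nonneg _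
  grind

variable (ρ η) in
/-- `κ` bounds the squared correlation of the Gaussian channel. -/
def IsCorrBound (κ : ℝ) : Prop := ∀ f : E → ℝ, BddCont f → ∫ q, f q.1 ∂chan ρ η = 0 →
  ∫ q, avg ρ η f q.2 ^ 2 ∂chan ρ η ≤ κ * ∫ q, f q.1 ^ 2 ∂(chan ρ η)

lemma avg_const_mul (c : ℝ) (f : E → ℝ) (y : E) :
    avg ρ η (fun x => c * f x) y = c * avg ρ η f y := integral_const_mul _ _

lemma avg_sub (hη : 0 < η) {f g : E → F} (hf : BddCont f) (hg : BddCont g) (y : E) :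
    avg ρ η (fun x => f x - g x) y = avg ρ η f y - avg ρ η g y := by
  have := isProbabilityMeasure_post (ρ := ρ) hη y
  exact integral_sub hf.integrable hg.integrable

lemma avg_const (hη : 0 < η) (c : F) (y : E) : avg ρ η (fun _ => c) y = c := by
  have := isProbabilityMeasure_post (ρ := ρ) hη y
  simp [avg]

/-- The optimal squared correlation, with near-optimizers. -/
lemma exists_isCorrBound (hη : 0 < η) : ∃ κ : ℝ, 0 ≤ κ ∧ κ ≤ 1 ∧ IsCorrBound ρ η κ ∧ ∀ ε > 0, ∃ f :
    E → ℝ, BddCont f ∧ ∫ q, f q.1 ∂chan ρ η = 0 ∧ ∫ q, f q.1 ^ 2 ∂chan ρ η ≤ 1 ∧ κ - ε ≤ ∫ q, avg ρ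
    η f q.2 ^ 2 ∂(chan ρ η) := by
  obtain ⟨S, hS⟩ : ∃ S : Set ℝ, S = {r | ∃ f : E → ℝ, BddCont f ∧ ∫ q, f q.1 ∂chan ρ η = 0 ∧
      ∫ q, f q.1 ^ 2 ∂chan ρ η ≤ 1 ∧ r = ∫ q, avg ρ η f q.2 ^ 2 ∂(chan ρ η)} := ⟨_, rfl⟩
  have h0 : (0 : ℝ) ∈ S := by
    rw [hS]
    exact ⟨fun _ => 0, BddCont.const 0, by simp, by simp, by simp [avg]⟩
  have hb : ∀ r ∈ S, r ≤ 1 := by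
    rw [hS]
    rintro r ⟨f, hf, -, h1, rfl⟩
    exact (integral_avg_sq_le hη hf).trans h1
  have hB : BddAbove S := ⟨1, hb⟩
  refine ⟨sSup S, le_csSup hB h0, csSup_le ⟨0, h0⟩ hb, fun f hf hf0 => ?_, fun ε hε => ?_⟩
  · have hn : 0 ≤ ∫ q, f q.1 ^ 2 ∂(chan ρ η) := integral_nonneg fun q => sq_nonneg _
    rcases hn.eq_or_lt with h | h
    · have := integral_avg_sq_le (ρ := ρ) hη hf
      rw [← h] at this ⊢
      simpa using this
    · obtain ⟨c, hc⟩ : ∃ c, c = √(∫ q, f q.1 ^ 2 ∂chan ρ η) := ⟨_, rfl⟩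
      have hc0 : 0 < c := by rw [hc]; exact sqrt_pos.2 h
      have hc2 : c ^ 2 = ∫ q, f q.1 ^ 2 ∂(chan ρ η) := by rw [hc, sq_sqrt hn]
      have hm : (c⁻¹ ^ 2 * ∫ q, avg ρ η f q.2 ^ 2 ∂chan ρ η) ∈ S := by
        rw [hS]
        refine ⟨fun x => c⁻¹ * f x, (BddCont.const _).mul hf, ?_, ?_, ?_⟩
        · rw [integral_const_mul, hf0, mul_zero]
        · simp only [mul_pow]
          rw [integral_const_mul, ← hc2, ← mul_pow, inv_mul_cancel₀ hc0.ne', one_pow]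
        · simp only [avg_const_mul, mul_pow]
          rw [integral_const_mul]
      have h2 := le_csSup hB hm
      rw [← hc2]
      have h3 : c ^ 2 * (c⁻¹ ^ 2 * ∫ q, avg ρ η f q.2 ^ 2 ∂chan ρ η) = ∫ q, avg ρ η f q.2 ^ 2 ∂(chan
        ρ η) := by rw [← mul_assoc, ← mul_pow, mul_inv_cancel₀ hc0.ne', one_pow, one_mul]
      rw [← h3, mul_comm (sSup S)]
      gcongr
  · obtain ⟨r, hr, hlt⟩ := exists_lt_of_lt_csSup ⟨0, h0⟩ (sub_lt_self (sSup S) hε)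
    rw [hS] at hr
    obtain ⟨f, hf, hf0, hf1, rfl⟩ := hr
    exact ⟨f, hf, hf0, hf1, hlt.le⟩

variable {κ : ℝ}

/-- The dual contraction. -/
lemma IsCorrBound.heat_sq_le (hκ : IsCorrBound ρ η κ) (hη : 0 < η) (hκ0 : 0 ≤ κ) {g : E → ℝ}
    (hg : BddCont g) (h0 : ∫ q, g q.2 ∂chan ρ η = 0) :
    ∫ q, heat η g q.1 ^ 2 ∂chan ρ η ≤ κ * ∫ q, g q.2 ^ 2 ∂(chan ρ η) := by
  have hb := hg.heat (η := η)
  have h1 := hκ _ hb (by rw [integral_heat hg, h0])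
  have h2 : ∫ q, heat η g q.1 ^ 2 ∂chan ρ η = ∫ q, avg ρ η (heat η g) q.2 * g q.2 ∂(chan ρ η) := by
    rw [integral_avg_mul hη hb hg, ← integral_mul_heat hb hg]
    simp only [sq]
  have h3 := sq_integral_mul_le (μ := chan ρ η)
    ((hb.avg (ρ := ρ) hη).comp continuous_snd).memLp (hg.comp continuous_snd).memLp
  rw [← h2] at h3
  obtain ⟨a, ha⟩ : ∃ a, a = ∫ q, heat η g q.1 ^ 2 ∂(chan ρ η) := ⟨_, rfl⟩
  obtain ⟨c, hc⟩ : ∃ c, c = ∫ q, g q.2 ^ 2 ∂(chan ρ η) := ⟨_, rfl⟩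
  have ha0 : 0 ≤ a := by rw [ha]; positivity
  have hc0 : 0 ≤ c := by rw [hc]; exact integral_nonneg fun q => sq_nonneg _
  rw [← ha] at h1 h3 ⊢
  rw [← hc] at h3 ⊢
  rcases ha0.eq_or_lt with h | h
  · rw [← h]; positivity
  · have : a * a ≤ (κ * c) * a := by nlinarith
    exact le_of_mul_le_mul_right this h

lemma integral_sub_const_sq {Ω : Type*} [MeasurableSpace Ω] {μ : Measure Ω} [IsProbabilityMeasure μ]
    {f : Ω → ℝ} (hf : MemLp f 2 μ) :
    ∫ x, (f x - ∫ z, f z ∂μ) ^ 2 ∂μ = ∫ x, f x ^ 2 ∂μ - (∫ x, f x ∂μ) ^ 2 := by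
  obtain ⟨m, hm⟩ : ∃ m, m = ∫ z, f z ∂μ := ⟨_, rfl⟩
  have h1 := hf.integrable one_le_two
  have h2 := hf.integrable_sq
  rw [← hm]
  have h3 : ∀ x, (f x - m) ^ 2 = f x ^ 2 - 2 * m * f x + m ^ 2 := fun x => by ring
  simp only [h3]
  rw [integral_add (isub h2 (imul _ h1)) (integrable_const _), integral_sub h2 (imul _ h1),
    integral_const_mul, ← hm, integral_const, probReal_univ]
  ring

lemma IsCorrBound.avg_var_le (hκ : IsCorrBound ρ η κ) (hη : 0 < η) {f : E → ℝ} (hf : BddCont f) : ∫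
    q, avg ρ η f q.2 ^ 2 ∂chan ρ η - (∫ q, f q.1 ∂chan ρ η) ^ 2 ≤ κ * (∫ q, f q.1 ^ 2 ∂chan ρ η - (∫
    q, f q.1 ∂chan ρ η) ^ 2) := by
  obtain ⟨m, hm⟩ : ∃ m, m = ∫ q, f q.1 ∂(chan ρ η) := ⟨_, rfl⟩
  have h1 := hκ (fun x => f x - m) (hf.sub (BddCont.const m)) (by
    rw [integral_sub (hf.comp continuous_fst).integrable (integrable_const _), ← hm]; simp)
  have h2 := integral_sub_const_sq (μ := chan ρ η) (hf.comp continuous_fst).memLp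
  have h3 := integral_sub_const_sq (μ := chan ρ η) ((hf.avg (ρ := ρ) hη).comp continuous_snd).memLp
  rw [integral_avg hη hf] at h3
  simp only [avg_sub (ρ := ρ) hη hf (BddCont.const m), avg_const (ρ := ρ) hη] at h1
  simp_all

lemma IsCorrBound.heat_var_le (hκ : IsCorrBound ρ η κ) (hη : 0 < η) (hκ0 : 0 ≤ κ) {g : E → ℝ} (hg :
    BddCont g) : ∫ q, heat η g q.1 ^ 2 ∂chan ρ η - (∫ q, g q.2 ∂chan ρ η) ^ 2 ≤ κ * (∫ q, g q.2 ^ 2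
    ∂chan ρ η - (∫ q, g q.2 ∂chan ρ η) ^ 2) := by
  obtain ⟨m, hm⟩ : ∃ m, m = ∫ q, g q.2 ∂(chan ρ η) := ⟨_, rfl⟩
  have h1 := hκ.heat_sq_le hη hκ0 (g := fun x => g x - m) (hg.sub (BddCont.const m)) (by
    rw [integral_sub (hg.comp continuous_snd).integrable (integrable_const _), ← hm]; simp)
  have h2 := integral_sub_const_sq (μ := chan ρ η) (hg.comp continuous_snd).memLp
  have h3 := integral_sub_const_sq (μ := chan ρ η) ((hg.heat (η := η)).comp continuous_fst).memLp
  rw [integral_heat hg] at h3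
  have h4 : ∀ x, heat η (fun x => g x - m) x = heat η g x - m := fun x => by
    refine (integral_sub (hg.comp (by fun_prop : Continuous fun u : E => x + √η • u)).integrable
      (integrable_const _)).trans ?_
    simp [heat]
  simp_all

lemma integral_norm_sq_eq_sum {Ω : Type*} [MeasurableSpace Ω] {μ : Measure Ω} {φ : Ω → E} (hφ :
    MemLp φ 2 μ) : ∫ x, ‖φ x‖ ^ 2 ∂μ = ∑ i, ∫ x, ⟪stdOrthonormalBasis ℝ E i, φ x⟫ ^ 2 ∂μ := by
  rw [← integral_finsetSum _ fun i _ => (hφ.const_inner _).integrable_sq]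
  refine integral_congr_ae (.of_forall fun x => ?_)
  exact ((stdOrthonormalBasis ℝ E).sum_sq_inner_right (φ x)).symm

lemma inner_avg (hη : 0 < η) {φ : E → E} (hφ : BddCont φ) (e y : E) :
    ⟪e, avg ρ η φ y⟫ = avg ρ η (fun x => ⟪e, φ x⟫) y := by
  have := isProbabilityMeasure_post (ρ := ρ) hη y
  exact (integral_inner (𝕜 := ℝ) hφ.integrable e).symm

lemma inner_heat {φ : E → E} (hφ : BddCont φ) (e y : E) : ⟪e, heat η φ y⟫ = heat η (fun x => ⟪e, φ
  x⟫) y := (integral_inner (𝕜 := ℝ) (hφ.comp (by fun_prop : Continuous fun u : E => y + √η •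
  u)).integrable e).symm

lemma IsCorrBound.norm_avg_sq_le (hκ : IsCorrBound ρ η κ) (hη : 0 < η) {φ : E → E} (hφ : BddCont φ)
    : ∫ q, ‖avg ρ η φ q.2‖ ^ 2 ∂chan ρ η - ‖∫ q, φ q.1 ∂(chan ρ η)‖ ^ 2 ≤ κ * (∫ q, ‖φ q.1‖ ^ 2
    ∂chan ρ η - ‖∫ q, φ q.1 ∂(chan ρ η)‖ ^ 2) := by
  rw [integral_norm_sq_eq_sum ((hφ.avg (ρ := ρ) hη).comp continuous_snd).memLp,
    integral_norm_sq_eq_sum (hφ.comp continuous_fst).memLp, ← (stdOrthonormalBasis ℝ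
    E).sum_sq_inner_right (∫ q, φ q.1 ∂chan ρ η), ← sum_sub_distrib, ← sum_sub_distrib, mul_sum]
  refine sum_le_sum fun i _ => ?_
  simp only [inner_avg (ρ := ρ) hη hφ]
  rw [← integral_inner (𝕜 := ℝ) (hφ.comp continuous_fst).integrable]
  exact hκ.avg_var_le hη (hφ.clm (innerSL ℝ (stdOrthonormalBasis ℝ E i)))

lemma IsCorrBound.norm_heat_sq_le (hκ : IsCorrBound ρ η κ) (hη : 0 < η) (hκ0 : 0 ≤ κ) {φ : E → E}
    (hφ : BddCont φ) : ∫ q, ‖heat η φ q.1‖ ^ 2 ∂chan ρ η - ‖∫ q, φ q.2 ∂(chan ρ η)‖ ^ 2 ≤ κ * (∫ q,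
    ‖φ q.2‖ ^ 2 ∂chan ρ η - ‖∫ q, φ q.2 ∂(chan ρ η)‖ ^ 2) := by
  rw [integral_norm_sq_eq_sum ((hφ.heat (η := η)).comp continuous_fst).memLp,
    integral_norm_sq_eq_sum (hφ.comp continuous_snd).memLp, ← (stdOrthonormalBasis ℝ
    E).sum_sq_inner_right (∫ q, φ q.2 ∂chan ρ η), ← sum_sub_distrib, ← sum_sub_distrib, mul_sum]
  refine sum_le_sum fun i _ => ?_
  simp only [inner_heat hφ]
  rw [← integral_inner (𝕜 := ℝ) (hφ.comp continuous_snd).integrable]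
  exact hκ.heat_var_le hη hκ0 (hφ.clm (innerSL ℝ (stdOrthonormalBasis ℝ E i)))

end Operators

section Mixture

variable {ρ ν : Measure E} [IsProbabilityMeasure ρ] [IsProbabilityMeasure ν] {η β R : ℝ}

lemma integral_sub_heat_sq_le (hη : 0 < η) {g : E → ℝ} {G : E → E} (hg : BddCont g) (hG : BddCont G)
    (h : ∀ x, HasFDerivAt g (innerSL ℝ (G x)) x) (x : E) : ∫ u, (g (x + √η • u) - heat η g x) ^ 2
    ∂stdGaussian E ≤ Real.pi ^ 2 / 8 * η * ∫ u, ‖G (x + √η • u)‖ ^ 2 ∂(stdGaussian E) := by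
  obtain ⟨C, hC⟩ := hg.bdd
  obtain ⟨C', hC'⟩ := hG.bdd
  have hd : ∀ u, HasFDerivAt (fun u => g (x + √η • u)) (√η • innerSL ℝ (G (x + √η • u))) u := by
    intro u
    have h1 : HasFDerivAt (fun u : E => x + √η • u) (√η • ContinuousLinearMap.id ℝ E) u :=
      ((hasFDerivAt_id u).const_smul (√η)).const_add x
    refine ((h _).comp u h1).congr_fderiv ?_
    ext v
    change ⟪G (x + √η • u), √η • v⟫ = √η * ⟪G (x + √η • u), v⟫
    rw [inner_smul_right]
  have hn : ∀ u, ‖fderiv ℝ (fun u => g (x + √η • u)) u‖ = √η * ‖G (x + √η • u)‖ := fun u => by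
    rw [(hd u).fderiv, norm_smul, innerSL_apply_norm, norm_eq_abs, abs_of_nonneg (sqrt_nonneg _)]
  have key := gaussian_poincare (F := fun u => g (x + √η • u)) (fun u => (hd u).differentiableAt) (C
    := √η * C') (fun u => by rw [hn]; gcongr; exact hC' _) (M := C) (fun u => hC _)
  simp only [hn, mul_pow, sq_sqrt hη.le] at key
  rw [integral_const_mul, ← mul_assoc] at key
  exact key

lemma integral_chan_sub_heat_sq_le (hη : 0 < η) {g : E → ℝ} {G : E → E} (hg : BddCont g) (hG :
    BddCont G) (h : ∀ x, HasFDerivAt g (innerSL ℝ (G x)) x) : ∫ q, (heat η g q.1 - g q.2) ^ 2 ∂chan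
    ρ η ≤ Real.pi ^ 2 / 8 * η * ∫ q, ‖G q.2‖ ^ 2 ∂(chan ρ η) := by
  have b1 : BddCont fun q : E × E => (heat η g q.1 - g q.2) ^ 2 :=
    ((hg.heat.comp continuous_fst).sub (hg.comp continuous_snd)).pow
  have b2 : BddCont fun q : E × E => ‖G q.2‖ ^ 2 := (hG.comp continuous_snd).norm.pow
  have b3 : BddCont (heat η fun x => ‖G x‖ ^ 2) := hG.norm.pow.heat
  rw [integral_chan b1.integrable, integral_chan b2.integrable, ← integral_const_mul]
  refine integral_mono_of_nonneg (.of_forall fun x => integral_nonneg fun u => sq_nonneg _)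
    (imul _ b3.integrable) (.of_forall fun x => ?_)
  have h1 := integral_sub_heat_sq_le hη hg hG h x
  grind

lemma integral_stdGaussian_eq (φ : E → ℝ) : ∫ u, φ u ∂stdGaussian E =
    (∫ u : E, exp (-‖u‖ ^ 2 / 2))⁻¹ * ∫ u, exp (-‖u‖ ^ 2 / 2) * φ u := by
  rw [stdGaussian_eq_tilted, integral_tilted_eq_smul]
  simp [gexp]

lemma cameron_martin (φ : E → ℝ) (h : E) : ∫ u, φ (u + h) ∂stdGaussian E =
    exp (-‖h‖ ^ 2 / 2) * ∫ u, φ u * exp ⟪h, u⟫ ∂(stdGaussian E) := by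
  rw [integral_stdGaussian_eq, integral_stdGaussian_eq, mul_left_comm, ← integral_const_mul (exp (-‖h‖ ^ 2 / 2))]
  congr 1
  rw [← integral_sub_right_eq_self (fun u => exp (-‖u‖ ^ 2 / 2) * φ (u + h)) h]
  refine integral_congr_ae (.of_forall fun u => ?_)
  change exp (-‖u - h‖ ^ 2 / 2) * φ (u - h + h) =
    exp (-‖h‖ ^ 2 / 2) * (exp (-‖u‖ ^ 2 / 2) * (φ u * exp ⟪h, u⟫))
  rw [sub_add_cancel, norm_sub_sq_real, real_inner_comm]
  have : exp (-(‖u‖ ^ 2 - 2 * ⟪h, u⟫ + ‖h‖ ^ 2) / 2) =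
      exp (-‖h‖ ^ 2 / 2) * exp (-‖u‖ ^ 2 / 2) * exp ⟪h, u⟫ := by
    rw [← exp_add, ← exp_add]; congr 1; ring
  rw [this]; ring

lemma integral_exp_inner_stdGaussian (h : E) :
    ∫ u, exp ⟪h, u⟫ ∂stdGaussian E = exp (‖h‖ ^ 2 / 2) := by
  have h1 := cameron_martin (fun _ => 1) h
  simp only [integral_const, probReal_univ, smul_eq_mul] at h1
  have h2 : exp (‖h‖ ^ 2 / 2) * exp (-‖h‖ ^ 2 / 2) = 1 := by
    rw [← exp_add, ← exp_zero]; congr 1; ring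
  grind

lemma sq_integral_shift_le {φ : E → ℝ} (hφ : BddCont φ) (h : E) : (∫ u, φ (u + h) ∂stdGaussian E) ^
    2 ≤ exp (‖h‖ ^ 2) * ∫ u, φ u ^ 2 ∂(stdGaussian E) := by
  have hsq : ∀ u : E, exp ⟪h, u⟫ ^ 2 = exp ⟪(2 : ℝ) • h, u⟫ := fun u => by
    rw [← exp_nat_mul, inner_smul_left]; simp
  have h0 := integral_exp_inner_stdGaussian ((2 : ℝ) • h)
  have hi : Integrable (fun u : E => exp ⟪(2 : ℝ) • h, u⟫) (stdGaussian E) := by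
    by_contra hcon
    rw [integral_undef hcon] at h0
    exact (exp_pos _).ne h0
  have m1 : MemLp (fun u : E => exp ⟪h, u⟫) 2 (stdGaussian E) := by
    rw [memLp_two_iff_integrable_sq (Continuous.aestronglyMeasurable (by fun_prop))]
    simp_all
  have key := sq_integral_mul_le hφ.memLp m1
  simp only [hsq] at key
  rw [h0, norm_smul] at key
  rw [cameron_martin, mul_pow]
  calc exp (-‖h‖ ^ 2 / 2) ^ 2 * (∫ u, φ u * exp ⟪h, u⟫ ∂stdGaussian E) ^ 2 ≤ exp (-‖h‖ ^ 2 / 2) ^ 2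
      * ((∫ u, φ u ^ 2 ∂stdGaussian E) * exp ((‖(2:ℝ)‖ * ‖h‖) ^ 2 / 2)) := by gcongr
    _ = exp (‖h‖ ^ 2) * ∫ u, φ u ^ 2 ∂(stdGaussian E) := by
        rw [mul_left_comm, ← exp_nat_mul, ← exp_add, mul_comm]
        congr 2
        norm_num
        ring

lemma sq_heat_sub_heat_le (hβ : 0 < β) {f : E → ℝ} (hf : BddCont f) (b b' : E) : (heat β f b - heat
    β f b') ^ 2 ≤ exp (‖b - b'‖ ^ 2 / β) * ∫ u, (f (b' + √β • u) - heat β f b') ^ 2 ∂(stdGaussian E)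
    := by
  have hs := (sqrt_pos.2 hβ).ne'
  have hb : BddCont fun u : E => f (b' + √β • u) - heat β f b' :=
    (hf.comp (by fun_prop)).sub (BddCont.const _)
  have h1 := sq_integral_shift_le hb ((√β)⁻¹ • (b - b'))
  have h2 : ∀ u, f (b' + √β • (u + (√β)⁻¹ • (b - b'))) - heat β f b' =
      f (b + √β • u) - heat β f b' := fun u => by
    rw [smul_add, smul_smul, mul_inv_cancel₀ hs, one_smul]
    congr 2; abel
  simp only [h2] at h1
  rw [integral_sub (hf.comp (by fun_prop : Continuous fun u : E => b + √β • u)).integrable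
    (integrable_const _), norm_smul, mul_pow] at h1
  simp only [integral_const, probReal_univ, one_smul, norm_eq_abs, inv_pow, sq_abs,
    sq_sqrt hβ.le] at h1
  rw [div_eq_inv_mul]
  exact h1

/-- A (poor) Poincaré inequality for Gaussian mixtures. -/
lemma smooth_poincare (hβ : 0 < β) (hν : SuppIn ν R) {f : E → ℝ} {G : E → E} (hf : BddCont f) (hG :
    BddCont G) (h : ∀ x, HasFDerivAt f (innerSL ℝ (G x)) x) (h0 : ∫ x, f x ∂smooth ν β = 0) : ∫ x, f
    x ^ 2 ∂smooth ν β ≤ (1 + exp ((2 * R) ^ 2 / β)) * (Real.pi ^ 2 / 8 * β) * ∫ x, ‖G x‖ ^ 2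
    ∂(smooth ν β) := by
  rw [integral_smooth hf.cont.aestronglyMeasurable] at h0
  rw [integral_smooth hf.pow.cont.aestronglyMeasurable,
    integral_smooth hG.norm.pow.cont.aestronglyMeasurable]
  have hP := integral_chan_sub_heat_sq_le (ρ := ν) hβ hf hG h
  obtain ⟨V, hV⟩ : ∃ V, V = ∫ q, (heat β f q.1 - f q.2) ^ 2 ∂(chan ν β) := ⟨_, rfl⟩
  have hVν : V = ∫ b, ∫ u, (f (b + √β • u) - heat β f b) ^ 2 ∂(stdGaussian E) ∂ν := by
    have b1 : BddCont fun q : E × E => (heat β f q.1 - f q.2) ^ 2 :=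
      ((hf.heat.comp continuous_fst).sub (hf.comp continuous_snd)).pow
    rw [hV, integral_chan b1.integrable]
    grind
  have hVi : Integrable (fun b => ∫ u, (f (b + √β • u) - heat β f b) ^ 2 ∂stdGaussian E) ν := by
    have e : ∀ b, ∫ u, (f (b + √β • u) - heat β f b) ^ 2 ∂stdGaussian E = heat β (fun x => f x ^ 2)
      b - heat β f b ^ 2 := fun b => integral_sub_const_sq (hf.comp (by fun_prop : Continuous fun u
      : E => b + √β • u)).memLp
    simp only [e]
    exact ((hf.pow.heat).sub hf.heat.pow).integrable
  have hm0 : ∫ b, heat β f b ∂ν = 0 := by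
    rw [← integral_heat hf, integral_chan_fst hf.heat] at h0
    exact h0
  have hm : ∀ᵐ b ∂ν, heat β f b ^ 2 ≤ exp ((2 * R) ^ 2 / β) * V := by
    filter_upwards [hν] with b hb
    have i1 : BddCont fun b' => heat β f b - heat β f b' := (BddCont.const _).sub hf.heat
    have e1 : heat β f b = ∫ b', (heat β f b - heat β f b') ∂ν := by
      rw [integral_sub (integrable_const _) hf.heat.integrable, hm0]; simp
    have e2 := sq_integral_le (J := ν) i1.integrable i1.pow.integrable
    rw [← e1, probReal_univ, one_mul] at e2
    refine e2.trans ?_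
    rw [hVν, ← integral_const_mul]
    refine integral_mono_ae i1.pow.integrable (imul _ hVi) ?_
    filter_upwards [hν] with b' hb'
    refine (sq_heat_sub_heat_le hβ hf b b').trans ?_
    have : ‖b - b'‖ ≤ 2 * R := (norm_sub_le _ _).trans (by linarith)
    gcongr
  have hm2 : ∫ q, heat β f q.1 ^ 2 ∂chan ν β ≤ exp ((2 * R) ^ 2 / β) * V := by
    rw [integral_chan_fst hf.heat.pow]
    refine (integral_mono_ae hf.heat.pow.integrable (integrable_const _) hm).trans ?_
    simp
  have hd : ∫ q, f q.2 ^ 2 ∂chan ν β = V + ∫ q, heat β f q.1 ^ 2 ∂(chan ν β) := by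
    have h1 := (hf.heat (η := β)).comp (continuous_fst : Continuous (Prod.fst : E × E → E))
    have h2 := hf.comp (continuous_snd : Continuous (Prod.snd : E × E → E))
    have h3 := integral_mul_heat (ρ := ν) (η := β) (hf.heat (η := β)) hf
    have e : ∀ q : E × E, f q.2 ^ 2 = (heat β f q.1 - f q.2) ^ 2 +
      (2 * (heat β f q.1 * f q.2) - heat β f q.1 ^ 2) := fun q => by ring
    have i1 : Integrable (fun q : E × E => (heat β f q.1 - f q.2) ^ 2) (chan ν β) :=
      (h1.sub h2).pow.integrable
    have i2 : Integrable (fun q : E × E => 2 * (heat β f q.1 * f q.2)) (chan ν β) :=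
      imul _ (h1.mul h2).integrable
    have i3 : Integrable (fun q : E × E => heat β f q.1 ^ 2) (chan ν β) := h1.pow.integrable
    rw [integral_congr_ae (.of_forall e), integral_add i1 (isub i2 i3),
      integral_sub i2 i3, integral_const_mul, ← h3, ← hV]
    ring_nf
  rw [← hV] at hP
  rw [hd]
  calc V + ∫ q, heat β f q.1 ^ 2 ∂chan ν β ≤ V + exp ((2 * R) ^ 2 / β) * V := by gcongr
    _ = (1 + exp ((2 * R) ^ 2 / β)) * V := by ring
    _ ≤ (1 + exp ((2 * R) ^ 2 / β)) * (Real.pi ^ 2 / 8 * β *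
        ∫ q, ‖G q.2‖ ^ 2 ∂chan ν β) := by gcongr
    _ = _ := by ring

end Mixture

section NearExtremal

variable {ν : Measure E} [IsProbabilityMeasure ν] {η β R : ℝ}

lemma memLp_smooth_id (hβ : 0 < β) (hν : SuppIn ν R) : MemLp (fun x : E => x) 2 (smooth ν β) := by
  have h1 : MemLp (fun q : E × E => q.2) 2 (chan ν β) := by
    rw [memLp_two_iff_integrable_sq_norm (by fun_prop), integrable_chan_iff (by fun_prop)]
    have hi : Integrable (fun p : E × E => 2 * R ^ 2 + 2 * β * ‖p.2‖ ^ 2) (ν.prod (stdGaussian E))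
      := (integrable_const _).add (((integrable_norm_pow_stdGaussian 2).const_mul (2 * β)).comp_snd
      ν)
    refine hi.mono' (by fun_prop) ?_
    have : ∀ᵐ p ∂(ν.prod (stdGaussian E)), ‖p.1‖ ≤ R := quasiMeasurePreserving_fst.ae hν
    filter_upwards [this] with p hp
    rw [norm_pow, norm_norm]
    have h2 : ‖p.1 + √β • p.2‖ ≤ R + √β * ‖p.2‖ := by
      refine (norm_add_le _ _).trans ?_
      rw [norm_smul, norm_eq_abs, abs_of_nonneg (sqrt_nonneg _)]
      gcongr
    calc ‖p.1 + √β • p.2‖ ^ 2 ≤ (R + √β * ‖p.2‖) ^ 2 := by gcongr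
      _ ≤ 2 * R ^ 2 + 2 * (√β ^ 2 * ‖p.2‖ ^ 2) := by nlinarith [sq_nonneg (R - √β * ‖p.2‖)]
      _ = _ := by grind
  exact (memLp_map_measure_iff (by fun_prop) (by fun_prop)).2 h1

lemma memLp_chan_fst {ρ : Measure E} [IsProbabilityMeasure ρ] (h : MemLp (fun x : E => x) 2 ρ) :
    MemLp (fun q : E × E => q.1) 2 (chan ρ η) := by
  rw [memLp_two_iff_integrable_sq_norm (by fun_prop)] at h ⊢
  rw [integrable_chan_iff (by fun_prop)]
  exact h.comp_fst (stdGaussian E)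

variable (E) in
/-- Fourth moment constant of the posterior. -/
def fourthConst (R β : ℝ) : ℝ := 8 * ((R / β) ^ 4 + ∫ u : E, ‖u‖ ^ 4 ∂stdGaussian E)

lemma fourthConst_nonneg : 0 ≤ fourthConst E R β := by
  unfold fourthConst
  positivity

lemma integral_norm_sq_post_le (hβ : 0 < β) (hη : 0 < η) (hη1 : η ≤ 1) (hν : SuppIn ν R) (y : E) : ∫
    x, ‖x - (β / (β + η)) • y‖ ^ 2 ∂(post (smooth ν β) η y) ≤ √(fourthConst E R β) * η := by
  have hp := isProbabilityMeasure_post (ρ := smooth ν β) hη y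
  have hR : 0 ≤ R := by
    obtain ⟨b, hb⟩ := hν.exists
    exact (norm_nonneg _).trans hb
  obtain ⟨h1, h2⟩ := integral_norm_pow_four_post hβ hη hη1 hν y
  have h3 : ∀ x : E, ‖x - (β / (β + η)) • y‖ ^ 4 = (‖x - (β / (β + η)) • y‖ ^ 2) ^ 2 := fun x => by
    ring
  have hm : MemLp (fun x : E => ‖x - (β / (β + η)) • y‖ ^ 2) 2 (post (smooth ν β) η y) := by
    rw [memLp_two_iff_integrable_sq (by fun_prop)]
    grind
  have h4 := sq_integral_le (hm.integrable one_le_two) hm.integrable_sq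
  rw [probReal_univ, one_mul] at h4
  simp only [← h3] at h4
  have h5 : (∫ x, ‖x - (β / (β + η)) • y‖ ^ 2 ∂(post (smooth ν β) η y)) ^ 2 ≤
      (√(fourthConst E R β) * η) ^ 2 := by
    rw [mul_pow, sq_sqrt fourthConst_nonneg]
    exact h4.trans h2
  exact abs_le_of_sq_le_sq' h5 (by positivity) |>.2

lemma norm_postGrad_sq_le (hβ : 0 < β) (hη : 0 < η) (hη1 : η ≤ 1) (hν : SuppIn ν R) {f : E → ℝ} (hf
    : BddCont f) (y : E) : ‖postGrad (smooth ν β) η f y‖ ^ 2 ≤ η⁻¹ * √(fourthConst E R β) * avg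
    (smooth ν β) η (fun x => f x ^ 2) y := by
  obtain ⟨C, hC⟩ := hf.bdd
  have h1 := norm_postGrad_le hη hf.cont.aestronglyMeasurable hC y _
    (integral_norm_sq_post_le hβ hη hη1 hν y)
  refine h1.trans_eq ?_
  unfold avg
  field_simp

lemma bddCont_postGrad (hβ : 0 < β) (hη : 0 < η) (hη1 : η ≤ 1) (hν : SuppIn ν R) {f : E → ℝ} (hf :
    BddCont f) : BddCont (postGrad (smooth ν β) η f) := by
  obtain ⟨C, hC⟩ := hf.bdd
  have hfc := hf.cont
  constructor
  · have hS1 : SubExp (smooth ν β) (fun x : E => η⁻¹ • innerSL ℝ x) (fun x => f x • x) := by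
      refine subExp_of_le_pow hη (by fun_prop) C 1 (.of_forall fun x => ?_)
      rw [norm_smul, pow_one]
      have := (norm_nonneg _).trans (hC x)
      bound
    have hS2 : SubExp (smooth ν β) (fun x : E => η⁻¹ • innerSL ℝ x) (fun x => x) := by
      refine subExp_of_le_pow hη (by fun_prop) 1 1 (.of_forall fun x => ?_)
      linarith
    have c1 := continuous_iff_continuousAt.2 fun y => (hasFDerivAt_post hη hS1 y).continuousAt
    have c2 := continuous_iff_continuousAt.2 fun y => (hasFDerivAt_post hη hS2 y).continuousAt
    have c3 := (hf.avg (ρ := smooth ν β) hη).cont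
    unfold postGrad
    exact (c1.sub (c3.smul c2)).const_smul _
  · obtain ⟨C2, hC2⟩ := (hf.pow.avg (ρ := smooth ν β) hη).bdd
    refine ⟨1 + η⁻¹ * √(fourthConst E R β) * C2, fun y => ?_⟩
    have h1 := norm_postGrad_sq_le hβ hη hη1 hν hf y
    have h2 : η⁻¹ * √(fourthConst E R β) * avg (smooth ν β) η (fun x => f x ^ 2) y ≤
      η⁻¹ * √(fourthConst E R β) * C2 := by
      gcongr
      exact (le_abs_self _).trans (hC2 y)
    nlinarith

lemma integral_norm_postGrad_sq_le (hβ : 0 < β) (hη : 0 < η) (hη1 : η ≤ 1) (hν : SuppIn ν R) {f : E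
    → ℝ} (hf : BddCont f) : ∫ q, ‖postGrad (smooth ν β) η f q.2‖ ^ 2 ∂(chan (smooth ν β) η) ≤ η⁻¹ *
    √(fourthConst E R β) * ∫ q, f q.1 ^ 2 ∂(chan (smooth ν β) η) := by
  rw [← integral_avg hη hf.pow, ← integral_const_mul]
  exact integral_mono ((bddCont_postGrad hβ hη hη1 hν hf).comp continuous_snd).norm.pow.integrable
    (imul _ ((hf.pow.avg hη).comp continuous_snd).integrable)
    fun q => norm_postGrad_sq_le hβ hη hη1 hν hf q.2

lemma postGrad_sub_mul {ρ : Measure E} [IsProbabilityMeasure ρ] (hη : 0 < η) {f g : E → ℝ}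
    (hf : BddCont f) (hg : BddCont g) (c : ℝ) (y : E) :
    postGrad ρ η (fun x => f x - c * g x) y = postGrad ρ η f y - c • postGrad ρ η g y := by
  obtain ⟨C, hC⟩ := hf.bdd
  obtain ⟨C', hC'⟩ := hg.bdd
  have hp := isProbabilityMeasure_post (ρ := ρ) hη y
  have i1 := integrable_post_smul_id hη hf.cont.aestronglyMeasurable hC (ρ := ρ) y
  have i2 := integrable_post_smul_id hη hg.cont.aestronglyMeasurable hC' (ρ := ρ) y
  have e1 : ∫ x, (f x - c * g x) • x ∂post ρ η y =
      ∫ x, f x • x ∂post ρ η y - c • ∫ x, g x • x ∂(post ρ η y) := by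
    simp only [sub_smul, mul_smul]
    rw [integral_sub i1 (ismul c i2), integral_smul]
  have e2 : ∫ x, (f x - c * g x) ∂post ρ η y = ∫ x, f x ∂post ρ η y - c * ∫ x, g x ∂(post ρ η y) :=
    by rw [integral_sub hf.integrable (imul c hg.integrable), integral_const_mul]
  unfold postGrad
  rw [e1, e2]
  module

lemma inner_integral_postGrad (hβ : 0 < β) (hη : 0 < η) (hν : SuppIn ν R) {f : E → ℝ}
    (hf : BddCont f) : ∫ q, postGrad (smooth ν β) η f q.2 ∂(chan (smooth ν β) η) = η⁻¹ • ∫ q, (f q.1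
    - heat η (avg (smooth ν β) η f) q.1) • q.1 ∂(chan (smooth ν β) η) := by
  have hX : Integrable (fun q : E × E => q.1) (chan (smooth ν β) η) :=
    (memLp_chan_fst (memLp_smooth_id hβ hν)).integrable one_le_two
  have hg := hf.avg (ρ := smooth ν β) hη
  have hfx : ∀ {T : E × E → ℝ}, BddCont T →
      Integrable (fun q : E × E => T q • q.1) (chan (smooth ν β) η) := by
    rintro T hT
    obtain ⟨C, hC⟩ := hT.bdd
    exact hX.bdd_smul C hT.cont.aestronglyMeasurable (.of_forall hC)
  obtain ⟨j1, k1⟩ := chan_bayes hη (hfx (hf.comp continuous_fst))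
  obtain ⟨j2, k2⟩ := chan_bayes hη (hfx (hg.comp continuous_snd))
  have j3 := hfx ((hg.heat (η := η)).comp continuous_fst)
  have k3 : ∫ q, heat η (avg (smooth ν β) η f) q.1 • q.1 ∂(chan (smooth ν β) η) =
      ∫ q, avg (smooth ν β) η f q.2 • q.1 ∂(chan (smooth ν β) η) := by
    rw [integral_chan j3, integral_chan (hfx (hg.comp continuous_snd))]
    refine integral_congr_ae (.of_forall fun x => ?_)
    change ∫ u, heat η (avg (smooth ν β) η f) x • x ∂stdGaussian E =
      ∫ u, avg (smooth ν β) η f (x + √η • u) • x ∂stdGaussian E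
    rw [integral_const, probReal_univ, one_smul, integral_smul_const]
    rfl
  have e : ∀ q : E × E, (f q.1 - heat η (avg (smooth ν β) η f) q.1) • q.1 =
      f q.1 • q.1 - heat η (avg (smooth ν β) η f) q.1 • q.1 := fun q => sub_smul _ _ _
  simp only [e]
  rw [integral_sub (hfx (hf.comp continuous_fst)) j3, k1, k3, k2, ← integral_sub j1 j2,
    ← integral_smul]
  refine integral_congr_ae (.of_forall fun q => ?_)
  change postGrad (smooth ν β) η f q.2 = η⁻¹ • (∫ x, f x • x ∂(post (smooth ν β) η q.2) -
    ∫ x, avg (smooth ν β) η f q.2 • x ∂(post (smooth ν β) η q.2))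
  rw [integral_smul]
  rfl

lemma norm_integral_postGrad_sq_le (hβ : 0 < β) (hη : 0 < η) (hν : SuppIn ν R) {f : E
    → ℝ} (hf : BddCont f) {l : ℝ} (hl : 0 ≤ l) (hcov : ∀ e : E, ∫ x, ⟪e, x⟫ ^ 2 ∂smooth ν β - (∫ x,
    ⟪e, x⟫ ∂smooth ν β) ^ 2 ≤ l * ‖e‖ ^ 2) : ‖∫ q, postGrad (smooth ν β) η f q.2 ∂(chan (smooth ν β)
    η)‖ ^ 2 ≤ η⁻¹ ^ 2 * l * ∫ q, (f q.1 - heat η (avg (smooth ν β) η f) q.1) ^ 2 ∂(chan (smooth ν β)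
    η) := by
  have hg := hf.avg (ρ := smooth ν β) hη
  obtain ⟨m, hm⟩ : ∃ m, m = ∫ q, postGrad (smooth ν β) η f q.2 ∂(chan (smooth ν β) η) := ⟨_, rfl⟩
  obtain ⟨h, hh⟩ : ∃ h : E → ℝ, h = fun x => f x - heat η (avg (smooth ν β) η f) x := ⟨_, rfl⟩
  have hhb : BddCont h := by rw [hh]; exact hf.sub hg.heat
  have hX := memLp_smooth_id (ν := ν) hβ hν
  have hXm : MemLp (fun x : E => ⟪m, x⟫) 2 (smooth ν β) := hX.const_inner m
  have h0 : ∫ x, h x ∂smooth ν β = 0 := by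
    rw [hh, integral_sub hf.integrable hg.heat.integrable, ← integral_chan_fst (η := η) hg.heat,
      integral_heat hg, integral_avg hη hf, integral_chan_fst hf, sub_self]
  have hint : Integrable (fun q : E × E => h q.1 • q.1) (chan (smooth ν β) η) := by
    obtain ⟨C, hC⟩ := hhb.bdd
    exact ((memLp_chan_fst hX).integrable one_le_two).bdd_smul C
      (hhb.comp continuous_fst).cont.aestronglyMeasurable (.of_forall fun q => hC _)
  have e1 : ‖m‖ ^ 2 = η⁻¹ * ∫ x, h x * ⟪m, x⟫ ∂(smooth ν β) := by
    have h1 := inner_integral_postGrad hβ hη hν hf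
    rw [← hm] at h1
    rw [← real_inner_self_eq_norm_sq]
    nth_rewrite 2 [h1]
    rw [inner_smul_right]
    congr 1
    have h2 : ∀ q : E × E, (f q.1 - heat η (avg (smooth ν β) η f) q.1) • q.1 = h q.1 • q.1 :=
      fun q => by rw [hh]
    simp only [h2]
    rw [← integral_inner (𝕜 := ℝ) hint m]
    have h3 : Integrable (fun q : E × E => ⟪m, h q.1 • q.1⟫) (chan (smooth ν β) η) :=
      hint.const_inner m
    rw [integral_chan h3]
    refine integral_congr_ae (.of_forall fun x => ?_)
    change ∫ u, ⟪m, h x • x⟫ ∂stdGaussian E = h x * ⟪m, x⟫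
    rw [integral_const, probReal_univ, one_smul, inner_smul_right]
  obtain ⟨c, hc⟩ : ∃ c, c = ∫ x, ⟪m, x⟫ ∂(smooth ν β) := ⟨_, rfl⟩
  have e2 : ∫ x, h x * ⟪m, x⟫ ∂smooth ν β = ∫ x, h x * (⟪m, x⟫ - c) ∂(smooth ν β) := by
    have i1 : Integrable (fun x => h x * ⟪m, x⟫) (smooth ν β) := hhb.memLp.integrable_mul hXm
    simp only [mul_sub]
    rw [integral_sub i1 (hhb.integrable.mul_const c), integral_mul_const, h0]
    ring
  have e3 := sq_integral_mul_le (hhb.memLp (μ := smooth ν β)) (hXm.sub (memLp_const c))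
  have e4 := integral_sub_const_sq hXm
  rw [← hc] at e4
  have e5 := hcov m
  rw [← hc, ← e4] at e5
  have e6 : ∫ q, (f q.1 - heat η (avg (smooth ν β) η f) q.1) ^ 2 ∂(chan (smooth ν β) η) = ∫ x, h x ^
    2 ∂(smooth ν β) := by rw [← integral_chan_fst (η := η) hhb.pow, hh]
  rw [← hm, e6]
  obtain ⟨H, hH⟩ : ∃ H, H = ∫ x, h x ^ 2 ∂(smooth ν β) := ⟨_, rfl⟩
  have hH0 : 0 ≤ H := by rw [hH]; exact integral_nonneg fun x => sq_nonneg _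
  rw [← hH]
  have e7 : (∫ x, h x * (⟪m, x⟫ - c) ∂smooth ν β) ^ 2 ≤ H * (l * ‖m‖ ^ 2) := by
    rw [hH]
    exact e3.trans (mul_le_mul_of_nonneg_left e5 (by rw [← hH]; exact hH0))
  have e8 : (‖m‖ ^ 2) * (‖m‖ ^ 2) ≤ (η⁻¹ ^ 2 * l * H) * ‖m‖ ^ 2 := by
    calc (‖m‖ ^ 2) * (‖m‖ ^ 2) = η⁻¹ ^ 2 * (∫ x, h x * (⟪m, x⟫ - c) ∂smooth ν β) ^ 2 := by
          rw [e1, e2]; ring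
      _ ≤ η⁻¹ ^ 2 * (H * (l * ‖m‖ ^ 2)) := by gcongr
      _ = _ := by ring
  rcases (sq_nonneg ‖m‖).eq_or_lt with h' | h'
  · rw [← h']; positivity
  · exact le_of_mul_le_mul_right e8 h'

end NearExtremal

section ChannelGap

variable {ρ ν : Measure E} [IsProbabilityMeasure ρ] [IsProbabilityMeasure ν] {η β R κ : ℝ}

lemma BddCont.sqrt {α : Type*} [TopologicalSpace α] {f : α → ℝ} (hf : BddCont f) :
    BddCont fun x => √(f x) := by
  obtain ⟨C, hC⟩ := hf.bdd
  refine ⟨hf.cont.sqrt, √C, fun x => ?_⟩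
  rw [norm_of_nonneg (sqrt_nonneg _)]
  exact sqrt_le_sqrt ((le_abs_self _).trans (hC x))

lemma isCorrBound_one (hη : 0 < η) : IsCorrBound ρ η 1 := fun f hf _ => by
  rw [one_mul]; exact integral_avg_sq_le hη hf

lemma near_extremal (hη : 0 < η) (hκ : IsCorrBound ρ η κ) (hκ0 : 0 ≤ κ) (hκ1 : κ ≤ 1) {ε : ℝ} {f : E
    → ℝ} (hf : BddCont f) (h0 : ∫ q, f q.1 ∂chan ρ η = 0) (h1 : ∫ q, f q.1 ^ 2 ∂chan ρ η ≤ 1) (hε :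
    κ - ε ≤ ∫ q, avg ρ η f q.2 ^ 2 ∂chan ρ η) : ∫ q, (heat η (avg ρ η f) q.1 - κ * f q.1) ^ 2 ∂chan
    ρ η ≤ κ * ε ∧ ∫ q, (f q.1 - heat η (avg ρ η f) q.1) ^ 2 ∂chan ρ η ≤ (1 - κ) ^ 2 + (2 - κ) * ε ∧
    (1 - κ) * ∫ q, avg ρ η f q.2 ^ 2 ∂chan ρ η ≤ ∫ q, (heat η (avg ρ η f) q.1 - avg ρ η f q.2) ^ 2
    ∂(chan ρ η) ∧ (∫ q, avg ρ η f q.2 ^ 2 ∂chan ρ η) ^ 2 ≤ ∫ q, heat η (avg ρ η f) q.1 ^ 2 ∂(chan ρ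
    η) := by
  have hg := hf.avg (ρ := ρ) hη
  have hF := hg.heat (η := η)
  have c1 : Continuous (Prod.fst : E × E → E) := continuous_fst
  have hg0 : ∫ q, avg ρ η f q.2 ∂chan ρ η = 0 := by rw [integral_avg hη hf, h0]
  obtain ⟨N, hN⟩ : ∃ N, N = ∫ q, avg ρ η f q.2 ^ 2 ∂(chan ρ η) := ⟨_, rfl⟩
  obtain ⟨M, hM⟩ : ∃ M, M = ∫ q, heat η (avg ρ η f) q.1 ^ 2 ∂(chan ρ η) := ⟨_, rfl⟩
  obtain ⟨L, hL⟩ : ∃ L, L = ∫ q, f q.1 ^ 2 ∂(chan ρ η) := ⟨_, rfl⟩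
  have hM0 : 0 ≤ M := by rw [hM]; exact integral_nonneg fun q => sq_nonneg _
  have e1 : ∫ q, f q.1 * heat η (avg ρ η f) q.1 ∂chan ρ η = N := by
    rw [integral_mul_heat hf hg, ← integral_avg_mul hη hf hg, hN]
    simp only [sq]
  have e2 : M ≤ κ * N := by rw [hM, hN]; exact hκ.heat_sq_le hη hκ0 hg hg0
  have i1 : Integrable (fun q : E × E => f q.1 ^ 2) (chan ρ η) := (hf.comp c1).pow.integrable
  have i2 : Integrable (fun q : E × E => heat η (avg ρ η f) q.1 ^ 2) (chan ρ η) :=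
    (hF.comp c1).pow.integrable
  have i3 : Integrable (fun q : E × E => f q.1 * heat η (avg ρ η f) q.1) (chan ρ η) :=
    ((hf.comp c1).mul (hF.comp c1)).integrable
  have e4 : ∀ c d : ℝ, ∫ q, (c * heat η (avg ρ η f) q.1 + d * f q.1) ^ 2 ∂chan ρ η =
      c ^ 2 * M + 2 * c * d * N + d ^ 2 * L := by
    intro c d
    have e : ∀ q : E × E, (c * heat η (avg ρ η f) q.1 + d * f q.1) ^ 2 =
        (c ^ 2 * heat η (avg ρ η f) q.1 ^ 2 +
        2 * c * d * (f q.1 * heat η (avg ρ η f) q.1)) + d ^ 2 * f q.1 ^ 2 := fun q => by ring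
    rw [integral_congr_ae (.of_forall e), integral_add (iadd (imul _ i2) (imul _ i3)) (imul _ i1),
      integral_add (imul _ i2) (imul _ i3), integral_const_mul, integral_const_mul,
      integral_const_mul, e1, hM, hL]
  rw [← hN, ← hM]
  refine ⟨?_, ?_, ?_, ?_⟩
  · have e := e4 1 (-κ)
    have e' : ∀ q : E × E, (heat η (avg ρ η f) q.1 - κ * f q.1) ^ 2 =
        (1 * heat η (avg ρ η f) q.1 + -κ * f q.1) ^ 2 := fun q => by ring
    rw [integral_congr_ae (.of_forall e'), e]
    nlinarith [mul_le_mul_of_nonneg_left h1 (sq_nonneg κ)]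
  · have e := e4 (-1) 1
    have e' : ∀ q : E × E, (f q.1 - heat η (avg ρ η f) q.1) ^ 2 =
        (-1 * heat η (avg ρ η f) q.1 + 1 * f q.1) ^ 2 := fun q => by ring
    rw [integral_congr_ae (.of_forall e'), e]
    nlinarith
  · rw [integral_sub_avg_sq hη hF hg]
    have e5 : ∫ q, avg ρ η (heat η (avg ρ η f)) q.2 * avg ρ η f q.2 ∂chan ρ η = M := by
      rw [integral_avg_mul hη hF hg, ← integral_mul_heat hF hg, hM]
      simp only [sq]
    linarith
  · have e6 := sq_integral_mul_le ((hf.comp c1).memLp (μ := chan ρ η))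
      ((hF.comp c1).memLp (μ := chan ρ η))
    rw [e1, ← hM, ← hL] at e6
    nlinarith

lemma integral_post_var_le (hη : 0 < η) {f g : E → ℝ} (hf : BddCont f) (hg : BddCont g) : ∫ q, (avg
    ρ η (fun x => f x ^ 2) q.2 - avg ρ η f q.2 ^ 2) ∂chan ρ η ≤ ∫ q, (f q.1 - g q.2) ^ 2 ∂(chan ρ η)
    := by
  have c2 : Continuous (Prod.snd : E × E → E) := continuous_snd
  have hF := hf.avg (ρ := ρ) hη
  rw [integral_sub_avg_sq hη hf hg, integral_sub ((hf.pow.avg hη).comp c2).integrable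
    (hF.comp c2).pow.integrable, integral_avg hη hf.pow]
  have h : 0 ≤ ∫ q, (avg ρ η f q.2 - g q.2) ^ 2 ∂(chan ρ η) := integral_nonneg fun q => sq_nonneg _
  have e : ∀ q : E × E, (avg ρ η f q.2 - g q.2) ^ 2 =
      (avg ρ η f q.2 ^ 2 - 2 * (avg ρ η f q.2 * g q.2)) + g q.2 ^ 2 := fun q => by ring
  have i1 : Integrable (fun q : E × E => avg ρ η f q.2 ^ 2) (chan ρ η) :=
    (hF.comp c2).pow.integrable
  have i2 : Integrable (fun q : E × E => 2 * (avg ρ η f q.2 * g q.2)) (chan ρ η) :=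
    imul _ ((hF.comp c2).mul (hg.comp c2)).integrable
  rw [integral_congr_ae (.of_forall e), integral_add (isub i1 i2) (hg.comp c2).pow.integrable,
    integral_sub i1 i2, integral_const_mul] at h
  linarith

/-- The error constant in the commutation estimate. -/
def commConst (E : Type*) [NormedAddCommGroup E] [InnerProductSpace ℝ E] [FiniteDimensional ℝ E]
  [MeasurableSpace E] [BorelSpace E] (R β : ℝ) : ℝ := β⁻¹ * (6 * (β⁻¹ ^ 2 * R ^ 3) * √(fourthConst E
  R β))

lemma sqrt_integral_postGrad_le (hβ : 0 < β) (hη : 0 < η) (hη1 : η ≤ 1) (hν : SuppIn ν R) (hR : 0 ≤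
    R) {s : ℝ} (hs : 0 ≤ s) (hvar : ∀ y v : E, ∫ b, ⟪v, b⟫ ^ 2 ∂post ν β y - (∫ b, ⟪v, b⟫ ∂post ν β
    y) ^ 2 ≤ ‖v‖ ^ 2 / (s + β⁻¹)) {f h : E → ℝ} {g : E → E} (hf : ∀ x, HasFDerivAt f (innerSL ℝ (g
    x)) x) (hfb : BddCont f) (hg : BddCont g) (hh : BddCont h) : (1 + η * (s / (1 + s * β))) * √(∫
    q, ‖postGrad (smooth ν β) η f q.2‖ ^ 2 ∂(chan (smooth ν β) η)) ≤ √(∫ q, ‖avg (smooth ν β) η g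
    q.2‖ ^ 2 ∂(chan (smooth ν β) η)) + commConst E R β * η * √(∫ q, (f q.1 - h q.2) ^ 2 ∂(chan
    (smooth ν β) η)) := by
  have c2 : Continuous (Prod.snd : E × E → E) := continuous_snd
  obtain ⟨C, hC⟩ := hfb.bdd
  obtain ⟨C', hC'⟩ := hg.bdd
  obtain ⟨a, ha⟩ : ∃ a, a = 1 + η * (s / (1 + s * β)) := ⟨_, rfl⟩
  obtain ⟨c, hc⟩ : ∃ c, c = commConst E R β * η := ⟨_, rfl⟩
  obtain ⟨V, hV⟩ : ∃ V : E → ℝ, V = fun y => avg (smooth ν β) η (fun x => f x ^ 2) y -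
    avg (smooth ν β) η f y ^ 2 := ⟨_, rfl⟩
  have hVb : BddCont V := by rw [hV]; exact (hfb.pow.avg hη).sub (hfb.avg hη).pow
  have hV' : ∀ y, ∫ x, (f x - ∫ z, f z ∂(post (smooth ν β) η y)) ^ 2
      ∂(post (smooth ν β) η y) = V y := fun y => by
    have := isProbabilityMeasure_post (ρ := smooth ν β) hη y
    rw [integral_sub_const_sq hfb.memLp, hV]
    rfl
  have hV0 : ∀ y, 0 ≤ V y := fun y => by
    rw [← hV']; exact integral_nonneg fun x => sq_nonneg _
  have ha0 : 0 ≤ a := by rw [ha]; positivity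
  have hc0 : 0 ≤ c := by rw [hc]; unfold commConst; positivity
  have hp : ∀ y, a * ‖postGrad (smooth ν β) η f y‖ ≤ ‖avg (smooth ν β) η g y‖ + c * √(V y) := by
    intro y
    have h4 : ∫ x, ‖x - (β / (β + η)) • y‖ ^ 4 ∂(post (smooth ν β) η y) ≤
        (√(fourthConst E R β) * η) ^ 2 := by
      rw [mul_pow, sq_sqrt fourthConst_nonneg]
      exact (integral_norm_pow_four_post hβ hη hη1 hν y).2
    have h5 := norm_postGrad_commute_le hβ hη hν hs hvar hf hg.cont hC hC' y h4 (by positivity)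
    rw [hV', ← ha] at h5
    refine h5.trans (le_of_eq ?_)
    rw [hc]
    unfold commConst avg
    ring
  have b1 : BddCont fun q : E × E => ‖avg (smooth ν β) η g q.2‖ := ((hg.avg hη).comp c2).norm
  have b2 := (BddCont.const c).mul (hVb.sqrt.comp c2)
  have t1 := sqrt_integral_norm_sq_mono (μ := chan (smooth ν β) η) (f := fun q : E × E => a •
    postGrad (smooth ν β) η f q.2) (b1.add b2).memLp (.of_forall fun q => by
      rw [norm_smul, norm_of_nonneg ha0]
      exact (hp q.2).trans (le_abs_self _))
  have t2 := sqrt_integral_norm_add_sq_le (b1.memLp (μ := chan (smooth ν β) η)) b2.memLp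
  have e1 : ∀ q : E × E, ‖a • postGrad (smooth ν β) η f q.2‖ ^ 2 =
      a ^ 2 * ‖postGrad (smooth ν β) η f q.2‖ ^ 2 := fun q => by
    rw [norm_smul, norm_of_nonneg ha0]; ring
  have e2 : ∀ q : E × E, ‖c * √(V q.2)‖ ^ 2 = c ^ 2 * V q.2 := fun q => by
    rw [norm_eq_abs, sq_abs, mul_pow, sq_sqrt (hV0 _)]
  have e3 : ∀ q : E × E, ‖‖avg (smooth ν β) η g q.2‖‖ ^ 2 = ‖avg (smooth ν β) η g q.2‖ ^ 2 :=
    fun q => by rw [norm_norm]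
  rw [integral_congr_ae (.of_forall e1), integral_const_mul,
    sqrt_mul (sq_nonneg a), sqrt_sq ha0] at t1
  rw [integral_congr_ae (.of_forall e2), integral_congr_ae (.of_forall e3),
    integral_const_mul, sqrt_mul (sq_nonneg c), sqrt_sq hc0] at t2
  rw [← ha, ← hc]
  refine (t1.trans t2).trans (add_le_add le_rfl (mul_le_mul_of_nonneg_left (sqrt_le_sqrt ?_) hc0))
  rw [hV]
  exact integral_post_var_le hη hfb hh

lemma gap_arith {a κ D D1 Av m t ε l c A c1 P : ℝ} (ha : 0 ≤ a) (hA : 0 < A) (hAD : A ≤ D) (hl : 0 ≤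
    l) (ht : 0 ≤ t) (hε : 0 < ε) (hκε : 0 < κ - ε) (h1 : a * √D1 ≤ √Av + c * √(P * D)) (h2 : Av ≤ κ
    ^ 2 * D + 2 * t * m) (h3 : κ * √D ≤ √D1 + √(c1 * ε)) (h4 : m ≤ l * (t ^ 2 + 2 * ε)) (h5 : t * (κ
    - ε) ≤ P * D) (hP : 0 ≤ P) (hc1 : 0 ≤ c1) : a * (κ - √(c1 * ε / A)) ≤ √(κ ^ 2 + 2 * t * (l * (t
    * (P / (κ - ε)) + 2 * ε / A))) + c * √P := by
  have hD := hA.trans_le hAD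
  have hsD := sqrt_pos.2 hD
  have h6 : t ^ 2 ≤ t * (P / (κ - ε)) * D := by
    have : t ≤ P / (κ - ε) * D := by
      rw [div_mul_eq_mul_div, le_div_iff₀ hκε]; exact h5
    nlinarith
  have h7 : 2 * ε ≤ 2 * ε / A * D := by
    rw [div_mul_eq_mul_div, le_div_iff₀ hA]
    simp_all
  have h8 : Av ≤ D * (κ ^ 2 + 2 * t * (l * (t * (P / (κ - ε)) + 2 * ε / A))) := by
    calc Av ≤ κ ^ 2 * D + 2 * t * (l * (t ^ 2 + 2 * ε)) := by
          refine h2.trans (add_le_add le_rfl (mul_le_mul_of_nonneg_left h4 (by positivity)))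
      _ ≤ κ ^ 2 * D + 2 * t * (l * (t * (P / (κ - ε)) * D + 2 * ε / A * D)) := by gcongr
      _ = _ := by ring
  have h9 : √Av ≤ √D * √(κ ^ 2 + 2 * t * (l * (t * (P / (κ - ε)) + 2 * ε / A))) := by
    rw [← sqrt_mul hD.le]; exact sqrt_le_sqrt h8
  have h10 : √(c1 * ε) ≤ √(c1 * ε / A) * √D := by
    rw [← sqrt_mul (by positivity)]
    refine sqrt_le_sqrt ?_
    rw [div_mul_eq_mul_div, le_div_iff₀ hA]
    exact mul_le_mul_of_nonneg_left hAD (by positivity)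
  have h11 : √(P * D) = √P * √D := sqrt_mul hP _
  rw [h11] at h1
  have h12 : a * ((κ - √(c1 * ε / A)) * √D) ≤ a * √D1 := mul_le_mul_of_nonneg_left (by linarith) ha
  refine le_of_mul_le_mul_right ?_ hsD
  linarith

lemma chan_gap_eps (hβ : 0 < β) (hη : 0 < η) (hη1 : η ≤ 1) (hν : SuppIn ν R) (hR : 0 ≤ R) {s : ℝ}
    (hs : 0 ≤ s) (hvar : ∀ y v : E, ∫ b, ⟪v, b⟫ ^ 2 ∂post ν β y - (∫ b, ⟪v, b⟫ ∂post ν β y) ^ 2 ≤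
    ‖v‖ ^ 2 / (s + β⁻¹)) {l : ℝ} (hl : 0 ≤ l) (hcov : ∀ e : E, ∫ x, ⟪e, x⟫ ^ 2 ∂smooth ν β - (∫ x,
    ⟪e, x⟫ ∂smooth ν β) ^ 2 ≤ l * ‖e‖ ^ 2) (hκ : IsCorrBound (smooth ν β) η κ) (hκ0 : 1 / 2 ≤ κ)
    (hκ1 : κ ≤ 1) {ε : ℝ} (hε : 0 < ε) (hε' : ε ≤ 1 / 4) {f : E → ℝ} (hf : BddCont f) (h0 : ∫ q, f
    q.1 ∂(chan (smooth ν β) η) = 0) (h1 : ∫ q, f q.1 ^ 2 ∂(chan (smooth ν β) η) ≤ 1) (hN : κ - ε ≤ ∫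
    q, avg (smooth ν β) η f q.2 ^ 2 ∂(chan (smooth ν β) η)) : (1 + η * (s / (1 + s * β))) * (κ -
    √(η⁻¹ * √(fourthConst E R β) * ε / (1 / (16 * ((1 + exp ((2 * R) ^ 2 / β)) * (Real.pi ^ 2 / 8 *
    β)))))) ≤ √(κ ^ 2 + 2 * (1 - κ) * (η⁻¹ ^ 2 * l * ((1 - κ) * (Real.pi ^ 2 / 8 * η / (κ - ε)) + 2
    * ε / (1 / (16 * ((1 + exp ((2 * R) ^ 2 / β)) * (Real.pi ^ 2 / 8 * β))))))) + commConst E R β *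
    η * √(Real.pi ^ 2 / 8 * η) := by
  have c2 : Continuous (Prod.snd : E × E → E) := continuous_snd
  have hk0 : 0 ≤ κ := by linarith
  have hk1 := mul_le_mul_of_nonneg_right hκ1 hε.le
  have hk2 : 0 ≤ κ * ε := by positivity
  have hk3 : (1 - κ) ^ 2 + (2 - κ) * ε ≤ (1 - κ) ^ 2 + 2 * ε := by linarith
  obtain ⟨n1, n2, n3, n4⟩ := near_extremal hη hκ hk0 hκ1 hf h0 h1 hN
  obtain ⟨C, hC⟩ := hf.bdd
  have hg := hf.avg (ρ := smooth ν β) hη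
  have hF := hg.heat (η := η)
  have hG := bddCont_postGrad hβ hη hη1 hν hf
  have hgd : ∀ y, HasFDerivAt (avg (smooth ν β) η f) (innerSL ℝ (postGrad (smooth ν β) η f y)) y :=
    hasFDerivAt_post_real hη hf.cont.aestronglyMeasurable hC
  have hFd := hasFDerivAt_heat (η := η) hg hG hgd
  have hGh := hG.heat (η := η)
  have hF0 : ∫ x, heat η (avg (smooth ν β) η f) x ∂smooth ν β = 0 := by
    rw [← integral_chan_fst (η := η) hF, integral_heat hg, integral_avg hη hf, h0]
  have a1 := smooth_poincare hβ hν hF hGh hFd hF0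
  rw [← integral_chan_fst (η := η) hF.pow, ← integral_chan_fst (η := η) hGh.norm.pow] at a1
  have a2 := (isCorrBound_one (ρ := smooth ν β) hη).norm_heat_sq_le hη zero_le_one hG
  have a3 := integral_chan_sub_heat_sq_le (ρ := smooth ν β) hη hg hG hgd
  have a4 := sqrt_integral_postGrad_le hβ hη hη1 hν hR hs hvar hFd hF hGh hg
  have a5 := hκ.norm_avg_sq_le hη hGh
  have a6 := hκ.norm_heat_sq_le hη hk0 hG
  rw [integral_heat hG] at a5
  have a7 := norm_integral_postGrad_sq_le hβ hη hν hf hl hcov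
  obtain ⟨D, hD⟩ : ∃ D, D = ∫ q, ‖postGrad (smooth ν β) η f q.2‖ ^ 2
    ∂(chan (smooth ν β) η) := ⟨_, rfl⟩
  obtain ⟨m, hm⟩ : ∃ m, m = ‖∫ q, postGrad (smooth ν β) η f q.2 ∂(chan (smooth ν β) η)‖ ^ 2 :=
    ⟨_, rfl⟩
  obtain ⟨Hh, hH⟩ : ∃ Hh, Hh = ∫ q, ‖heat η (postGrad (smooth ν β) η f) q.1‖ ^ 2
    ∂(chan (smooth ν β) η) := ⟨_, rfl⟩
  rw [← hH] at a1 a2 a5 a6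
  rw [← hD] at a2 a3 a6
  rw [← hm] at a2 a5 a6 a7
  obtain ⟨C0, hC0⟩ : ∃ C0, C0 = (1 + exp ((2 * R) ^ 2 / β)) * (Real.pi ^ 2 / 8 * β) := ⟨_, rfl⟩
  have hC0p : 0 < C0 := by rw [hC0]; positivity
  rw [← hC0] at a1 ⊢
  have hη' : η⁻¹ ^ 2 * l ≥ 0 := by positivity
  have hAD : 1 / (16 * C0) ≤ D := by
    rw [div_le_iff₀ (by positivity)]
    have : (1 / 4 : ℝ) ^ 2 ≤ (∫ q, avg (smooth ν β) η f q.2 ^ 2 ∂(chan (smooth ν β) η)) ^ 2 :=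
      pow_le_pow_left₀ (by norm_num) (by linarith) 2
    have : C0 * Hh ≤ C0 * D := mul_le_mul_of_nonneg_left (by linarith) hC0p.le
    linarith
  refine gap_arith (D := D) (m := m) (D1 := ∫ q, ‖postGrad (smooth ν β) η (heat η (avg (smooth ν β)
    η f)) q.2‖ ^ 2 ∂(chan (smooth ν β) η)) (Av := ∫ q, ‖avg (smooth ν β) η (heat η (postGrad (smooth
    ν β) η f)) q.2‖ ^ 2 ∂(chan (smooth ν β) η)) (by positivity) (by positivity) hAD hη' (by
    linarith) hε (by linarith) ?_ ?_ ?_ ?_ ?_ (by positivity) (by positivity)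
  · refine a4.trans (add_le_add le_rfl (mul_le_mul_of_nonneg_left (sqrt_le_sqrt a3) ?_))
    unfold commConst
    positivity
  · have hm0 : 0 ≤ m := by rw [hm]; positivity
    have b1 := mul_le_mul_of_nonneg_left a6 hk0
    have b2 := mul_nonneg hm0 (sq_nonneg (1 - κ))
    linarith
  · have t := sqrt_integral_norm_add_sq_le (μ := chan (smooth ν β) η)
      (((bddCont_postGrad hβ hη hη1 hν hF).comp c2).memLp)
      (((bddCont_postGrad hβ hη hη1 hν ((BddCont.const κ).mul hf |>.sub hF)).comp c2).memLp)
    have e : ∀ q : E × E, ‖postGrad (smooth ν β) η (heat η (avg (smooth ν β) η f)) q.2 +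
        postGrad (smooth ν β) η (fun x => κ * f x - heat η (avg (smooth ν β) η f) x) q.2‖ ^ 2 =
        κ ^ 2 * ‖postGrad (smooth ν β) η f q.2‖ ^ 2 := by
      intro q
      have e1 := postGrad_sub_mul (ρ := smooth ν β) hη ((BddCont.const κ).mul hf) hF 1 q.2
      have e2 := postGrad_sub_mul (ρ := smooth ν β) hη (BddCont.const 0) hf (-κ) q.2
      have e3 : postGrad (smooth ν β) η (fun _ => (0 : ℝ)) q.2 = 0 := by
        unfold postGrad; simp
      have e4 : (fun x => (0 : ℝ) - -κ * f x) = fun x => κ * f x := by ext; ring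
      simp only [one_mul, one_smul] at e1
      rw [e3, e4] at e2
      rw [e1, e2, ← mul_pow]
      rw [show ∀ u v : E, u + (0 - -κ • v - u) = κ • v from fun u v => by module, norm_smul,
        norm_of_nonneg hk0]
    rw [integral_congr_ae (.of_forall e), integral_const_mul,
      sqrt_mul (sq_nonneg κ), sqrt_sq hk0, ← hD] at t
    refine t.trans (add_le_add le_rfl (sqrt_le_sqrt ?_))
    have t2 := integral_norm_postGrad_sq_le hβ hη hη1 hν ((BddCont.const κ).mul hf |>.sub hF)
    refine t2.trans (mul_le_mul_of_nonneg_left ?_ (by positivity))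
    have e5 : ∀ q : E × E, (κ * f q.1 - heat η (avg (smooth ν β) η f) q.1) ^ 2 =
      (heat η (avg (smooth ν β) η f) q.1 - κ * f q.1) ^ 2 := fun q => by ring
    rw [integral_congr_ae (.of_forall e5)]
    rw [one_mul] at hk1
    exact n1.trans hk1
  · exact a7.trans (mul_le_mul_of_nonneg_left (n2.trans hk3) hη')
  · refine (mul_le_mul_of_nonneg_left hN (by linarith)).trans (n3.trans a3)

end ChannelGap

section ChannelGapLimit

variable {ν : Measure E} [IsProbabilityMeasure ν] {η β R κ : ℝ}

lemma chan_gap (hβ : 0 < β) (hη : 0 < η) (hη1 : η ≤ 1) (hν : SuppIn ν R) (hR : 0 ≤ R) {s : ℝ} (hs :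
    0 ≤ s) (hvar : ∀ y v : E, ∫ b, ⟪v, b⟫ ^ 2 ∂post ν β y - (∫ b, ⟪v, b⟫ ∂post ν β y) ^ 2 ≤ ‖v‖ ^ 2
    / (s + β⁻¹)) {l : ℝ} (hl : 0 ≤ l) (hcov : ∀ e : E, ∫ x, ⟪e, x⟫ ^ 2 ∂smooth ν β - (∫ x, ⟪e, x⟫
    ∂smooth ν β) ^ 2 ≤ l * ‖e‖ ^ 2) (hκ : IsCorrBound (smooth ν β) η κ) (hκ0 : 1 / 2 ≤ κ) (hκ1 : κ ≤
    1) (hex : ∀ ε > 0, ∃ f : E → ℝ, BddCont f ∧ ∫ q, f q.1 ∂(chan (smooth ν β) η) = 0 ∧ ∫ q, f q.1 ^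
    2 ∂(chan (smooth ν β) η) ≤ 1 ∧ κ - ε ≤ ∫ q, avg (smooth ν β) η f q.2 ^ 2 ∂(chan (smooth ν β) η))
    : (1 + η * (s / (1 + s * β))) * κ ≤ √(κ ^ 2 + 2 * (1 - κ) * (η⁻¹ ^ 2 * l * ((1 - κ) * (Real.pi ^
    2 / 8 * η / κ)))) + commConst E R β * η * √(Real.pi ^ 2 / 8 * η) := by
  obtain ⟨A, hA⟩ : ∃ A, A = 1 / (16 * ((1 + exp ((2 * R) ^ 2 / β)) *
    (Real.pi ^ 2 / 8 * β))) := ⟨_, rfl⟩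
  obtain ⟨c, hc⟩ : ∃ c, c = η⁻¹ * √(fourthConst E R β) := ⟨_, rfl⟩
  obtain ⟨a, ha⟩ : ∃ a, a = 1 + η * (s / (1 + s * β)) := ⟨_, rfl⟩
  obtain ⟨P, hP⟩ : ∃ P, P = Real.pi ^ 2 / 8 * η := ⟨_, rfl⟩
  have hev : ∀ᶠ ε in 𝓝[>] (0 : ℝ), a * (κ - √(c * ε / A)) ≤ √(κ ^ 2 + 2 * (1 - κ) * (η⁻¹ ^ 2 * l *
      ((1 - κ) * (P / (κ - ε)) + 2 * ε / A))) + commConst E R β * η * √P := by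
    filter_upwards [Ioc_mem_nhdsGT (show (0 : ℝ) < 1 / 4 by norm_num)] with ε hε
    obtain ⟨f, hf, h0, h1, h2⟩ := hex ε hε.1
    have := chan_gap_eps hβ hη hη1 hν hR hs hvar hl hcov hκ hκ0 hκ1 hε.1 hε.2 hf h0 h1 h2
    rwa [← hA, ← hc, ← ha, ← hP] at this
  have hne : κ ≠ 0 := by linarith
  have l1 : Tendsto (fun ε : ℝ => a * (κ - √(c * ε / A))) (𝓝[>] 0) (𝓝 (a * κ)) := by
    have : Continuous fun ε : ℝ => a * (κ - √(c * ε / A)) := by fun_prop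
    have h := (this.tendsto 0).mono_left (nhdsWithin_le_nhds (s := Ioi 0))
    simpa using h
  have l2 : Tendsto (fun ε : ℝ => √(κ ^ 2 + 2 * (1 - κ) * (η⁻¹ ^ 2 * l * ((1 - κ) * (P / (κ - ε)) +
      2 * ε / A))) + commConst E R β * η * √P) (𝓝[>] 0) (𝓝 (√(κ ^ 2 + 2 * (1 - κ) * (η⁻¹ ^ 2 * l *
      ((1 - κ) * (P / κ)))) + commConst E R β * η * √P)) := by
    have h1 : ContinuousAt (fun ε : ℝ => P / (κ - ε)) 0 :=
      ContinuousAt.div (by fun_prop) (by fun_prop) (by simpa using hne)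
    have h2 : ContinuousAt (fun ε : ℝ => √(κ ^ 2 + 2 * (1 - κ) * (η⁻¹ ^ 2 * l * ((1 - κ) * (P / (κ -
      ε)) + 2 * ε / A))) + commConst E R β * η * √P) 0 := by fun_prop
    have h := h2.tendsto.mono_left (nhdsWithin_le_nhds (s := Ioi 0))
    simpa using h
  rw [← ha, ← hP]
  exact le_of_tendsto_of_tendsto l1 l2 hev

lemma gap_arith_final {η κ s l q c P : ℝ} (hη : 0 < η) (hκ : 1 / 2 ≤ κ) (hs : 0 < s)
    (hql : q ^ 2 * l = s) (hP : P = Real.pi ^ 2 / 8 * η) (hl : 0 ≤ l) (hκ1 : κ ≤ 1) (h : (1 + η * s)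
    * κ ≤ √(κ ^ 2 + 2 * (1 - κ) * (η⁻¹ ^ 2 * l * ((1 - κ) * (P / κ)))) + c * η * √P) (hsm : c * √P <
    s / 5) : η * q / 5 ≤ 1 - κ := by
  by_contra! hlt
  have hpi : Real.pi ^ 2 ≤ 10 := by nlinarith [pi_lt_d2, pi_pos]
  have h2 : 2 * (1 - κ) * (η⁻¹ ^ 2 * l * ((1 - κ) * (P / κ))) ≤ η * s / 5 := by
    have e : 2 * (1 - κ) * (η⁻¹ ^ 2 * l * ((1 - κ) * (P / κ))) = (1 - κ) ^ 2 * (Real.pi ^ 2 / 4 * l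
      / η / κ) := by grind
    rw [e]
    calc (1 - κ) ^ 2 * (Real.pi ^ 2 / 4 * l / η / κ)
        ≤ (η * q / 5) ^ 2 * (10 / 4 * l / η / (1 / 2)) := by gcongr
      _ = η * (q ^ 2 * l) / 5 := by field_simp; ring
      _ = _ := by rw [hql]
  have h3 : √(κ ^ 2 + 2 * (1 - κ) * (η⁻¹ ^ 2 * l * ((1 - κ) * (P / κ)))) ≤ κ + η * s / 5 := by
    refine sqrt_le_iff.2 ⟨by positivity, ?_⟩
    have : 0 < η * s := by positivity
    nlinarith
  have : 0 < η * s := by positivity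
  nlinarith

lemma exists_chan_gap (hβ : 0 < β) (hν : SuppIn ν R) (hR : 0 ≤ R) {s : ℝ} (hs : 0 < s) (hvar : ∀ y v
    : E, ∫ b, ⟪v, b⟫ ^ 2 ∂post ν β y - (∫ b, ⟪v, b⟫ ∂post ν β y) ^ 2 ≤ ‖v‖ ^ 2 / (s + β⁻¹)) {l : ℝ}
    (hl : 0 < l) (hcov : ∀ e : E, ∫ x, ⟪e, x⟫ ^ 2 ∂smooth ν β - (∫ x, ⟪e, x⟫ ∂smooth ν β) ^ 2 ≤ l *
    ‖e‖ ^ 2) : ∀ᶠ η in 𝓝[>] (0 : ℝ), ∀ f : E → ℝ, BddCont f → ∫ q, f q.1 ∂(chan (smooth ν β) η) = 0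
    → η * √(s / (1 + s * β) / l) / 5 * ∫ q, f q.1 ^ 2 ∂(chan (smooth ν β) η) ≤ ∫ q, f q.1 ^ 2 ∂(chan
    (smooth ν β) η) - ∫ q, avg (smooth ν β) η f q.2 ^ 2 ∂(chan (smooth ν β) η) := by
  obtain ⟨s', hs'⟩ : ∃ s', s' = s / (1 + s * β) := ⟨_, rfl⟩
  have hsp : 0 < s' := by rw [hs']; positivity
  obtain ⟨q, hq⟩ : ∃ q, q = √(s' / l) := ⟨_, rfl⟩
  have hq0 : 0 ≤ q := by simp_all
  have hql : q ^ 2 * l = s' := by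
    rw [hq, sq_sqrt (by positivity)]; field_simp
  have l1 : ∀ᶠ η in 𝓝[>] (0 : ℝ), commConst E R β * √(Real.pi ^ 2 / 8 * η) < s' / 5 := by
    have : Continuous fun η : ℝ => commConst E R β * √(Real.pi ^ 2 / 8 * η) := by fun_prop
    have h := (this.tendsto 0).mono_left (nhdsWithin_le_nhds (s := Ioi 0))
    simp only [mul_zero, sqrt_zero] at h
    exact h.eventually (gt_mem_nhds (by positivity))
  have l2 : ∀ᶠ η in 𝓝[>] (0 : ℝ), η * q / 5 < 1 / 2 := by
    have : Continuous fun η : ℝ => η * q / 5 := by fun_prop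
    have h := (this.tendsto 0).mono_left (nhdsWithin_le_nhds (s := Ioi 0))
    simp only [zero_mul, zero_div] at h
    exact h.eventually (gt_mem_nhds (by positivity))
  rw [← hs', ← hq]
  filter_upwards [l1, l2, Ioc_mem_nhdsGT (zero_lt_one' ℝ)] with η h1 h2 h3 f hf h0
  obtain ⟨κ, hκ0, hκ1, hκ, hex⟩ := exists_isCorrBound (ρ := smooth ν β) h3.1
  have hgap : η * q / 5 ≤ 1 - κ := by
    rcases lt_or_ge κ (1 / 2) with hk | hk
    · linarith
    · have := chan_gap hβ h3.1 h3.2 hν hR hs.le hvar hl.le hcov hκ hk hκ1 hex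
      rw [← hs'] at this
      exact gap_arith_final h3.1 hk hsp hql rfl hl.le hκ1 this h1
  have h4 := hκ f hf h0
  have h5 : 0 ≤ ∫ q, f q.1 ^ 2 ∂(chan (smooth ν β) η) := integral_nonneg fun _ => sq_nonneg _
  have h6 := mul_le_mul_of_nonneg_right hgap h5
  linarith

end ChannelGapLimit

section Quadratic

variable {ρ ν : Measure E} [IsProbabilityMeasure ρ] [IsProbabilityMeasure ν] {η β R : ℝ}

/-- Truncation to `[-N, N]`. -/
def clip (N t : ℝ) : ℝ := max (-N) (min N t)

lemma abs_clip_sub_le (N a b : ℝ) : |clip N a - clip N b| ≤ |a - b| := (abs_max_sub_max_le_max _ _ _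
  _).trans (by grind)

lemma clip_eq {N t : ℝ} (h : |t| ≤ N) : clip N t = t := by
  rw [abs_le] at h
  rw [clip, min_eq_right h.2, max_eq_right h.1]

lemma bddCont_clip (N : ℝ) (H : E →L[ℝ] E) : BddCont fun x : E => clip N ⟪H x, x⟫ := by
  refine ⟨by unfold clip; fun_prop, |N|, fun x => ?_⟩
  rw [norm_eq_abs, clip, abs_le]
  grind

lemma integrable_inner_sq_stdGaussian (v : E) :
    Integrable (fun u => ⟪v, u⟫ ^ 2) (stdGaussian E) := by
  refine ((integrable_norm_pow_stdGaussian (E := E) 2).const_mul (‖v‖ ^ 2)).mono' (by fun_prop)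
    (.of_forall fun u => ?_)
  rw [norm_pow, ← mul_pow]
  gcongr
  exact norm_inner_le_norm _ _

lemma integrable_quad_sq_stdGaussian (H : E →L[ℝ] E) :
    Integrable (fun u => ⟪H u, u⟫ ^ 2) (stdGaussian E) := by
  refine ((integrable_norm_pow_stdGaussian (E := E) 4).const_mul (‖H‖ ^ 2)).mono' (by fun_prop)
    (.of_forall fun u => ?_)
  rw [norm_pow]
  calc ‖⟪H u, u⟫‖ ^ 2 ≤ (‖H‖ * ‖u‖ * ‖u‖) ^ 2 := by
        gcongr
        exact (norm_inner_le_norm _ _).trans (by gcongr; exact H.le_opNorm u)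
    _ = _ := by ring

lemma integral_inner_sq_stdGaussian (v : E) : ∫ u, ⟪v, u⟫ ^ 2 ∂stdGaussian E = ‖v‖ ^ 2 := by
  have := integral_sq_stdGaussian (innerSL ℝ v)
  simp_all

lemma integral_clip_sub_sq_le (hη : 0 ≤ η) (N : ℝ) (H : E →L[ℝ] E) (hH : ∀ x y, ⟪H x, y⟫ = ⟪x, H y⟫)
    (hρ : MemLp (fun x : E => x) 2 ρ) : ∫ q, (clip N ⟪H q.1, q.1⟫ - clip N ⟪H q.2, q.2⟫) ^ 2 ∂chan ρ
    η ≤ 8 * η * ∫ x, ‖H x‖ ^ 2 ∂ρ + 2 * η ^ 2 * ∫ u, ⟪H u, u⟫ ^ 2 ∂(stdGaussian E) := by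
  have hb := bddCont_clip N H
  have c1 : Continuous (Prod.fst : E × E → E) := continuous_fst
  have c2 : Continuous (Prod.snd : E × E → E) := continuous_snd
  have hi : Integrable (fun q : E × E => (clip N ⟪H q.1, q.1⟫ - clip N ⟪H q.2, q.2⟫) ^ 2)
    (chan ρ η) := ((hb.comp c1).sub (hb.comp c2)).pow.integrable
  rw [integral_chan hi]
  have hHi : Integrable (fun x => ‖H x‖ ^ 2) ρ := by
    have := H.comp_memLp' hρ
    exact (memLp_two_iff_integrable_sq_norm (by fun_prop)).1 this
  have e : ∀ x : E, ∫ u, (clip N ⟪H x, x⟫ - clip N ⟪H (x + √η • u), x + √η • u⟫) ^ 2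
      ∂stdGaussian E ≤ 8 * η * ‖H x‖ ^ 2 + 2 * η ^ 2 * ∫ u, ⟪H u, u⟫ ^ 2 ∂(stdGaussian E) := by
    intro x
    have j1 := (integrable_inner_sq_stdGaussian (H x)).const_mul (8 * η)
    have j2 := (integrable_quad_sq_stdGaussian H).const_mul (2 * η ^ 2)
    rw [← integral_inner_sq_stdGaussian (H x), ← integral_const_mul, ← integral_const_mul,
      ← integral_add j1 j2]
    refine integral_mono_of_nonneg (.of_forall fun u => sq_nonneg _) (iadd j1 j2)
      (.of_forall fun u => ?_)
    have h1 := abs_clip_sub_le N ⟪H x, x⟫ ⟪H (x + √η • u), x + √η • u⟫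
    have h2 : ⟪H (x + √η • u), x + √η • u⟫ = ⟪H x, x⟫ + 2 * √η * ⟪H x, u⟫ + η * ⟪H u, u⟫ := by
      rw [map_add, map_smul]
      simp only [inner_add_left, inner_add_right, inner_smul_left, inner_smul_right, conj_trivial]
      rw [hH u x, real_inner_comm (H x) u, ← mul_self_sqrt hη]
      simp only [sqrt_mul_self (sqrt_nonneg η)]
      ring
    have h3 := (sq_le_sq.2 h1)
    have hs := sq_sqrt hη
    refine h3.trans ?_
    rw [h2]
    have : (⟪H x, x⟫ - (⟪H x, x⟫ + 2 * √η * ⟪H x, u⟫ + η * ⟪H u, u⟫)) ^ 2 ≤ 2 * (2 * √η * ⟪H x, u⟫)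
      ^ 2 + 2 * (η * ⟪H u, u⟫) ^ 2 := by nlinarith [sq_nonneg (2 * √η * ⟪H x, u⟫ - η * ⟪H u, u⟫)]
    refine this.trans (le_of_eq ?_)
    rw [mul_pow, mul_pow, hs]
    ring
  refine (integral_mono_of_nonneg (.of_forall fun x => integral_nonneg fun u =>
    sq_nonneg _) (iadd (imul _ hHi) (integrable_const _)) (.of_forall e)).trans ?_
  rw [integral_add (imul _ hHi) (integrable_const _), integral_const_mul]
  simp

lemma variance_le_sq_sub {Ω : Type*} [MeasurableSpace Ω] {μ : Measure Ω} [IsProbabilityMeasure μ]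
    {f : Ω → ℝ} (hf : MemLp f 2 μ) (m : ℝ) :
    ∫ x, f x ^ 2 ∂μ - (∫ x, f x ∂μ) ^ 2 ≤ ∫ x, (f x - m) ^ 2 ∂μ := by
  have h1 := hf.integrable_sq
  have h2 : Integrable (fun x => 2 * m * f x) μ := imul _ (hf.integrable one_le_two)
  have e : ∀ x, (f x - m) ^ 2 = (f x ^ 2 - 2 * m * f x) + m ^ 2 := fun x => by ring
  rw [integral_congr_ae (.of_forall e), integral_add (isub h1 h2) (integrable_const _),
    integral_sub h1 h2, integral_const_mul]
  simp only [integral_const, probReal_univ, one_smul]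
  nlinarith [sq_nonneg (∫ x, f x ∂μ - m)]

lemma integral_sub_avg_sq_le' (hη : 0 < η) {f : E → ℝ} (hf : BddCont f) : ∫ q, f q.1 ^ 2 ∂chan ρ η -
    ∫ q, avg ρ η f q.2 ^ 2 ∂chan ρ η ≤ ∫ q, (f q.1 - f q.2) ^ 2 ∂(chan ρ η) := by
  have c2 : Continuous (Prod.snd : E × E → E) := continuous_snd
  have hF := hf.avg (ρ := ρ) hη
  rw [integral_sub_avg_sq hη hf hf]
  have h : 0 ≤ ∫ q, (avg ρ η f q.2 - f q.2) ^ 2 ∂(chan ρ η) := integral_nonneg fun q => sq_nonneg _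
  have e : ∀ q : E × E, (avg ρ η f q.2 - f q.2) ^ 2 =
      (avg ρ η f q.2 ^ 2 - 2 * (avg ρ η f q.2 * f q.2)) + f q.2 ^ 2 := fun q => by ring
  have i1 : Integrable (fun q : E × E => avg ρ η f q.2 ^ 2) (chan ρ η) :=
    (hF.comp c2).pow.integrable
  have i2 : Integrable (fun q : E × E => 2 * (avg ρ η f q.2 * f q.2)) (chan ρ η) :=
    imul _ ((hF.comp c2).mul (hf.comp c2)).integrable
  rw [integral_congr_ae (.of_forall e), integral_add (isub i1 i2) (hf.comp c2).pow.integrable,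
    integral_sub i1 i2, integral_const_mul] at h
  linarith

lemma smooth_quad_var_le (hβ : 0 < β) (hν : SuppIn ν R) (hR : 0 ≤ R) {s : ℝ} (hs : 0 < s) (hvar : ∀
    y v : E, ∫ b, ⟪v, b⟫ ^ 2 ∂post ν β y - (∫ b, ⟪v, b⟫ ∂post ν β y) ^ 2 ≤ ‖v‖ ^ 2 / (s + β⁻¹)) {l :
    ℝ} (hl : 0 < l) (hcov : ∀ e : E, ∫ x, ⟪e, x⟫ ^ 2 ∂smooth ν β - (∫ x, ⟪e, x⟫ ∂smooth ν β) ^ 2 ≤ l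
    * ‖e‖ ^ 2) (N : ℝ) (H : E →L[ℝ] E) (hH : ∀ x y, ⟪H x, y⟫ = ⟪x, H y⟫) : √(s / (1 + s * β) / l) /
    5 * ∫ x, (clip N ⟪H x, x⟫ - ∫ z, clip N ⟪H z, z⟫ ∂smooth ν β) ^ 2 ∂smooth ν β ≤ 8 * ∫ x, ‖H x‖ ^
    2 ∂(smooth ν β) := by
  have hgap := exists_chan_gap hβ hν hR hs hvar hl hcov
  have hb := bddCont_clip N H
  obtain ⟨m, hm⟩ : ∃ m, m = ∫ z, clip N ⟪H z, z⟫ ∂(smooth ν β) := ⟨_, rfl⟩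
  have hfb := hb.sub (BddCont.const m)
  obtain ⟨c, hc⟩ : ∃ c, c = ∫ u : E, ⟪H u, u⟫ ^ 2 ∂(stdGaussian E) := ⟨_, rfl⟩
  rw [← hm]
  have hev : ∀ᶠ η in 𝓝[>] (0 : ℝ), √(s / (1 + s * β) / l) / 5 * ∫ x, (clip N ⟪H x, x⟫ - m) ^ 2
      ∂smooth ν β ≤ 8 * ∫ x, ‖H x‖ ^ 2 ∂smooth ν β + 2 * η * c := by
    filter_upwards [hgap, self_mem_nhdsWithin] with η h1 h2
    have h2 := h2
    have h0 : ∫ q, (clip N ⟪H q.1, q.1⟫ - m) ∂(chan (smooth ν β) η) = 0 := by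
      rw [integral_chan_fst (η := η) hfb, integral_sub hb.integrable (integrable_const _), ← hm]
      simp
    have h3 := h1 _ hfb h0
    have h4 := h3.trans (integral_sub_avg_sq_le' h2 hfb)
    have h5 := integral_clip_sub_sq_le h2.le N H hH (memLp_smooth_id hβ hν)
    have e : ∀ q : E × E, (clip N ⟪H q.1, q.1⟫ - m - (clip N ⟪H q.2, q.2⟫ - m)) ^ 2 =
      (clip N ⟪H q.1, q.1⟫ - clip N ⟪H q.2, q.2⟫) ^ 2 := fun q => by ring
    rw [integral_congr_ae (.of_forall e), integral_chan_fst (η := η) hfb.pow] at h4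
    have h6 := h4.trans h5
    rw [← hc] at h6
    refine le_of_mul_le_mul_left (le_of_eq_of_le ?_ (h6.trans (le_of_eq ?_))) h2
    · ring
    · ring
  have l2 : Tendsto (fun η : ℝ => 8 * ∫ x, ‖H x‖ ^ 2 ∂smooth ν β + 2 * η * c) (𝓝[>] 0)
      (𝓝 (8 * ∫ x, ‖H x‖ ^ 2 ∂smooth ν β)) := by
    have : Continuous (fun η : ℝ => 8 * ∫ x, ‖H x‖ ^ 2 ∂smooth ν β + 2 * η * c) := by fun_prop
    have h := (this.tendsto 0).mono_left (nhdsWithin_le_nhds (s := Ioi 0))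
    simpa using h
  exact ge_of_tendsto l2 hev

lemma integrable_of_bound {f : E → ℝ} (hν : SuppIn ν R) (hf : Continuous f) : Integrable f ν := by
  obtain ⟨C, hC⟩ := (isCompact_closedBall (0 : E) R).exists_bound_of_continuousOn hf.continuousOn
  refine Integrable.of_bound hf.aestronglyMeasurable C ?_
  filter_upwards [hν] with b hb using hC b (by simpa using hb)

lemma integral_smooth_eq (hβ : 0 < β) (hν : SuppIn ν R) {f : E → ℝ} (hf : Continuous f)
    {C : ℝ} (hC : ∀ x, |f x| ≤ C * ‖x‖ ^ 2) :
    ∫ x, f x ∂smooth ν β = ∫ b, ∫ u, f (b + √β • u) ∂(stdGaussian E) ∂ν := by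
  have hi : Integrable f (smooth ν β) := by
    have h2 := (memLp_two_iff_integrable_sq_norm (by fun_prop)).1 (memLp_smooth_id hβ hν)
    exact (h2.const_mul C).mono' hf.aestronglyMeasurable (.of_forall hC)
  rw [integral_smooth hf.aestronglyMeasurable, integral_chan]
  exact hi.comp_aemeasurable (by fun_prop)

lemma smooth_var_eq (hβ : 0 < β) (hν : SuppIn ν R) (e : E) : ∫ x, ⟪e, x⟫ ^ 2 ∂smooth ν β - (∫ x, ⟪e,
    x⟫ ∂smooth ν β) ^ 2 = ∫ b, ⟪e, b⟫ ^ 2 ∂ν - (∫ b, ⟪e, b⟫ ∂ν) ^ 2 + β * ‖e‖ ^ 2 := by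
  have i1 : Integrable (fun u : E => ⟪e, u⟫) (stdGaussian E) :=
    ((integrable_norm_pow_stdGaussian (E := E) 1).const_mul ‖e‖).mono' (by fun_prop)
      (.of_forall fun u => by rw [pow_one]; exact norm_inner_le_norm _ _)
  have i2 := integrable_inner_sq_stdGaussian e
  have z : ∫ u : E, ⟪e, u⟫ ∂stdGaussian E = 0 := by
    rw [integral_inner (𝕜 := ℝ) (by
      have := (integrable_norm_pow_stdGaussian (E := E) 1)
      simp only [pow_one] at this
      exact (integrable_norm_iff (by fun_prop)).1 this) e, integral_id_stdGaussian, inner_zero_right]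
  have h1 : ∫ x, ⟪e, x⟫ ^ 2 ∂smooth ν β = ∫ b, ⟪e, b⟫ ^ 2 ∂ν + β * ‖e‖ ^ 2 := by
    rw [integral_smooth_eq hβ hν (C := ‖e‖ ^ 2) (by fun_prop) (fun x => by
      rw [abs_of_nonneg (sq_nonneg _), ← mul_pow, ← sq_abs]
      gcongr
      exact abs_real_inner_le_norm _ _)]
    have e2 : ∀ b : E, ∫ u, ⟪e, b + √β • u⟫ ^ 2 ∂stdGaussian E = ⟪e, b⟫ ^ 2 + β * ‖e‖ ^ 2 := by
      intro b
      have e3 : ∀ u : E, ⟪e, b + √β • u⟫ ^ 2 =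
          (⟪e, b⟫ ^ 2 + 2 * √β * ⟪e, b⟫ * ⟪e, u⟫) + β * ⟪e, u⟫ ^ 2 := fun u => by
        rw [inner_add_right, inner_smul_right]
        nth_rewrite 3 [← sq_sqrt hβ.le]
        ring
      rw [integral_congr_ae (.of_forall e3), integral_add (iadd (integrable_const _)
        (imul _ i1)) (imul _ i2), integral_add (integrable_const _) (imul _ i1),
        integral_const_mul, integral_const_mul, z, integral_inner_sq_stdGaussian]
      simp
    rw [integral_congr_ae (.of_forall e2), integral_add (integrable_of_bound hν
      (by fun_prop)) (integrable_const _)]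
    simp
  have h2 : ∫ x, ⟪e, x⟫ ∂smooth ν β = ∫ b, ⟪e, b⟫ ∂ν := by
    have hm := memLp_smooth_id hβ hν
    have hi : Integrable (fun x : E => ⟪e, x⟫) (smooth ν β) :=
      (hm.const_inner e).integrable one_le_two
    have hi' : Integrable (fun q : E × E => ⟪e, q.2⟫) (chan ν β) :=
      hi.comp_aemeasurable (f := Prod.snd) (by fun_prop)
    rw [integral_smooth (by fun_prop), integral_chan hi']
    refine integral_congr_ae (.of_forall fun b => ?_)
    simp only [inner_add_right, inner_smul_right]
    rw [integral_add (integrable_const _) (imul _ i1), integral_const_mul, z]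
    simp
  rw [h1, h2]
  ring

lemma smooth_norm_sq_le (hβ : 0 < β) (hν : SuppIn ν R) (H : E →L[ℝ] E) : ∫ x, ‖H x‖ ^ 2 ∂smooth ν β
    ≤ 2 * ∫ b, ‖H b‖ ^ 2 ∂ν + 2 * β * ∫ u, ‖H u‖ ^ 2 ∂(stdGaussian E) := by
  have hb : ∀ x, ‖H x‖ ^ 2 ≤ ‖H‖ ^ 2 * ‖x‖ ^ 2 := fun x => by
    rw [← mul_pow]; gcongr; exact H.le_opNorm x
  have i2 : Integrable (fun u => ‖H u‖ ^ 2) (stdGaussian E) := ((integrable_norm_pow_stdGaussian (E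
    := E) 2).const_mul (‖H‖ ^ 2)).mono' (by fun_prop) (.of_forall fun u => by
        rw [norm_of_nonneg (sq_nonneg _)]; exact hb u)
  have i1 : Integrable (fun b => ‖H b‖ ^ 2) ν := integrable_of_bound hν (by fun_prop)
  rw [integral_smooth_eq hβ hν (f := fun x => ‖H x‖ ^ 2) (C := ‖H‖ ^ 2) (by fun_prop) (fun x => by
    rw [abs_of_nonneg (sq_nonneg _)]; exact hb x)]
  have e : ∀ b : E, ∫ u, ‖H (b + √β • u)‖ ^ 2 ∂stdGaussian E ≤
      2 * ‖H b‖ ^ 2 + 2 * β * ∫ u, ‖H u‖ ^ 2 ∂(stdGaussian E) := by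
    intro b
    have : ∫ u, ‖H (b + √β • u)‖ ^ 2 ∂stdGaussian E ≤
        ∫ u, (2 * ‖H b‖ ^ 2 + 2 * β * ‖H u‖ ^ 2) ∂(stdGaussian E) := by
      refine integral_mono_of_nonneg (.of_forall fun u => sq_nonneg _)
        (iadd (integrable_const _) (imul _ i2)) (.of_forall fun u => ?_)
      have h1 : ‖H (b + √β • u)‖ ≤ ‖H b‖ + √β * ‖H u‖ := by
        rw [map_add, map_smul]
        refine (norm_add_le _ _).trans (add_le_add le_rfl (le_of_eq ?_))
        rw [norm_smul, norm_of_nonneg (sqrt_nonneg _)]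
      have h2 := pow_le_pow_left₀ (norm_nonneg _) h1 2
      have h3 := sq_sqrt hβ.le
      have h4 : 2 * β * ‖H u‖ ^ 2 = 2 * (√β * ‖H u‖) ^ 2 := by rw [mul_pow, h3]; ring
      nlinarith [sq_nonneg (‖H b‖ - √β * ‖H u‖)]
    refine this.trans (le_of_eq ?_)
    rw [integral_add (integrable_const _) (imul _ i2), integral_const_mul (2 * β)]
    simp
  refine (integral_mono_of_nonneg (.of_forall fun b => integral_nonneg fun u =>
    sq_nonneg _) (iadd (imul _ i1) (integrable_const _)) (.of_forall e)).trans ?_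
  rw [integral_add (imul _ i1) (integrable_const _), integral_const_mul]
  simp

/-- Improved Lichnerowicz inequality for quadratic forms. -/
theorem quad_var_le (hν : SuppIn ν R) (hR : 0 ≤ R) {s : ℝ} (hs : 0 < s) (hvar : ∀ β, 0 < β → ∀ y v :
    E, ∫ b, ⟪v, b⟫ ^ 2 ∂post ν β y - (∫ b, ⟪v, b⟫ ∂post ν β y) ^ 2 ≤ ‖v‖ ^ 2 / (s + β⁻¹)) {l : ℝ}
    (hl : 0 < l) (hcov : ∀ e : E, ∫ b, ⟪e, b⟫ ^ 2 ∂ν - (∫ b, ⟪e, b⟫ ∂ν) ^ 2 ≤ l * ‖e‖ ^ 2) (H : E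
    →L[ℝ] E) (hH : ∀ x y, ⟪H x, y⟫ = ⟪x, H y⟫) : √(s / l) * (∫ b, ⟪H b, b⟫ ^ 2 ∂ν - (∫ b, ⟪H b, b⟫
    ∂ν) ^ 2) ≤ 160 * ∫ b, ‖H b‖ ^ 2 ∂ν := by
  obtain ⟨N, hN⟩ : ∃ N, N = ‖H‖ * R ^ 2 := ⟨_, rfl⟩
  obtain ⟨c, hc⟩ : ∃ c, c = ∫ u : E, ⟪H u, u⟫ ^ 2 ∂(stdGaussian E) := ⟨_, rfl⟩
  obtain ⟨d, hd⟩ : ∃ d, d = ∫ u : E, ‖H u‖ ^ 2 ∂(stdGaussian E) := ⟨_, rfl⟩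
  obtain ⟨V, hV⟩ : ∃ V, V = ∫ b, ⟪H b, b⟫ ^ 2 ∂ν - (∫ b, ⟪H b, b⟫ ∂ν) ^ 2 := ⟨_, rfl⟩
  obtain ⟨W, hW⟩ : ∃ W, W = ∫ b, ‖H b‖ ^ 2 ∂ν := ⟨_, rfl⟩
  have hb := bddCont_clip N H
  have c1 : Continuous (Prod.fst : E × E → E) := continuous_fst
  have c2 : Continuous (Prod.snd : E × E → E) := continuous_snd
  have hclip : ∀ᵐ b ∂ν, clip N ⟪H b, b⟫ = ⟪H b, b⟫ := by
    filter_upwards [hν] with b hbR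
    refine clip_eq ((abs_real_inner_le_norm _ _).trans ?_)
    rw [hN]
    calc ‖H b‖ * ‖b‖ ≤ (‖H‖ * ‖b‖) * ‖b‖ := by gcongr; exact H.le_opNorm b
      _ = ‖H‖ * ‖b‖ ^ 2 := by ring
      _ ≤ _ := by gcongr
  have hVc : V = ∫ b, clip N ⟪H b, b⟫ ^ 2 ∂ν - (∫ b, clip N ⟪H b, b⟫ ∂ν) ^ 2 := by
    rw [hV, integral_congr_ae hclip]
    congr 1
    refine integral_congr_ae ?_
    filter_upwards [hclip] with b h
    rw [h]
  have hmem : MemLp (fun x : E => x) 2 ν := by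
    refine (memLp_two_iff_integrable_sq_norm (by fun_prop)).2 (integrable_of_bound hν (by fun_prop))
  have key : ∀ β, 0 < β → √(s / (1 + s * β) / (l + β)) / 5 * V ≤ √(s / (1 + s * β) / (l + β)) / 5 *
      (2 * (8 * β * W + 2 * β ^ 2 * c)) + 16 * (2 * W + 2 * β * d) := by
    intro β hβ
    have hcov' : ∀ e : E, ∫ x, ⟪e, x⟫ ^ 2 ∂smooth ν β -
      (∫ x, ⟪e, x⟫ ∂smooth ν β) ^ 2 ≤ (l + β) * ‖e‖ ^ 2 := fun e => by
      rw [smooth_var_eq hβ hν, add_mul]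
      exact add_le_add (hcov e) le_rfl
    have h1 := smooth_quad_var_le hβ hν hR hs (hvar β hβ) (by positivity) hcov' N H hH
    have h2 := smooth_norm_sq_le hβ hν H
    have h3 := integral_clip_sub_sq_le hβ.le N H hH hmem
    obtain ⟨m, hm⟩ : ∃ m, m = ∫ z, clip N ⟪H z, z⟫ ∂(smooth ν β) := ⟨_, rfl⟩
    rw [← hm] at h1
    rw [← hW, ← hd] at h2
    rw [← hW, ← hc] at h3
    have h4 : V ≤ ∫ b, (clip N ⟪H b, b⟫ - m) ^ 2 ∂ν := by
      rw [hVc]; exact variance_le_sq_sub hb.memLp m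
    have hbm := hb.sub (BddCont.const (α := E) m)
    have h5 : ∫ b, (clip N ⟪H b, b⟫ - m) ^ 2 ∂ν ≤ 2 * ∫ q, (clip N ⟪H q.1, q.1⟫ - clip N ⟪H q.2,
        q.2⟫) ^ 2 ∂chan ν β + 2 * ∫ x, (clip N ⟪H x, x⟫ - m) ^ 2 ∂(smooth ν β) := by
      rw [← integral_chan_fst (η := β) hbm.pow, integral_smooth hbm.pow.cont.aestronglyMeasurable, ←
        integral_const_mul, ← integral_const_mul, ← integral_add (imul _ ((hb.comp c1).sub (hb.comp
        c2)).pow.integrable) (imul _ (hbm.comp c2).pow.integrable)]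
      refine integral_mono (hbm.comp c1).pow.integrable (iadd (imul _ ((hb.comp c1).sub (hb.comp
        c2)).pow.integrable) (imul _ (hbm.comp c2).pow.integrable)) fun q => ?_
      change (clip N ⟪H q.1, q.1⟫ - m) ^ 2 ≤
        2 * (clip N ⟪H q.1, q.1⟫ - clip N ⟪H q.2, q.2⟫) ^ 2 + 2 * (clip N ⟪H q.2, q.2⟫ - m) ^ 2
      nlinarith [sq_nonneg ((clip N ⟪H q.1, q.1⟫ - clip N ⟪H q.2, q.2⟫) -
        (clip N ⟪H q.2, q.2⟫ - m))]
    obtain ⟨k, hk⟩ : ∃ k, k = √(s / (1 + s * β) / (l + β)) / 5 := ⟨_, rfl⟩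
    have hk0 : 0 ≤ k := by rw [hk]; positivity
    rw [← hk] at h1 ⊢
    have h6 := mul_le_mul_of_nonneg_left (h4.trans h5) hk0
    have h7 := mul_le_mul_of_nonneg_left h3 hk0
    linarith
  have hev : ∀ᶠ β in 𝓝[>] (0 : ℝ), √(s / (1 + s * β) / (l + β)) / 5 * V ≤
      √(s / (1 + s * β) / (l + β)) / 5 * (2 * (8 * β * W + 2 * β ^ 2 * c)) +
        16 * (2 * W + 2 * β * d) := by filter_upwards [self_mem_nhdsWithin] with β hβ using key β hβ
  have lim : ContinuousAt (fun β : ℝ => √(s / (1 + s * β) / (l + β))) 0 := ((ContinuousAt.div (by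
    fun_prop) (by fun_prop) (by simp)).div (by fun_prop) (by simpa using hl.ne')).sqrt
  have l1 : Tendsto (fun β : ℝ => √(s / (1 + s * β) / (l + β)) / 5 * V) (𝓝[>] 0)
      (𝓝 (√(s / l) / 5 * V)) := by
    have h : ContinuousAt (fun β : ℝ => √(s / (1 + s * β) / (l + β)) / 5 * V) 0 := by fun_prop
    simpa using h.tendsto.mono_left (nhdsWithin_le_nhds (s := Ioi 0))
  have l2 : Tendsto (fun β : ℝ => √(s / (1 + s * β) / (l + β)) / 5 * (2 * (8 * β * W +
      2 * β ^ 2 * c)) + 16 * (2 * W + 2 * β * d)) (𝓝[>] 0) (𝓝 (16 * (2 * W))) := by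
    have h : ContinuousAt (fun β : ℝ => √(s / (1 + s * β) / (l + β)) / 5 * (2 * (8 * β * W +
      2 * β ^ 2 * c)) + 16 * (2 * W + 2 * β * d)) 0 := by fun_prop
    simpa using h.tendsto.mono_left (nhdsWithin_le_nhds (s := Ioi 0))
  have h := le_of_tendsto_of_tendsto l1 l2 hev
  rw [← hV, ← hW]
  linarith

end Quadratic

section Localization

variable {V : Type*} [NormedAddCommGroup V] [NormedSpace ℝ V] {ι : Type*} [Fintype ι]

/-- The sufficient statistic of the quadratic-exponential tilts. -/
def stat (b : E) : (ℝ × E) →L[ℝ] ℝ := (-‖b‖ ^ 2 / 2) • fst ℝ ℝ E + (innerSL ℝ b).comp (snd ℝ ℝ E)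

lemma stat_apply (b : E) (w : ℝ × E) : stat b w = -‖b‖ ^ 2 / 2 * w.1 + ⟪b, w.2⟫ := by simp [stat]

lemma continuous_stat : Continuous (stat : E → (ℝ × E) →L[ℝ] ℝ) := by
  unfold stat
  fun_prop

/-- The stochastic-localization tilt of `μ` at `w = (s, θ)`. -/
def loc (μ : Measure E) (w : ℝ × E) : Measure E := μ.tilted (fun b => stat b w)

/-- The barycenter of the tilt. -/
def bary (μ : Measure E) (w : ℝ × E) : E := ∫ b, b ∂(loc μ w)

/-- The mean of `f` along stochastic localization at time `s`. -/
def law (μ : Measure E) (s : ℝ) (f : ℝ × E → V) : V :=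
  ∫ q : E × E, f (s, s • q.1 + √s • q.2) ∂(μ.prod (stdGaussian E))

lemma post_eq_loc {μ : Measure E} {s : ℝ} (hs : 0 < s) (y : E) :
    post μ s⁻¹ y = loc μ (s, s • y) := by
  rw [loc, ← tilted_add_const _ (-(s * ‖y‖ ^ 2 / 2)), post]
  congr 1; ext x
  rw [gexp, stat_apply, norm_sub_sq_real, inner_smul_right, real_inner_comm x y]
  field_simp
  ring

/-- `G` is differentiable with derivative `G'` and second derivatives `k` in the spatial
directions of the basis `e`. -/
structure Gen (e : OrthonormalBasis ι ℝ E) (G : ℝ × E → V) (G' : ℝ × E → (ℝ × E) →L[ℝ] V)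
    (k : ι → ℝ × E → V) : Prop where
  deriv : ∀ w, HasFDerivAt G (G' w) w
  line : ∀ i w, HasLineDerivAt ℝ (fun w => G' w (0, e i)) (k i w) w (0, e i)
  bdd : BddCont G'
  bddk : ∀ i, BddCont (k i)

/-- The generator of stochastic localization. -/
def gen (μ : Measure E) (G' : ℝ × E → (ℝ × E) →L[ℝ] V) (k : ι → ℝ × E → V) (w : ℝ × E) : V :=
  G' w (1, bary μ w) + (1 / 2 : ℝ) • ∑ i, k i w

variable {μ : Measure E} [IsProbabilityMeasure μ] {R : ℝ} {e : OrthonormalBasis ι ℝ E}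

lemma ae_prod_fst {p : E → Prop} (h : ∀ᵐ b ∂μ, p b) : ∀ᵐ q ∂(μ.prod (stdGaussian E)), p q.1 :=
  quasiMeasurePreserving_fst.ae h

lemma integrable_snd_pow (k : ℕ) : Integrable (fun q : E × E => ‖q.2‖ ^ k) (μ.prod (stdGaussian E))
  := (integrable_norm_pow_stdGaussian k).comp_snd μ

lemma Gen.norm_le {G : ℝ × E → V} {G' : ℝ × E → (ℝ × E) →L[ℝ] V} {k : ι → ℝ × E → V}
    (hG : Gen e G G' k) : ∃ C, 0 ≤ C ∧ ∀ w, ‖G w‖ ≤ C * (1 + ‖w‖) := by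
  obtain ⟨_, C, hC⟩ := hG.bdd
  have hC0 := le_trans (norm_nonneg (G' 0)) (hC 0)
  refine ⟨C + ‖G 0‖, by positivity, fun w => ?_⟩
  have h1 : ‖G w - G 0‖ ≤ C * ‖w - 0‖ := convex_univ.norm_image_sub_le_of_norm_hasFDerivWithin_le
    (fun x _ => (hG.deriv x).hasFDerivWithinAt) (fun x _ => hC x) (mem_univ _) (mem_univ _)
  rw [sub_zero] at h1
  have h2 := norm_sub_norm_le (G w) (G 0)
  have h3 := mul_nonneg (norm_nonneg (G 0)) (norm_nonneg w)
  nlinarith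

lemma norm_path_le {s T : ℝ} (hT : |s| ≤ T) {x u : E} (hx : ‖x‖ ≤ R) :
    ‖((s, s • x + √s • u) : ℝ × E)‖ ≤ T + T * R + √T * ‖u‖ := by
  have hs := abs_nonneg s
  have hR := (norm_nonneg x).trans hx
  have hT0 := hs.trans hT
  refine (norm_prod_le_iff.2 ⟨?_, ?_⟩)
  · rw [norm_eq_abs]
    have : 0 ≤ T * R := by positivity
    have : 0 ≤ √T * ‖u‖ := by positivity
    linarith
  · have h1 : ‖s • x‖ ≤ T * R := by
      rw [norm_smul]; bound
    have h2 : ‖√s • u‖ ≤ √T * ‖u‖ := by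
      rw [norm_smul, norm_of_nonneg (sqrt_nonneg _)]
      exact mul_le_mul_of_nonneg_right (sqrt_le_sqrt ((le_abs_self s).trans hT)) (norm_nonneg _)
    have := norm_add_le (s • x) (√s • u)
    linarith

lemma path_bound {G : ℝ × E → V} {C : ℝ} (hC0 : 0 ≤ C) (hC : ∀ w, ‖G w‖ ≤ C * (1 + ‖w‖)) (hμ :
    SuppIn μ R) {s T : ℝ} (hT : |s| ≤ T) : ∀ᵐ q ∂(μ.prod (stdGaussian E)), ‖G (s, s • q.1 + √s •
    q.2)‖ ≤ C * (1 + (T + T * R + √T * ‖q.2‖ ^ 1)) := by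
  filter_upwards [ae_prod_fst hμ] with q hq
  rw [pow_one]
  exact (hC _).trans (mul_le_mul_of_nonneg_left (add_le_add le_rfl (norm_path_le hT hq)) hC0)

lemma integrable_path_bound (C T : ℝ) : Integrable (fun q : E × E => C * (1 + (T + T * R + √T *
  ‖q.2‖ ^ 1))) (μ.prod (stdGaussian E)) := ((integrable_const _).add ((integrable_const _).add
  ((integrable_snd_pow 1).const_mul _))).const_mul _

lemma integrable_law {G : ℝ × E → ℝ} (hc : Continuous G) {C : ℝ} (hC0 : 0 ≤ C) (hC : ∀ w, ‖G w‖ ≤ C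
  * (1 + ‖w‖)) (hμ : SuppIn μ R) (s : ℝ) : Integrable (fun q : E × E => G (s, s • q.1 + √s • q.2))
  (μ.prod (stdGaussian E)) := (integrable_path_bound (R := R) C |s|).mono' (by fun_prop) (path_bound
  hC0 hC hμ le_rfl)

lemma BddCont.norm_le_linear {G : ℝ × E → V} (hG : BddCont G) :
    ∃ C, 0 ≤ C ∧ ∀ w, ‖G w‖ ≤ C * (1 + ‖w‖) := by
  obtain ⟨_, C, hC⟩ := hG
  have hC0 := (norm_nonneg _).trans (hC 0)
  exact ⟨C, hC0, fun w => (hC w).trans (le_mul_of_one_le_right hC0 (by simp))⟩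

lemma continuous_law {G : ℝ × E → ℝ} (hc : Continuous G) {C : ℝ} (hC0 : 0 ≤ C) (hC : ∀ w, ‖G w‖ ≤ C
    * (1 + ‖w‖)) (hμ : SuppIn μ R) : Continuous fun s => law μ s G := by
  rw [continuous_iff_continuousAt]
  intro s
  refine continuousAt_of_dominated (bound := fun q : E × E => C * (1 + ((|s| + 1) + (|s| + 1) * R +
    √(|s| + 1) * ‖q.2‖ ^ 1))) (.of_forall fun t => ?_) ?_ (integrable_path_bound _ _) (.of_forall
    fun q => ?_)
  · fun_prop
  · have : ∀ᶠ t in 𝓝 s, |t| ≤ |s| + 1 :=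
      (continuous_abs.tendsto s).eventually (eventually_le_nhds (by linarith))
    filter_upwards [this] with t ht
    exact path_bound hC0 hC hμ ht
  fun_prop

lemma law_bayes (hμ : SuppIn μ R) {L : ℝ × E → (ℝ × E) →L[ℝ] ℝ} (hL : BddCont L) {s : ℝ} (hs : 0 <
    s) : Integrable (fun q : E × E => L (s, s • q.1 + √s • q.2) (1, bary μ (s, s • q.1 + √s • q.2)))
    (μ.prod (stdGaussian E)) ∧ ∫ q : E × E, L (s, s • q.1 + √s • q.2) (1, q.1) ∂(μ.prod (stdGaussian
    E)) = law μ s fun w => L w (1, bary μ w) := by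
  have hs' := inv_pos.2 hs
  obtain ⟨hLc, C, hC⟩ := hL
  have hC0 := le_trans (norm_nonneg (L 0)) (hC 0)
  have key : ∀ q : E × E, s • (q.1 + √s⁻¹ • q.2) = s • q.1 + √s • q.2 := fun q => by
    rw [smul_add, smul_smul]
    congr 2
    rw [sqrt_inv]
    grind
  obtain ⟨φ, hφ⟩ : ∃ φ : E × E → ℝ, φ = fun p => L (s, s • p.2) (1, p.1) := ⟨_, rfl⟩
  have hφc : Continuous φ := by
    rw [hφ]
    fun_prop
  have hint0 : Integrable (fun p : E × E => φ (p.1, p.1 + √s⁻¹ • p.2))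
      (μ.prod (stdGaussian E)) := by
    refine (integrable_const (C * (1 + |R|))).mono' (by fun_prop) ?_
    filter_upwards [ae_prod_fst hμ] with q hq
    rw [hφ]
    refine (le_opNorm _ _).trans (mul_le_mul (hC _) ?_ (norm_nonneg _) hC0)
    refine norm_prod_le_iff.2 ⟨?_, ?_⟩
    · simp
    · exact hq.trans ((le_abs_self R).trans (by linarith))
  have hint := (integrable_chan_iff hφc.aestronglyMeasurable).2 hint0
  obtain ⟨h1, h2⟩ := chan_bayes hs' hint
  have hin : ∀ y : E, ∫ x, φ (x, y) ∂post μ s⁻¹ y = L (s, s • y) (1, bary μ (s, s • y)) := by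
    intro y
    have := isProbabilityMeasure_post (ρ := μ) hs' y
    have hb : SuppIn (post μ s⁻¹ y) R := (tilted_absolutelyContinuous _ _).ae_le hμ
    have hi : Integrable (fun x : E => x) (post μ s⁻¹ y) := (integrable_const R).mono'
      aestronglyMeasurable_id hb
    rw [bary, ← post_eq_loc hs]
    have h3 : ∫ x, φ (x, y) ∂post μ s⁻¹ y = ∫ x, (L (s, s • y) (1, 0) + (L (s, s • y)).comp (inr ℝ ℝ
        E) x) ∂(post μ s⁻¹ y) := by
      refine integral_congr_ae (.of_forall fun x => ?_)
      rw [hφ]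
      simp only [comp_apply]
      rw [← map_add]; simp
    rw [h3, integral_add (integrable_const _) (ContinuousLinearMap.integrable_comp _ hi),
      integral_comp_comm _ hi]
    simp only [integral_const, probReal_univ, one_smul, comp_apply]
    rw [← map_add]; simp
  simp only [hin] at h1 h2
  have h1' := (integrable_chan_iff h1.aestronglyMeasurable).1 h1
  simp only [key] at h1'
  refine ⟨h1', ?_⟩
  rw [integral_chan hint, integral_chan h1, ← integral_prod _ hint0] at h2
  rw [law]
  have h4 : ∫ q : E × E, L (s, s • q.1 + √s • q.2) (1, q.1) ∂(μ.prod (stdGaussian E)) =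
      ∫ z : E × E, φ (z.1, z.1 + √s⁻¹ • z.2) ∂(μ.prod (stdGaussian E)) := by
    refine integral_congr_ae (.of_forall fun q => ?_)
    rw [hφ]
    simp only [key]
  rw [h4, h2, ← integral_prod (fun q : E × E => L (s, s • (q.1 + √s⁻¹ • q.2))
    (1, bary μ (s, s • (q.1 + √s⁻¹ • q.2))))]
  · simp only [key]
  · simpa only [key] using h1'

lemma law_stein (hμ : SuppIn μ R) {L : ℝ × E → (ℝ × E) →L[ℝ] ℝ} (hL : BddCont L) {k : ι → ℝ × E → ℝ}
    (hk : ∀ i, BddCont (k i)) (hd : ∀ i w, HasLineDerivAt ℝ (fun w => L w (0, e i)) (k i w) w (0, e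
    i)) (s : ℝ) : ∫ q : E × E, L (s, s • q.1 + √s • q.2) (0, q.2) ∂(μ.prod (stdGaussian E)) = √s *
    law μ s fun w => ∑ i, k i w := by
  obtain ⟨hLc, C, hC⟩ := hL
  have hC0 : 0 ≤ C := le_trans (norm_nonneg (L 0)) (hC 0)
  have hint : ∀ i, Integrable (fun q : E × E => L (s, s • q.1 + √s • q.2) (0, e i) * ⟪e i, q.2⟫)
      (μ.prod (stdGaussian E)) := fun i => by
    refine ((integrable_snd_pow 1).const_mul C).mono' (by fun_prop) (.of_forall fun q => ?_)
    rw [norm_mul, pow_one]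
    refine mul_le_mul ?_ ?_ (norm_nonneg _) hC0
    · refine (le_opNorm _ _).trans ((mul_le_of_le_one_right (norm_nonneg _) ?_).trans (hC _))
      simp
    · exact (norm_inner_le_norm _ _).trans (by simp)
  have hlin : ∀ i s, Integrable (fun q : E × E => k i (s, s • q.1 + √s • q.2))
      (μ.prod (stdGaussian E)) := fun i s => by
    obtain ⟨D, hD0, hD⟩ := (hk i).norm_le_linear
    exact integrable_law (hk i).1 hD0 hD hμ s
  have hone : ∀ i, ∫ q : E × E, L (s, s • q.1 + √s • q.2) (0, e i) * ⟪e i, q.2⟫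
      ∂(μ.prod (stdGaussian E)) = √s * law μ s (k i) := fun i => by
    rw [integral_prod _ (hint i), law, integral_prod _ (hlin i s), ← integral_const_mul]
    refine integral_congr_ae (.of_forall fun x => ?_)
    change ∫ u, L (s, s • x + √s • u) (0, e i) * ⟪e i, u⟫ ∂stdGaussian E = _
    have hF : BddCont fun u : E => L (s, s • x + √s • u) (0, e i) := ⟨(hLc.comp (by
      fun_prop)).clm_apply continuous_const, C * ‖((0, e i) : ℝ × E)‖, fun u => (le_opNorm _
      _).trans (mul_le_mul_of_nonneg_right (hC _) (norm_nonneg _))⟩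
    have hk' : BddCont fun u : E => √s * k i (s, s • x + √s • u) :=
      (BddCont.const (√s)).mul ((hk i).comp (by fun_prop))
    rw [stein (F' := fun u => √s * k i (s, s • x + √s • u)) (e i) (fun u => ?_) hF.integrable
      hk'.integrable, integral_const_mul]
    · obtain ⟨hFc, D, hD⟩ := hF
      refine ((integrable_norm_pow_stdGaussian (E := E) 1).const_mul D).mono'
        (hFc.mul (by fun_prop)).aestronglyMeasurable (.of_forall fun u => ?_)
      rw [norm_mul, pow_one]
      exact mul_le_mul (hD u) ((norm_inner_le_norm _ _).trans (by rw [e.norm_eq_one i, one_mul]))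
        (norm_nonneg _) ((norm_nonneg _).trans (hD u))
    · have h1 := hd i (s, s • x + √s • u)
      have h2 : HasDerivAt (fun t : ℝ => √s * t) (√s * 1) 0 := (hasDerivAt_id 0).const_mul _
      have h3 : HasDerivAt (fun t => L ((s, s • x + √s • u) + t • (0, e i)) (0, e i))
          (k i (s, s • x + √s • u)) (√s * 0) := by rw [mul_zero]; exact h1
      have h4 := h3.comp (0 : ℝ) h2
      refine (h4.congr_deriv (by ring)).congr_of_eventuallyEq (.of_forall fun t => ?_)
      change L (s, s • x + √s • (u + t • e i)) (0, e i) =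
        L ((s, s • x + √s • u) + (√s * t) • (0, e i)) (0, e i)
      congr 2
      simp [smul_add, smul_smul, add_assoc]
  calc ∫ q : E × E, L (s, s • q.1 + √s • q.2) (0, q.2) ∂(μ.prod (stdGaussian E)) = ∫ q : E × E, ∑ i,
      L (s, s • q.1 + √s • q.2) (0, e i) * ⟪e i, q.2⟫ ∂(μ.prod (stdGaussian E)) := by
        refine integral_congr_ae (.of_forall fun q => ?_)
        change ((L (s, s • q.1 + √s • q.2)).comp (inr ℝ ℝ E)) q.2 =
          ∑ i, ((L (s, s • q.1 + √s • q.2)).comp (inr ℝ ℝ E)) (e i) * ⟪e i, q.2⟫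
        generalize (L (s, s • q.1 + √s • q.2)).comp (inr ℝ ℝ E) = T
        conv_lhs => rw [← e.sum_repr q.2]
        rw [map_sum]
        refine sum_congr rfl fun i _ => ?_
        rw [map_smul, e.repr_apply_apply, smul_eq_mul, mul_comm]
    _ = _ := by
        rw [integral_finsetSum _ fun i _ => hint i, sum_congr rfl fun i _ => hone i, ← mul_sum]
        congr 1
        unfold law
        rw [integral_finsetSum _ fun i _ => hlin i s]

/-- The evolution of expectations along stochastic localization. -/
theorem hasDerivAt_law (hμ : SuppIn μ R) {G : ℝ × E → ℝ} {G' : ℝ × E → (ℝ × E) →L[ℝ] ℝ}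
    {k : ι → ℝ × E → ℝ} (hG : Gen e G G' k) {s : ℝ} (hs : 0 < s) :
    HasDerivAt (fun s => law μ s G) (law μ s (gen μ G' k)) s := by
  obtain ⟨hLc, C, hC⟩ := id hG.bdd
  have hC0 := le_trans (norm_nonneg (G' 0)) (hC 0)
  obtain ⟨D, hD0, hD⟩ := hG.norm_le
  have hGc := continuous_iff_continuousAt.2 fun w => (hG.deriv w).continuousAt
  have hpath : ∀ t : ℝ, 0 < t → ∀ q : E × E, HasDerivAt (fun t : ℝ => G (t, t • q.1 + √t • q.2))
      (G' (t, t • q.1 + √t • q.2) (1, q.1 + (1 / (2 * √t)) • q.2)) t := fun t ht q => by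
    refine (hG.deriv _).comp_hasDerivAt t ((hasDerivAt_id t).prodMk ?_)
    have h1 : HasDerivAt (fun t : ℝ => t • q.1) ((1 : ℝ) • q.1) t := (hasDerivAt_id t).smul_const _
    rw [one_smul] at h1
    exact h1.add ((hasDerivAt_sqrt ht.ne').smul_const q.2)
  have hmeas : ∀ t : ℝ, AEStronglyMeasurable (fun q : E × E => G (t, t • q.1 + √t • q.2)) (μ.prod
    (stdGaussian E)) := fun t => by fun_prop
  obtain ⟨P, hP⟩ : ∃ P, P = (μ.prod (stdGaussian E)) := ⟨_, rfl⟩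
  have hbd : Integrable (fun q : E × E => C * (1 + |R|) + C * (1 / (2 * √(s / 2))) * ‖q.2‖ ^ 1) P := by
    rw [hP]
    exact (integrable_const _).add ((integrable_snd_pow 1).const_mul _)
  have main := (hasDerivAt_integral_of_dominated_loc_of_deriv_le (μ := P) (F := fun (t : ℝ) (q : E ×
    E) => G (t, t • q.1 + √t • q.2)) (F' := fun t q => G' (t, t • q.1 + √t • q.2) (1, q.1 + (1 / (2
    * √t)) • q.2)) (bound := fun q => C * (1 + |R|) + C * (1 / (2 * √(s / 2))) * ‖q.2‖ ^ 1)
    (Ioi_mem_nhds (show s / 2 < s by linarith)) (.of_forall fun t => hP ▸ hmeas t) (hP ▸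
    integrable_law hGc hD0 hD hμ s) (by
      have : Continuous fun q : E × E => G' (s, s • q.1 + √s • q.2) (1, q.1 + (1 / (2 * √s)) • q.2)
        := (hLc.comp (by fun_prop)).clm_apply (by fun_prop)
      exact this.aestronglyMeasurable) (by
      rw [hP]
      filter_upwards [ae_prod_fst hμ] with q hq t ht
      have ht' := ht
      refine (le_opNorm _ _).trans ((mul_le_mul_of_nonneg_right (hC _) (norm_nonneg _)).trans ?_)
      rw [mul_assoc C, ← mul_add, pow_one]
      refine mul_le_mul_of_nonneg_left ?_ hC0
      have h1 : 1 / (2 * √t) ≤ 1 / (2 * √(s / 2)) := one_div_le_one_div_of_le (by positivity) (by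
          have := sqrt_le_sqrt ht'.le
          linarith)
      have h0 : 0 ≤ 1 / (2 * √t) := by positivity
      have h2 : ‖q.1 + (1 / (2 * √t)) • q.2‖ ≤ |R| + 1 / (2 * √(s / 2)) * ‖q.2‖ := by
        refine (norm_add_le _ _).trans (add_le_add (hq.trans (le_abs_self R)) ?_)
        rw [norm_smul, norm_of_nonneg h0]
        exact mul_le_mul_of_nonneg_right h1 (norm_nonneg _)
      have h3 : 0 ≤ 1 / (2 * √(s / 2)) * ‖q.2‖ := by positivity
      refine norm_prod_le_iff.2 ⟨?_, ?_⟩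
      · rw [norm_one]
        have := abs_nonneg R
        linarith
      · exact h2.trans (by linarith)) hbd
    (.of_forall fun q t ht => hpath t (lt_trans (by linarith) ht) q)).2
  unfold law
  rw [hP] at main
  refine main.congr_deriv ?_
  obtain ⟨hb1, hb2⟩ := law_bayes hμ hG.bdd hs
  have hst := law_stein hμ hG.bdd hG.bddk hG.line s
  have hi1 : Integrable (fun q : E × E => G' (s, s • q.1 + √s • q.2) (1, q.1))
      (μ.prod (stdGaussian E)) := by
    refine (integrable_const (C * (1 + |R|))).mono' (by
      have : Continuous fun q : E × E => G' (s, s • q.1 + √s • q.2) (1, q.1) :=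
        (hLc.comp (by fun_prop)).clm_apply (by fun_prop)
      exact this.aestronglyMeasurable) ?_
    filter_upwards [ae_prod_fst hμ] with q hq
    refine (le_opNorm _ _).trans (mul_le_mul (hC _) ?_ (norm_nonneg _) hC0)
    exact norm_prod_le_iff.2 ⟨by simp, hq.trans ((le_abs_self R).trans (by linarith))⟩
  have hi2 : Integrable (fun q : E × E => G' (s, s • q.1 + √s • q.2) (0, q.2))
      (μ.prod (stdGaussian E)) := by
    refine ((integrable_snd_pow 1).const_mul C).mono' (by
      have : Continuous fun q : E × E => G' (s, s • q.1 + √s • q.2) (0, q.2) :=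
        (hLc.comp (by fun_prop)).clm_apply (by fun_prop)
      exact this.aestronglyMeasurable) (.of_forall fun q => ?_)
    refine (le_opNorm _ _).trans (mul_le_mul (hC _) ?_ (norm_nonneg _) hC0)
    rw [pow_one]
    exact norm_prod_le_iff.2 ⟨by simp, le_rfl⟩
  have hi3 : Integrable (fun q : E × E => ∑ i, k i (s, s • q.1 + √s • q.2))
      (μ.prod (stdGaussian E)) := integrable_finsetSum _ fun i _ => by
    obtain ⟨D, hD0, hD⟩ := (hG.bddk i).norm_le_linear
    exact integrable_law (hG.bddk i).1 hD0 hD hμ s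
  have e1 : ∀ q : E × E, G' (s, s • q.1 + √s • q.2) (1, q.1 + (1 / (2 * √s)) • q.2) = G' (s, s • q.1
      + √s • q.2) (1, q.1) + (1 / (2 * √s)) * G' (s, s • q.1 + √s • q.2) (0, q.2) := fun q => by
    generalize G' (s, s • q.1 + √s • q.2) = T
    generalize 1 / (2 * √s) = c
    have : ((1, q.1 + c • q.2) : ℝ × E) = (1, q.1) + c • (0, q.2) := by simp
    rw [this, T.map_add, T.map_smul, smul_eq_mul]
  simp only [e1]
  rw [integral_add hi1 (hi2.const_mul _), integral_const_mul, hb2, hst]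
  unfold law gen
  simp only [smul_eq_mul]
  rw [integral_add hb1 (hi3.const_mul _), integral_const_mul]
  field_simp

end Localization

section Moments

variable {V : Type*} [NormedAddCommGroup V] [NormedSpace ℝ V] {U : Type*} [NormedAddCommGroup U]
  [NormedSpace ℝ U] {ι : Type*} [Fintype ι] {μ : Measure E} [IsProbabilityMeasure μ] {R : ℝ} {e :
  OrthonormalBasis ι ℝ E}

lemma exists_ae_bound (hμ : SuppIn μ R) {φ : E → V} (hφ : Continuous φ) :
    ∃ C, 0 ≤ C ∧ ∀ᵐ b ∂μ, ‖φ b‖ ≤ C := by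
  obtain ⟨C, hC⟩ := (isCompact_closedBall (0 : E) R).exists_bound_of_continuousOn hφ.continuousOn
  refine ⟨|C|, abs_nonneg C, ?_⟩
  filter_upwards [hμ] with b hb
  exact (hC b (by simpa using hb)).trans (le_abs_self C)

lemma isExpFamily_stat (hμ : SuppIn μ R) : IsExpFamily μ (fun _ => 0) stat where
  aesm := aestronglyMeasurable_const
  aesmS := continuous_stat.aestronglyMeasurable
  integrable c := by
    obtain ⟨C, hC0, hC⟩ := exists_ae_bound (V := (ℝ × E) →L[ℝ] ℝ) hμ continuous_stat
    have hm : AEStronglyMeasurable (fun b : E => stat b) μ := continuous_stat.aestronglyMeasurable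
    refine (integrable_const (exp (|c| * C))).mono' (continuous_exp.comp_aestronglyMeasurable
      ((hm.norm.const_mul c).const_add 0)) ?_
    filter_upwards [hC] with b hb
    rw [norm_of_nonneg (exp_pos _).le, zero_add]
    bound

lemma isProbabilityMeasure_loc (hμ : SuppIn μ R) (w : ℝ × E) : IsProbabilityMeasure (loc μ w) := by
  refine isProbabilityMeasure_tilted ?_
  have hc : Continuous fun b : E => exp (stat b w) :=
    continuous_exp.comp (continuous_stat.clm_apply continuous_const)
  obtain ⟨C, -, hC⟩ := exists_ae_bound hμ hc
  exact (integrable_const C).mono' hc.aestronglyMeasurable hC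

lemma loc_ae {p : E → Prop} (h : ∀ᵐ b ∂μ, p b) (w : ℝ × E) : ∀ᵐ b ∂loc μ w, p b :=
  (tilted_absolutelyContinuous _ _).ae_le h

/-- The mean of `φ` under the tilt. -/
def mom (μ : Measure E) (φ : E → V) (w : ℝ × E) : V := ∫ b, φ b ∂(loc μ w)

lemma integrable_loc (hμ : SuppIn μ R) {φ : E → V} (hφ : Continuous φ) (w : ℝ × E) :
    Integrable φ (loc μ w) := by
  have := isProbabilityMeasure_loc hμ w
  obtain ⟨C, -, hC⟩ := exists_ae_bound hμ hφ
  exact (integrable_const C).mono' hφ.aestronglyMeasurable (loc_ae hC w)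

lemma mom_const (hμ : SuppIn μ R) [CompleteSpace V] (c : V) (w : ℝ × E) :
    mom μ (fun _ => c) w = c := by
  have := isProbabilityMeasure_loc hμ w
  simp [mom]

lemma mom_add (hμ : SuppIn μ R) {φ ψ : E → V} (hφ : Continuous φ) (hψ : Continuous ψ) (w : ℝ × E) :
  mom μ (fun b => φ b + ψ b) w = mom μ φ w + mom μ ψ w := integral_add (integrable_loc hμ hφ w)
  (integrable_loc hμ hψ w)

lemma mom_sub (hμ : SuppIn μ R) {φ ψ : E → V} (hφ : Continuous φ) (hψ : Continuous ψ) (w : ℝ × E) :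
  mom μ (fun b => φ b - ψ b) w = mom μ φ w - mom μ ψ w := integral_sub (integrable_loc hμ hφ w)
  (integrable_loc hμ hψ w)

lemma mom_smul (c : ℝ) (φ : E → V) (w : ℝ × E) : mom μ (fun b => c • φ b) w = c • mom μ φ w :=
  integral_smul c _

lemma mom_sum (hμ : SuppIn μ R) {κ : Type*} (I : Finset κ) {φ : κ → E → V} (hφ : ∀ i, Continuous (φ
  i)) (w : ℝ × E) : mom μ (fun b => ∑ i ∈ I, φ i b) w = ∑ i ∈ I, mom μ (φ i) w := integral_finsetSum
  _ fun i _ => integrable_loc hμ (hφ i) w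

lemma mom_clm (hμ : SuppIn μ R) [CompleteSpace V] [CompleteSpace U] (L : V →L[ℝ] U) {φ : E → V} (hφ
  : Continuous φ) (w : ℝ × E) : mom μ (fun b => L (φ b)) w = L (mom μ φ w) := L.integral_comp_comm
  (integrable_loc hμ hφ w)

/-- The derivative of `mom`. -/
def momD (μ : Measure E) (φ : E → V) (w : ℝ × E) : (ℝ × E) →L[ℝ] V :=
  mom μ (fun b => (stat b).smulRight (φ b)) w - (mom μ stat w).smulRight (mom μ φ w)

lemma hasFDerivAt_mom (hμ : SuppIn μ R) [CompleteSpace V] {φ : E → V} (hφ : Continuous φ)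
    (w : ℝ × E) : HasFDerivAt (mom μ φ) (momD μ φ w) w := by
  obtain ⟨C, -, hC⟩ := exists_ae_bound hμ hφ
  have h1 : SubExp μ stat φ := subExp_of_bound hφ.aestronglyMeasurable hC
  have h2 := h1.hasFDerivAt_mean (isExpFamily_stat hμ) w
  aesop

lemma bddCont_mom (hμ : SuppIn μ R) [CompleteSpace V] {φ : E → V} (hφ : Continuous φ) :
    BddCont (mom μ φ) := by
  obtain ⟨C, -, hC⟩ := exists_ae_bound hμ hφ
  refine ⟨continuous_iff_continuousAt.2 fun w => (hasFDerivAt_mom hμ hφ w).continuousAt, C,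
    fun w => ?_⟩
  have := isProbabilityMeasure_loc hμ w
  have := norm_integral_le_of_norm_le_const (loc_ae hC w)
  aesop

lemma continuous_stat_smulRight {φ : E → V} (hφ : Continuous φ) : Continuous fun b : E => (stat
  b).smulRight (φ b) := ((smulRightL ℝ (ℝ × E) V).continuous.comp continuous_stat).clm_apply hφ

lemma bddCont_smulRight {α : Type*} [TopologicalSpace α] {W : Type*} [NormedAddCommGroup W]
    [NormedSpace ℝ W] {f : α → W →L[ℝ] ℝ} {g : α → V} (hf : BddCont f) (hg : BddCont g) :
    BddCont fun x => (f x).smulRight (g x) := by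
  obtain ⟨hfc, C, hC⟩ := hf
  obtain ⟨hgc, D, hD⟩ := hg
  refine ⟨((smulRightL ℝ W V).continuous.comp hfc).clm_apply hgc, C * D, fun x => ?_⟩
  rw [norm_smulRight_apply]
  exact mul_le_mul (hC x) (hD x) (norm_nonneg _) ((norm_nonneg _).trans (hC x))

lemma momD_apply (hμ : SuppIn μ R) [CompleteSpace V] {φ : E → V} (hφ : Continuous φ) (w v : ℝ × E) :
    momD μ φ w v = mom μ (fun b => stat b v • φ b) w - mom μ (fun b => stat b v) w • mom μ φ w := by
  have h1 := mom_clm hμ (ContinuousLinearMap.apply ℝ V v) (continuous_stat_smulRight hφ) w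
  have h2 := mom_clm hμ (ContinuousLinearMap.apply ℝ ℝ v) (continuous_stat (E := E)) w
  aesop

lemma stat_inr (b v : E) : stat b (0, v) = ⟪b, v⟫ := by simp [stat_apply]

lemma mom_inner (hμ : SuppIn μ R) (v : E) (w : ℝ × E) :
    mom μ (fun b => ⟪b, v⟫) w = ⟪bary μ w, v⟫ := by
  have := mom_clm hμ (innerSL ℝ v) (continuous_id (X := E)) w
  simp only [real_inner_comm v] at this ⊢
  exact this

/-- The second spatial derivative of `mom`. -/
def momK (μ : Measure E) (φ : E → V) (v : E) (w : ℝ × E) : V := mom μ (fun b => ⟪b, v⟫ ^ 2 • φ b) w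
  - (2 * ⟪bary μ w, v⟫) • mom μ (fun b => ⟪b, v⟫ • φ b) w + (2 * ⟪bary μ w, v⟫ ^ 2 - mom μ (fun b =>
  ⟪b, v⟫ ^ 2) w) • mom μ φ w

lemma bddCont_smul {α : Type*} [TopologicalSpace α] {f : α → ℝ} {g : α → V} (hf : BddCont f)
    (hg : BddCont g) : BddCont fun x => f x • g x := by
  obtain ⟨hfc, C, hC⟩ := hf
  obtain ⟨hgc, D, hD⟩ := hg
  refine ⟨hfc.smul hgc, C * D, fun x => ?_⟩
  rw [norm_smul]
  exact mul_le_mul (hC x) (hD x) (norm_nonneg _) ((norm_nonneg _).trans (hC x))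

lemma bddCont_clm_apply {α : Type*} [TopologicalSpace α] {f : α → V →L[ℝ] U} {g : α → V}
    (hf : BddCont f) (hg : BddCont g) : BddCont fun x => f x (g x) := by
  obtain ⟨hfc, C, hC⟩ := hf
  obtain ⟨hgc, D, hD⟩ := hg
  exact ⟨hfc.clm_apply hgc, C * D, fun x => (f x).le_of_opNorm_le_of_le (hC x) (hD x)⟩

/-- Means of fixed observables are in the domain of the generator. -/
lemma gen_mom (hμ : SuppIn μ R) [CompleteSpace V] {φ : E → V} (hφ : Continuous φ) :
    Gen e (mom μ φ) (momD μ φ) (fun i => momK μ φ (e i)) where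
  deriv := hasFDerivAt_mom hμ hφ
  bdd := (bddCont_mom hμ (continuous_stat_smulRight hφ)).sub
    (bddCont_smulRight (bddCont_mom hμ continuous_stat) (bddCont_mom hμ hφ))
  bddk i := by
    have ha : BddCont fun w => ⟪bary μ w, e i⟫ := by
      simp only [← mom_inner hμ]
      exact bddCont_mom hμ (by fun_prop)
    exact ((bddCont_mom hμ (by fun_prop)).sub (bddCont_smul ((BddCont.const 2).mul ha)
      (bddCont_mom hμ (by fun_prop)))).add (bddCont_smul (((BddCont.const 2).mul ha.pow).sub
      (bddCont_mom hμ (by fun_prop))) (bddCont_mom hμ hφ))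
  line i w := by
    obtain ⟨v, hv⟩ : ∃ v, v = e i := ⟨_, rfl⟩
    rw [← hv]
    have h1 : (fun w => momD μ φ w (0, v)) = fun w => mom μ (fun b => ⟪b, v⟫ • φ b) w -
        mom μ (fun b => ⟪b, v⟫) w • mom μ φ w := by
      ext1 w
      simp only [momD_apply hμ hφ, stat_inr]
    rw [h1]
    have d1 := hasFDerivAt_mom hμ (φ := fun b => ⟪b, v⟫ • φ b) (by fun_prop) w
    have d2 := hasFDerivAt_mom hμ (φ := fun b => ⟪b, v⟫) (by fun_prop) w
    have d := (d1.sub (d2.smul (hasFDerivAt_mom hμ hφ w))).hasLineDerivAt (0, v)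
    refine HasDerivAt.congr_deriv d ?_
    change momD μ (fun b => ⟪b, v⟫ • φ b) w (0, v) - (mom μ (fun b => ⟪b, v⟫) w • momD μ φ w (0, v)
      + momD μ (fun b => ⟪b, v⟫) w (0, v) • mom μ φ w) = _
    rw [momD_apply hμ (by fun_prop), momD_apply hμ hφ, momD_apply hμ (by fun_prop)]
    simp only [stat_inr, mom_inner hμ, momK, smul_smul, smul_eq_mul, ← sq]
    module

lemma gen_mom_eq_zero (hμ : SuppIn μ R) [CompleteSpace V] {φ : E → V} (hφ : Continuous φ)
    (w : ℝ × E) : gen μ (momD μ φ) (fun i => momK μ φ (e i)) w = 0 := by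
  have hpars : ∀ x : E, ∑ i, ⟪x, e i⟫ ^ 2 = ‖x‖ ^ 2 := fun x => e.sum_sq_inner_left x
  have h1 : ∑ i, mom μ (fun b => ⟪b, e i⟫ ^ 2 • φ b) w = mom μ (fun b => ‖b‖ ^ 2 • φ b) w := by
    rw [← mom_sum hμ _ (fun i => by fun_prop)]
    simp only [← sum_smul, hpars]
  have h2 : ∑ i, mom μ (fun b => ⟪b, e i⟫ ^ 2) w = mom μ (fun b => ‖b‖ ^ 2) w := by
    rw [← mom_sum hμ _ (fun i => by fun_prop)]
    grind
  have h3 : ∑ i, (2 * ⟪bary μ w, e i⟫) • mom μ (fun b => ⟪b, e i⟫ • φ b) w =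
      (2 : ℝ) • mom μ (fun b => ⟪b, bary μ w⟫ • φ b) w := by
    simp only [mul_smul, ← smul_sum]
    congr 1
    simp only [← mom_smul]
    rw [← mom_sum hμ _ (fun i => by fun_prop)]
    simp only [smul_smul, ← sum_smul]
    congr 1
    ext1 b
    congr 1
    rw [← e.sum_inner_mul_inner b (bary μ w)]
    refine sum_congr rfl fun i _ => ?_
    rw [real_inner_comm (e i) (bary μ w)]; ring
  simp only [gen, momK, momD_apply hμ hφ, sum_add_distrib, sum_sub_distrib,
    ← sum_smul, h1, h2, h3, ← mul_sum, hpars]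
  have h4 : mom μ (fun b => stat b (1, bary μ w) • φ b) w = (-(1 / 2) : ℝ) • mom μ (fun b => ‖b‖ ^ 2
      • φ b) w + mom μ (fun b => ⟪b, bary μ w⟫ • φ b) w := by
    rw [← mom_smul, ← mom_add hμ (by fun_prop) (by fun_prop)]
    congr 1; ext1 b
    rw [stat_apply, smul_smul, ← add_smul]
    ring_nf
  have h5 : mom μ (fun b => stat b (1, bary μ w)) w =
      -(1 / 2) * mom μ (fun b => ‖b‖ ^ 2) w + ‖bary μ w‖ ^ 2 := by
    rw [← real_inner_self_eq_norm_sq, ← mom_inner hμ, ← smul_eq_mul, ← mom_smul,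
      ← mom_add hμ (by fun_prop) (by fun_prop)]
    congr 1; ext1 b
    rw [stat_apply, smul_eq_mul]; ring
  rw [h4, h5]
  module

/-- Composition with a twice differentiable function. -/
lemma Gen.comp {G : ℝ × E → V} {G' : ℝ × E → (ℝ × E) →L[ℝ] V} {k : ι → ℝ × E → V} (hG : Gen e G G'
    k) {𝒦 : Set V} (h𝒦 : IsCompact 𝒦) (hG𝒦 : ∀ w, G w ∈ 𝒦) {Φ : V → U} {Φ' : V → V →L[ℝ] U} {Φ'' : V
    → V →L[ℝ] V →L[ℝ] U} (h1 : ∀ z ∈ 𝒦, HasFDerivAt Φ (Φ' z) z) (h2 : ∀ z ∈ 𝒦, HasFDerivAt Φ' (Φ''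
    z) z) (h3 : ContinuousOn Φ'' 𝒦) : Gen e (fun w => Φ (G w)) (fun w => (Φ' (G w)).comp (G' w))
    (fun i w => Φ' (G w) (k i w) + Φ'' (G w) (G' w (0, e i)) (G' w (0, e i))) := by
  have hGc := continuous_iff_continuousAt.2 fun w => (hG.deriv w).continuousAt
  have b' : BddCont fun w => Φ' (G w) := by
    have hc : ContinuousOn Φ' 𝒦 := fun z hz => (h2 z hz).continuousAt.continuousWithinAt
    obtain ⟨C, hC⟩ := h𝒦.exists_bound_of_continuousOn hc
    exact ⟨hc.comp_continuous hGc hG𝒦, C, fun w => hC _ (hG𝒦 w)⟩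
  have b'' : BddCont fun w => Φ'' (G w) := by
    obtain ⟨C, hC⟩ := h𝒦.exists_bound_of_continuousOn (E := V →L[ℝ] V →L[ℝ] U) h3
    exact ⟨h3.comp_continuous hGc hG𝒦, C, fun w => hC _ (hG𝒦 w)⟩
  have bd : ∀ i, BddCont fun w => G' w (0, e i) := fun i =>
    bddCont_clm_apply hG.bdd (BddCont.const _)
  refine ⟨fun w => (h1 _ (hG𝒦 w)).comp w (hG.deriv w), fun i w => ?_, ?_, fun i => ?_⟩
  · have l1 := (hG.deriv w).hasLineDerivAt (0, e i)
    have l2 : HasDerivAt (fun t : ℝ => G' (w + t • (0, e i)) (0, e i)) (k i w) 0 := hG.line i w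
    have l3 : HasFDerivAt Φ' (Φ'' (G w)) (G (w + (0 : ℝ) • (0, e i))) := by simp_all
    have l4 := l3.comp_hasDerivAt (0 : ℝ) l1
    have l5 := l4.clm_apply l2
    have l6 : w + (0 : ℝ) • ((0, e i) : ℝ × E) = w := by simp
    refine l5.congr_deriv ?_
    simp only [Function.comp_apply, l6]
    exact add_comm _ _
  · obtain ⟨hc, C, hC⟩ := b'
    obtain ⟨hc', D, hD⟩ := hG.bdd
    refine ⟨hc.clm_comp hc', C * D, fun w => ?_⟩
    exact (opNorm_comp_le _ _).trans
      (mul_le_mul (hC w) (hD w) (norm_nonneg _) ((norm_nonneg _).trans (hC w)))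
  · exact (bddCont_clm_apply b' (hG.bddk i)).add (bddCont_clm_apply (bddCont_clm_apply b'' (bd i))
      (bd i))

lemma gen_comp {G' : ℝ × E → (ℝ × E) →L[ℝ] V} {k : ι → ℝ × E → V} {G : ℝ × E → V} {Φ' : V → V →L[ℝ]
    U} {Φ'' : V → V →L[ℝ] V →L[ℝ] U} (w : ℝ × E) : gen μ (fun w => (Φ' (G w)).comp (G' w)) (fun i w
    => Φ' (G w) (k i w) + Φ'' (G w) (G' w (0, e i)) (G' w (0, e i))) w = Φ' (G w) (gen μ G' k w) +
    (1 / 2 : ℝ) • ∑ i, Φ'' (G w) (G' w (0, e i)) (G' w (0, e i)) := by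
  simp only [gen, comp_apply, map_add, map_smul, map_sum, sum_add_distrib, smul_add, add_assoc]

end Moments

section Resolvent

variable {𝔸 : Type*} [NormedRing 𝔸] [NormedAlgebra ℝ 𝔸] [CompleteSpace 𝔸]

/-- The resolvent `(1 + A)⁻¹`. -/
def res (A : 𝔸) : 𝔸 := Ring.inverse (1 + A)

/-- The bounded transform `A (1 + A)⁻¹`. -/
def shr (A : 𝔸) : 𝔸 := 1 - res A

/-- The function `λ ↦ λ² (λ / (1 + λ)) ^ m` applied to an algebra element. -/
def quadPow (m : ℕ) (A : 𝔸) : 𝔸 := A * A * shr A ^ m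

/-- The derivative of `λ ↦ λ² (λ / (1 + λ)) ^ m` applied to an algebra element. -/
def quadPowD (m : ℕ) (A : 𝔸) : 𝔸 := (2 : ℝ) • (A * shr A ^ m) + (m : ℝ) • shr A ^ (m + 1)

variable {A : 𝔸}

lemma contDiffAt_shr (h : IsUnit (1 + A)) : ContDiffAt ℝ 2 (shr : 𝔸 → 𝔸) A := by
  obtain ⟨u, hu⟩ := h
  have h1 : ContDiffAt ℝ 2 (Ring.inverse : 𝔸 → 𝔸) (1 + A) := hu ▸ contDiffAt_ringInverse ℝ u
  have h2 := h1.comp A (contDiffAt_const.add contDiffAt_id)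
  exact contDiffAt_const.sub h2

lemma hasFDerivAt_shr (h : IsUnit (1 + A)) :
    HasFDerivAt (shr : 𝔸 → 𝔸) (mulLeftRight ℝ 𝔸 (res A) (res A)) A := by
  obtain ⟨u, hu⟩ := h
  have h1 := hasFDerivAt_ringInverse (𝕜 := ℝ) u
  have h2 : (↑u⁻¹ : 𝔸) = res A := by rw [res, ← hu, Ring.inverse_unit]
  rw [h2, hu] at h1
  have h3 := (h1.comp A ((hasFDerivAt_id A).const_add 1)).const_sub 1
  aesop

lemma hasFDerivAt_shr_pow (h : IsUnit (1 + A)) (m : ℕ) : ∃ L : 𝔸 →L[ℝ] 𝔸, HasFDerivAt (fun A : 𝔸 =>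
    shr A ^ m) L A ∧ ∀ U, L U = ∑ i ∈ Finset.range m, shr A ^ (m - 1 - i) * (res A * U * res A) *
    shr A ^ i := by
  refine ⟨_, (hasFDerivAt_shr h).pow' m, fun U => ?_⟩
  simp

lemma hasFDerivAt_quadPow (h : IsUnit (1 + A)) (m : ℕ) : ∃ L : 𝔸 →L[ℝ] 𝔸, HasFDerivAt (quadPow m : 𝔸
    → 𝔸) L A ∧ ∀ U, L U = (U * A + A * U) * shr A ^ m + A * A * ∑ i ∈ Finset.range m, shr A ^ (m - 1
    - i) * (res A * U * res A) * shr A ^ i := by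
  obtain ⟨L, hL, hL'⟩ := hasFDerivAt_shr_pow h m
  refine ⟨_, ((hasFDerivAt_id A).mul' (hasFDerivAt_id A)).mul' hL, fun U => ?_⟩
  simp [hL', add_mul]
  abel

lemma hasFDerivAt_quadPowD (h : IsUnit (1 + A)) (m : ℕ) : ∃ L : 𝔸 →L[ℝ] 𝔸, HasFDerivAt (quadPowD m :
    𝔸 → 𝔸) L A ∧ ∀ U, L U = (2 : ℝ) • (U * shr A ^ m + A * ∑ i ∈ Finset.range m, shr A ^ (m - 1 - i)
    * (res A * U * res A) * shr A ^ i) + (m : ℝ) • ∑ i ∈ Finset.range (m + 1), shr A ^ (m - i) *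
    (res A * U * res A) * shr A ^ i := by
  obtain ⟨L, hL, hL'⟩ := hasFDerivAt_shr_pow h m
  obtain ⟨L₁, hL₁, hL₁'⟩ := hasFDerivAt_shr_pow h (m + 1)
  refine ⟨_, (((hasFDerivAt_id A).mul' hL).const_smul (2 : ℝ)).add (hL₁.const_smul (m : ℝ)),
    fun U => ?_⟩
  simp [hL', hL₁', add_comm]

lemma contDiffAt_quadPowD (h : IsUnit (1 + A)) (m : ℕ) : ContDiffAt ℝ 2 (quadPowD m : 𝔸 → 𝔸) A :=
  ((contDiffAt_id.mul ((contDiffAt_shr h).pow m)).const_smul (2 : ℝ)).add (((contDiffAt_shr h).pow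
  (m + 1)).const_smul (m : ℝ))

lemma res_mul (h : IsUnit (1 + A)) : res A * A = shr A := by
  have := Ring.inverse_mul_cancel _ h
  rw [mul_add, mul_one] at this
  rw [shr, ← this, res]; abel

lemma mul_res (h : IsUnit (1 + A)) : A * res A = shr A := by
  have := Ring.mul_inverse_cancel _ h
  rw [add_mul, one_mul] at this
  rw [shr, ← this, res]; abel

lemma commute_shr (h : IsUnit (1 + A)) : Commute A (shr A) := by
  have : Commute A (res A) := by rw [Commute, SemiconjBy, mul_res h, res_mul h]
  exact (Commute.one_right A).sub_right this

lemma commute_res_shr : Commute (res A) (shr A) := (Commute.one_right _).sub_right (Commute.refl _)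

/-- The trace form `τ (quadPowD m A * ·)`. -/
def trForm (τ : 𝔸 →L[ℝ] ℝ) (m : ℕ) (A : 𝔸) : 𝔸 →L[ℝ] ℝ :=
  τ.comp (ContinuousLinearMap.mul ℝ 𝔸 (quadPowD m A))

lemma hasFDerivAt_trace_quadPow {τ : 𝔸 →L[ℝ] ℝ} (hτ : ∀ a b, τ (a * b) = τ (b * a)) (h : IsUnit (1 +
    A)) (m : ℕ) : HasFDerivAt (fun A : 𝔸 => τ (quadPow m A)) (trForm τ m A) A := by
  obtain ⟨L, hL, hL'⟩ := hasFDerivAt_quadPow h m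
  refine (τ.hasFDerivAt.comp A hL).congr_fderiv ?_
  ext U
  have hc := commute_shr h
  have hcr := commute_res_shr (A := A)
  change τ (L U) = τ (quadPowD m A * U)
  rw [hL', mul_sum, map_add, map_sum]
  have h1 : ∀ i ∈ Finset.range m, τ (A * A * (shr A ^ (m - 1 - i) * (res A * U * res A) * shr A ^
      i)) = τ (shr A ^ (m + 1) * U) := fun i hi => by
    have hi' : i < m := Finset.mem_range.1 hi
    have e1 : A * A * (shr A ^ (m - 1 - i) * (res A * U * res A) * shr A ^ i) = (A * A * shr A ^ (m
      - 1 - i) * res A) * (U * (res A * shr A ^ i)) := by grind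
    rw [e1, hτ, mul_assoc, hτ]
    congr 2
    have e2 : shr A ^ (m + 1) = shr A ^ 2 * (shr A ^ i * shr A ^ (m - 1 - i)) := by
      rw [← pow_add, ← pow_add]; congr 1; omega
    calc res A * shr A ^ i * (A * A * shr A ^ (m - 1 - i) * res A)
        = shr A ^ i * (res A * A) * (A * res A) * shr A ^ (m - 1 - i) := by
          rw [(hcr.pow_right i).eq]
          simp only [mul_assoc]
          rw [(hcr.pow_right (m - 1 - i)).eq]
      _ = shr A ^ (m + 1) := by
          rw [res_mul h, mul_res h]
          simp only [← pow_succ, ← pow_add]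
          congr 1; omega
  have h2 : τ ((U * A + A * U) * shr A ^ m) = τ ((2 : ℝ) • (A * shr A ^ m) * U) := by
    have e1 : τ (U * A * shr A ^ m) = τ (A * shr A ^ m * U) := by rw [mul_assoc, hτ]
    have e2 : τ (A * U * shr A ^ m) = τ (A * shr A ^ m * U) := by
      rw [hτ, ← mul_assoc, (hc.pow_right m).eq]
    rw [add_mul, map_add, e1, e2, smul_mul_assoc, map_smul, smul_eq_mul, two_mul]
  rw [h2, sum_congr rfl h1, quadPowD, add_mul, map_add, smul_mul_assoc (m : ℝ), map_smul τ (m : ℝ)]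
  simp

lemma hasFDerivAt_trForm {τ : 𝔸 →L[ℝ] ℝ} (h : IsUnit (1 + A)) (m : ℕ) : HasFDerivAt (trForm τ m)
    (fderiv ℝ (trForm τ m) A) A ∧ ContinuousAt (fderiv ℝ (trForm τ m)) A ∧ ∀ U V, fderiv ℝ (trForm τ
    m) A U V = τ (((2 : ℝ) • (U * shr A ^ m + A * ∑ i ∈ Finset.range m, shr A ^ (m - 1 - i) * (res A
    * U * res A) * shr A ^ i) + (m : ℝ) • ∑ i ∈ Finset.range (m + 1), shr A ^ (m - i) * (res A * U *
    res A) * shr A ^ i) * V) := by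
  obtain ⟨T, hT⟩ : ∃ T : 𝔸 →L[ℝ] 𝔸 →L[ℝ] ℝ, ∀ x y, T x y = τ (x * y) :=
    ⟨(ContinuousLinearMap.compL ℝ 𝔸 𝔸 ℝ τ).comp (ContinuousLinearMap.mul ℝ 𝔸), fun x y => rfl⟩
  have he : trForm τ m = fun A => T (quadPowD m A) := by aesop
  have hcd : ContDiffAt ℝ 2 (trForm τ m) A := by
    rw [he]
    exact T.contDiff.contDiffAt.comp A (contDiffAt_quadPowD h m)
  refine ⟨(hcd.differentiableAt (by norm_num)).hasFDerivAt, hcd.continuousAt_fderiv (by norm_num),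
    fun U V => ?_⟩
  obtain ⟨L, hL, hL'⟩ := hasFDerivAt_quadPowD h m
  have h1 : HasFDerivAt (trForm τ m) (T.comp L) A := by
    rw [he]
    exact T.hasFDerivAt.comp A hL
  rw [h1.fderiv, comp_apply, hT, hL']

end Resolvent

section Quadratic

variable {V U : Type*} [NormedAddCommGroup V] [NormedSpace ℝ V] [NormedAddCommGroup U]
  [NormedSpace ℝ U]

/-- The derivative of `z ↦ L z - q z z`. -/
def quadD (L : V →L[ℝ] U) (q : V →L[ℝ] V →L[ℝ] U) (z : V) : V →L[ℝ] U := L - (q + q.flip) z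

/-- The second derivative of `z ↦ L z - q z z`. -/
def quadDD (q : V →L[ℝ] V →L[ℝ] U) : V →L[ℝ] V →L[ℝ] U := -(q + q.flip)

lemma quadDD_apply (q : V →L[ℝ] V →L[ℝ] U) (u v : V) : quadDD q u v = -(q u v + q v u) := rfl

lemma hasFDerivAt_quad (L : V →L[ℝ] U) (q : V →L[ℝ] V →L[ℝ] U) (z : V) :
    HasFDerivAt (fun z => L z - q z z) (quadD L q z) z := by
  refine (L.hasFDerivAt.sub (q.hasFDerivAt_of_bilinear (hasFDerivAt_id z)
    (hasFDerivAt_id z))).congr_fderiv ?_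
  aesop

lemma hasFDerivAt_quadD (L : V →L[ℝ] U) (q : V →L[ℝ] V →L[ℝ] U) (z : V) :
    HasFDerivAt (quadD L q) (quadDD q) z := by
  refine (((q + q.flip).hasFDerivAt (x := z)).const_sub L).congr_fderiv ?_
  bound

end Quadratic

section Covariance

variable {E : Type*} [NormedAddCommGroup E] [InnerProductSpace ℝ E] [FiniteDimensional ℝ E]

/-- The operator `x ↦ ⟪a, x⟫ c`, bilinear in `a` and `c`. -/
def tens : E →L[ℝ] E →L[ℝ] E →L[ℝ] E := LinearMap.toContinuousLinearMap
    { toFun := fun a => (smulRightL ℝ E E) (innerSL ℝ a)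
      map_add' := fun a b => by simp
      map_smul' := fun c a => by ext; simp }

lemma tens_apply (a c x : E) : tens a c x = ⟪a, x⟫ • c := rfl

/-- The trace of a continuous linear operator. -/
def trL : (E →L[ℝ] E) →L[ℝ] ℝ :=
  LinearMap.toContinuousLinearMap ((LinearMap.trace ℝ E).comp (ContinuousLinearMap.coeLM ℝ))

lemma trL_mul_comm (S T : E →L[ℝ] E) : trL (S * T) = trL (T * S) :=
  LinearMap.trace_mul_comm ℝ (S : E →ₗ[ℝ] E) (T : E →ₗ[ℝ] E)

lemma trL_eq_sum {ι : Type*} [Fintype ι] (e : OrthonormalBasis ι ℝ E) (T : E →L[ℝ] E) : trL T = ∑ i,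
  ⟪e i, T (e i)⟫ := LinearMap.trace_eq_sum_inner (T : E →ₗ[ℝ] E) e

/-- The symmetric positive semidefinite operators of norm at most `C`. -/
def psd (E : Type*) [NormedAddCommGroup E] [InnerProductSpace ℝ E] (C : ℝ) : Set (E →L[ℝ] E) :=
  {A | (∀ x y, ⟪A x, y⟫ = ⟪x, A y⟫) ∧ (∀ x, 0 ≤ ⟪A x, x⟫) ∧ ‖A‖ ≤ C}

lemma isCompact_psd (C : ℝ) : IsCompact (psd E C) := by
  refine (isCompact_closedBall (0 : E →L[ℝ] E) C).of_isClosed_subset ?_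
    fun A hA => by simpa using hA.2.2
  have h : ∀ x : E, Continuous fun A : E →L[ℝ] E => A x := fun x =>
    (ContinuousLinearMap.apply ℝ E x).continuous
  have e : psd E C = (⋂ x, ⋂ y, {A : E →L[ℝ] E | ⟪A x, y⟫ = ⟪x, A y⟫}) ∩ ((⋂ x, {A : E →L[ℝ] E | 0 ≤
    ⟪A x, x⟫}) ∩ {A | ‖A‖ ≤ C}) := by aesop
  rw [e]
  refine (isClosed_iInter fun x => isClosed_iInter fun y => isClosed_eq ((h x).inner
    continuous_const) (continuous_const.inner (h y))).inter ((isClosed_iInter fun x => isClosed_le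
    continuous_const ((h x).inner continuous_const)).inter (isClosed_le continuous_norm
    continuous_const))

lemma isUnit_one_add_of_psd {C : ℝ} {A : E →L[ℝ] E} (hA : A ∈ psd E C) : IsUnit (1 + A) := by
  refine ContinuousLinearMap.isUnit_of_forall_le_norm_inner_map (1 + A) (c := 1) one_pos fun x => ?_
  have := hA.2.1 x
  rw [_root_.add_apply, inner_add_left, one_apply_eq_self,
    real_inner_self_eq_norm_sq, norm_of_nonneg (by positivity)]
  simp [this]

/-- The second moment and the barycenter, as a moment map. -/
def sec (b : E) : (E →L[ℝ] E) × E := (tens b b, b)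

lemma continuous_sec : Continuous (sec : E → (E →L[ℝ] E) × E) :=
  Continuous.prodMk ((tens.continuous).clm_apply continuous_id) continuous_id

variable [MeasurableSpace E] [BorelSpace E] {μ : Measure E} [IsProbabilityMeasure μ] {R : ℝ}
  {ι : Type*} [Fintype ι] {e : OrthonormalBasis ι ℝ E}

/-- The bilinear map `(M, a), (M', a') ↦ a ⊗ a'`. -/
def tensSnd : (E →L[ℝ] E) × E →L[ℝ] (E →L[ℝ] E) × E →L[ℝ] E →L[ℝ] E :=
  tens.bilinearComp (snd ℝ _ _) (snd ℝ _ _)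

/-- The covariance operator of the tilted measure. -/
def cov (μ : Measure E) (w : ℝ × E) : E →L[ℝ] E :=
  (mom μ sec w).1 - tensSnd (mom μ sec w) (mom μ sec w)

/-- The derivative of `cov`. -/
def covD (μ : Measure E) (w : ℝ × E) : (ℝ × E) →L[ℝ] E →L[ℝ] E :=
  (quadD (fst ℝ _ _) tensSnd (mom μ sec w)).comp (momD μ sec w)

/-- The second derivative of `cov` in direction `v`. -/
def covK (μ : Measure E) (v : E) (w : ℝ × E) : E →L[ℝ] E := quadD (fst ℝ _ _) tensSnd (mom μ sec w)
  (momK μ sec v w) + quadDD tensSnd (momD μ sec w (0, v)) (momD μ sec w (0, v))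

lemma mom_sec_mem (hμ : SuppIn μ R) :
    ∃ 𝒦 : Set ((E →L[ℝ] E) × E), IsCompact 𝒦 ∧ ∀ w, mom μ sec w ∈ 𝒦 := by
  obtain ⟨C, hC⟩ := (bddCont_mom hμ (continuous_sec (E := E))).bdd
  exact ⟨closedBall 0 C, isCompact_closedBall _ _, fun w => by simp_all⟩

lemma mom_sec_snd (hμ : SuppIn μ R) (w : ℝ × E) : (mom μ sec w).2 = bary μ w :=
  (mom_clm hμ (snd ℝ (E →L[ℝ] E) E) continuous_sec w).symm

lemma mom_sec_fst (hμ : SuppIn μ R) (w : ℝ × E) (u v : E) :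
    ⟪(mom μ sec w).1 u, v⟫ = mom μ (fun b => ⟪b, u⟫ * ⟪b, v⟫) w := by
  have h := mom_clm hμ ((innerSL ℝ v).comp ((ContinuousLinearMap.apply ℝ E u).comp
    (fst ℝ (E →L[ℝ] E) E))) continuous_sec w
  rw [real_inner_comm]
  refine h.symm.trans (integral_congr_ae (.of_forall fun b => ?_))
  change ⟪v, ⟪b, u⟫ • b⟫ = ⟪b, u⟫ * ⟪b, v⟫
  rw [inner_smul_right, real_inner_comm v]

lemma mom_centered₂ (hμ : SuppIn μ R) (w : ℝ × E) {f g : E → ℝ} (hf : Continuous f) (hg : Continuous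
    g) : mom μ (fun b => (f b - mom μ f w) * (g b - mom μ g w)) w = mom μ (fun b => f b * g b) w -
    mom μ f w * mom μ g w := by
  generalize hα : mom μ f w = α
  generalize hβ : mom μ g w = β
  have e : (fun b => (f b - α) * (g b - β)) = fun b => f b * g b - α • g b - β • f b + α * β := by
    ext b; simp only [smul_eq_mul]; ring
  rw [e, mom_add hμ (by fun_prop) (by fun_prop), mom_sub hμ (by fun_prop) (by fun_prop),
    mom_sub hμ (by fun_prop) (by fun_prop), mom_smul, mom_smul, mom_const hμ, hα, hβ]
  ring

lemma mom_centered₃ (hμ : SuppIn μ R) (w : ℝ × E) {f g h : E → ℝ} (hf : Continuous f) (hg :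
    Continuous g) (hh : Continuous h) : mom μ (fun b => (f b - mom μ f w) * (g b - mom μ g w) * (h b
    - mom μ h w)) w = mom μ (fun b => f b * g b * h b) w - mom μ f w * mom μ (fun b => g b * h b) w
    - mom μ g w * mom μ (fun b => f b * h b) w - mom μ h w * mom μ (fun b => f b * g b) w + 2 * (mom
    μ f w * mom μ g w * mom μ h w) := by
  generalize hα : mom μ f w = α
  generalize hβ : mom μ g w = β
  generalize hγ : mom μ h w = γ
  have e : (fun b => (f b - α) * (g b - β) * (h b - γ)) = fun b => f b * g b * h b - α • (g b * h b)
      - β • (f b * h b) - γ • (f b * g b) + (α * β) • h b + (α * γ) • g b + (β * γ) • f b - α * β *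
      γ := by
    ext b; simp only [smul_eq_mul]; ring
  rw [e, mom_sub hμ (by fun_prop) (by fun_prop), mom_add hμ (by fun_prop) (by fun_prop), mom_add hμ
    (by fun_prop) (by fun_prop), mom_add hμ (by fun_prop) (by fun_prop), mom_sub hμ (by fun_prop)
    (by fun_prop), mom_sub hμ (by fun_prop) (by fun_prop), mom_sub hμ (by fun_prop) (by fun_prop),
    mom_smul, mom_smul, mom_smul, mom_smul, mom_smul, mom_smul, mom_const hμ, hα, hβ, hγ]
  ring

lemma inner_cov' (hμ : SuppIn μ R) (w : ℝ × E) (u v : E) : ⟪cov μ w u, v⟫ = mom μ (fun b => ⟪b, u⟫ *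
    ⟪b, v⟫) w - ⟪bary μ w, u⟫ * ⟪bary μ w, v⟫ := by
  change ⟪(mom μ sec w).1 u - tens (mom μ sec w).2 (mom μ sec w).2 u, v⟫ = _
  rw [inner_sub_left, mom_sec_fst hμ, mom_sec_snd hμ, tens_apply, inner_smul_left]
  rfl

lemma inner_cov (hμ : SuppIn μ R) (w : ℝ × E) (u v : E) :
    ⟪cov μ w u, v⟫ = mom μ (fun b => ⟪b - bary μ w, u⟫ * ⟪b - bary μ w, v⟫) w := by
  have h := mom_centered₂ hμ w (f := fun b => ⟪b, u⟫) (g := fun b => ⟪b, v⟫) (by fun_prop)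
    (by fun_prop)
  simp only [mom_inner hμ, ← inner_sub_left] at h
  rw [inner_cov' hμ, h]

lemma momD_clm (hμ : SuppIn μ R) {V : Type*} [NormedAddCommGroup V] [NormedSpace ℝ V] [CompleteSpace
    V] {φ : E → V} (hφ : Continuous φ) (L : V →L[ℝ] ℝ) (w : ℝ × E) (v : E) : L (momD μ φ w (0, v)) =
    mom μ (fun b => ⟪b, v⟫ * L (φ b)) w - ⟪bary μ w, v⟫ * mom μ (fun b => L (φ b)) w := by
  have hc : Continuous fun b : E => ⟪b, v⟫ • φ b := by fun_prop
  rw [momD_apply hμ hφ, map_sub, map_smul]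
  simp only [stat_inr, mom_inner hμ]
  rw [← mom_clm hμ L hφ, ← mom_clm hμ L hc]
  simp

lemma momD_sec_snd (hμ : SuppIn μ R) (w : ℝ × E) (v : E) : (momD μ sec w (0, v)).2 = cov μ w v := by
  refine ext_inner_left ℝ fun y => ?_
  have h := momD_clm hμ continuous_sec ((innerSL ℝ y).comp (snd ℝ (E →L[ℝ] E) E)) w v
  rw [real_inner_comm (cov μ w v) y, inner_cov' hμ, ← mom_inner hμ y]
  simp only [real_inner_comm y]
  exact h

lemma momD_sec_fst (hμ : SuppIn μ R) (w : ℝ × E) (v x y : E) : ⟪(momD μ sec w (0, v)).1 x, y⟫ = mom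
    μ (fun b => ⟪b, v⟫ * ⟪b, x⟫ * ⟪b, y⟫) w - ⟪bary μ w, v⟫ * mom μ (fun b => ⟪b, x⟫ * ⟪b, y⟫) w :=
    by
  have h := momD_clm hμ continuous_sec ((innerSL ℝ y).comp ((ContinuousLinearMap.apply ℝ E x).comp
    (fst ℝ (E →L[ℝ] E) E))) w v
  have e : ∀ b : E, ((innerSL ℝ y).comp ((ContinuousLinearMap.apply ℝ E x).comp
      (fst ℝ (E →L[ℝ] E) E))) (sec b) = ⟪b, x⟫ * ⟪b, y⟫ := fun b => by
    change ⟪y, ⟪b, x⟫ • b⟫ = _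
    rw [inner_smul_right, real_inner_comm y]
  simp only [e, ← mul_assoc] at h
  rw [real_inner_comm, ← h]
  rfl

lemma inner_covD (hμ : SuppIn μ R) (w : ℝ × E) (v x y : E) : ⟪covD μ w (0, v) x, y⟫ = mom μ (fun b
    => ⟪b - bary μ w, v⟫ * ⟪b - bary μ w, x⟫ * ⟪b - bary μ w, y⟫) w := by
  have h := mom_centered₃ hμ w (f := fun b => ⟪b, v⟫) (g := fun b => ⟪b, x⟫)
    (h := fun b => ⟪b, y⟫) (by fun_prop) (by fun_prop) (by fun_prop)
  simp only [mom_inner hμ, ← inner_sub_left] at h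
  have e : covD μ w (0, v) x = (momD μ sec w (0, v)).1 x - (⟪(mom μ sec w).2, x⟫ • (momD μ sec w (0,
      v)).2 + ⟪(momD μ sec w (0, v)).2, x⟫ • (mom μ sec w).2) := rfl
  rw [h, e, inner_sub_left, inner_add_left, inner_smul_left, inner_smul_left, momD_sec_snd hμ,
    momD_sec_fst hμ, mom_sec_snd hμ, inner_cov' hμ, inner_cov' hμ]
  simp only [conj_trivial]
  ring

lemma cov_symm (hμ : SuppIn μ R) (w : ℝ × E) (x y : E) : ⟪cov μ w x, y⟫ = ⟪x, cov μ w y⟫ := by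
  rw [real_inner_comm _ x, inner_cov hμ, inner_cov hμ]
  grind

lemma cov_mem_psd (hμ : SuppIn μ R) : ∃ C, ∀ w, cov μ w ∈ psd E C := by
  obtain ⟨𝒦, h𝒦, hm⟩ := mom_sec_mem hμ
  obtain ⟨C, hC⟩ := h𝒦.exists_bound_of_continuousOn (f := fun z => z.1 - tensSnd z z) (by fun_prop)
  refine ⟨C, fun w => ⟨cov_symm hμ w, fun x => ?_, hC _ (hm w)⟩⟩
  rw [inner_cov hμ]
  exact integral_nonneg fun b => mul_self_nonneg _

lemma gen_cov (hμ : SuppIn μ R) : Gen e (cov μ) (covD μ) (fun i => covK μ (e i)) := by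
  obtain ⟨𝒦, h𝒦, hm⟩ := mom_sec_mem hμ
  exact (gen_mom (e := e) hμ continuous_sec).comp h𝒦 hm (fun z _ => hasFDerivAt_quad (fst ℝ _ _)
    tensSnd z) (fun z _ => hasFDerivAt_quadD (fst ℝ _ _) tensSnd z) continuousOn_const

lemma gen_cov_eq (hμ : SuppIn μ R) (w : ℝ × E) :
    gen μ (covD μ) (fun i => covK μ (e i)) w = -(cov μ w * cov μ w) := by
  have h := gen_comp (e := e) (μ := μ) (G := mom μ sec) (G' := momD μ sec) (k := fun i => momK μ sec
    (e i)) (Φ' := quadD (fst ℝ (E →L[ℝ] E) E) tensSnd) (Φ'' := fun _ => quadDD tensSnd) w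
  rw [gen_mom_eq_zero hμ continuous_sec, map_zero, zero_add] at h
  refine h.trans ?_
  have e1 : ∀ i, quadDD tensSnd (momD μ sec w (0, e i)) (momD μ sec w (0, e i)) =
      (-2 : ℝ) • tens (cov μ w (e i)) (cov μ w (e i)) := fun i => by
    rw [← momD_sec_snd hμ, quadDD_apply, ← two_smul ℝ, ← neg_smul]
    rfl
  simp only [e1, ← smul_sum, smul_smul]
  ext x
  refine ext_inner_right ℝ fun y => ?_
  have e2 : (∑ i, tens (cov μ w (e i)) (cov μ w (e i))) x = ∑ i, ⟪cov μ w (e i), x⟫ • cov μ w (e i) := by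
    rw [_root_.sum_apply]
    rfl
  have e3 : (-(cov μ w * cov μ w)) x = -(cov μ w (cov μ w x)) := rfl
  rw [e3, inner_neg_left, cov_symm hμ, ← e.sum_inner_mul_inner (cov μ w x), _root_.smul_apply,
    e2, inner_smul_left, sum_inner, conj_trivial]
  norm_num
  refine sum_congr rfl fun i _ => ?_
  rw [inner_smul_left, conj_trivial, cov_symm hμ, cov_symm hμ _ (e i), real_inner_comm (e i)]

end Covariance

section Weights

/-- The second derivative of `λ ↦ λ² (λ / (1 + λ)) ^ m`, in terms of `x = λ / (1 + λ)`. -/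
def hess (m : ℕ) (x : ℝ) : ℝ := x ^ m * (2 + 2 * m * (1 - x) + m * (m + 1) * (1 - x) ^ 2)

lemma hess_mono (m : ℕ) {x y : ℝ} (hx : 0 ≤ x) (hxy : x ≤ y) (hy : y ≤ 1) :
    hess m x ≤ hess m y := by
  have hd : ∀ z : ℝ, HasDerivAt (hess m) (m * z ^ (m - 1) * (2 + 2 * m * (1 - z) + m * (m + 1) * (1
      - z) ^ 2) + z ^ m * (-(2 * m) - 2 * (m * (m + 1)) * (1 - z))) z := fun z => by
    have h1 : HasDerivAt (fun z : ℝ => 1 - z) (-1) z := by simpa using (hasDerivAt_id z).const_sub 1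
    refine ((hasDerivAt_pow m z).mul (((h1.const_mul (2 * m : ℝ)).const_add 2).add
      ((h1.pow 2).const_mul (m * (m + 1) : ℝ)))).congr_deriv ?_
    simp only [Pi.add_apply, Pi.pow_apply]
    ring
  refine monotoneOn_of_deriv_nonneg (convex_Icc 0 1) (fun z _ => (hd
    z).continuousAt.continuousWithinAt) (fun z _ => (hd z).differentiableAt.differentiableWithinAt)
    (fun z hz => ?_) ⟨hx, hxy.trans hy⟩ ⟨hx.trans hxy, hy⟩ hxy
  rw [interior_Icc] at hz
  rw [(hd z).deriv]
  rcases m with _ | m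
  · simp
  · have e : ((m + 1 : ℕ) : ℝ) * z ^ (m + 1 - 1) * (2 + 2 * ((m + 1 : ℕ) : ℝ) * (1 - z) + ((m + 1 :
      ℕ) : ℝ) * (((m + 1 : ℕ) : ℝ) + 1) * (1 - z) ^ 2) + z ^ (m + 1) * (-(2 * ((m + 1 : ℕ) : ℝ)) - 2
      * (((m + 1 : ℕ) : ℝ) * (((m + 1 : ℕ) : ℝ) + 1)) * (1 - z)) = (m + 1) * (m + 2) * (m + 3) * z ^
      m * (1 - z) ^ 2 := by grind
    rw [e]
    have := hz.1.le
    positivity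

lemma hess_nonneg (m : ℕ) {x : ℝ} (hx : 0 ≤ x) (hx1 : x ≤ 1) : 0 ≤ hess m x := by
  rw [hess]; positivity

lemma geom_sum₂_le {z M : ℝ} (hz : 0 ≤ z) (hzM : z ≤ M) (k : ℕ) :
    (1 - z) * (∑ i ∈ Finset.range k, z ^ i * M ^ (k - 1 - i)) ≤
      |1 - M| * (k * M ^ (k - 1)) + M ^ k := by
  have hM := hz.trans hzM
  have h1 : ∑ i ∈ Finset.range k, z ^ i * M ^ (k - 1 - i) ≤ k * M ^ (k - 1) := by
    refine (sum_le_sum (g := fun _ => M ^ (k - 1)) fun i hi => ?_).trans (by simp)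
    have hi' := Finset.mem_range.1 hi
    calc z ^ i * M ^ (k - 1 - i) ≤ M ^ i * M ^ (k - 1 - i) :=
          mul_le_mul_of_nonneg_right (pow_le_pow_left₀ hz hzM i) (by positivity)
      _ = M ^ (k - 1) := by rw [← pow_add]; congr 1; omega
  have h0 : 0 ≤ ∑ i ∈ Finset.range k, z ^ i * M ^ (k - 1 - i) := sum_nonneg fun i _ => by positivity
  have h2 := geom_sum₂_mul z M k
  have h3 := mul_le_mul (le_abs_self (1 - M)) h1 h0 (abs_nonneg _)
  have := pow_nonneg hz k
  linarith

lemma weight_le (m : ℕ) {p q : ℝ} (hp : 0 ≤ p) (hp1 : p ≤ 1) (hq : 0 ≤ q) (hq1 : q ≤ 1) : 2 * q ^ m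
    + 2 * (p * (1 - q) * ∑ i ∈ Finset.range m, p ^ (m - 1 - i) * q ^ i) + m * ((1 - p) * (1 - q) * ∑
    i ∈ Finset.range (m + 1), p ^ (m - i) * q ^ i) ≤ 2 * hess m (max p q) := by
  have key : ∀ {z M : ℝ}, 0 ≤ z → z ≤ M → M ≤ 1 → ∀ S₁ S₂ : ℝ, 0 ≤ S₁ → S₁ = ∑ i ∈ Finset.range m, z
      ^ i * M ^ (m - 1 - i) → S₂ = ∑ i ∈ Finset.range (m + 1), z ^ i * M ^ (m - i) → 2 * M ^ m + 2 *
      (M * (1 - z) * S₁) + m * ((1 - M) * (1 - z) * S₂) ≤ 2 * hess m M := by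
    intro z M hz hzM hM S₁ S₂ h0 h1 h2
    have hM0 := hz.trans hzM
    have hM1 : 0 ≤ 1 - M := by linarith
    have e1 := geom_sum₂_le hz hzM m
    have e2 := geom_sum₂_le hz hzM (m + 1)
    simp only [Nat.add_sub_cancel] at e2
    rw [← h1, abs_of_nonneg hM1] at e1
    rw [← h2, abs_of_nonneg hM1] at e2
    have e3 : (m : ℝ) * M ^ (m - 1) * M = m * M ^ m := by
      rcases m with _ | m
      · simp
      · simp only [Nat.add_sub_cancel]; rw [pow_succ]; ring
    have f1 := mul_le_mul_of_nonneg_left e1 hM0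
    have f2 := mul_le_mul_of_nonneg_left e2 (mul_nonneg (Nat.cast_nonneg (α := ℝ) m) hM1)
    have g1 : M * M ^ m ≤ M ^ m := mul_le_of_le_one_left (by positivity) hM
    have g2 := mul_le_mul_of_nonneg_left g1 (mul_nonneg (Nat.cast_nonneg (α := ℝ) m) hM1)
    have g3 : 0 ≤ M ^ m * (m * (1 - M)) := by positivity
    have g4 : 0 ≤ M ^ m * (m * (m + 1) * (1 - M) ^ 2) := by positivity
    have f1' : M * ((1 - M) * (m * M ^ (m - 1)) + M ^ m) = (1 - M) * (m * M ^ m) + M * M ^ m := by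
      rw [← e3]; ring
    rw [pow_succ'] at f2
    push_cast at f2
    rw [hess]
    linarith
  have hS : ∀ a b : ℝ, 0 ≤ a → 0 ≤ b → 0 ≤ ∑ i ∈ Finset.range m, a ^ (m - 1 - i) * b ^ i :=
    fun a b _ _ => sum_nonneg fun i _ => by positivity
  have hc : ∀ k, ∑ i ∈ Finset.range k, p ^ (k - 1 - i) * q ^ i =
      ∑ i ∈ Finset.range k, p ^ i * q ^ (k - 1 - i) := fun k => by
    rw [geom_sum₂_comm]
    simp only [mul_comm]
  rcases le_total p q with h | h
  · rw [max_eq_right h]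
    refine le_trans ?_ (key hp h hq1 _ _ (hS p q hp hq) (hc m) (hc (m + 1)))
    have : p * (1 - q) ≤ q * (1 - p) := by linarith
    have := mul_le_mul_of_nonneg_right this (hS p q hp hq)
    simp only [Nat.add_sub_cancel]
    linarith
  · rw [max_eq_left h]
    refine le_trans ?_ (key hq h hp1 _ _ (hS p q hp hq) (sum_congr rfl fun _ _ => mul_comm _ _)
      (sum_congr rfl fun _ _ => mul_comm _ _))
    have := pow_le_pow_left₀ hq h m
    linarith

end Weights

section Spectral

variable {E : Type*} [NormedAddCommGroup E] [InnerProductSpace ℝ E] [FiniteDimensional ℝ E]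
  {ι : Type*} [Fintype ι] {ε : OrthonormalBasis ι ℝ E} {A : E →L[ℝ] E} {C : ℝ} {l : ι → ℝ}

lemma exists_eigenbasis (hA : A ∈ psd E C) : ∃ (ε : OrthonormalBasis (Fin (Module.finrank ℝ E)) ℝ E)
    (l : Fin (Module.finrank ℝ E) → ℝ), ∀ a, A (ε a) = l a • ε a := by
  have hs : (A : E →ₗ[ℝ] E).IsSymmetric := fun x y => hA.1 x y
  exact ⟨hs.eigenvectorBasis rfl, hs.eigenvalues rfl, fun a => hs.apply_eigenvectorBasis rfl a⟩

lemma eigenvalue_eq (hl : ∀ a, A (ε a) = l a • ε a) (a : ι) : l a = ⟪A (ε a), ε a⟫ := by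
  rw [hl, inner_smul_left, real_inner_self_eq_norm_sq, ε.norm_eq_one]; simp

lemma eigenvalue_nonneg (hA : A ∈ psd E C) (hl : ∀ a, A (ε a) = l a • ε a) (a : ι) : 0 ≤ l a := by
  rw [eigenvalue_eq hl]
  exact hA.2.1 _

lemma diag_pow {T : E →L[ℝ] E} {t : ι → ℝ} (hT : ∀ a, T (ε a) = t a • ε a) (k : ℕ) (a : ι) :
    (T ^ k) (ε a) = t a ^ k • ε a := by
  induction k with
  | zero => simp
  | succ k ih => rw [pow_succ', mul_apply_eq_comp, ih, map_smul, hT, smul_smul, pow_succ]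

lemma diag_mul {S T : E →L[ℝ] E} {s t : ι → ℝ} (hS : ∀ a, S (ε a) = s a • ε a) (hT : ∀ a, T (ε a) =
  t a • ε a) (a : ι) : (S * T) (ε a) = (s a * t a) • ε a := by rw [mul_apply_eq_comp, hT, map_smul, hS,
  smul_smul, mul_comm]

lemma diag_res (hA : A ∈ psd E C) (hl : ∀ a, A (ε a) = l a • ε a) (a : ι) :
    res A (ε a) = (1 - l a / (1 + l a)) • ε a := by
  have h0 := eigenvalue_nonneg hA hl a
  have h1 := congrArg (fun T : E →L[ℝ] E => T (ε a))
    (Ring.inverse_mul_cancel _ (isUnit_one_add_of_psd hA))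
  simp only [mul_apply_eq_comp, _root_.add_apply, one_apply_eq_self, hl] at h1
  have e : ε a + l a • ε a = (1 + l a) • ε a := by rw [add_smul, one_smul]
  rw [e, map_smul] at h1
  have e2 : 1 - l a / (1 + l a) = (1 + l a)⁻¹ := by grind
  rw [e2]
  exact (eq_inv_smul_iff₀ (by positivity)).2 h1

lemma diag_shr (hA : A ∈ psd E C) (hl : ∀ a, A (ε a) = l a • ε a) (a : ι) :
    shr A (ε a) = (l a / (1 + l a)) • ε a := by
  rw [shr, _root_.sub_apply, diag_res hA hl, one_apply_eq_self, sub_smul, one_smul]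
  abel

lemma trL_diag {T : E →L[ℝ] E} {t : ι → ℝ} (hT : ∀ a, T (ε a) = t a • ε a) : trL T = ∑ a, t a := by
  rw [trL_eq_sum ε]
  refine sum_congr rfl fun a _ => ?_
  rw [hT, inner_smul_right, real_inner_self_eq_norm_sq, ε.norm_eq_one]; simp

lemma inner_diag {Q : E →L[ℝ] E} {q : ι → ℝ} (hQ : ∀ a, Q (ε a) = q a • ε a) (b : ι) (z : E) :
    ⟪ε b, Q z⟫ = q b * ⟪ε b, z⟫ := by
  classical
  conv_lhs => rw [← ε.sum_repr' z]
  simp only [map_sum, map_smul, hQ, inner_sum, inner_smul_right,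
    ε.inner_eq_ite, mul_ite, mul_one, mul_zero, Finset.sum_ite_eq, Finset.mem_univ, if_true]
  ring

lemma trL_diag_mul {P Q : E →L[ℝ] E} {p q : ι → ℝ} (hP : ∀ a, P (ε a) = p a • ε a)
    (hQ : ∀ a, Q (ε a) = q a • ε a) {U : E →L[ℝ] E} (hU : ∀ x y, ⟪U x, y⟫ = ⟪x, U y⟫) :
    trL (P * U * Q * U) = ∑ a, ∑ b, p a * q b * ⟪ε a, U (ε b)⟫ ^ 2 := by
  rw [mul_assoc, mul_assoc, trL_mul_comm, trL_eq_sum ε]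
  refine sum_congr rfl fun a _ => ?_
  simp only [mul_apply_eq_comp, hP, map_smul, inner_smul_right]
  rw [← hU, ← ε.sum_inner_mul_inner, mul_sum]
  refine sum_congr rfl fun b _ => ?_
  rw [inner_diag hQ, hU, ← hU (ε b), real_inner_comm (ε a)]
  ring

lemma sum_comm₃ (I : Finset ℕ) (f : ℕ → ι → ι → ℝ) :
    ∑ i ∈ I, ∑ a, ∑ b, f i a b = ∑ a, ∑ b, ∑ i ∈ I, f i a b := by
  rw [Finset.sum_comm]
  exact sum_congr rfl fun a _ => sum_comm

lemma hessian_le (hA : A ∈ psd E C) (hl : ∀ a, A (ε a) = l a • ε a) (m : ℕ) {U : E →L[ℝ] E} (hU : ∀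
    x y, ⟪U x, y⟫ = ⟪x, U y⟫) : fderiv ℝ (trForm trL m) A U U ≤ ∑ a, ∑ b, 2 * hess m (max (l a / (1
    + l a)) (l b / (1 + l b))) * ⟪ε a, U (ε b)⟫ ^ 2 := by
  have hu := isUnit_one_add_of_psd hA
  have hR := diag_res hA hl
  have hX := diag_shr hA hl
  have hAR : ∀ a, (A * res A) (ε a) = (l a / (1 + l a)) • ε a := by rwa [mul_res hu]
  have hx : ∀ a, 0 ≤ l a / (1 + l a) ∧ l a / (1 + l a) ≤ 1 := fun a => by
    have := eigenvalue_nonneg hA hl a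
    exact ⟨by positivity, by rw [div_le_one (by positivity)]; linarith⟩
  obtain ⟨x, hxd⟩ : ∃ x : ι → ℝ, ∀ a, l a / (1 + l a) = x a := ⟨_, fun a => rfl⟩
  simp only [hxd] at hR hX hx hAR ⊢
  have h1 : trL (U * shr A ^ m * U) = ∑ a, ∑ b, 1 * x b ^ m * ⟪ε a, U (ε b)⟫ ^ 2 := by
    rw [← trL_diag_mul (P := 1) (fun a => by simp) (diag_pow hX m) hU, one_mul]
  have hc := (commute_res_shr (A := A))
  have h2 : ∀ i, trL (A * (shr A ^ (m - 1 - i) * (res A * U * res A) * shr A ^ i) * U) =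
      ∑ a, ∑ b, (x a * x a ^ (m - 1 - i)) * ((1 - x b) * x b ^ i) * ⟪ε a, U (ε b)⟫ ^ 2 := fun i => by
    rw [← trL_diag_mul (diag_mul hAR (diag_pow hX _)) (diag_mul hR (diag_pow hX _)) hU,
      mul_assoc A (res A), (hc.pow_right (m - 1 - i)).eq]
    simp only [mul_assoc]
  have h3 : ∀ i, trL ((shr A ^ (m - i) * (res A * U * res A) * shr A ^ i) * U) = ∑ a, ∑ b, (x a ^ (m
    - i) * (1 - x a)) * ((1 - x b) * x b ^ i) * ⟪ε a, U (ε b)⟫ ^ 2 := fun i => by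
    rw [← trL_diag_mul (diag_mul (diag_pow hX _) hR) (diag_mul hR (diag_pow hX _)) hU]
    simp only [mul_assoc]
  rw [(hasFDerivAt_trForm hu m).2.2 U U, add_mul, map_add, smul_mul_assoc, smul_mul_assoc, map_smul,
    map_smul, add_mul, map_add, h1, mul_sum, sum_mul, map_sum, sum_mul, map_sum, sum_congr rfl fun i
    _ => h2 i, sum_congr rfl fun i _ => h3 i, sum_comm₃, sum_comm₃ (Finset.range (m + 1)), ←
    sum_add_distrib, smul_eq_mul, smul_eq_mul, mul_sum, mul_sum, ← sum_add_distrib]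
  refine sum_le_sum fun a _ => ?_
  rw [← sum_add_distrib, mul_sum, mul_sum, ← sum_add_distrib]
  refine sum_le_sum fun b _ => ?_
  refine (le_of_eq ?_).trans (mul_le_mul_of_nonneg_right (weight_le m (hx a).1 (hx a).2 (hx b).1
    (hx b).2) (sq_nonneg _))
  simp only [mul_sum, add_mul, sum_mul, mul_add]
  congr 1
  · congr 1
    · ring
    · exact sum_congr rfl fun i _ => by ring
  · exact sum_congr rfl fun i _ => by ring

end Spectral

section ThirdMoment

variable {μ : Measure E} [IsProbabilityMeasure μ] {R : ℝ}
  {ι : Type*} [Fintype ι] {ε : OrthonormalBasis ι ℝ E}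

/-- Every localization of `μ` at time `s`, every image of it under a symmetric contraction, and
every further Gaussian reweighting of that image satisfies the linear Brascamp--Lieb inequality. -/
def IsSLC (μ : Measure E) : Prop := ∀ w : ℝ × E, 0 < w.1 → ∀ P : E →L[ℝ] E, (∀ x y, ⟪P x, y⟫ = ⟪x, P
  y⟫) → (∀ z, ‖P z‖ ≤ ‖z‖) → ∀ (a : E) (β : ℝ), 0 < β → ∀ y v : E, ∫ b, ⟪v, b⟫ ^ 2 ∂(post ((loc μ
  w).map fun b => P (b - a)) β y) - (∫ b, ⟪v, b⟫ ∂(post ((loc μ w).map fun b => P (b - a)) β y)) ^ 2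
  ≤ ‖v‖ ^ 2 / (w.1 + β⁻¹)

lemma exists_diag (ε : OrthonormalBasis ι ℝ E) (j : ι → ℝ) :
    ∃ P : E →L[ℝ] E, ∀ b, P (ε b) = j b • ε b := by
  refine ⟨∑ b, j b • tens (ε b) (ε b), fun b => ?_⟩
  simp only [FunLike.coe_sum, FunLike.coe_smul, Finset.sum_apply, Pi.smul_apply, tens_apply]
  rw [Finset.sum_eq_single b]
  · simp
  · simp_all
  · simp

lemma diag_symm {P : E →L[ℝ] E} {j : ι → ℝ} (hP : ∀ b, P (ε b) = j b • ε b) (x y : E) :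
    ⟪P x, y⟫ = ⟪x, P y⟫ := by
  rw [← ε.sum_inner_mul_inner, ← ε.sum_inner_mul_inner]
  refine sum_congr rfl fun b _ => ?_
  rw [inner_diag hP, real_inner_comm (ε b) (P x), inner_diag hP, real_inner_comm (ε b) x]; ring

lemma inner_diag_self {A : E →L[ℝ] E} {l : ι → ℝ} (hl : ∀ b, A (ε b) = l b • ε b) (z : E) :
    ⟪A z, z⟫ = ∑ b, l b * ⟪ε b, z⟫ ^ 2 := by
  rw [← ε.sum_inner_mul_inner]
  refine sum_congr rfl fun b _ => ?_
  rw [real_inner_comm (ε b) (A z), inner_diag hl]; ring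

lemma mom_triple (hμ : SuppIn μ R) (w : ℝ × E) (u : E) (H : E →L[ℝ] E) : mom μ (fun b => ⟪b - bary μ
    w, u⟫ * ⟪H (b - bary μ w), b - bary μ w⟫) w = ∑ b, ∑ c, ⟪H (ε b), ε c⟫ * ⟪covD μ w (0, u) (ε b),
    ε c⟫ := by
  have h : (fun b => ⟪b - bary μ w, u⟫ * ⟪H (b - bary μ w), b - bary μ w⟫) = fun z => ∑ b, ∑ c, ⟪H
      (ε b), ε c⟫ • (⟪z - bary μ w, u⟫ * ⟪z - bary μ w, ε b⟫ * ⟪z - bary μ w, ε c⟫) := by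
    funext z
    generalize z - bary μ w = y
    have h1 : ⟪H y, y⟫ = ∑ b, ∑ c, ⟪H (ε b), ε c⟫ * (⟪y, ε b⟫ * ⟪y, ε c⟫) := by
      conv_lhs => rw [← ε.sum_repr' y]
      simp only [map_sum, map_smul, sum_inner, inner_sum, inner_smul_left, inner_smul_right,
        RCLike.conj_to_real]
      rw [Finset.sum_comm]
      refine sum_congr rfl fun b _ => ?_
      rw [mul_sum]
      refine sum_congr rfl fun c _ => ?_
      rw [real_inner_comm y (ε b), real_inner_comm y (ε c)]; ring
    rw [h1, mul_sum]
    refine sum_congr rfl fun b _ => ?_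
    rw [mul_sum]
    refine sum_congr rfl fun c _ => ?_
    rw [smul_eq_mul]; ring
  rw [h, mom_sum hμ _ (fun b => by fun_prop)]
  refine sum_congr rfl fun b _ => ?_
  rw [mom_sum hμ _ (fun b => by fun_prop)]
  refine sum_congr rfl fun c _ => ?_
  rw [mom_smul, inner_covD hμ, smul_eq_mul]

lemma mom_norm_sq (hμ : SuppIn μ R) (w : ℝ × E) {H : E →L[ℝ] E} (hH : ∀ x y, ⟪H x, y⟫ = ⟪x, H y⟫) :
    mom μ (fun b => ‖H (b - bary μ w)‖ ^ 2) w = ∑ c, ⟪cov μ w (H (ε c)), H (ε c)⟫ := by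
  have h : (fun b => ‖H (b - bary μ w)‖ ^ 2) =
      fun z => ∑ c, ⟪z - bary μ w, H (ε c)⟫ * ⟪z - bary μ w, H (ε c)⟫ := by
    funext z
    rw [← ε.sum_sq_inner_left]
    grind
  rw [h, mom_sum hμ _ (fun b => by fun_prop)]
  exact sum_congr rfl fun c _ => (inner_cov hμ w _ _).symm

lemma mom_centered_inner (hμ : SuppIn μ R) (w : ℝ × E) (u : E) :
    mom μ (fun b => ⟪b - bary μ w, u⟫) w = 0 := by
  simp only [inner_sub_left]
  rw [mom_sub hμ (by fun_prop) (by fun_prop), mom_inner hμ, mom_const hμ, sub_self]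

lemma sq_mom_le (hμ : SuppIn μ R) (w : ℝ × E) (u : E) {q : E → ℝ} (hq : Continuous q) : mom μ (fun b
    => ⟪b - bary μ w, u⟫ * q b) w ^ 2 ≤ ⟪cov μ w u, u⟫ * (mom μ (fun b => q b ^ 2) w - mom μ q w ^
    2) := by
  have := isProbabilityMeasure_loc hμ w
  have h1 := mom_centered₂ hμ w (f := fun b => ⟪b - bary μ w, u⟫) (by fun_prop) hq
  have h2 := mom_centered₂ hμ w hq hq
  rw [mom_centered_inner hμ] at h1
  simp only [sub_zero, zero_mul] at h1
  have h3 := sq_integral_mul_le (μ := loc μ w) (f := fun b => ⟪b - bary μ w, u⟫)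
    (g := fun b => q b - mom μ q w) ?_ ?_
  · change mom μ (fun b => ⟪b - bary μ w, u⟫ * (q b - mom μ q w)) w ^ 2 ≤
      mom μ (fun b => ⟪b - bary μ w, u⟫ ^ 2) w * mom μ (fun b => (q b - mom μ q w) ^ 2) w at h3
    simp only [sq (⟪_, u⟫ : ℝ), ← inner_cov hμ, sq (q _ - _), h2, h1] at h3
    simpa only [sq (q _), sq (mom μ q w)] using h3
  all_goals
    obtain ⟨C, -, hC⟩ := exists_ae_bound hμ (φ := fun b => ⟪b - bary μ w, u⟫) (by fun_prop)
    obtain ⟨C', -, hC'⟩ := exists_ae_bound hμ (φ := fun b => q b - mom μ q w) (by fun_prop)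
  · exact MemLp.of_bound (Continuous.aestronglyMeasurable (by fun_prop)) C (loc_ae hC w)
  · exact MemLp.of_bound (Continuous.aestronglyMeasurable (by fun_prop)) C' (loc_ae hC' w)

theorem third_moment_le (hμ : SuppIn μ R) (hslc : IsSLC μ) {w : ℝ × E} (hs : 0 < w.1) {l : ι → ℝ}
    (hl : ∀ a, cov μ w (ε a) = l a • ε a) (a : ι) : √w.1 * ∑ b, ∑ c, (if l b ≤ l a ∧ l c ≤ l a then
    ⟪covD μ w (0, ε a) (ε b), ε c⟫ ^ 2 else 0) ≤ 160 * (l a ^ 2 * √(l a)) := by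
  classical
  obtain ⟨C₀, hC₀⟩ := cov_mem_psd hμ
  have hl0 := eigenvalue_nonneg (hC₀ w) hl
  obtain ⟨j, hj⟩ : ∃ j : ι → ℝ, j = fun b => if l b ≤ l a then 1 else 0 := ⟨_, rfl⟩
  have hjj : ∀ b, j b * j b = j b := fun b => by rw [hj]; dsimp; split_ifs <;> simp
  have hj1 : ∀ b, j b ≤ 1 := fun b => by rw [hj]; dsimp; split_ifs <;> simp
  have hlj : ∀ b, l b * j b ≤ l a := fun b => by
    rw [hj]; dsimp; split_ifs with h
    · simpa using h
    · simpa using hl0 a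
  obtain ⟨P, hP⟩ := exists_diag ε j
  have hPs := diag_symm hP
  have hPP : ∀ z, P (P z) = P z := fun z => by
    refine ε.repr.injective (PiLp.ext fun b => ?_)
    rw [ε.repr_apply_apply, ε.repr_apply_apply, inner_diag hP, inner_diag hP, ← mul_assoc, hjj]
  have hPn : ∀ z, ‖P z‖ ≤ ‖z‖ := fun z => by
    refine (pow_le_pow_iff_left₀ (norm_nonneg _) (norm_nonneg _) two_ne_zero).1 ?_
    rw [← ε.sum_sq_inner_right, ← ε.sum_sq_inner_right]
    refine sum_le_sum fun b _ => ?_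
    rw [inner_diag hP, mul_pow, sq (j b), hjj]
    exact mul_le_of_le_one_left (sq_nonneg _) (hj1 b)
  have hPA : ∀ z, ⟪cov μ w (P z), P z⟫ ≤ l a * ‖z‖ ^ 2 := fun z => by
    rw [inner_diag_self hl, ← ε.sum_sq_inner_right, mul_sum]
    refine sum_le_sum fun b _ => ?_
    rw [inner_diag hP, mul_pow, sq (j b), hjj, ← mul_assoc]
    exact mul_le_mul_of_nonneg_right (hlj b) (sq_nonneg _)
  obtain ⟨T, hT⟩ : ∃ T, T = covD μ w (0, ε a) := ⟨_, rfl⟩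
  have hTs : ∀ x y, ⟪T x, y⟫ = ⟪x, T y⟫ := fun x y => by
    rw [hT, real_inner_comm (covD μ w (0, ε a) y), inner_covD hμ, inner_covD hμ]
    exact congrArg (mom μ · w) (funext fun b => by ring)
  obtain ⟨H, hH⟩ : ∃ H : E →L[ℝ] E, H = P * T * P := ⟨_, rfl⟩
  have hHa : ∀ z, H z = P (T (P z)) := fun z => by rw [hH]; rfl
  have hHs : ∀ x y, ⟪H x, y⟫ = ⟪x, H y⟫ := fun x y => by rw [hHa, hHa, hPs, hTs, hPs]
  have hHP : ∀ z, H (P z) = H z := fun z => by rw [hHa, hHa, hPP]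
  have hPH : ∀ z, P (H z) = H z := fun z => by rw [hHa, hPP]
  have hHbc : ∀ b c, ⟪H (ε b), ε c⟫ = j b * j c * ⟪T (ε b), ε c⟫ := fun b c => by
    rw [hHa, hPs, hP, hP, map_smul, inner_smul_left, inner_smul_right, RCLike.conj_to_real]; ring
  obtain ⟨S, hS⟩ : ∃ S, S = ∑ b, ∑ c, ⟪H (ε b), ε c⟫ ^ 2 := ⟨_, rfl⟩
  have hSeq : ∑ b, ∑ c, (if l b ≤ l a ∧ l c ≤ l a then ⟪covD μ w (0, ε a) (ε b), ε c⟫ ^ 2 else 0)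
      = S := by
    rw [hS]
    refine sum_congr rfl fun b _ => sum_congr rfl fun c _ => ?_
    rw [hHbc, ← hT, hj]; dsimp
    by_cases h1 : l b ≤ l a <;> by_cases h2 : l c ≤ l a <;> simp [h1]
  have hSn : ∑ c, ‖H (ε c)‖ ^ 2 = S := by
    rw [hS]
    exact sum_congr rfl fun c _ => (ε.sum_sq_inner_left _).symm
  have hS0 := hSn ▸ sum_nonneg fun c _ => sq_nonneg _
  obtain ⟨q, hq⟩ : ∃ q : E → ℝ, q = fun b => ⟪H (b - bary μ w), b - bary μ w⟫ := ⟨_, rfl⟩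
  have hqc : Continuous q := by rw [hq]; fun_prop
  have hmq : mom μ (fun b => ⟪b - bary μ w, ε a⟫ * q b) w = S := by
    rw [hq, mom_triple (ε := ε) hμ, hS, ← hT]
    refine sum_congr rfl fun b _ => sum_congr rfl fun c _ => ?_
    rw [hHbc]
    linear_combination -(hjj b) * (j c * ⟪T (ε b), ε c⟫ ^ 2) * (j c) - (hjj c) * (j b * ⟪T (ε b), ε c⟫ ^ 2)
  have hcs := sq_mom_le hμ w (ε a) hqc
  rw [hmq, hl, inner_smul_left, real_inner_self_eq_norm_sq, ε.norm_eq_one, RCLike.conj_to_real,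
    one_pow, mul_one] at hcs
  have hnorm : mom μ (fun b => ‖H (b - bary μ w)‖ ^ 2) w ≤ l a * S := by
    rw [mom_norm_sq (ε := ε) hμ w hHs, ← hSn, mul_sum]
    refine sum_le_sum fun c _ => ?_
    rw [← hPH]
    exact (hPA _).trans_eq (by rw [hPH])
  rw [hSeq]
  rcases (hl0 a).eq_or_lt with h0 | hla
  · rw [← h0, zero_mul] at hcs
    have := pow_eq_zero_iff two_ne_zero |>.mp (le_antisymm hcs (sq_nonneg S))
    rw [this, ← h0]; simp
  have hloc := isProbabilityMeasure_loc hμ w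
  have hfc : Continuous fun b => P (b - bary μ w) := by fun_prop
  obtain ⟨ν, hν⟩ : ∃ ν, ν = (loc μ w).map fun b => P (b - bary μ w) := ⟨_, rfl⟩
  have hνp : IsProbabilityMeasure ν := hν ▸ isProbabilityMeasure_map hfc.aemeasurable
  have hint : ∀ g : E → ℝ, Continuous g → ∫ b, g b ∂ν = mom μ (fun b => g (P (b - bary μ w))) w :=
    fun g hg => by
      rw [hν, integral_map hfc.aemeasurable hg.aestronglyMeasurable]; rfl
  have hνb : ∀ᵐ b ∂ν, ‖b‖ ≤ R + ‖bary μ w‖ := by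
    rw [hν, ae_map_iff hfc.aemeasurable (measurableSet_le (by fun_prop) (by fun_prop))]
    filter_upwards [loc_ae hμ w] with b hb
    exact (hPn _).trans ((norm_sub_le _ _).trans (by linarith))
  have hR : 0 ≤ R + ‖bary μ w‖ := by
    obtain ⟨b, hb⟩ := hνb.exists
    exact (norm_nonneg b).trans hb
  have hcov : ∀ e : E, ∫ b, ⟪e, b⟫ ^ 2 ∂ν - (∫ b, ⟪e, b⟫ ∂ν) ^ 2 ≤ l a * ‖e‖ ^ 2 := fun e => by
    rw [hint _ (by fun_prop), hint _ (by fun_prop)]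
    have h1 : ∀ b, ⟪e, P (b - bary μ w)⟫ = ⟪b - bary μ w, P e⟫ := fun b => by
      rw [← hPs, real_inner_comm]
    simp only [h1, mom_centered_inner hμ, sq (⟪_, P e⟫ : ℝ), ← inner_cov hμ]
    simpa using hPA e
  have hfin := quad_var_le hνb hR hs (fun β hβ y v => hν ▸ hslc w hs P hPs hPn (bary μ w) β hβ y v)
    hla hcov H hHs
  rw [hint _ (by fun_prop), hint _ (by fun_prop), hint _ (by fun_prop)] at hfin
  have h2 : ∀ b, ⟪H b, P b⟫ = ⟪H b, b⟫ := fun b => by rw [← hPs, hPH]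
  simp only [hHP, h2] at hfin
  rw [hq] at hcs
  change S ^ 2 ≤ l a * (mom μ (fun b => ⟪H (b - bary μ w), b - bary μ w⟫ ^ 2) w -
    mom μ (fun b => ⟪H (b - bary μ w), b - bary μ w⟫) w ^ 2) at hcs
  generalize mom μ (fun b => ⟪H (b - bary μ w), b - bary μ w⟫ ^ 2) w -
    mom μ (fun b => ⟪H (b - bary μ w), b - bary μ w⟫) w ^ 2 = V at hcs hfin
  rw [sqrt_div hs.le] at hfin
  have hsl := sqrt_pos.2 hla
  have h3 : √w.1 * V ≤ 160 * (l a * S) * √(l a) := by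
    rw [div_mul_eq_mul_div, div_le_iff₀ hsl] at hfin
    exact hfin.trans (mul_le_mul_of_nonneg_right (by linarith) hsl.le)
  rcases hS0.eq_or_lt with h | h
  · rw [← h]; simp only [mul_zero]; positivity
  · refine le_of_mul_le_mul_right ?_ h
    calc √w.1 * S * S = √w.1 * S ^ 2 := by ring
      _ ≤ √w.1 * (l a * V) := mul_le_mul_of_nonneg_left hcs (sqrt_nonneg _)
      _ = l a * (√w.1 * V) := by ring
      _ ≤ l a * (160 * (l a * S) * √(l a)) := mul_le_mul_of_nonneg_left h3 hla.le
      _ = 160 * (l a ^ 2 * √(l a)) * S := by ring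

end ThirdMoment

section Drift

variable {μ : Measure E} [IsProbabilityMeasure μ] {R : ℝ}
  {ι : Type*} [Fintype ι] {e : OrthonormalBasis ι ℝ E}

lemma sum_max_le {κ : Type*} [Fintype κ] {l x h : κ → ℝ} {H : ℝ → ℝ} (hH : ∀ a, H (x a) = h a) (hx :
    ∀ a b, l a ≤ l b → x a ≤ x b) (hh : ∀ a b, l a ≤ l b → h a ≤ h b) (h0 : ∀ a, 0 ≤ h a) {t : κ → κ
    → κ → ℝ} (h12 : ∀ a b c, t a b c = t b a c) (h23 : ∀ a b c, t a b c = t a c b) : ∑ a, ∑ b, ∑ c,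
    H (max (x a) (x b)) * t a b c ^ 2 ≤ 3 * ∑ a, h a * ∑ b, ∑ c, if l b ≤ l a ∧ l c ≤ l a then t a b
    c ^ 2 else 0 := by
  classical
  obtain ⟨g, hg⟩ : ∃ g : κ → κ → κ → ℝ, g = fun a b c =>
    h a * if l b ≤ l a ∧ l c ≤ l a then t a b c ^ 2 else 0 := ⟨_, rfl⟩
  have hg0 : ∀ a b c, 0 ≤ g a b c := fun a b c => by
    rw [hg]; exact mul_nonneg (h0 a) (by split_ifs <;> positivity)
  have hpt : ∀ a b c, H (max (x a) (x b)) * t a b c ^ 2 ≤ g a b c + g b a c + g c a b := by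
    intro a b c
    have hm : H (max (x a) (x b)) = max (h a) (h b) := by
      rcases le_total (l a) (l b) with hab | hab
      · rw [max_eq_right (hx _ _ hab), max_eq_right (hh _ _ hab), hH]
      · rw [max_eq_left (hx _ _ hab), max_eq_left (hh _ _ hab), hH]
    have key : ∀ d, l a ≤ l d → l b ≤ l d →
        H (max (x a) (x b)) * t a b c ^ 2 ≤ h d * t a b c ^ 2 := fun d had hbd => by
      rw [hm]
      exact mul_le_mul_of_nonneg_right (max_le (hh _ _ had) (hh _ _ hbd)) (sq_nonneg _)
    have e1 : l b ≤ l a → l c ≤ l a → g a b c = h a * t a b c ^ 2 := fun p q => by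
      rw [hg]; simp only [p, q, and_self, if_true]
    have e2 : l a ≤ l b → l c ≤ l b → g b a c = h b * t a b c ^ 2 := fun p q => by
      rw [hg, h12 a b c]; simp only [p, q, and_self, if_true]
    have e3 : l a ≤ l c → l b ≤ l c → g c a b = h c * t a b c ^ 2 := fun p q => by
      rw [hg, h23 a b c, h12 a c b]; simp only [p, q, and_self, if_true]
    have p1 := hg0 a b c
    have p2 := hg0 b a c
    have p3 := hg0 c a b
    rcases le_total (l a) (l b) with hab | hab
    · rcases le_total (l c) (l b) with hcb | hcb
      · linarith [key b hab le_rfl, e2 hab hcb]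
      · linarith [key c (hab.trans hcb) hcb, e3 (hab.trans hcb) hcb]
    · rcases le_total (l c) (l a) with hca | hca
      · linarith [key a le_rfl hab, e1 hab hca]
      · linarith [key c hca (hab.trans hca), e3 hca (hab.trans hca)]
  have hs : ∀ f : κ → κ → κ → ℝ, ∑ a, ∑ b, ∑ c, f b a c = ∑ a, ∑ b, ∑ c, f a b c :=
    fun f => sum_comm
  have hs' : ∑ a, ∑ b, ∑ c, g c a b = ∑ a, ∑ b, ∑ c, g a b c := by
    rw [← hs fun a b c => g a b c]
    exact sum_congr rfl fun a _ => sum_comm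
  have hgs : ∑ a, h a * ∑ b, ∑ c, (if l b ≤ l a ∧ l c ≤ l a then t a b c ^ 2 else 0) = ∑ a, ∑ b, ∑
    c, g a b c := by simp only [hg, mul_sum]
  calc _ ≤ ∑ a, ∑ b, ∑ c, (g a b c + g b a c + g c a b) := sum_le_sum fun a _ => sum_le_sum fun b _
        => sum_le_sum fun c _ => hpt a b c
    _ = _ := by
        simp only [sum_add_distrib]
        rw [hs g, hs', hgs]; ring

lemma sqrt_mul_hess_le (m : ℕ) {l Λ : ℝ} (hl : 0 ≤ l) (hΛ : √l ≤ Λ) :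
    √l * hess m (l / (1 + l)) ≤ (2 * Λ + 4 * m ^ 2) * (l / (1 + l)) ^ m := by
  have h1 : 1 - l / (1 + l) = 1 / (1 + l) := by grind
  have hr : √l * (1 / (1 + l)) ≤ 1 := by
    rw [mul_one_div, div_le_one (by positivity)]
    nlinarith [sq_sqrt hl]
  have hr1 : 1 / (1 + l) ≤ 1 := by bound
  have hr0 : 0 ≤ 1 / (1 + l) := by positivity
  have hm : (m : ℝ) ≤ m ^ 2 := by exact_mod_cast Nat.le_self_pow two_ne_zero m
  rw [hess, h1, mul_left_comm, mul_comm (2 * Λ + _)]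
  refine mul_le_mul_of_nonneg_left ?_ (by positivity)
  have h3 : √l * (1 / (1 + l)) ^ 2 ≤ 1 := by nlinarith
  calc √l * (2 + 2 * m * (1 / (1 + l)) + m * (m + 1) * (1 / (1 + l)) ^ 2)
      = 2 * √l + 2 * m * (√l * (1 / (1 + l))) + m * (m + 1) * (√l * (1 / (1 + l)) ^ 2) := by ring
    _ ≤ 2 * Λ + 2 * m * 1 + m * (m + 1) * 1 := by gcongr
    _ ≤ 2 * Λ + 4 * m ^ 2 := by nlinarith

/-- The spectral functional `Tr (A² (A (1 + A)⁻¹) ^ m)` of the localized covariance. -/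
def trQ (μ : Measure E) (m : ℕ) (w : ℝ × E) : ℝ := trL (quadPow m (cov μ w))

lemma trL_quadPow {κ : Type*} [Fintype κ] {ε : OrthonormalBasis κ ℝ E} {l : κ → ℝ} {C : ℝ} {A : E
  →L[ℝ] E} (hA : A ∈ psd E C) (hl : ∀ a, A (ε a) = l a • ε a) (m : ℕ) : trL (quadPow m A) = ∑ a, l a
  * l a * (l a / (1 + l a)) ^ m := trL_diag (ε := ε) (diag_mul (diag_mul hl hl) (diag_pow (diag_shr
  hA hl) m))

lemma trQ_nonneg (hμ : SuppIn μ R) (m : ℕ) (w : ℝ × E) : 0 ≤ trQ μ m w := by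
  obtain ⟨C, hC⟩ := cov_mem_psd hμ
  obtain ⟨ε, l, hl⟩ := exists_eigenbasis (hC w)
  rw [trQ, trL_quadPow (hC w) hl]
  refine sum_nonneg fun a _ => ?_
  have := eigenvalue_nonneg (hC w) hl a
  positivity

lemma trQ_le (hμ : SuppIn μ R) (k j : ℕ) {ω : ℝ} (h0 : 0 < ω) (h1 : ω < 1) (w : ℝ × E) : trQ μ k w ≤
    (ω ^ j)⁻¹ * trQ μ (k + j) w + Module.finrank ℝ E * (((1 - ω) ^ 2)⁻¹ * ω ^ k) := by
  obtain ⟨C, hC⟩ := cov_mem_psd hμ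
  obtain ⟨ε, l, hl⟩ := exists_eigenbasis (hC w)
  have hcard : (Module.finrank ℝ E : ℝ) * (((1 - ω) ^ 2)⁻¹ * ω ^ k) =
      ∑ _a : Fin (Module.finrank ℝ E), ((1 - ω) ^ 2)⁻¹ * ω ^ k := by simp
  rw [trQ, trQ, trL_quadPow (hC w) hl, trL_quadPow (hC w) hl, hcard, mul_sum, ← sum_add_distrib]
  refine sum_le_sum fun a _ => ?_
  have hl0 := eigenvalue_nonneg (hC w) hl a
  have h1' : 0 < 1 - ω := by linarith
  rcases le_or_gt ω (l a / (1 + l a)) with h | h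
  · have hA : 0 ≤ ((1 - ω) ^ 2)⁻¹ * ω ^ k := by positivity
    have hB : l a * l a * (l a / (1 + l a)) ^ k ≤
        (ω ^ j)⁻¹ * (l a * l a * (l a / (1 + l a)) ^ (k + j)) := by
      rw [inv_mul_eq_div, le_div_iff₀ (by positivity), pow_add, ← mul_assoc]
      gcongr
    linarith
  · have hA : 0 ≤ (ω ^ j)⁻¹ * (l a * l a * (l a / (1 + l a)) ^ (k + j)) := by positivity
    have hla : l a ≤ (1 - ω)⁻¹ := by
      rw [div_lt_iff₀ (by positivity)] at h
      rw [← one_div, le_div_iff₀ h1']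
      nlinarith
    have hB : l a * l a * (l a / (1 + l a)) ^ k ≤ ((1 - ω) ^ 2)⁻¹ * ω ^ k := by
      rw [sq, mul_inv]
      gcongr
    linarith

lemma sum_inner_covD_sq {κ : Type*} [Fintype κ] (ε : OrthonormalBasis κ ℝ E) (w :
    ℝ × E) (x y : E) : ∑ i, ⟪covD μ w (0, e i) x, y⟫ ^ 2 = ∑ i, ⟪covD μ w (0, ε i) x, y⟫ ^ 2 := by
  obtain ⟨L, hL⟩ : ∃ L : E →L[ℝ] ℝ, ∀ v, L v = ⟪covD μ w (0, v) x, y⟫ := ⟨((innerSL ℝ y).comp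
    ((ContinuousLinearMap.apply ℝ E x).comp ((covD μ w).comp (inr ℝ ℝ E)))), fun v => by simp
    [real_inner_comm]⟩
  have h : ∀ v, ⟪covD μ w (0, v) x, y⟫ = ⟪(InnerProductSpace.toDual ℝ E).symm L, v⟫ := fun v => by
    simp_all
  simp only [h, OrthonormalBasis.sum_sq_inner_left]

theorem exists_gen_trQ (hμ : SuppIn μ R) (e : OrthonormalBasis ι ℝ E) (m : ℕ) : ∃ G' k, Gen e (trQ μ
    m) G' k ∧ (IsSLC μ → ∀ w : ℝ × E, 0 < w.1 → ∀ Λ : ℝ, 0 ≤ Λ → (∀ z, ⟪cov μ w z, z⟫ ≤ Λ ^ 2 * ‖z‖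
    ^ 2) → gen μ G' k w ≤ 480 / √w.1 * (2 * Λ + 4 * m ^ 2) * trQ μ m w) := by
  obtain ⟨C, hC⟩ := cov_mem_psd hμ
  have hu : ∀ A ∈ psd E C, IsUnit (1 + A) := fun A hA => isUnit_one_add_of_psd hA
  refine ⟨_, _, (gen_cov (e := e) hμ).comp (isCompact_psd C) hC (Φ := fun A => trL (quadPow m A))
    (Φ' := trForm trL m) (Φ'' := fderiv ℝ (trForm trL m)) (fun A hA => hasFDerivAt_trace_quadPow
    trL_mul_comm (hu A hA) m) (fun A hA => (hasFDerivAt_trForm (hu A hA) m).1) (fun A hA =>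
    (hasFDerivAt_trForm (hu A hA) m).2.1.continuousWithinAt), ?_⟩
  intro hslc w hs Λ hΛ0 hΛ
  rw [gen_comp (e := e) (μ := μ) (G := cov μ) (G' := covD μ) (k := fun i => covK μ (e i))
    (Φ' := trForm trL m) (Φ'' := fderiv ℝ (trForm trL m)) w, gen_cov_eq hμ]
  obtain ⟨ε, l, hl⟩ := exists_eigenbasis (hC w)
  have hl0 := eigenvalue_nonneg (hC w) hl
  have hx0 : ∀ a, 0 ≤ l a / (1 + l a) := fun a => by have := hl0 a; positivity
  have hx1 : ∀ a, l a / (1 + l a) ≤ 1 := fun a => by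
    have := hl0 a
    rw [div_le_one (by positivity)]; linarith
  have hxm : ∀ a b, l a ≤ l b → l a / (1 + l a) ≤ l b / (1 + l b) := fun a b hab => by
    have := hl0 a
    have := hl0 b
    rw [div_le_div_iff₀ (by positivity) (by positivity)]; nlinarith
  have hdrift : trForm trL m (cov μ w) (-(cov μ w * cov μ w)) ≤ 0 := by
    rw [map_neg, neg_nonpos]
    change 0 ≤ trL (quadPowD m (cov μ w) * (cov μ w * cov μ w))
    have h1 := diag_mul hl (diag_pow (diag_shr (hC w) hl) m)
    have h2 := diag_pow (diag_shr (hC w) hl) (m + 1)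
    have h3 : ∀ a, quadPowD m (cov μ w) (ε a) = (2 * (l a * (l a / (1 + l a)) ^ m) +
        m * (l a / (1 + l a)) ^ (m + 1)) • ε a := fun a => by
      rw [quadPowD, FunLike.coe_add, Pi.add_apply, FunLike.coe_smul, FunLike.coe_smul,
        Pi.smul_apply, Pi.smul_apply, h1, h2, smul_smul, smul_smul, add_smul]
    rw [trL_diag (diag_mul h3 (diag_mul hl hl))]
    refine sum_nonneg fun a _ => ?_
    have := hl0 a
    have := hx0 a
    positivity
  have hTs : ∀ v x y, ⟪covD μ w (0, v) x, y⟫ = ⟪x, covD μ w (0, v) y⟫ := fun v x y => by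
    rw [real_inner_comm (covD μ w (0, v) y), inner_covD hμ, inner_covD hμ]
    exact congrArg (mom μ · w) (funext fun b => by ring)
  have hhess : ∑ i, fderiv ℝ (trForm trL m) (cov μ w) (covD μ w (0, e i)) (covD μ w (0, e i)) ≤ 2 *
      ∑ a, ∑ b, ∑ c, hess m (max (l a / (1 + l a)) (l b / (1 + l b))) * ⟪covD μ w (0, ε a) (ε b), ε
      c⟫ ^ 2 := by
    calc _ ≤ ∑ i, ∑ a, ∑ b, 2 * hess m (max (l a / (1 + l a)) (l b / (1 + l b))) * ⟪ε a, covD μ w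
          (0, e i) (ε b)⟫ ^ 2 := sum_le_sum fun i _ => hessian_le (hC w) hl m (hTs _)
      _ = ∑ a, ∑ b, ∑ i, 2 * hess m (max (l a / (1 + l a)) (l b / (1 + l b))) *
          ⟪ε a, covD μ w (0, e i) (ε b)⟫ ^ 2 := by
          rw [Finset.sum_comm]
          exact sum_congr rfl fun a _ => sum_comm
      _ = _ := by
          rw [mul_sum]
          refine sum_congr rfl fun a _ => ?_
          rw [mul_sum]
          refine sum_congr rfl fun b _ => ?_
          simp only [← mul_sum, ← mul_assoc]
          congr 1
          simp only [← hTs]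
          rw [sum_inner_covD_sq ε]
          refine sum_congr rfl fun c _ => ?_
          rw [inner_covD hμ, inner_covD hμ]
          exact congrArg (fun f => mom μ f w ^ 2) (funext fun b => by ring)
  have hsum := sum_max_le (l := l) (x := fun a => l a / (1 + l a)) (H := hess m) (h := fun a => hess
    m (l a / (1 + l a))) (t := fun a b c => ⟪covD μ w (0, ε a) (ε b), ε c⟫) (fun _ => rfl) hxm (fun
    a b hab => hess_mono m (hx0 a) (hxm a b hab) (hx1 b)) (fun a => hess_nonneg m (hx0 a) (hx1 a))
    (fun a b c => by
      rw [inner_covD hμ, inner_covD hμ]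
      exact congrArg (mom μ · w) (funext fun b => by ring)) (fun a b c => by
      rw [inner_covD hμ, inner_covD hμ]
      exact congrArg (mom μ · w) (funext fun b => by ring))
  have hsq := sqrt_pos.2 hs
  have hthird : ∀ a, hess m (l a / (1 + l a)) * ∑ b, ∑ c,
      (if l b ≤ l a ∧ l c ≤ l a then ⟪covD μ w (0, ε a) (ε b), ε c⟫ ^ 2 else 0) ≤
      160 / √w.1 * (2 * Λ + 4 * m ^ 2) * (l a * l a * (l a / (1 + l a)) ^ m) := fun a => by
    have h1 := third_moment_le hμ hslc hs hl a
    rw [mul_comm, ← le_div_iff₀ hsq] at h1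
    have hla : √(l a) ≤ Λ := by
      refine sqrt_le_iff.2 ⟨hΛ0, ?_⟩
      have := hΛ (ε a)
      rwa [← eigenvalue_eq hl, ε.norm_eq_one, one_pow, mul_one] at this
    refine (mul_le_mul_of_nonneg_left h1 (hess_nonneg m (hx0 a) (hx1 a))).trans ?_
    calc _ = 160 / √w.1 * l a ^ 2 * (√(l a) * hess m (l a / (1 + l a))) := by ring
      _ ≤ 160 / √w.1 * l a ^ 2 * ((2 * Λ + 4 * m ^ 2) * (l a / (1 + l a)) ^ m) :=
          mul_le_mul_of_nonneg_left (sqrt_mul_hess_le m (hl0 a) hla) (by positivity)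
      _ = _ := by ring
  have hlast := sum_le_sum fun a (_ : a ∈ Finset.univ) => hthird a
  rw [← mul_sum, ← trL_quadPow (hC w) hl] at hlast
  rw [trQ, smul_eq_mul]
  calc _ ≤ 0 + 1 / 2 * (2 * (3 * (160 / √w.1 * (2 * Λ + 4 * m ^ 2) *
        trL (quadPow m (cov μ w))))) := by
        refine add_le_add hdrift (mul_le_mul_of_nonneg_left (hhess.trans ?_) (by norm_num))
        exact mul_le_mul_of_nonneg_left (hsum.trans
          (mul_le_mul_of_nonneg_left hlast (by norm_num))) (by norm_num)
    _ = _ := by ring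

end Drift

section Gronwall

lemma le_mul_exp_of_deriv_le {f f' g g' : ℝ → ℝ} {a b : ℝ} (hab : a ≤ b)
    (hf : ContinuousOn f (Icc a b)) (hg : ContinuousOn g (Icc a b))
    (hf' : ∀ x ∈ Ioo a b, HasDerivAt f (f' x) x) (hg' : ∀ x ∈ Ioo a b, HasDerivAt g (g' x) x)
    (h : ∀ x ∈ Ioo a b, f' x ≤ g' x * f x) : f b ≤ f a * exp (g b - g a) := by
  have hd : ∀ x ∈ Ioo a b, HasDerivAt (fun x => f x * exp (-g x)) (f' x * exp (-g x) + f x * (exp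
    (-g x) * -g' x)) x := fun x hx => (hf' x hx).mul (hg' x hx).neg.exp
  have hanti : AntitoneOn (fun x => f x * exp (-g x)) (Icc a b) := by
    refine antitoneOn_of_deriv_nonpos (convex_Icc a b) (hf.mul (hg.neg.rexp)) ?_ ?_ <;>
      rw [interior_Icc]
    · exact fun x hx => (hd x hx).differentiableAt.differentiableWithinAt
    · intro x hx
      rw [(hd x hx).deriv]
      have := mul_nonneg (sub_nonneg.2 (h x hx)) (exp_pos (-g x)).le
      linarith
  have h1 := hanti (left_mem_Icc.2 hab) (right_mem_Icc.2 hab) hab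
  have h2 := mul_le_mul_of_nonneg_right h1 (exp_pos (g b)).le
  have h3 : f b * exp (-g b) * exp (g b) = f b := by
    rw [mul_assoc, ← exp_add]; simp
  rwa [h3, mul_assoc, ← exp_add, neg_add_eq_sub] at h2

lemma sub_le_of_deriv_le {f f' g g' : ℝ → ℝ} {b : ℝ} (hb : 0 ≤ b) (hf : Continuous f) (hg :
    Continuous g) (hf' : ∀ x, 0 < x → HasDerivAt f (f' x) x) (hg' : ∀ x, HasDerivAt g (g' x) x) (h :
    ∀ x ∈ Ioo 0 b, f' x ≤ g' x) : f b - f 0 ≤ g b - g 0 := by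
  have hanti : AntitoneOn (fun x => f x - g x) (Icc 0 b) := by
    refine antitoneOn_of_deriv_nonpos (convex_Icc 0 b) (hf.sub hg).continuousOn ?_ ?_ <;>
      rw [interior_Icc]
    · exact fun x hx => ((hf' x hx.1).sub (hg' x)).differentiableAt.differentiableWithinAt
    · intro x hx
      have := ((hf' x hx.1).sub (hg' x)).deriv
      rw [show (fun x => f x - g x) = f - g from rfl, this]
      grind
  have := hanti (left_mem_Icc.2 hb) (right_mem_Icc.2 hb) hb
  linarith

end Gronwall

section Evolution

variable {μ : Measure E} [IsProbabilityMeasure μ] {R : ℝ}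
  {ι : Type*} [Fintype ι] {e : OrthonormalBasis ι ℝ E}

lemma loc_zero : loc μ (0 : ℝ × E) = μ := by
  have : (fun b : E => stat b (0 : ℝ × E)) = fun _ => (0 : ℝ) := funext fun b => map_zero _
  rw [loc, this]
  simp

lemma law_zero (f : ℝ × E → ℝ) : law μ 0 f = f 0 := by
  have h : ∀ q : E × E, ((0 : ℝ), (0 : ℝ) • q.1 + √0 • q.2) = (0 : ℝ × E) := fun q => by simp
  simp only [law, h]
  simp

lemma Gen.continuous_law {G : ℝ × E → ℝ} {G' k} (hG : Gen e G G' k) (hμ : SuppIn μ R) :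
    Continuous fun s => law μ s G := by
  obtain ⟨C, hC0, hC⟩ := hG.norm_le
  exact SmallBall.continuous_law
    (continuous_iff_continuousAt.2 fun w => (hG.deriv w).continuousAt) hC0 hC hμ

lemma Gen.integrable_law {G : ℝ × E → ℝ} {G' k} (hG : Gen e G G' k) (hμ : SuppIn μ R)
    (s : ℝ) : Integrable (fun q : E × E => G (s, s • q.1 + √s • q.2)) (μ.prod (stdGaussian E)) := by
  obtain ⟨C, hC0, hC⟩ := hG.norm_le
  exact SmallBall.integrable_law
    (continuous_iff_continuousAt.2 fun w => (hG.deriv w).continuousAt) hC0 hC hμ s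

lemma law_mom (hμ : SuppIn μ R) {φ : E → ℝ} (hφ : Continuous φ) {s : ℝ} (hs : 0 ≤ s) :
    law μ s (mom μ φ) = ∫ b, φ b ∂μ := by
  obtain ⟨e, -⟩ : ∃ e : OrthonormalBasis (Fin (Module.finrank ℝ E)) ℝ E, e = e :=
    ⟨stdOrthonormalBasis ℝ E, rfl⟩
  have hG := gen_mom (e := e) hμ hφ
  have h0 : law μ 0 (mom μ φ) = ∫ b, φ b ∂μ := by rw [law_zero, mom, loc_zero]
  have hd : ∀ x, 0 < x → HasDerivAt (fun s => law μ s (mom μ φ)) 0 x := fun x hx => by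
    refine (hasDerivAt_law hμ hG hx).congr_deriv ?_
    simp only [law, gen_mom_eq_zero hμ hφ]; simp
  have h1 := sub_le_of_deriv_le (g := fun _ => 0) (g' := fun _ => 0) hs (hG.continuous_law hμ)
    continuous_const hd (fun x => hasDerivAt_const x _) (fun _ _ => le_rfl)
  have h2 := sub_le_of_deriv_le (f := fun s => -law μ s (mom μ φ)) (f' := fun _ => -0)
    (g := fun _ => 0) (g' := fun _ => 0) hs (hG.continuous_law hμ).neg
    continuous_const (fun x hx => (hd x hx).neg) (fun x => hasDerivAt_const x _) (fun _ _ => by simp)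
  linarith

lemma law_mono {f g : ℝ × E → ℝ} {s : ℝ}
    (hg : Integrable (fun q : E × E => g (s, s • q.1 + √s • q.2)) (μ.prod (stdGaussian E)))
    (hg0 : ∀ w, w.1 = s → 0 ≤ g w) (h : ∀ w, w.1 = s → f w ≤ g w) : law μ s f ≤ law μ s g := by
  by_cases hf : Integrable (fun q : E × E => f (s, s • q.1 + √s • q.2)) (μ.prod (stdGaussian E))
  · exact integral_mono hf hg fun q => h _ rfl
  · rw [law, integral_undef hf]
    exact integral_nonneg fun q => hg0 _ rfl

lemma law_trQ_growth (hμ : SuppIn μ R) (hslc : IsSLC μ) (m : ℕ) {a b : ℝ} (ha : 0 ≤ a) (hab : a ≤ b)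
    {Λ g : ℝ → ℝ} (hΛ0 : ∀ s, 0 ≤ Λ s) (hΛ : ∀ w : ℝ × E, 0 < w.1 → ∀ z, ⟪cov μ w z, z⟫ ≤ Λ w.1 ^ 2
    * ‖z‖ ^ 2) (hg : ContinuousOn g (Icc a b)) (hg' : ∀ s, 0 < s → HasDerivAt g (480 / √s * (2 * Λ s
    + 4 * m ^ 2)) s) : law μ b (trQ μ m) ≤ law μ a (trQ μ m) * exp (g b - g a) := by
  obtain ⟨G', k, hG, hle⟩ := exists_gen_trQ hμ (stdOrthonormalBasis ℝ E) m
  refine le_mul_exp_of_deriv_le hab (hG.continuous_law hμ).continuousOn hg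
    (fun s hs => hasDerivAt_law hμ hG (ha.trans_lt hs.1)) (fun s hs => hg' s (ha.trans_lt hs.1)) ?_
  intro s hs
  have hs0 := ha.trans_lt hs.1
  have h1 : law μ s (gen μ G' k) ≤
      law μ s (fun w => 480 / √s * (2 * Λ s + 4 * m ^ 2) * trQ μ m w) := by
    have h0 := hΛ0 s
    refine law_mono ((hG.integrable_law hμ s).const_mul _)
      (fun w _ => mul_nonneg (by positivity) (trQ_nonneg hμ m w)) fun w hw => ?_
    have := hle hslc w (hw ▸ hs0) (Λ s) h0 (fun z => hw ▸ hΛ w (hw ▸ hs0) z)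
    rwa [hw] at this
  refine h1.trans_eq ?_
  simp only [law, integral_const_mul]

lemma hasDerivAt_sqrt_mul {s : ℝ} (hs : 0 < s) (c : ℝ) :
    HasDerivAt (fun s => c * √s) (c / 2 / √s) s := by
  refine ((hasDerivAt_sqrt hs.ne').const_mul c).congr_deriv ?_
  field_simp

lemma law_trQ_le_of_bdd (hμ : SuppIn μ R) (hR : 0 ≤ R) (hslc : IsSLC μ) (m : ℕ) {b : ℝ} (hb : 0 ≤ b)
    : law μ b (trQ μ m) ≤ trQ μ m (0 : ℝ × E) * exp ((1920 * R + 3840 * m ^ 2) * √b) := by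
  have h := law_trQ_growth hμ hslc m le_rfl hb (Λ := fun _ => R) (g := fun s => (1920 * R + 3840 * m
    ^ 2) * √s) (fun _ => hR) ?_ (Continuous.continuousOn (by fun_prop)) ?_
  · simpa [law_zero] using h
  · intro w _ z
    have := isProbabilityMeasure_loc hμ w
    have h1 : mom μ (fun b => ⟪b, z⟫ * ⟪b, z⟫) w ≤ R ^ 2 * ‖z‖ ^ 2 := by
      refine (integral_mono_ae (integrable_loc hμ (by fun_prop) w)
        (integrable_const (R ^ 2 * ‖z‖ ^ 2)) ?_).trans_eq (by simp)
      filter_upwards [loc_ae hμ w] with b hb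
      rw [← sq, ← mul_pow, ← sq_abs]
      exact pow_le_pow_left₀ (abs_nonneg _) ((abs_real_inner_le_norm b z).trans
        (mul_le_mul_of_nonneg_right hb (norm_nonneg z))) 2
    rw [inner_cov' hμ]
    nlinarith
  · intro s hs
    exact (hasDerivAt_sqrt_mul hs _).congr_deriv (by ring)

lemma law_trQ_le_of_pos (hμ : SuppIn μ R) (hslc : IsSLC μ) (hbl : ∀ w : ℝ × E, 0 < w.1 → ∀ z, ⟪cov μ
    w z, z⟫ ≤ w.1⁻¹ * ‖z‖ ^ 2) (m : ℕ) {a b : ℝ} (ha : 0 < a) (hab : a ≤ b) : law μ b (trQ μ m) ≤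
    law μ a (trQ μ m) * exp (960 * log (b / a) + 3840 * m ^ 2 * √b) := by
  have h := law_trQ_growth hμ hslc m ha.le hab (Λ := fun s => (√s)⁻¹)
    (g := fun s => 960 * log s + 3840 * m ^ 2 * √s) (fun _ => by positivity) ?_ ?_ ?_
  · refine h.trans (mul_le_mul_of_nonneg_left (exp_le_exp.2 ?_)
      (integral_nonneg fun q => trQ_nonneg hμ m _))
    rw [log_div (ha.trans_le hab).ne' ha.ne']
    have : 0 ≤ 3840 * (m : ℝ) ^ 2 * √a := by positivity
    linarith
  · intro w hw z
    rw [inv_pow, sq_sqrt hw.le]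
    grind
  · refine ContinuousOn.add (ContinuousOn.mul continuousOn_const (continuousOn_log.mono ?_))
      (Continuous.continuousOn (by fun_prop))
    grind
  · intro s hs
    refine (((hasDerivAt_log hs.ne').const_mul 960).add (hasDerivAt_sqrt_mul hs _)).congr_deriv ?_
    have h2 : s⁻¹ = (√s)⁻¹ * (√s)⁻¹ := by rw [← mul_inv, mul_self_sqrt hs.le]
    rw [h2]
    ring

end Evolution

section Bootstrap

variable {μ : Measure E} [IsProbabilityMeasure μ] {R : ℝ}

/-- The measure is centered with identity covariance. -/
def IsIsotropic (μ : Measure E) : Prop := bary μ 0 = 0 ∧ ∀ u v, ∫ b, ⟪b, u⟫ * ⟪b, v⟫ ∂μ = ⟪u, v⟫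

lemma IsIsotropic.cov_zero (hiso : IsIsotropic μ) (hμ : SuppIn μ R) (u : E) : cov μ 0 u = u := by
  refine ext_inner_right ℝ fun v => ?_
  rw [inner_cov' hμ, hiso.1, mom, loc_zero, hiso.2]; simp

lemma IsIsotropic.trQ_zero (hiso : IsIsotropic μ) (hμ : SuppIn μ R) (m : ℕ) :
    trQ μ m (0 : ℝ × E) = Module.finrank ℝ E * (1 / 2) ^ m := by
  obtain ⟨C, hC⟩ := cov_mem_psd hμ
  rw [trQ, trL_quadPow (ε := stdOrthonormalBasis ℝ E) (l := fun _ => 1) (hC 0)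
    (fun a => by rw [hiso.cov_zero hμ, one_smul])]
  norm_num

lemma integrable_law_trQ (hμ : SuppIn μ R) (m : ℕ) (s : ℝ) :
    Integrable (fun q : E × E => trQ μ m (s, s • q.1 + √s • q.2)) (μ.prod (stdGaussian E)) := by
  obtain ⟨G', k, hG, -⟩ := exists_gen_trQ hμ (stdOrthonormalBasis ℝ E) m
  exact hG.integrable_law hμ s

lemma law_trQ_le (hμ : SuppIn μ R) (k j : ℕ) {ω : ℝ} (h0 : 0 < ω) (h1 : ω < 1) (s : ℝ) : law μ s
    (trQ μ k) ≤ (ω ^ j)⁻¹ * law μ s (trQ μ (k + j)) + Module.finrank ℝ E * (((1 - ω) ^ 2)⁻¹ * ω ^ k)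
    := by
  have hi := (integrable_law_trQ hμ (k + j) s).const_mul (ω ^ j)⁻¹
  have h := integral_mono (integrable_law_trQ hμ k s) (hi.add (integrable_const (Module.finrank ℝ E
    * (((1 - ω) ^ 2)⁻¹ * ω ^ k)))) fun q => trQ_le hμ k j h0 h1 (s, s • q.1 + √s • q.2)
  refine h.trans_eq ?_
  simp only [Pi.add_apply]
  rw [integral_add hi (integrable_const _), integral_const_mul]
  simp [law]

lemma sqrt_le_of_le_inv {m s : ℝ} (h : s ≤ (m ^ 4)⁻¹) : m ^ 2 * √s ≤ 1 := by
  rcases eq_or_ne m 0 with rfl | hm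
  · norm_num
  · have hm2 : 0 < m ^ 2 := by positivity
    rw [← le_div_iff₀' hm2]
    refine sqrt_le_iff.2 ⟨by positivity, h.trans_eq ?_⟩
    grind

lemma law_trQ_base (hμ : SuppIn μ R) (hR : 0 ≤ R) (hslc : IsSLC μ) (hiso : IsIsotropic μ)
    (m : ℕ) (hm : 2 * R ≤ m ^ 2) {s : ℝ} (hs : 0 ≤ s) (hsm : s ≤ ((m : ℝ) ^ 4)⁻¹) :
    law μ s (trQ μ m) ≤ Module.finrank ℝ E * exp (-m / 2 + 20000) := by
  have h := law_trQ_le_of_bdd hμ hR hslc m hs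
  rw [hiso.trQ_zero hμ] at h
  have h2 : (1 / 2 : ℝ) ^ m ≤ exp (-m / 2) := by
    have h3 : (1 / 2 : ℝ) ≤ exp (-(1 / 2)) := by
      have := add_one_le_exp (-(1 / 2) : ℝ)
      linarith
    calc (1 / 2 : ℝ) ^ m ≤ exp (-(1 / 2)) ^ m := pow_le_pow_left₀ (by norm_num) h3 m
      _ = exp (-m / 2) := by rw [← exp_nat_mul]; congr 1; ring
  have h4 : (1920 * R + 3840 * (m : ℝ) ^ 2) * √s ≤ 20000 := by
    have := sqrt_le_of_le_inv hsm
    have h5 : R * √s ≤ m ^ 2 / 2 * √s := mul_le_mul_of_nonneg_right (by linarith) (sqrt_nonneg s)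
    linarith
  refine h.trans ?_
  rw [exp_add, mul_assoc]
  gcongr

lemma exp_interp {m : ℝ} (hm : 40000 ≤ m) : exp (-(1 / 2) + 10000 / m) ≤ 4 / 5 := by
  have h1 : -(1 / 2) + 10000 / m ≤ -(1 / 4) := by
    have : 10000 / m ≤ 1 / 4 := by rw [div_le_div_iff₀ (by linarith) (by norm_num)]; linarith
    linarith
  refine (exp_le_exp.2 h1).trans ?_
  rw [exp_neg, inv_le_comm₀ (exp_pos _) (by norm_num)]
  have := add_one_le_exp (1 / 4 : ℝ)
  linarith

lemma law_trQ_step (hμ : SuppIn μ R) (hslc : IsSLC μ) (hbl : ∀ w : ℝ × E, 0 < w.1 → ∀ z, ⟪cov μ w z,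
    z⟫ ≤ w.1⁻¹ * ‖z‖ ^ 2) {m : ℕ} (hm : 40000 ≤ (m : ℝ)) {N : ℝ} (hN : Module.finrank ℝ E = N) (H :
    ∀ s, 0 ≤ s → s ≤ (((2 * m : ℕ) : ℝ) ^ 4)⁻¹ → law μ s (trQ μ (2 * m)) ≤ N * exp (-((2 * m : ℕ) :
    ℝ) / 2 + 20000)) {s : ℝ} (hs : 0 ≤ s) (hsm : s ≤ ((m : ℝ) ^ 4)⁻¹) : law μ s (trQ μ m) ≤ N * exp
    (-m / 2 + 20000) := by
  have hN0 := hN ▸ Nat.cast_nonneg _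
  push_cast at H
  have early : ∀ s, 0 ≤ s → s ≤ ((2 * (m : ℝ)) ^ 4)⁻¹ →
      law μ s (trQ μ m) ≤ N * exp (-m / 2 + 10026) := by
    intro s hs hsm
    obtain ⟨ω, hω⟩ : ∃ ω, ω = exp (-(1 / 2) + 10000 / m) := ⟨_, rfl⟩
    have hω1 := hω ▸ exp_interp hm
    have hωm : ω ^ m = exp (-m / 2 + 10000) := by
      rw [hω, ← exp_nat_mul]; congr 1; field_simp
    have h1 := law_trQ_le hμ m m (hω ▸ exp_pos _ : 0 < ω) (by linarith) s
    rw [← two_mul, hωm, ← exp_neg, hN] at h1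
    have h2 : ((1 - ω) ^ 2)⁻¹ ≤ 25 := by
      rw [inv_le_comm₀ (pow_pos (by linarith) 2) (by norm_num)]
      nlinarith
    have h26 : (26 : ℝ) ≤ exp 26 := by linarith [add_one_le_exp (26 : ℝ)]
    calc _ ≤ exp (-(-m / 2 + 10000)) * (N * exp (-(2 * m) / 2 + 20000)) + N * (25 * exp (-m / 2 +
          10000)) := h1.trans (add_le_add (mul_le_mul_of_nonneg_left (H s hs hsm) (exp_pos _).le)
          (mul_le_mul_of_nonneg_left (mul_le_mul_of_nonneg_right h2 (exp_pos _).le) hN0))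
      _ = N * (26 * exp (-m / 2 + 10000)) := by
          rw [mul_left_comm, ← exp_add,
            show -(-(m : ℝ) / 2 + 10000) + (-(2 * m) / 2 + 20000) = -m / 2 + 10000 by ring]
          ring
      _ ≤ N * (exp 26 * exp (-m / 2 + 10000)) := by gcongr
      _ = _ := by rw [← exp_add]; congr 2; ring
  rcases le_total s ((2 * (m : ℝ)) ^ 4)⁻¹ with h | h
  · refine (early s hs h).trans ?_
    gcongr
    norm_num
  · have ha : 0 < ((2 * (m : ℝ)) ^ 4)⁻¹ := by positivity
    have h1 := law_trQ_le_of_pos hμ hslc hbl m ha h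
    have h2 : Real.log (s / ((2 * (m : ℝ)) ^ 4)⁻¹) ≤ 4 := by
      have h3 : s / ((2 * (m : ℝ)) ^ 4)⁻¹ ≤ 16 := by
        rw [div_inv_eq_mul]
        calc s * (2 * (m : ℝ)) ^ 4 ≤ ((m : ℝ) ^ 4)⁻¹ * (2 * (m : ℝ)) ^ 4 := by gcongr
          _ = 16 := by field_simp; norm_num
      rw [log_le_iff_le_exp (div_pos (ha.trans_le h) ha)]
      refine h3.trans ?_
      have := add_one_le_exp (1 : ℝ)
      calc (16 : ℝ) = 2 ^ 4 := by norm_num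
        _ ≤ exp 1 ^ 4 := by gcongr; linarith
        _ = exp 4 := by rw [← exp_nat_mul]; norm_num
    have h4 := sqrt_le_of_le_inv hsm
    calc _ ≤ N * exp (-m / 2 + 10026) * exp (960 * 4 + 3840) := by
          refine h1.trans ?_
          have h5 := early _ ha.le le_rfl
          have h6 : 960 * Real.log (s / ((2 * (m : ℝ)) ^ 4)⁻¹) + 3840 * (m : ℝ) ^ 2 * √s ≤
            960 * 4 + 3840 := by linarith
          gcongr
      _ = N * exp (-m / 2 + 10026 + (960 * 4 + 3840)) := by rw [mul_assoc, ← exp_add]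
      _ ≤ _ := mul_le_mul_of_nonneg_left (exp_le_exp.2 (by linarith)) hN0

theorem law_trQ_dyadic (hμ : SuppIn μ R) (hR : 0 ≤ R) (hslc : IsSLC μ)
    (hbl : ∀ w : ℝ × E, 0 < w.1 → ∀ z, ⟪cov μ w z, z⟫ ≤ w.1⁻¹ * ‖z‖ ^ 2) (hiso : IsIsotropic μ)
    (j : ℕ) (hj : 40000 ≤ (2 : ℝ) ^ j) {s : ℝ} (hs : 0 ≤ s) (hsj : s ≤ (((2 : ℝ) ^ j) ^ 4)⁻¹) :
    law μ s (trQ μ (2 ^ j)) ≤ Module.finrank ℝ E := by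
  suffices H : ∀ k i : ℕ, 40000 ≤ (2 : ℝ) ^ i → 2 * R ≤ ((2 : ℝ) ^ (i + k)) ^ 2 → ∀ s, 0 ≤ s → s ≤
      (((2 ^ i : ℕ) : ℝ) ^ 4)⁻¹ → law μ s (trQ μ (2 ^ i)) ≤ Module.finrank ℝ E * exp (-((2 ^ i : ℕ)
      : ℝ) / 2 + 20000) by
    obtain ⟨k, hk⟩ := pow_unbounded_of_one_lt (2 * R) one_lt_two
    refine (H k j hj ?_ s hs (by grind)).trans (mul_le_of_le_one_right
      (Nat.cast_nonneg _) (exp_le_one_iff.2 (by grind)))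
    have h1 : (2 : ℝ) ^ k ≤ 2 ^ (j + k) := pow_le_pow_right₀ one_le_two (Nat.le_add_left k j)
    have h2 : (1 : ℝ) ≤ 2 ^ (j + k) := one_le_pow₀ one_le_two
    nlinarith
  intro k
  induction k with
  | zero =>
    intro i _ hi s hs hsi
    exact law_trQ_base hμ hR hslc hiso _ (by grind) hs hsi
  | succ k ih =>
    intro i hi hik s hs hsi
    refine law_trQ_step hμ hslc hbl (by push_cast; exact hi) rfl (fun s hs hs2 => ?_) hs hsi
    rw [← pow_succ'] at hs2 ⊢
    refine ih (i + 1) ?_ ?_ s hs hs2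
    · rw [pow_succ]; linarith
    · rwa [show i + 1 + k = i + (k + 1) by ring]

theorem law_trQ_zero_le (hμ : SuppIn μ R) (hR : 0 ≤ R) (hslc : IsSLC μ)
    (hbl : ∀ w : ℝ × E, 0 < w.1 → ∀ z, ⟪cov μ w z, z⟫ ≤ w.1⁻¹ * ‖z‖ ^ 2) (hiso : IsIsotropic μ)
    (j : ℕ) (hj : 40000 ≤ (2 : ℝ) ^ j) {s : ℝ} (hs : 0 ≤ s) (hsj : s ≤ (((2 : ℝ) ^ j) ^ 4)⁻¹) :
    law μ s (trQ μ 0) ≤ (2 ^ 2 ^ j + 4) * Module.finrank ℝ E := by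
  have h1 := law_trQ_le hμ 0 (2 ^ j) (ω := 1 / 2) (by norm_num) (by norm_num) s
  have h2 := law_trQ_dyadic hμ hR hslc hbl hiso j hj hs hsj
  rw [zero_add] at h1
  have h3 : (((1 - 1 / 2 : ℝ)) ^ 2)⁻¹ * (1 / 2) ^ 0 = 4 := by norm_num
  have h4 : (((1 / 2 : ℝ)) ^ 2 ^ j)⁻¹ = 2 ^ 2 ^ j := by simp
  rw [h3, h4] at h1
  refine h1.trans ?_
  have h5 := mul_le_mul_of_nonneg_left h2 (by positivity : (0 : ℝ) ≤ 2 ^ 2 ^ j)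
  linarith

end Bootstrap

section Entropy

variable {μ : Measure E} [IsProbabilityMeasure μ] {R : ℝ}
  {ι : Type*} [Fintype ι] {e : OrthonormalBasis ι ℝ E}

lemma exists_gen_trL_cov (hμ : SuppIn μ R) (e : OrthonormalBasis ι ℝ E) :
    ∃ G' k, Gen e (fun w => trL (cov μ w)) G' k ∧ ∀ w, gen μ G' k w = -trQ μ 0 w := by
  obtain ⟨C, hC⟩ := cov_mem_psd hμ
  refine ⟨_, _, (gen_cov (e := e) hμ).comp (isCompact_psd C) hC (Φ := fun A => trL A) (Φ' := fun _
    => trL) (Φ'' := fun _ => 0) (fun A _ => (trL (E := E)).hasFDerivAt) (fun A _ =>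
    hasFDerivAt_const _ _) continuousOn_const, fun w => ?_⟩
  rw [gen_comp (e := e) (μ := μ) (G := cov μ) (G' := covD μ) (k := fun i => covK μ (e i))
    (Φ' := fun _ => trL) (Φ'' := fun _ => 0) w, gen_cov_eq hμ]
  aesop

/-- The logarithmic partition function of the localized measures. -/
def logZ (μ : Measure E) (w : ℝ × E) : ℝ := log (∫ b, exp (stat b w) ∂μ)

lemma integrable_exp_stat (hμ : SuppIn μ R) (w : ℝ × E) :
    Integrable (fun b => exp (stat b w)) μ := by
  obtain ⟨C, -, hC⟩ := exists_ae_bound hμ (φ := fun b : E => exp (stat b w))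
    (continuous_exp.comp (continuous_stat.clm_apply continuous_const))
  exact Integrable.of_bound (Real.continuous_exp.comp
    (continuous_stat.clm_apply continuous_const)).aestronglyMeasurable C hC

lemma gen_logZ (hμ : SuppIn μ R) (e : OrthonormalBasis ι ℝ E) :
    Gen e (logZ μ) (mom μ stat) (fun i w => ⟪cov μ w (e i), e i⟫) where
  deriv w := by
    have h := (isExpFamily_stat hμ).hasFDerivAt_log_partition w
    aesop
  line i w := by
    have h1 := funext fun w => by
      have h := mom_clm hμ (ContinuousLinearMap.apply ℝ ℝ ((0, e i) : ℝ × E)) continuous_stat w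
      simp only [apply_apply, stat_inr] at h
      exact h.symm
    rw [h1]
    have hc : Continuous fun b : E => ⟪b, e i⟫ := by fun_prop
    have h := ((hasFDerivAt_mom hμ hc w).hasLineDerivAt (0, e i))
    rw [momD_apply hμ hc] at h
    simp only [stat_inr] at h
    rwa [inner_cov' hμ, ← mom_inner hμ]
  bdd := bddCont_mom hμ continuous_stat
  bddk i := by
    have hc : Continuous fun b : E => ⟪b, e i⟫ := by fun_prop
    have h := (bddCont_mom hμ (hc.mul hc)).sub ((bddCont_mom hμ hc).mul (bddCont_mom hμ hc))
    refine (congrArg BddCont (funext fun w => ?_)).mp h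
    rw [inner_cov' hμ, ← mom_inner hμ]
    rfl

lemma gen_logZ_eq (hμ : SuppIn μ R) (e : OrthonormalBasis ι ℝ E) (w : ℝ × E) : gen μ (mom μ stat)
    (fun i w => ⟪cov μ w (e i), e i⟫) w = 1 / 2 * (mom μ (fun b => ‖b‖ ^ 2) w - trL (cov μ w)) := by
  have h1 : mom μ stat w (1, bary μ w) =
      -(1 / 2) * mom μ (fun b => ‖b‖ ^ 2) w + ⟪bary μ w, bary μ w⟫ := by
    have h := mom_clm hμ (ContinuousLinearMap.apply ℝ ℝ ((1, bary μ w) : ℝ × E)) continuous_stat w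
    simp only [apply_apply] at h
    rw [← h, ← mom_inner hμ, ← smul_eq_mul, ← mom_smul, ← mom_add hμ (by fun_prop) (by fun_prop)]
    refine congrArg (mom μ · w) (funext fun b => ?_)
    rw [stat_apply, smul_eq_mul]; ring
  have h2 : trL (cov μ w) = mom μ (fun b => ‖b‖ ^ 2) w - ⟪bary μ w, bary μ w⟫ := by
    have hs : mom μ (fun b => ‖b‖ ^ 2) w = ∑ i, mom μ (fun b => ⟪b, e i⟫ * ⟪b, e i⟫) w := by
      rw [← mom_sum hμ _ (fun i => by fun_prop)]
      refine congrArg (mom μ · w) (funext fun b => ?_)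
      rw [← e.sum_sq_inner_left b]
      grind
    rw [trL_eq_sum e, hs, real_inner_self_eq_norm_sq, ← e.sum_sq_inner_left (bary μ w),
      ← sum_sub_distrib]
    refine sum_congr rfl fun i _ => ?_
    rw [real_inner_comm, inner_cov' hμ, sq]
  have h3 : ∑ i, ⟪cov μ w (e i), e i⟫ = trL (cov μ w) := by
    rw [trL_eq_sum e]
    exact sum_congr rfl fun i _ => real_inner_comm _ _
  rw [gen, h1, smul_eq_mul, h3]
  linarith

lemma IsIsotropic.integral_norm_sq (hiso : IsIsotropic μ) (hμ : SuppIn μ R) :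
    ∫ b, ‖b‖ ^ 2 ∂μ = Module.finrank ℝ E := by
  have h : ∀ b : E, ‖b‖ ^ 2 = ∑ i, ⟪b, stdOrthonormalBasis ℝ E i⟫ * ⟪b, stdOrthonormalBasis ℝ E i⟫ :=
    fun b => by
      rw [← (stdOrthonormalBasis ℝ E).sum_sq_inner_left b]
      grind
  simp only [h]
  rw [integral_finsetSum _ fun i _ => ?_]
  · simp [hiso.2]
  · have := integrable_loc hμ (φ := fun b : E => ⟪b, stdOrthonormalBasis ℝ E i⟫ *
      ⟪b, stdOrthonormalBasis ℝ E i⟫) (by fun_prop) 0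
    rwa [loc_zero] at this

/-- The expected logarithmic partition function grows at most quadratically in time. -/
lemma law_logZ_le (hμ : SuppIn μ R) (hiso : IsIsotropic μ) {C t : ℝ} (ht : 0 ≤ t) (hC : ∀ s, 0 < s →
    s < t → law μ s (trQ μ 0) ≤ C) : law μ t (logZ μ) ≤ C * t ^ 2 / 4 := by
  have e := stdOrthonormalBasis ℝ E
  obtain ⟨G', k, hG, hgen⟩ := exists_gen_trL_cov hμ e
  have hN : trL (cov μ 0) = Module.finrank ℝ E := by
    rw [trL_eq_sum e]; simp [hiso.cov_zero hμ]
  have hT : ∀ s, 0 ≤ s → s ≤ t → Module.finrank ℝ E - law μ s (fun w => trL (cov μ w)) ≤ C * s := by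
    intro s hs hst
    have h := sub_le_of_deriv_le (f := fun s => -law μ s (fun w => trL (cov μ w))) (g := fun s => C
      * s) (g' := fun _ => C) hs (hG.continuous_law hμ).neg (by fun_prop) (fun x hx =>
      (hasDerivAt_law hμ hG hx).neg) (fun x => by simpa using (hasDerivAt_id x).const_mul C) (fun x
      hx => by
        rw [funext hgen, law, integral_neg, neg_neg]
        exact hC x hx.1 (hx.2.trans_le hst))
    rw [law_zero, hN] at h
    linarith
  have hZ := gen_logZ hμ e
  have hc : Continuous fun b : E => ‖b‖ ^ 2 := by fun_prop
  have h := sub_le_of_deriv_le (f := fun s => law μ s (logZ μ)) (g := fun s => C * s ^ 2 / 4) (g' :=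
    fun s => C * s / 2) ht (hZ.continuous_law hμ) (by fun_prop) (fun x hx => hasDerivAt_law hμ hZ
    hx) (fun x => (((hasDerivAt_pow 2 x).const_mul C).div_const 4).congr_deriv (by ring)) (fun x hx
    => by
      have h1 := hT x hx.1.le hx.2.le
      have h2 : law μ x (gen μ (mom μ stat) fun i w => ⟪cov μ w (e i), e i⟫) =
          1 / 2 * (Module.finrank ℝ E - law μ x fun w => trL (cov μ w)) := by
        rw [funext (gen_logZ_eq hμ e), ← hiso.integral_norm_sq hμ, ← law_mom hμ hc hx.1.le, law,
          law, law, integral_const_mul, integral_sub ((gen_mom (e := e) hμ hc).integrable_law hμ x)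
          (hG.integrable_law hμ x)]
      linarith)
  rw [law_zero] at h
  have h0 : logZ μ 0 = 0 := by simp [logZ]
  linarith

/-- Change of measure: the log-probability of `S` is controlled by the localized one. -/
lemma log_measureReal_le_loc (hμ : SuppIn μ R) {S : Set E} (hS0 : 0 < μ.real S) (w : ℝ × E) : log
    (μ.real S) ≤ log ((loc μ w).real S) + logZ μ w - (μ.real S)⁻¹ * ∫ b in S, stat b w ∂μ := by
  have hi := integrable_exp_stat hμ w
  have hZ := MeasureTheory.integral_exp_pos hi
  have hst : Integrable (fun b : E => stat b w) μ := by
    have := integrable_loc hμ (φ := fun b : E => stat b w)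
      (continuous_stat.clm_apply continuous_const) 0
    rwa [loc_zero] at this
  obtain ⟨c, hc⟩ : ∃ c, c = (μ.real S)⁻¹ * ∫ b in S, stat b w ∂μ := ⟨_, rfl⟩
  have h1 : (loc μ w).real S = (∫ b in S, exp (stat b w) ∂μ) / ∫ b, exp (stat b w) ∂μ := by
    have := setIntegral_tilted (μ := μ) (fun b : E => stat b w) (fun _ => (1 : ℝ)) S
    simp only [smul_eq_mul, mul_one, integral_div, setIntegral_const] at this
    exact this
  have h2 : exp c * μ.real S ≤ ∫ b in S, exp (stat b w) ∂μ := by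
    have hle : ∀ b, exp c * (stat b w + (1 - c)) ≤ exp (stat b w) := fun b => by
      have := add_one_le_exp (stat b w - c)
      calc _ ≤ exp c * exp (stat b w - c) := mul_le_mul_of_nonneg_left (by linarith) (exp_pos c).le
        _ = _ := by rw [← exp_add]; congr 1; ring
    refine le_trans (le_of_eq ?_) (integral_mono ((hst.integrableOn.add
      (integrable_const (1 - c))).const_mul (exp c)) hi.integrableOn hle)
    simp only [Pi.add_apply]
    rw [integral_const_mul, integral_add hst.integrableOn (integrable_const _)]
    have : ∫ b in S, stat b w ∂μ = c * μ.real S := by grind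
    rw [this]
    simp; ring
  have h3 := (mul_pos (exp_pos c) hS0).trans_le h2
  rw [h1, log_div h3.ne' hZ.ne', logZ, ← hc]
  have := log_le_log (mul_pos (exp_pos c) hS0) h2
  rw [log_mul (exp_pos c).ne' hS0.ne', log_exp] at this
  linarith

end Entropy

end Euclidean

section Uniform

variable {n : ℕ} {K : Set (EuclideanSpace ℝ (Fin n))}

local notation "𝔼" => EuclideanSpace ℝ (Fin n)

/-- The uniform probability measure on `K`. -/
def unif (K : Set 𝔼) : Measure 𝔼 := (volume.restrict K).tilted fun _ => 0

lemma isProbabilityMeasure_unif (hK : IsCompact K) (hK0 : volume K ≠ 0) :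
    IsProbabilityMeasure (unif K) := by
  have : NeZero (volume.restrict K) := ⟨by simpa using hK0⟩
  have : IsFiniteMeasure (volume.restrict K) := ⟨by simpa using hK.measure_lt_top⟩
  exact isProbabilityMeasure_tilted (integrable_const _)

lemma unif_ae_mem (hK : IsCompact K) : ∀ᵐ b ∂unif K, b ∈ K :=
  (tilted_absolutelyContinuous _ _).ae_le (ae_restrict_mem hK.measurableSet)

lemma loc_unif (hK : IsCompact K) (w : ℝ × 𝔼) :
    loc (unif K) w = (volume.restrict K).tilted fun b => stat b w := by
  have : IsFiniteMeasure (volume.restrict K) := ⟨by simpa using hK.measure_lt_top⟩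
  rw [loc, unif, tilted_tilted (integrable_const _)]
  exact congrArg _ (funext fun b => zero_add _)

lemma map_tilted {α β : Type*} [MeasurableSpace α] [MeasurableSpace β] {ρ : Measure α} {g : α → β}
    (hg : Measurable g) {f : β → ℝ} (hf : Measurable f) :
    (ρ.map g).tilted f = (ρ.tilted (f ∘ g)).map g := by
  have hm : Measurable fun x => ENNReal.ofReal (exp (f x) / ∫ x, exp (f x) ∂(ρ.map g)) :=
    (hf.exp.div_const _).ennreal_ofReal
  ext s hs
  rw [tilted, map_apply hg hs, withDensity_apply _ hs, setLIntegral_map hs hm hg, tilted,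
    withDensity_apply _ (hg hs), integral_map hg.aemeasurable hf.exp.aestronglyMeasurable]
  rfl

/-- Brascamp--Lieb for linear functionals under Gaussian reweightings of the uniform measure. -/
lemma variance_inner_le (hK : IsCompact K) (hKc : Convex ℝ K) (hK0 : volume K ≠ 0) (w : ℝ × 𝔼) (P :
    𝔼 →L[ℝ] 𝔼) (a y e : 𝔼) (κ : ℝ) {σ : ℝ} (hσ : 0 < σ) (h : ∀ d, σ * ⟪e, d⟫ ^ 2 ≤ w.1 * ‖d‖ ^ 2 + κ
    * ‖P d‖ ^ 2) {ν : Measure 𝔼} (hν : ν = (volume.restrict K).tilted fun x => stat x w - κ / 2 * ‖y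
    - P (x - a)‖ ^ 2) : ∫ x, (⟪e, x⟫ - ∫ z, ⟪e, z⟫ ∂ν) ^ 2 ∂ν ≤ 1 / σ := by
  subst hν
  have hs : Continuous fun x : 𝔼 => stat x w := continuous_stat.clm_apply continuous_const
  refine integral_inner_sq_le hK hKc hK0 (by fun_prop) hσ fun x z => ?_
  have h1 := h (x - z)
  have h2 : ‖(1 / 2 : ℝ) • x + (1 / 2 : ℝ) • z‖ ^ 2 =
      (‖x‖ ^ 2 + ‖z‖ ^ 2) / 2 - ‖x - z‖ ^ 2 / 4 := by
    have := parallelogram_law_with_norm ℝ x z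
    rw [← smul_add, norm_smul, mul_pow, show ‖(1 / 2 : ℝ)‖ ^ 2 = 1 / 4 by norm_num]
    linarith
  have h3 : ‖y - P ((1 / 2 : ℝ) • x + (1 / 2 : ℝ) • z - a)‖ ^ 2 =
      (‖y - P (x - a)‖ ^ 2 + ‖y - P (z - a)‖ ^ 2) / 2 - ‖P (x - z)‖ ^ 2 / 4 := by
    have := parallelogram_law_with_norm ℝ (y - P (x - a)) (y - P (z - a))
    have e1 : y - P ((1 / 2 : ℝ) • x + (1 / 2 : ℝ) • z - a) =
        (1 / 2 : ℝ) • ((y - P (x - a)) + (y - P (z - a))) := by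
      simp only [map_sub, map_add, map_smul]; module
    have e2 : ‖(y - P (x - a)) - (y - P (z - a))‖ = ‖P (x - z)‖ := by
      rw [← norm_neg]; congr 1; simp only [map_sub]; abel
    rw [e2] at this
    rw [e1, norm_smul, mul_pow, show ‖(1 / 2 : ℝ)‖ ^ 2 = 1 / 4 by norm_num]
    linarith
  rw [h3, stat_apply, stat_apply, stat_apply, h2, inner_add_left, inner_smul_left, inner_smul_left]
  simp only [conj_trivial]
  linarith

lemma integral_sub_mean_sq {ν : Measure 𝔼} [IsProbabilityMeasure ν] {f : 𝔼 → ℝ}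
    (h1 : Integrable f ν) (h2 : Integrable (fun x => f x ^ 2) ν) :
    ∫ x, (f x - ∫ z, f z ∂ν) ^ 2 ∂ν = ∫ x, f x ^ 2 ∂ν - (∫ z, f z ∂ν) ^ 2 := by
  obtain ⟨m, hm⟩ : ∃ m, m = ∫ z, f z ∂ν := ⟨_, rfl⟩
  rw [← hm]
  have : ∀ x, (f x - m) ^ 2 = f x ^ 2 - (2 * m * f x - m ^ 2) := fun x => by ring
  simp only [this]
  rw [integral_sub h2 (f := fun x => f x ^ 2) (g := fun x => 2 * m * f x - m ^ 2)
    ((h1.const_mul _).sub (integrable_const _)),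
    integral_sub (h1.const_mul _) (integrable_const _), integral_const_mul, ← hm]
  simp; ring

lemma isSLC_unif (hK : IsCompact K) (hKc : Convex ℝ K) (hK0 : volume K ≠ 0) : IsSLC (unif K) := by
  intro w hw P hP hP1 a β hβ y v
  have : NeZero (volume.restrict K) := ⟨by simpa using hK0⟩
  have hs : Continuous fun x : 𝔼 => stat x w := continuous_stat.clm_apply continuous_const
  have hg : Continuous fun b : 𝔼 => P (b - a) := by fun_prop
  have hgc : Continuous fun x : 𝔼 => gexp β x y := by unfold gexp; fun_prop
  obtain ⟨ν, hν⟩ : ∃ ν, ν = (volume.restrict K).tilted fun x =>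
    stat x w - β⁻¹ / 2 * ‖y - P (x - a)‖ ^ 2 := ⟨_, rfl⟩
  have iexp : ∀ {φ : 𝔼 → ℝ}, Continuous φ → Integrable φ (volume.restrict K) := fun hφ =>
    hφ.continuousOn.integrableOn_compact hK
  have hpost : post ((loc (unif K) w).map fun b => P (b - a)) β y = ν.map fun b => P (b - a) := by
    rw [post, map_tilted hg.measurable hgc.measurable, loc_unif hK,
      tilted_tilted (iexp (continuous_exp.comp hs)), hν]
    congr 2
    funext x
    simp only [Pi.add_apply, Function.comp, gexp]
    ring
  have hνp : IsProbabilityMeasure ν := hν ▸ isProbabilityMeasure_tilted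
    (iexp (continuous_exp.comp (by fun_prop)))
  have hνK : ∀ᵐ b ∂ν, b ∈ K := by
    rw [hν]
    exact (tilted_absolutelyContinuous _ _).ae_le (ae_restrict_mem hK.measurableSet)
  have hint : ∀ {φ : 𝔼 → ℝ}, Continuous φ → Integrable φ ν := fun {φ} hφ => by
    obtain ⟨C, hC⟩ := hK.exists_bound_of_continuousOn hφ.continuousOn
    exact Integrable.of_bound hφ.aestronglyMeasurable C (hνK.mono hC)
  rw [hpost, integral_map hg.aemeasurable (by fun_prop), integral_map hg.aemeasurable (by fun_prop),
    ← integral_sub_mean_sq (hint (by fun_prop)) (hint (by fun_prop))]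
  rcases eq_or_ne v 0 with rfl | hv
  · simp
  have hσ : 0 < (w.1 + β⁻¹) / ‖v‖ ^ 2 := by positivity
  have h := variance_inner_le hK hKc hK0 w P a y (P v) β⁻¹ hσ (fun d => ?_) hν
  · rw [one_div_div] at h
    refine le_trans (le_of_eq ?_) h
    have e1 : ∀ x, ⟪v, P (x - a)⟫ = ⟪P v, x⟫ - ⟪P v, a⟫ := fun x => by rw [← inner_sub_right, hP]
    simp only [e1]
    rw [integral_sub (hint (by fun_prop)) (integrable_const _)]
    simp
  · have h1 : ⟪P v, d⟫ ^ 2 ≤ ‖v‖ ^ 2 * ‖P d‖ ^ 2 := by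
      rw [hP, ← mul_pow]
      exact sq_le_sq' (by linarith [neg_abs_le ⟪v, P d⟫, abs_real_inner_le_norm v (P d)])
        ((le_abs_self _).trans (abs_real_inner_le_norm _ _))
    have h2 := pow_le_pow_left₀ (norm_nonneg _) (hP1 d) 2
    calc _ ≤ (w.1 + β⁻¹) / ‖v‖ ^ 2 * (‖v‖ ^ 2 * ‖P d‖ ^ 2) := mul_le_mul_of_nonneg_left h1 hσ.le
      _ = (w.1 + β⁻¹) * ‖P d‖ ^ 2 := by field_simp
      _ ≤ _ := by rw [add_mul]; gcongr

lemma inner_cov_unif_le (hK : IsCompact K) (hKc : Convex ℝ K) (hK0 : volume K ≠ 0) (w : ℝ × 𝔼)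
    (hw : 0 < w.1) (z : 𝔼) : ⟪cov (unif K) w z, z⟫ ≤ w.1⁻¹ * ‖z‖ ^ 2 := by
  have := isProbabilityMeasure_unif hK hK0
  obtain ⟨R, hR⟩ := hK.isBounded.exists_norm_le
  have hμ := (unif_ae_mem hK).mono hR
  rcases eq_or_ne z 0 with rfl | hz
  · simp
  have h := variance_inner_le hK hKc hK0 w 0 0 0 z 0 (σ := w.1 / ‖z‖ ^ 2) (by positivity)
    (fun d => ?_) (ν := loc (unif K) w) (by rw [loc_unif hK]; simp)
  · rw [inner_cov hμ, mom]
    have e1 : ∀ b : 𝔼, ⟪b - bary (unif K) w, z⟫ = ⟪z, b⟫ - ∫ x, ⟪z, x⟫ ∂(loc (unif K) w) := fun b => by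
      rw [inner_sub_left, ← mom_inner hμ, mom]
      simp only [real_inner_comm]
    simp only [e1, ← sq]
    refine h.trans_eq ?_
    grind
  · have h1 : ⟪z, d⟫ ^ 2 ≤ ‖z‖ ^ 2 * ‖d‖ ^ 2 := by
      rw [← mul_pow]
      exact sq_le_sq' (by linarith [neg_abs_le ⟪z, d⟫, abs_real_inner_le_norm z d])
        ((le_abs_self _).trans (abs_real_inner_le_norm _ _))
    calc _ ≤ w.1 / ‖z‖ ^ 2 * (‖z‖ ^ 2 * ‖d‖ ^ 2) := mul_le_mul_of_nonneg_left h1 (by positivity)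
      _ = w.1 * ‖d‖ ^ 2 := by field_simp
      _ ≤ _ := by simp

lemma law_inner {μ : Measure 𝔼} [IsProbabilityMeasure μ] {R : ℝ} (hμ : SuppIn μ R) (hiso :
    IsIsotropic μ) (m : 𝔼) (t : ℝ) : Integrable (fun q : 𝔼 × 𝔼 => ⟪m, t • q.1 + √t • q.2⟫) (μ.prod
    (stdGaussian 𝔼)) ∧ ∫ q : 𝔼 × 𝔼, ⟪m, t • q.1 + √t • q.2⟫ ∂(μ.prod (stdGaussian 𝔼)) = 0 := by
  have i1 : Integrable (fun q : 𝔼 × 𝔼 => t * ⟪m, q.1⟫) (μ.prod (stdGaussian 𝔼)) := by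
    obtain ⟨C, -, hC⟩ := exists_ae_bound hμ (φ := fun b => t * ⟪m, b⟫) (by fun_prop)
    exact Integrable.of_bound (by fun_prop) C (ae_prod_fst hC)
  have i2 : Integrable (fun q : 𝔼 × 𝔼 => √t * ⟪m, q.2⟫) (μ.prod (stdGaussian 𝔼)) :=
    (((integrable_snd_pow 1).const_mul ‖m‖).mono' (by fun_prop) (.of_forall fun q => by
      rw [pow_one]; exact norm_inner_le_norm _ _)).const_mul _
  simp only [inner_add_right, inner_smul_right]
  refine ⟨i1.add i2, ?_⟩
  rw [integral_add i1 i2, integral_const_mul, integral_const_mul,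
    integral_fun_fst (fun x : 𝔼 => ⟪m, x⟫), integral_fun_snd (fun x : 𝔼 => ⟪m, x⟫)]
  have h1 : ∫ x, ⟪m, x⟫ ∂μ = 0 := by
    have := mom_inner hμ m 0
    rw [hiso.1, mom, loc_zero, inner_zero_left] at this
    simpa only [real_inner_comm] using this
  have h2 := integral_strongDual_stdGaussian (innerSL ℝ m)
  simp only [innerSL_apply_apply] at h2
  simp [h1, h2]

lemma le_integral_combination {Ω : Type*} [MeasurableSpace Ω] {ν : Measure Ω}
    [IsProbabilityMeasure ν] {f g h : Ω → ℝ} (hf : Integrable f ν) (hg : Integrable g ν)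
    (hh : Integrable h ν) {a b c : ℝ} (H : ∀ x, c ≤ a * f x + g x + (b - h x)) :
    c ≤ a * ∫ x, f x ∂ν + ∫ x, g x ∂ν + (b - ∫ x, h x ∂ν) := by
  have i1 : Integrable (fun x => a * f x + g x) ν := (hf.const_mul a).add hg
  have i2 : Integrable (fun x => b - h x) ν := (integrable_const b).sub hh
  have h1 := integral_mono (integrable_const c) (i1.add i2) H
  simp only [Pi.add_apply] at h1
  rw [integral_add i1 i2, integral_add (hf.const_mul a) hg, integral_sub (integrable_const b) hh,
    integral_const_mul] at h1
  simpa using h1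

lemma log_loc_unif_le (hK : IsCompact K) (hKc : Convex ℝ K) {y : 𝔼} {r ρ t : ℝ} (hρ : 0 < ρ) (hρ1 :
    ρ < 1) (hS0 : volume (K ∩ closedBall y r) ≠ 0) (ht : 0 < t) (v : 𝔼) : log ((loc (unif K) (t,
    v)).real (K ∩ closedBall y r)) ≤ -((1 - ρ) * (t / 2)) * mom (unif K) (fun x => (1 - ρ) * ‖x - y‖
    ^ 2 - r ^ 2 / ρ) (t, v) := by
  have h := log_measureReal_le hK hKc (hK.inter_right isClosed_closedBall) inter_subset_left hS0 v
    ht (D := fun x => (1 - ρ) * ‖x - y‖ ^ 2 - r ^ 2 / ρ) (by fun_prop) (fun x z hz => ?_) hρ hρ1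
  · have e : loc (unif K) (t, v) = (volume.restrict K).tilted fun x => ⟪v, x⟫ - t / 2 * ‖x‖ ^ 2 := by
      rw [loc_unif hK]
      refine congrArg _ (funext fun x => ?_)
      rw [stat_apply, real_inner_comm]; ring
    rw [mom, e]
    linarith
  · have h1 := norm_sub_le_norm_sub_add_norm_sub x z y
    have h2 : ‖z - y‖ ≤ r := by aesop
    have h3 : r ^ 2 / ρ = ρ * (r / ρ) ^ 2 := by field_simp
    have h4 : r = ρ * (r / ρ) := by field_simp
    have h5 : ‖x - y‖ ^ 2 ≤ (‖x - z‖ + ρ * (r / ρ)) ^ 2 :=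
      pow_le_pow_left₀ (norm_nonneg _) (by linarith) 2
    have h6 := mul_le_mul_of_nonneg_left h5 (sub_nonneg.2 hρ1.le)
    have h7 : 0 ≤ ρ * ((‖x - z‖ - (1 - ρ) * (r / ρ)) ^ 2 + ρ * (r / ρ) ^ 2) := by positivity
    linarith

lemma measureReal_closedBall_le (hK : IsCompact K) (hKc : Convex ℝ K) (hK0 : volume K ≠ 0)
    (hiso : IsIsotropic (unif K)) {C t : ℝ} (ht : 0 < t) (htC : C * t ≤ 1)
    (hC : ∀ s, 0 < s → s < t → law (unif K) s (trQ (unif K) 0) ≤ C * n) {M η : ℝ} (hM : 1 ≤ M)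
    (hη : 0 < η) (hηM : η * M ^ 2 = 1 / 100) {y : 𝔼} (hy : ‖y‖ ≤ M * √n) :
    (unif K).real (K ∩ closedBall y (η * √n)) ≤ exp (-(t / 8) * n) := by
  have hη2 : η * M ≤ 1 / 100 := by nlinarith
  have hη3 := (le_mul_of_one_le_right hη.le hM).trans hη2
  have hη1 : η < 1 := by linarith
  have := isProbabilityMeasure_unif hK hK0
  obtain ⟨R, hR⟩ := hK.isBounded.exists_norm_le
  have hμ := (unif_ae_mem hK).mono hR
  obtain ⟨S, hS⟩ : ∃ S, S = K ∩ closedBall y (η * √n) := ⟨_, rfl⟩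
  rw [← hS]
  rcases (measureReal_nonneg (μ := unif K) (s := S)).eq_or_lt with h0 | h0
  · rw [← h0]; positivity
  rw [← log_le_iff_le_exp h0]
  have hSv : volume S ≠ 0 := fun h => h0.ne' (by
    rw [measureReal_def, unif, (tilted_absolutelyContinuous _ _).trans
      restrict_le_self.absolutelyContinuous h]
    rfl)
  obtain ⟨D, hD⟩ : ∃ D : 𝔼 → ℝ, D = fun x => (1 - η) * ‖x - y‖ ^ 2 - (η * √n) ^ 2 / (η) := ⟨_, rfl⟩
  have hDc : Continuous D := by rw [hD]; fun_prop
  obtain ⟨m, hm⟩ : ∃ m : 𝔼, m = ((unif K).real S)⁻¹ • ∫ b in S, b ∂(unif K) := ⟨_, rfl⟩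
  obtain ⟨Y, hY⟩ : ∃ Y, Y = ‖y‖ + η * √n := ⟨_, rfl⟩
  have key : ∀ v, log ((unif K).real S) ≤ -((1 - η) * (t / 2)) * mom (unif K) D (t, v) +
      logZ (unif K) (t, v) + (t / 2 * Y ^ 2 - ⟪m, v⟫) := fun v => by
    have h1 := log_measureReal_le_loc hμ h0 (t, v)
    have h2 := log_loc_unif_le hK hKc (r := η * √n) (ρ := η) hη hη1 (hS ▸ hSv) ht v
    rw [← hS, ← hD] at h2
    have h3 : -(t / 2) * Y ^ 2 + ⟪m, v⟫ ≤ ((unif K).real S)⁻¹ * ∫ b in S, stat b (t, v) ∂(unif K) := by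
      have hSK := hS ▸ hK.inter_right isClosed_closedBall
      have hi : ∀ {φ : 𝔼 → ℝ}, Continuous φ → IntegrableOn φ S (unif K) := fun hφ =>
        hφ.continuousOn.integrableOn_compact hSK
      have i1 : IntegrableOn (fun b : 𝔼 => b) S (unif K) := continuousOn_id.integrableOn_compact hSK
      have h4 : ∫ b in S, (-(t / 2) * Y ^ 2 + ⟪v, b⟫) ∂unif K ≤ ∫ b in S, stat b (t, v) ∂(unif K) := by
        refine setIntegral_mono_on (hi (by fun_prop))
          (hi (continuous_stat.clm_apply continuous_const)) hSK.measurableSet fun b hb => ?_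
        have h5 : ‖b‖ ≤ Y := by
          have h6 : ‖b - y‖ ≤ η * √n := by
            rw [hS] at hb; simpa [dist_eq_norm] using hb.2
          have := norm_sub_norm_le b y
          linarith
        have h6 := mul_le_mul_of_nonneg_left (pow_le_pow_left₀ (norm_nonneg b) h5 2) ht.le
        rw [stat_apply, real_inner_comm v b]
        linarith
      rw [integral_add (hi continuous_const) (hi (by fun_prop)), integral_inner i1,
        setIntegral_const] at h4
      have h5 := mul_le_mul_of_nonneg_left h4 (inv_nonneg.2 h0.le)
      refine le_trans (le_of_eq ?_) h5
      rw [hm, real_inner_comm, inner_smul_right, smul_eq_mul]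
      field_simp
    linarith
  have hmean : ∫ x, D x ∂unif K = (1 - η) * (n + ‖y‖ ^ 2) - η * n := by
    have hi : ∀ {φ : 𝔼 → ℝ}, Continuous φ → Integrable φ (unif K) := fun hφ => by
      have := integrable_loc hμ hφ 0
      rwa [loc_zero] at this
    have h1 : ∀ x, D x = (1 - η) * ‖x‖ ^ 2 + (1 - η) * ‖y‖ ^ 2 - η * n +
        -(2 * (1 - η)) * ⟪x, y⟫ := fun x => by
      rw [hD]
      simp only
      rw [norm_sub_sq_real, mul_pow, sq_sqrt n.cast_nonneg]; field_simp; ring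
    have h2 : ∫ x, ⟪x, y⟫ ∂unif K = 0 := by
      have := mom_inner hμ y 0
      rwa [hiso.1, mom, loc_zero, inner_zero_left] at this
    have h3 := hiso.integral_norm_sq hμ
    simp only [h1]
    rw [integral_add (hi (by fun_prop)) (hi (by fun_prop)), integral_sub (hi (by fun_prop))
      (hi (by fun_prop)), integral_add (hi (by fun_prop)) (hi (by fun_prop)), integral_const_mul,
      integral_const_mul, integral_const_mul, integral_const_mul, h2, h3]
    simp; ring
  have iD := (gen_mom (e := stdOrthonormalBasis ℝ 𝔼) hμ hDc).integrable_law hμ t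
  have iZ := (gen_logZ hμ (stdOrthonormalBasis ℝ 𝔼)).integrable_law hμ t
  have iI := law_inner hμ hiso m t
  have h := le_integral_combination iD iZ iI.1 fun q => key (t • q.1 + √t • q.2)
  have e1 := law_mom hμ hDc ht.le
  have e2 := law_logZ_le hμ hiso ht.le hC
  rw [law] at e1 e2
  rw [e1, hmean, iI.2] at h
  have hn := sq_sqrt n.cast_nonneg
  have hn0 : (0 : ℝ) ≤ n := n.cast_nonneg
  have hy2 : ‖y‖ ^ 2 ≤ M ^ 2 * n := by
    have := pow_le_pow_left₀ (norm_nonneg y) hy 2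
    rwa [mul_pow, hn] at this
  have hY2 : Y ^ 2 ≤ ‖y‖ ^ 2 + 2 * (η * M) * n + η ^ 2 * n := by
    have := mul_le_mul_of_nonneg_left hy (by positivity : 0 ≤ 2 * (η * √n))
    rw [hY, add_sq, mul_pow, hn]
    have e : 2 * (η * √n) * (M * √n) = 2 * (η * M) * n :=
      (by ring : _ = 2 * (η * M) * √n ^ 2).trans (by rw [hn])
    linarith
  have e3 : C * n * t ^ 2 / 4 ≤ t / 4 * n := by
    have := mul_le_mul_of_nonneg_right htC (mul_nonneg ht.le hn0)
    nlinarith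
  have e4 : -(1 - η) * ((1 - η) * (n + ‖y‖ ^ 2) - η * n) + Y ^ 2 ≤ -(3 / 4) * n := by
    have f3 := mul_le_mul_of_nonneg_left hy2 hη.le
    nlinarith
  have e5 := mul_le_mul_of_nonneg_left e4 (by positivity : 0 ≤ t / 2)
  linarith

lemma exists_measureReal_closedBall_le : ∃ c : ℝ, 0 < c ∧ c ≤ 1 ∧
    ∀ (n : ℕ) (K : Set (EuclideanSpace ℝ (Fin n))), IsCompact K → Convex ℝ K → volume K ≠ 0 →
    IsIsotropic (unif K) → ∀ M η : ℝ, 1 ≤ M → 0 < η → η * M ^ 2 = 1 / 100 → ∀ y, ‖y‖ ≤ M * √n →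
    (unif K).real (K ∩ closedBall y (η * √n)) ≤ exp (-c * n) := by
  obtain ⟨j, hj⟩ : ∃ j : ℕ, 40000 ≤ (2 : ℝ) ^ j := ⟨16, by norm_num⟩
  obtain ⟨C, hC⟩ : ∃ C : ℝ, C = 2 ^ 2 ^ j + 4 := ⟨_, rfl⟩
  have hC1 : 1 ≤ C := by
    have : (0 : ℝ) ≤ 2 ^ 2 ^ j := by positivity
    linarith
  have hCi := inv_le_one_of_one_le₀ hC1
  obtain ⟨t, ht⟩ : ∃ t, t = min (((2 : ℝ) ^ j) ^ 4)⁻¹ C⁻¹ := ⟨_, rfl⟩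
  have ht0 : 0 < t := by rw [ht]; positivity
  have ht1 := ht ▸ min_le_right _ _
  refine ⟨t / 8, by positivity, by linarith, fun n K hK hKc hK0 hiso M η hM hη hηM y hy => ?_⟩
  have := isProbabilityMeasure_unif hK hK0
  obtain ⟨R, hR0, hR⟩ := hK.isBounded.exists_pos_norm_le
  refine measureReal_closedBall_le hK hKc hK0 hiso (C := C) ht0 ?_ (fun s hs hst => ?_) hM hη hηM hy
  · exact (mul_le_mul_of_nonneg_left ht1 (by linarith)).trans_eq (mul_inv_cancel₀ (by linarith))
  · have := law_trQ_zero_le ((unif_ae_mem hK).mono hR) hR0.le (isSLC_unif hK hKc hK0)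
      (inner_cov_unif_le hK hKc hK0) hiso j hj hs.le (hst.le.trans (ht ▸ min_le_left _ _))
    rwa [finrank_euclideanSpace_fin, ← hC] at this

lemma unif_real_inter (hK : IsCompact K) {B : Set 𝔼} (hB : MeasurableSet B) :
    (unif K).real (K ∩ B) = (volume.real K)⁻¹ * volume.real (K ∩ B) := by
  rw [unif, tilted_const', measureReal_ennreal_smul_apply, restrict_apply_univ,
    toReal_inv, measureReal_restrict_apply (hK.measurableSet.inter hB),
    inter_right_comm, inter_self, ← measureReal_def]

lemma one_sub_le_unif_closedBall (hK : IsCompact K) (hK0 : volume K ≠ 0)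
    (hiso : IsIsotropic (unif K)) (hn : 0 < n) {M : ℝ} (hM : 0 < M) :
    1 - 1 / M ^ 2 ≤ (unif K).real (K ∩ closedBall 0 (M * √n)) := by
  have := isProbabilityMeasure_unif hK hK0
  obtain ⟨R, hR⟩ := hK.isBounded.exists_norm_le
  have hμ := (unif_ae_mem hK).mono hR
  have hi : Integrable (fun b : 𝔼 => ‖b‖ ^ 2) (unif K) := by
    have := integrable_loc hμ (φ := fun b : 𝔼 => ‖b‖ ^ 2) (by fun_prop) 0
    rwa [loc_zero] at this
  have h1 := mul_meas_ge_le_integral_of_nonneg (ae_of_all (unif K) fun b : 𝔼 => sq_nonneg ‖b‖) hi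
    (M ^ 2 * n)
  rw [hiso.integral_norm_sq hμ, finrank_euclideanSpace_fin] at h1
  have hn0 : (0 : ℝ) < n := Nat.cast_pos.2 hn
  have h2 : (unif K).real {b : 𝔼 | M ^ 2 * n ≤ ‖b‖ ^ 2} ≤ 1 / M ^ 2 := by
    rw [le_div_iff₀ (by positivity)]
    nlinarith
  have h3 : (unif K).real univ ≤ (unif K).real (K ∩ closedBall 0 (M * √n)) +
      (unif K).real {b : 𝔼 | M ^ 2 * n ≤ ‖b‖ ^ 2} := by
    refine le_trans ?_ (measureReal_union_le _ _)
    refine toReal_mono (measure_ne_top _ _) (measure_mono_ae ?_)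
    filter_upwards [unif_ae_mem hK] with b hb _
    by_cases h : ‖b‖ ≤ M * √n
    · exact Or.inl ⟨hb, by simpa using h⟩
    · refine Or.inr ?_
      have := pow_le_pow_left₀ (by positivity) (not_le.1 h).le 2
      rwa [mul_pow, sq_sqrt hn0.le] at this
  rw [probReal_univ] at h3
  linarith

lemma volume_convex_combination_le (hK : IsCompact K) (hKc : Convex ℝ K) {r ρ l m : ℝ} (hr : 0 ≤ r)
    (hl0 : 0 < l) (hl1 : l < 1) (hm0 : 0 ≤ m) (hm : ∀ y ∈ K ∩ closedBall 0 ρ, volume.real (K ∩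
    closedBall y (2 * r / l)) ≤ m) : (1 - l) ^ n * volume.real (K ∩ closedBall 0 r) * volume.real (K
    ∩ closedBall 0 ρ) ≤ volume.real (K ∩ closedBall 0 (r + l * ρ)) * m := by
  obtain ⟨A, hA⟩ : ∃ A, A = K ∩ closedBall 0 r := ⟨_, rfl⟩
  obtain ⟨Y, hY⟩ : ∃ Y, Y = K ∩ closedBall 0 ρ := ⟨_, rfl⟩
  obtain ⟨T, hT⟩ : ∃ T, T = K ∩ closedBall 0 (r + l * ρ) := ⟨_, rfl⟩
  have hAc := hA ▸ hK.inter_right isClosed_closedBall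
  have hYc := hY ▸ hK.inter_right isClosed_closedBall
  have hTc := hT ▸ hK.inter_right isClosed_closedBall
  rw [← hA, ← hY, ← hT]
  rw [← hY] at hm
  obtain ⟨G, hG⟩ : ∃ G, G = (fun p : 𝔼 × 𝔼 => ((1 - l) • p.1 + l • p.2, p.2)) '' (A ×ˢ Y) :=
    ⟨_, rfl⟩
  have hGm := (hG ▸ (hAc.prod hYc).image (by fun_prop) : IsCompact G).measurableSet
  have hmem : ∀ z y, (z, y) ∈ G ↔ y ∈ Y ∧ ∃ x ∈ A, (1 - l) • x + l • y = z := fun z y => by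
    rw [hG]
    constructor
    · rintro ⟨⟨x, y'⟩, ⟨hx, hy⟩, h⟩
      simp only [Prod.mk.injEq] at h
      obtain ⟨h, rfl⟩ := h
      exact ⟨hy, x, hx, h⟩
    · rintro ⟨hy, x, hx, rfl⟩
      exact ⟨(x, y), ⟨hx, hy⟩, rfl⟩
  have h1 : ENNReal.ofReal ((1 - l) ^ n) * volume A * volume Y ≤
      (volume : Measure 𝔼).prod volume G := by
    rw [prod_apply_symm hGm, ← setLIntegral_const, ← lintegral_indicator hYc.measurableSet]
    refine lintegral_mono fun y => ?_
    by_cases hy : y ∈ Y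
    · rw [indicator_of_mem hy]
      have := addHaar_image_homothety (volume : Measure 𝔼) y (1 - l) A
      rw [finrank_euclideanSpace_fin, abs_of_nonneg (pow_nonneg (by linarith) _)] at this
      rw [← this]
      refine measure_mono ?_
      rintro _ ⟨x, hx, rfl⟩
      refine (hmem _ _).2 ⟨hy, x, hx, ?_⟩
      rw [AffineMap.homothety_apply, vsub_eq_sub, vadd_eq_add]
      module
    · rw [indicator_of_notMem hy]
      exact zero_le
  have h2 : (volume : Measure 𝔼).prod volume G ≤ ENNReal.ofReal m * volume T := by
    rw [prod_apply hGm, ← setLIntegral_const, ← lintegral_indicator hTc.measurableSet]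
    refine lintegral_mono fun z => ?_
    rcases eq_empty_or_nonempty (Prod.mk z ⁻¹' G) with h | ⟨y₀, hy₀⟩
    · rw [h, measure_empty]; exact zero_le
    obtain ⟨hyY, x₀, hx₀, rfl⟩ := (hmem _ _).1 hy₀
    have hxK : x₀ ∈ K ∧ ‖x₀‖ ≤ r := by rw [hA] at hx₀; simpa using hx₀
    have hzT : (1 - l) • x₀ + l • y₀ ∈ T := by
      have hyK : y₀ ∈ K ∧ ‖y₀‖ ≤ ρ := by rw [hY] at hyY; simpa using hyY
      rw [hT]
      refine ⟨hKc hxK.1 hyK.1 (by linarith) hl0.le (by ring), ?_⟩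
      rw [mem_closedBall_zero_iff]
      refine (norm_add_le _ _).trans ?_
      rw [norm_smul, norm_smul, norm_of_nonneg hl0.le, norm_of_nonneg (by linarith : 0 ≤ 1 - l)]
      have := mul_le_mul_of_nonneg_left hyK.2 hl0.le
      have := mul_le_mul_of_nonneg_left hxK.2 (by linarith : 0 ≤ 1 - l)
      have := mul_nonneg hl0.le hr
      linarith
    rw [indicator_of_mem hzT]
    refine le_trans (measure_mono (t := K ∩ closedBall y₀ (2 * r / l)) ?_) ?_
    · intro y hy
      obtain ⟨hy, x, hx, h⟩ := (hmem _ _).1 hy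
      refine ⟨(hY ▸ hy : y ∈ K ∩ _).1, ?_⟩
      have e2 : ‖x‖ ≤ r := by rw [hA] at hx; simpa using hx.2
      have e3 : l • (y - y₀) = (1 - l) • (x₀ - x) := by
        rw [smul_sub, smul_sub, sub_eq_sub_iff_add_eq_add, add_comm, h]
      have e4 := congrArg norm e3
      rw [norm_smul, norm_smul, norm_of_nonneg hl0.le,
        norm_of_nonneg (by linarith : 0 ≤ 1 - l)] at e4
      rw [mem_closedBall, dist_eq_norm, le_div_iff₀ hl0, mul_comm, e4]
      have e5 := norm_sub_le x₀ x
      have e7 := mul_le_of_le_one_left (norm_nonneg (x₀ - x)) (by linarith : 1 - l ≤ 1)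
      linarith
    · have hfin : volume (K ∩ closedBall y₀ (2 * r / l)) ≠ ∞ :=
        ((measure_mono inter_subset_left).trans_lt hK.measure_lt_top).ne
      rw [← ofReal_toReal hfin]
      exact ofReal_le_ofReal (hm y₀ hyY)
  have h3 := toReal_mono (mul_ne_top ofReal_ne_top hTc.measure_ne_top) (h1.trans h2)
  rw [toReal_mul, toReal_mul, toReal_mul,
    toReal_ofReal (pow_nonneg (by linarith) _), toReal_ofReal hm0] at h3
  simp only [measureReal_def]
  linarith

lemma exp_neg_le {x : ℝ} (h0 : 0 ≤ x) (h1 : x ≤ 1) : exp (-x) ≤ 1 - x / 2 := by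
  rw [exp_neg, inv_le_iff_one_le_mul₀ (exp_pos x)]
  have := mul_le_mul_of_nonneg_left (add_one_le_exp x) (by linarith : 0 ≤ 1 - x / 2)
  nlinarith

lemma exists_unif_closedBall_le_mul : ∃ c A b : ℝ, 0 < c ∧ 1 < A ∧ 0 < b ∧ b < 1 ∧ ∀ (n : ℕ) (K :
    Set (EuclideanSpace ℝ (Fin n))), 0 < n → IsCompact K → Convex ℝ K → volume K ≠ 0 → IsIsotropic
    (unif K) → ∀ r, 0 < r → r ≤ b * √n → (unif K).real (K ∩ closedBall 0 r) ≤ exp (-c * n) * (unif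
    K).real (K ∩ closedBall 0 (A * r)) := by
  obtain ⟨c, hc0, hc1, hc⟩ := exists_measureReal_closedBall_le
  obtain ⟨M, hM⟩ : ∃ M, M = 2 / √c := ⟨_, rfl⟩
  obtain ⟨η, hη⟩ : ∃ η, η = c / 400 := ⟨_, rfl⟩
  have hM2 : M ^ 2 = 4 / c := by rw [hM, div_pow, sq_sqrt hc0.le]; norm_num
  have hM0 : 0 < M := by rw [hM]; positivity
  have hM1 : 1 ≤ M := by
    rw [← one_le_sq_iff₀ hM0.le, hM2, one_le_div hc0]; linarith
  have hη0 : 0 < η := by rw [hη]; positivity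
  refine ⟨c / 4, 1 + 2 * M / η, η * c / 16, by positivity, ?_, by positivity, ?_, ?_⟩
  · have : 0 < 2 * M / η := by positivity
    linarith
  · have := mul_le_one₀ (by linarith : η ≤ 1) hc0.le hc1
    linarith
  intro n K hn hK hKc hK0 hiso r hr hrb
  have hn0 : (0 : ℝ) < n := Nat.cast_pos.2 hn
  obtain ⟨l, hl⟩ : ∃ l, l = 2 * r / (η * √n) := ⟨_, rfl⟩
  have hl0 : 0 < l := by rw [hl]; positivity
  have hl1 : l ≤ c / 8 := by
    rw [hl, div_le_iff₀ (by positivity)]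
    linarith
  have e1 : 2 * r / l = η * √n := by rw [hl]; field_simp
  have e2 : r + l * (M * √n) = (1 + 2 * M / η) * r := by rw [hl]; field_simp
  have hV : 0 < volume.real K := toReal_pos hK0 hK.measure_ne_top
  obtain ⟨f, hf⟩ : ∃ f : ℝ → ℝ, f = fun r => (unif K).real (K ∩ closedBall 0 r) := ⟨_, rfl⟩
  have hfv : ∀ r, volume.real (K ∩ closedBall 0 r) = volume.real K * f r := fun r => by
    rw [hf]
    simp only
    rw [unif_real_inter hK isClosed_closedBall.measurableSet, mul_inv_cancel_left₀ hV.ne']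
  have h1 := volume_convex_combination_le hK hKc (r := r) (ρ := M * √n) (m := volume.real K * exp
    (-c * n)) hr.le hl0 (by linarith) (by positivity) fun y hy => by
      have := hc n K hK hKc hK0 hiso M η hM1 hη0 (by rw [hM2, hη]; field_simp; norm_num) y
        (by simpa using hy.2)
      rw [unif_real_inter hK isClosed_closedBall.measurableSet, inv_mul_le_iff₀ hV] at this
      rwa [e1]
  rw [e2, hfv, hfv, hfv] at h1
  have h2 : (1 - l) ^ n * f r * f (M * √n) ≤ f ((1 + 2 * M / η) * r) * exp (-c * n) := by
    refine le_of_mul_le_mul_left ?_ (mul_pos hV hV)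
    linarith
  have h3 : exp (-(c / 4) * n) ≤ (1 - l) ^ n := by
    rw [mul_comm, exp_nat_mul]
    refine pow_le_pow_left₀ (exp_pos _).le ?_ n
    have := exp_neg_le (by positivity : 0 ≤ c / 4) (by linarith)
    linarith
  have h4 : exp (-(c / 2) * n) ≤ f (M * √n) := by
    have h5 := one_sub_le_unif_closedBall hK hK0 hiso hn hM0
    rw [hM2, one_div_div] at h5
    have h6 := exp_neg_le (by positivity : 0 ≤ c / 2) (by linarith)
    have h7 : exp (-(c / 2) * n) ≤ exp (-(c / 2)) := by
      refine exp_le_exp.2 ?_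
      have := mul_le_mul_of_nonneg_left (Nat.one_le_cast.2 hn : (1 : ℝ) ≤ n)
        (by positivity : 0 ≤ c / 2)
      linarith
    rw [hf]
    linarith
  have hf0 : 0 ≤ f r := by rw [hf]; positivity
  have h5 : exp (-(c / 4) * n) * exp (-(c / 2) * n) * f r ≤
      f ((1 + 2 * M / η) * r) * exp (-c * n) := by
    refine le_trans ?_ h2
    rw [mul_right_comm]
    exact mul_le_mul (mul_le_mul_of_nonneg_right h3 hf0) h4 (exp_pos _).le
      (mul_nonneg ((exp_pos _).le.trans h3) hf0)
  have h6 : exp (-c * n) = exp (-(c / 4) * n) * exp (-(c / 2) * n) * exp (-(c / 4) * n) := by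
    rw [← exp_add, ← exp_add]; ring_nf
  rw [h6] at h5
  have h7 : f r ≤ exp (-(c / 4) * n) * f ((1 + 2 * M / η) * r) := by
    refine le_of_mul_le_mul_left ?_ (mul_pos (exp_pos (-(c / 4) * n)) (exp_pos (-(c / 2) * n)))
    linarith
  rwa [hf] at h7

theorem exists_unif_small_ball_le : ∃ c : ℝ, 0 < c ∧ c < 1 ∧ ∀ (n : ℕ) (K : Set (EuclideanSpace ℝ
    (Fin n))), 0 < n → IsCompact K → Convex ℝ K → volume K ≠ 0 → IsIsotropic (unif K) → ∀ ε, 0 < ε →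
    ε < c → (unif K).real (K ∩ closedBall 0 √(ε * n)) ≤ ε ^ (c * n) := by
  obtain ⟨c, A, b, hc, hA, hb0, hb1, h⟩ := exists_unif_closedBall_le_mul
  have hlA := log_pos hA
  have hb4 : b ^ 4 < 1 := pow_lt_one₀ hb0.le hb1 (by norm_num)
  refine ⟨min (b ^ 4) (c / (4 * log A)), by positivity, (min_le_left _ _).trans_lt hb4,
    fun n K hn hK hKc hK0 hiso ε hε hεc => ?_⟩
  have := isProbabilityMeasure_unif hK hK0
  have hstep : ∀ (k : ℕ) (r : ℝ), 0 < r → A ^ k * r ≤ b * √n →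
      (unif K).real (K ∩ closedBall 0 r) ≤ exp (-c * n) ^ (k + 1) := by
    intro k
    induction k with
    | zero =>
      intro r hr hrb
      rw [pow_zero, one_mul] at hrb
      rw [zero_add, pow_one]
      exact (h n K hn hK hKc hK0 hiso r hr hrb).trans
        (mul_le_of_le_one_right (exp_pos _).le measureReal_le_one)
    | succ k ih =>
      intro r hr hrb
      have h1 := (le_mul_of_one_le_left hr.le (one_le_pow₀ hA.le)).trans hrb
      have h2 := ih (A * r) (by positivity) (by rwa [← mul_assoc, ← pow_succ])
      rw [pow_succ']
      exact (h n K hn hK hKc hK0 hiso r hr h1).trans (mul_le_mul_of_nonneg_left h2 (exp_pos _).le)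
  have hεb := hεc.le.trans (min_le_left _ _)
  have hε1 := hεb.trans_lt hb4
  have hsε := sqrt_pos.2 hε
  have h1 : 1 ≤ b / √ε := by
    rw [one_le_div hsε, sqrt_le_left hb0.le]
    exact hεb.trans (pow_le_pow_of_le_one hb0.le hb1.le (by norm_num))
  obtain ⟨k, hk1, hk2⟩ := exists_nat_pow_near h1 hA
  rw [le_div_iff₀ hsε] at hk1
  refine (hstep k √(ε * n) (sqrt_pos.2 (mul_pos hε (Nat.cast_pos.2 hn))) ?_).trans ?_
  · rw [sqrt_mul hε.le, ← mul_assoc]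
    exact mul_le_mul_of_nonneg_right hk1 (sqrt_nonneg _)
  have hlε := log_neg hε hε1
  have h2 : -log ε / 4 ≤ (k + 1) * log A := by
    have h3 := log_le_log (by positivity) hk2.le
    rw [log_div hb0.ne' hsε.ne', log_sqrt hε.le, Real.log_pow, Nat.cast_succ] at h3
    have h4 := log_le_log hε hεb
    norm_num at h4
    linarith
  rw [← exp_nat_mul, rpow_def_of_pos hε, exp_le_exp, Nat.cast_succ]
  have h5 : min (b ^ 4) (c / (4 * log A)) * -log ε ≤ c * (k + 1) := by
    have h6 := mul_le_mul_of_nonneg_right (min_le_right (b ^ 4) (c / (4 * log A)))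
      (by linarith : 0 ≤ -log ε)
    refine h6.trans ?_
    rw [div_mul_eq_mul_div, div_le_iff₀ (by positivity)]
    have := mul_le_mul_of_nonneg_left h2 hc.le
    linarith
  have h7 := mul_le_mul_of_nonneg_right h5 (n.cast_nonneg : (0 : ℝ) ≤ n)
  linarith

lemma volume_smul_inv {L : ℝ} (hL : 0 < L) (S : Set 𝔼) : volume (L⁻¹ • S) = ENNReal.ofReal ((L ^
  n)⁻¹) * volume S := by rw [addHaar_smul, finrank_euclideanSpace_fin, abs_of_pos (by positivity),
  inv_pow]

lemma integral_unif_smul {V : Type*} [NormedAddCommGroup V] [NormedSpace ℝ V] (hV : volume K = 1) {L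
    : ℝ} (hL : 0 < L) (f : 𝔼 → V) : ∫ b, f b ∂(unif (L⁻¹ • K)) = ∫ x in K, f (L⁻¹ • x) := by
  rw [setIntegral_comp_smul_of_pos _ _ _ (inv_pos.2 hL), unif, tilted_const',
    integral_smul_measure, restrict_apply_univ, volume_smul_inv hL, hV, mul_one,
    toReal_inv, toReal_ofReal (by positivity), finrank_euclideanSpace_fin, inv_pow]

lemma isIsotropic_unif_smul {L : ℝ} (h : IsConvexIsotropic K L) : IsIsotropic (unif (L⁻¹ • K)) := by
  obtain ⟨⟨hK, -, -⟩, hV, hL, h1, h2⟩ := h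
  have hi : ∀ {φ : 𝔼 → ℝ}, Continuous φ → Integrable φ (volume.restrict K) := fun hφ =>
    hφ.continuousOn.integrableOn_compact hK
  have hin : ∀ x u : 𝔼, ⟪x, u⟫ = ∑ i, u i * x i := fun x u => by aesop
  have h3 : ∀ u : 𝔼, ∫ x in K, ⟪x, u⟫ = 0 := fun u => by
    simp only [hin]
    rw [integral_finsetSum _ fun i _ => hi (by fun_prop)]
    simp [integral_const_mul, h1]
  have h4 : ∀ u v : 𝔼, ∫ x in K, ⟪x, u⟫ * ⟪x, v⟫ = L ^ 2 * ⟪u, v⟫ := fun u v => by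
    have e : ∀ x : 𝔼, ⟪x, u⟫ * ⟪x, v⟫ = ∑ i, ∑ j, u i * v j * (x i * x j) := fun x => by
      rw [hin, hin, Finset.sum_mul_sum]
      grind
    simp only [e]
    rw [integral_finsetSum _ fun i _ => hi (by fun_prop)]
    have e2 : ∀ i, ∫ x in K, ∑ j, u i * v j * (x i * x j) = L ^ 2 * (v i * u i) := fun i => by
      rw [integral_finsetSum _ fun j _ => hi (by fun_prop)]
      simp only [integral_const_mul, h2]
      simp
      ring
    simp only [e2]
    rw [hin, mul_sum]
  have hKc : IsCompact (L⁻¹ • K) := hK.smul _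
  obtain ⟨R, hR⟩ := hKc.isBounded.exists_norm_le
  have hμ := (unif_ae_mem hKc).mono hR
  have := isProbabilityMeasure_unif hKc (by
    rw [volume_smul_inv hL, hV, mul_one]
    exact (ofReal_pos.2 (by positivity)).ne')
  refine ⟨ext_inner_right ℝ fun v => ?_, fun u v => ?_⟩
  · have e := mom_inner hμ v 0
    rw [mom, loc_zero, integral_unif_smul hV hL] at e
    rw [← e, inner_zero_left]
    simp only [inner_smul_left, integral_const_mul, h3]
    simp
  · rw [integral_unif_smul hV hL]
    have e : ∀ x : 𝔼, ⟪L⁻¹ • x, u⟫ * ⟪L⁻¹ • x, v⟫ = (L ^ 2)⁻¹ * (⟪x, u⟫ * ⟪x, v⟫) := fun x => by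
      simp only [real_inner_smul_left]
      ring
    simp only [e, integral_const_mul, h4]
    field_simp

end Uniform

end SmallBall

/-- There is a universal constant `c₀ > 0` (the constant of the main small-ball
theorem) such that for every `n ≥ 1`, every convex body `K ⊂ ℝⁿ` in convex isotropic
position with constant `L_K`, and every `0 < ε < c₀`,
`Vol(K ∩ L_K √(ε n) B₂ⁿ) ≤ ε^{c₀ n}`. -/
theorem small_ball_volume_convex_isotropic :
    ∃ c₀ : ℝ, 0 < c₀ ∧
      ∀ n : ℕ, 1 ≤ n → ∀ (K : Set (EuclideanSpace ℝ (Fin n))) (L : ℝ),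
        IsConvexIsotropic K L →
        ∀ ε : ℝ, 0 < ε → ε < c₀ →
          volume (K ∩ Metric.closedBall 0 (L * Real.sqrt (ε * n))) ≤
            ENNReal.ofReal (ε ^ (c₀ * (n : ℝ))) := by
  open Pointwise in
  obtain ⟨c, hc, -, h⟩ := SmallBall.exists_unif_small_ball_le
  refine ⟨c, hc, fun n hn K L hKL ε hε hεc => ?_⟩
  obtain ⟨⟨hK, hKc, -⟩, hV, hL, -, -⟩ := id hKL
  have hp : 0 < (L ^ n)⁻¹ := by positivity
  have hv := SmallBall.volume_smul_inv hL K
  rw [hV, mul_one] at hv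
  have h1 := h n (L⁻¹ • K) hn (hK.smul _) (hKc.smul _)
    (by rw [hv]; exact (ENNReal.ofReal_pos.2 hp).ne') (SmallBall.isIsotropic_unif_smul hKL) ε hε hεc
  have h2 : L⁻¹ • K ∩ Metric.closedBall 0 √(ε * n) =
      L⁻¹ • (K ∩ Metric.closedBall 0 (L * √(ε * n))) := by
    rw [Set.smul_set_inter₀ (inv_ne_zero hL.ne'), smul_closedBall _ _ (by positivity), smul_zero,
      Real.norm_of_nonneg (by positivity), inv_mul_cancel_left₀ hL.ne']
  rw [SmallBall.unif_real_inter (hK.smul _) Metric.isClosed_closedBall.measurableSet, h2,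
    measureReal_def, measureReal_def, SmallBall.volume_smul_inv hL, hV, mul_one,
    SmallBall.volume_smul_inv hL, ENNReal.toReal_mul,
    ENNReal.toReal_ofReal hp.le, inv_mul_cancel_left₀ hp.ne'] at h1
  rw [← ENNReal.ofReal_toReal (((measure_mono Set.inter_subset_left).trans_lt
    hK.measure_lt_top).ne)]
  exact ENNReal.ofReal_le_ofReal h1

end
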